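/- There exist universal constants C, c > 0 such that for any α, ε, δ ∈ (0,1) and k, d ∈ ℕ, there exists an (ε, δ)-differentially private algorithm A with the following guarantee: for every mixture D of at most k Gaussians in ℝ^d, if A is given n i.i.d. samples from D where n ≥ C · L^C · ( kd²/α² + (kd² + d^{7/4}·k^{3/2}·log^{1/2}(1/δ) + k^{3/2}·log^{3/2}(1/δ))/(αε) + k²d/α ) with L = log(2 + kd/(αεδ)), then with probability at least 2/3 (over the samples and the algorithm's internal randomness) A outputs a mixture D̃ of at most k Gaussians in ℝ^d with TV(D̃, D) ≤ α. -/

import Mathlib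

open MeasureTheory ProbabilityTheory Matrix Real
open scoped ENNReal

noncomputable section

instance matMS {d : ℕ} : MeasurableSpace (Matrix (Fin d) (Fin d) ℝ) := MeasurableSpace.pi

/-- The Gaussian measure `N(μ, Σ)` on `ℝ^d`, defined via its density w.r.t. Lebesgue measure. -/
def gauss (d : ℕ) (μ : Fin d → ℝ) (S : Matrix (Fin d) (Fin d) ℝ) : Measure (Fin d → ℝ) :=
  volume.withDensity fun x =>
    ENNReal.ofReal ((Real.sqrt ((2 * Real.pi) ^ d * S.det))⁻¹ *
      Real.exp (-(1/2) * ((x - μ) ⬝ᵥ (S⁻¹ *ᵥ (x - μ)))))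

/-- Total variation distance between two measures. -/
def TV {E : Type*} [MeasurableSpace E] (P Q : Measure E) : ℝ :=
  ⨆ A : {s : Set E // MeasurableSet s}, |(P A.1).toReal - (Q A.1).toReal|

/-- Two datasets are adjacent if they differ in at most one entry. -/
def Adjacent {n : ℕ} {E : Type*} (X X' : Fin n → E) : Prop :=
  ∃ i : Fin n, ∀ j : Fin n, j ≠ i → X j = X' j

/-- `(ε, δ)`-differential privacy of a Markov kernel from datasets to outputs. -/
def IsDP {n : ℕ} {E Ω : Type*} [MeasurableSpace E] [MeasurableSpace Ω]
    (K : Kernel (Fin n → E) Ω) (ε δ : ℝ) : Prop :=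
  ∀ X X' : Fin n → E, Adjacent X X' → ∀ O : Set Ω, MeasurableSet O →
    K X' O ≤ ENNReal.ofReal (Real.exp ε) * K X O + ENNReal.ofReal δ

/-- The Gaussian mixture with weights `w`, means `μs`, covariances `Ss`. -/
def mixture (d k : ℕ) (w : Fin k → ℝ) (μs : Fin k → (Fin d → ℝ))
    (Ss : Fin k → Matrix (Fin d) (Fin d) ℝ) : Measure (Fin d → ℝ) :=
  Measure.sum fun i => ENNReal.ofReal (w i) • gauss d (μs i) (Ss i)

/-- Valid GMM parameters: nonnegative weights summing to 1, positive definite covariances. -/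
def IsMixtureParams {d k : ℕ} (w : Fin k → ℝ) (Ss : Fin k → Matrix (Fin d) (Fin d) ℝ) : Prop :=
  (∀ i, 0 ≤ w i) ∧ (∑ i, w i = 1) ∧ ∀ i, (Ss i).PosDef

section
/-- product of standard Gaussians -/
def stdG (ι : Type*) [Fintype ι] : Measure (ι → ℝ) := Measure.pi fun _ => gaussianReal 0 1

instance stdG_prob (ι : Type*) [Fintype ι] : IsProbabilityMeasure (stdG ι) := by
  unfold stdG; infer_instance

theorem lintegral_pi_prod {ι : Type*} [Fintype ι] {E : ι → Type*} [∀ i, MeasurableSpace (E i)]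
    (μ : ∀ i, Measure (E i)) [∀ i, IsProbabilityMeasure (μ i)] (f : ∀ i, E i → ℝ≥0∞)
    (hf : ∀ i, Measurable (f i)) :
    ∫⁻ x, ∏ i, f i (x i) ∂(Measure.pi μ) = ∏ i, ∫⁻ x, f i x ∂(μ i) := by
  have h := lintegral_prod_eq_prod_lintegral_of_indepFun (μ := Measure.pi μ) Finset.univ
    (fun i ω => f i (ω i)) (iIndepFun_pi fun i => (hf i).aemeasurable)
    (fun i => (hf i).comp (measurable_pi_apply i))
  rw [h]
  refine Finset.prod_congr rfl fun i _ => ?_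
  exact (measurePreserving_eval μ i).lintegral_comp (hf i)

theorem stdG_map_lin {ι : Type*} [Fintype ι] (a : ι → ℝ) :
    (stdG ι).map (fun g => ∑ i, a i * g i) = gaussianReal 0 (Real.toNNReal (∑ i, a i ^ 2)) := by
  classical
  have key : ∀ s : Finset ι, (stdG ι).map (fun g => ∑ i ∈ s, a i * g i)
      = gaussianReal 0 (Real.toNNReal (∑ i ∈ s, a i ^ 2)) := by
    intro s
    have hind : iIndepFun (fun (i : ι) (g : ι → ℝ) => a i * g i) (stdG ι) := by
      unfold stdG
      exact iIndepFun_pi (X := fun i x => a i * x) fun i => by fun_prop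
    have h1 : ∀ i, (stdG ι).map (fun g => a i * g i) = gaussianReal 0 (Real.toNNReal (a i ^ 2)) := by
      intro i
      have h0 : (stdG ι).map (fun g => g i) = gaussianReal 0 1 :=
        (measurePreserving_eval (fun _ : ι => gaussianReal 0 1) i).map_eq
      have : (fun g : ι → ℝ => a i * g i) = (fun x => a i * x) ∘ (fun g => g i) := rfl
      rw [this, ← Measure.map_map (by fun_prop) (by fun_prop), h0, gaussianReal_map_const_mul]
      simp only [mul_zero, mul_one]
      congr 1
      ext
      simp [Real.coe_toNNReal _ (sq_nonneg (a i))]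
    induction s using Finset.induction_on with
    | empty => simp [Measure.map_const, gaussianReal_zero_var]
    | insert i s his ih =>
      simp only [Finset.sum_insert his]
      have hI : IndepFun (fun g : ι → ℝ => a i * g i) (fun g : ι → ℝ => ∑ j ∈ s, a j * g j) (stdG ι) := by
        have := hind.indepFun_finsetSum_of_notMem (fun i => by fun_prop) his
        have h2 := this.symm
        convert h2 using 1
        ext g; simp
      have := gaussianReal_add_gaussianReal_of_indepFun hI (h1 i) ih
      rw [Real.toNNReal_add (sq_nonneg _) (Finset.sum_nonneg fun j _ => sq_nonneg _)]
      simpa [Pi.add_def] using this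
  exact key Finset.univ

theorem measure_ext_of_proj {ι : Type*} [Fintype ι] {μ ν : Measure (ι → ℝ)} [IsFiniteMeasure μ]
    [IsFiniteMeasure ν] (h : ∀ v : ι → ℝ, μ.map (fun x => v ⬝ᵥ x) = ν.map (fun x => v ⬝ᵥ x)) :
    μ = ν := by
  classical
  apply Measure.ext_of_charFunDual
  ext L
  rw [charFunDual_eq_charFun_map_one, charFunDual_eq_charFun_map_one]
  have : (L : (ι → ℝ) → ℝ) = fun x => (fun i => L (Pi.single i 1)) ⬝ᵥ x := by
    ext x
    conv_lhs => rw [pi_eq_sum_univ x]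
    simp only [dotProduct, map_sum, map_smul, smul_eq_mul]
    refine Finset.sum_congr rfl fun i _ => ?_
    rw [mul_comm]; congr 2; ext j; simp [Pi.single_apply, eq_comm]
  rw [this, h]

theorem stdG_withDensity (ι : Type*) [Fintype ι] :
    stdG ι = (volume : Measure (ι → ℝ)).withDensity
      (fun x => ∏ i, gaussianPDF 0 1 (x i)) := by
  unfold stdG
  have hm : Measurable (fun x : ι → ℝ => ∏ i, gaussianPDF 0 1 (x i)) :=
    Finset.measurable_prod _ fun i _ => (measurable_gaussianPDF 0 1).comp (measurable_pi_apply i)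
  symm
  refine (Measure.pi_eq fun s hs => ?_).symm
  rw [withDensity_apply _ (MeasurableSet.univ_pi hs), ← lintegral_indicator (MeasurableSet.univ_pi hs)]
  have e1 : ∀ x : ι → ℝ, (Set.univ.pi s).indicator (fun x => ∏ i, gaussianPDF 0 1 (x i)) x
      = ENNReal.ofReal (∏ i, (s i).indicator (gaussianPDFReal 0 1) (x i)) := by
    intro x
    rw [ENNReal.ofReal_prod_of_nonneg]
    · by_cases hx : x ∈ Set.univ.pi s
      · rw [Set.indicator_of_mem hx]
        refine Finset.prod_congr rfl fun i _ => ?_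
        rw [Set.indicator_of_mem (hx i trivial)]; rfl
      · rw [Set.indicator_of_notMem hx]
        simp only [Set.mem_pi, Set.mem_univ, true_imp_iff, not_forall] at hx
        obtain ⟨i, hi⟩ := hx
        symm
        apply Finset.prod_eq_zero (Finset.mem_univ i)
        rw [Set.indicator_of_notMem hi]; simp
    · intro i _
      exact Set.indicator_nonneg (fun _ _ => gaussianPDFReal_nonneg _ _ _) _
  simp_rw [e1]
  have hIntg : ∀ i, Integrable ((s i).indicator (gaussianPDFReal 0 1)) :=
    fun i => (integrable_gaussianPDFReal 0 1).indicator (hs i)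
  rw [← ofReal_integral_eq_lintegral_ofReal, integral_fintype_prod_volume_eq_prod,
    ENNReal.ofReal_prod_of_nonneg]
  · refine Finset.prod_congr rfl fun i _ => ?_
    rw [gaussianReal_apply_eq_integral 0 one_ne_zero, integral_indicator (hs i)]
  · intro i _
    exact integral_nonneg fun x => Set.indicator_nonneg (fun _ _ => gaussianPDFReal_nonneg _ _ _) _
  · exact Integrable.fintype_prod hIntg
  · exact Filter.Eventually.of_forall fun x => Finset.prod_nonneg fun i _ =>
      Set.indicator_nonneg (fun _ _ => gaussianPDFReal_nonneg _ _ _) _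

theorem stdG_density_eq (d : ℕ) (x : Fin d → ℝ) :
    ∏ i, gaussianPDF 0 1 (x i)
      = ENNReal.ofReal ((Real.sqrt ((2 * Real.pi) ^ d))⁻¹ * Real.exp (-(1/2) * (x ⬝ᵥ x))) := by
  unfold gaussianPDF
  rw [← ENNReal.ofReal_prod_of_nonneg fun i _ => gaussianPDFReal_nonneg _ _ _]
  congr 1
  simp only [gaussianPDFReal, NNReal.coe_one, mul_one, sub_zero, Finset.prod_mul_distrib,
    Finset.prod_const, Finset.card_univ, Fintype.card_fin]
  have hsq : Real.sqrt ((2 * Real.pi) ^ d) = Real.sqrt (2 * Real.pi) ^ d := by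
    rw [← Real.sqrt_sq (pow_nonneg (Real.sqrt_nonneg (2 * Real.pi)) d)]
    congr 1
    rw [← pow_mul, mul_comm d 2, pow_mul, Real.sq_sqrt (by positivity)]
  rw [← Real.exp_sum, hsq, inv_pow]
  congr 2
  rw [dotProduct, Finset.mul_sum]
  refine Finset.sum_congr rfl fun i _ => by ring

theorem gauss_eq_map (d : ℕ) (μ : Fin d → ℝ) (A : Matrix (Fin d) (Fin d) ℝ) (hA : A.det ≠ 0) :
    gauss d μ (A * Aᵀ) = (stdG (Fin d)).map (fun g => μ + A *ᵥ g) := by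
  have hmeas : Measurable (fun g : Fin d → ℝ => μ + A *ᵥ g) :=
    (continuous_const.add (Continuous.matrix_mulVec continuous_const continuous_id)).measurable
  ext s hs
  rw [Measure.map_apply hmeas hs, stdG_withDensity, gauss, withDensity_apply _ hs,
    withDensity_apply _ (hmeas hs), ← lintegral_indicator hs, ← lintegral_indicator (hmeas hs)]
  -- change of variables
  have hmap : Measure.map (fun g : Fin d → ℝ => A *ᵥ g) volume
      = ENNReal.ofReal |A.det⁻¹| • (volume : Measure (Fin d → ℝ)) := by
    have := Real.map_matrix_volume_pi_eq_smul_volume_pi hA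
    have e0 : (fun g : Fin d → ℝ => A *ᵥ g) = ⇑(toLin' A) := by ext g; simp [toLin'_apply]
    rw [e0]; exact this
  have hvol : (volume : Measure (Fin d → ℝ))
      = ENNReal.ofReal |A.det| • Measure.map (fun g : Fin d → ℝ => μ + A *ᵥ g) volume := by
    have h2 : Measure.map (fun g : Fin d → ℝ => μ + A *ᵥ g) volume
        = ENNReal.ofReal |A.det⁻¹| • (volume : Measure (Fin d → ℝ)) := by
      have : (fun g : Fin d → ℝ => μ + A *ᵥ g) = (fun y => μ + y) ∘ (fun g => A *ᵥ g) := rfl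
      have hc : Measurable (fun g : Fin d → ℝ => A *ᵥ g) :=
        (Continuous.matrix_mulVec continuous_const continuous_id).measurable
      rw [this, ← Measure.map_map (measurable_const_add μ) hc, hmap, Measure.map_smul]
      rw [(measurePreserving_add_left volume μ).map_eq]
    rw [h2, smul_smul, ← ENNReal.ofReal_mul (abs_nonneg _), ← abs_mul, mul_inv_cancel₀ hA]
    simp
  conv_lhs => rw [hvol]
  have hm2 : Measurable (fun x : Fin d → ℝ => ENNReal.ofReal ((Real.sqrt ((2 * Real.pi) ^ d * (A * Aᵀ).det))⁻¹ *
      Real.exp (-(1/2) * ((x - μ) ⬝ᵥ ((A * Aᵀ)⁻¹ *ᵥ (x - μ)))))) := by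
    apply Measurable.ennreal_ofReal
    apply Continuous.measurable
    refine continuous_const.mul (Real.continuous_exp.comp (continuous_const.mul ?_))
    exact (continuous_id.sub continuous_const).dotProduct
      (Continuous.matrix_mulVec continuous_const (continuous_id.sub continuous_const))
  rw [lintegral_smul_measure, lintegral_map (hm2.indicator hs) hmeas, smul_eq_mul,
    ← lintegral_const_mul _ (show Measurable fun g => s.indicator (fun x : Fin d → ℝ => ENNReal.ofReal ((Real.sqrt ((2 * Real.pi) ^ d * (A * Aᵀ).det))⁻¹ *
      Real.exp (-(1/2) * ((x - μ) ⬝ᵥ ((A * Aᵀ)⁻¹ *ᵥ (x - μ)))))) (μ + A *ᵥ g) from (hm2.indicator hs).comp hmeas)]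
  refine lintegral_congr fun g => ?_
  by_cases hg : μ + A *ᵥ g ∈ s
  · rw [Set.indicator_of_mem hg, Set.indicator_of_mem (show g ∈ (fun g => μ + A *ᵥ g) ⁻¹' s from hg), stdG_density_eq,
      ← ENNReal.ofReal_mul (abs_nonneg _)]
    congr 1
    have hU : IsUnit A.det := isUnit_iff_ne_zero.mpr hA
    have e2 : (A * Aᵀ)⁻¹ *ᵥ (A *ᵥ g) = (Aᵀ)⁻¹ *ᵥ g := by
      rw [Matrix.mulVec_mulVec, Matrix.mul_inv_rev, Matrix.mul_assoc, Matrix.nonsing_inv_mul _ hU,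
        Matrix.mul_one]
    have e3 : (μ + A *ᵥ g - μ) ⬝ᵥ ((A * Aᵀ)⁻¹ *ᵥ (μ + A *ᵥ g - μ)) = g ⬝ᵥ g := by
      rw [add_sub_cancel_left, e2, Matrix.dotProduct_mulVec, ← Matrix.mulVec_transpose,
        Matrix.mulVec_mulVec, Matrix.transpose_nonsing_inv, Matrix.transpose_transpose,
        Matrix.nonsing_inv_mul _ hU, Matrix.one_mulVec]
    rw [e3, ← mul_assoc]
    congr 1
    rw [Matrix.det_mul, Matrix.det_transpose, Real.sqrt_mul (by positivity), Real.sqrt_mul_self_eq_abs,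
      mul_inv]
    field_simp
  · rw [Set.indicator_of_notMem hg, Set.indicator_of_notMem (show g ∉ (fun g => μ + A *ᵥ g) ⁻¹' s from hg), mul_zero]

open scoped MatrixOrder in
theorem psd_factor {m : ℕ} {S : Matrix (Fin m) (Fin m) ℝ} (hS : S.PosSemidef) :
    ∃ A : Matrix (Fin m) (Fin m) ℝ, A * Aᵀ = S := by
  refine ⟨CFC.sqrt S, ?_⟩
  have h1 : (CFC.sqrt S)ᵀ = CFC.sqrt S := by
    have := (Matrix.nonneg_iff_posSemidef.mp (CFC.sqrt_nonneg S)).isHermitian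
    rwa [Matrix.IsHermitian, conjTranspose_eq_transpose_of_trivial] at this
  rw [h1]
  exact CFC.sqrt_mul_sqrt_self S (Matrix.nonneg_iff_posSemidef.mpr hS)

theorem exists_sqrt {d : ℕ} {S : Matrix (Fin d) (Fin d) ℝ} (hS : S.PosDef) :
    ∃ A : Matrix (Fin d) (Fin d) ℝ, A.det ≠ 0 ∧ A * Aᵀ = S := by
  obtain ⟨B, hB⟩ := psd_factor hS.posSemidef
  refine ⟨B, ?_, hB⟩
  have := hS.det_pos.ne'
  rw [← hB, det_mul] at this
  exact left_ne_zero_of_mul this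

end

section
theorem gaussian_small_ball (v : NNReal) (b w : ℝ) (hw : 0 ≤ w) (hvb : 1/4 ≤ (v : ℝ) + b ^ 2) :
    gaussianReal 0 v {x | |b + x| ≤ w} ≤ ENNReal.ofReal (10 * w) := by
  rcases le_or_gt (1/10 : ℝ) w with h1 | h1
  · refine prob_le_one.trans ?_
    rw [← ENNReal.ofReal_one]
    exact ENNReal.ofReal_le_ofReal (by linarith)
  have hset : {x : ℝ | |b + x| ≤ w} = Set.Icc (-b - w) (-b + w) := by
    ext x; simp only [Set.mem_ofPred_eq, abs_le, Set.mem_Icc]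
    constructor <;> rintro ⟨h, h'⟩ <;> constructor <;> linarith
  by_cases hv : v = 0
  · subst hv
    rw [gaussianReal_zero_var, Measure.dirac_apply' _ (by rw [hset]; exact measurableSet_Icc)]
    rw [Set.indicator_of_notMem]
    · simp
    · simp only [Set.mem_ofPred_eq, add_zero, not_le]
      have : (1/2:ℝ) ≤ |b| := by
        apply le_of_sq_le_sq _ (abs_nonneg b)
        rw [sq_abs]; simp at hvb; linarith
      linarith
  have hv' : 0 < (v : ℝ) := by positivity
  have hbound : ∀ x ∈ {x : ℝ | |b + x| ≤ w}, gaussianPDF 0 v x ≤ ENNReal.ofReal 5 := by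
    intro x hx
    unfold gaussianPDF
    apply ENNReal.ofReal_le_ofReal
    apply le_of_sq_le_sq _ (by norm_num)
    rw [gaussianPDFReal, mul_pow, inv_pow, Real.sq_sqrt (by positivity), ← Real.exp_nat_mul]
    have hpi := Real.pi_gt_three
    rcases le_or_gt (1/16 : ℝ) v with h2 | h2
    · have e1 : Real.exp ((2:ℕ) * (-(x - 0)^2 / (2 * v))) ≤ 1 := by
        apply Real.exp_le_one_iff.mpr
        have : 0 ≤ (x-0)^2 / (2 * (v:ℝ)) := by positivity
        push_cast; rw [neg_div]; linarith
      have e2 : (2 * Real.pi * (v:ℝ))⁻¹ ≤ 25 := by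
        rw [inv_le_comm₀ (by positivity) (by norm_num)]
        nlinarith
      calc _ ≤ (25:ℝ) * 1 := mul_le_mul e2 e1 (Real.exp_pos _).le (by norm_num)
        _ ≤ _ := by norm_num
    · have hx2 : 1/100 ≤ x ^ 2 := by
        have hb : (4/10:ℝ) ≤ |b| := by
          apply le_of_sq_le_sq _ (abs_nonneg b)
          rw [sq_abs]; linarith
        have : |b| ≤ |b + x| + |x| := by
          have := abs_sub (b + x) x; simpa using this
        have hx3 : (1/10:ℝ) ≤ |x| := by
          have : |b + x| ≤ w := hx
          linarith
        rw [← sq_abs]; nlinarith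
      have e1 : Real.exp ((2:ℕ) * (-(x - 0)^2 / (2 * v))) ≤ v / x ^ 2 := by
        have : ((2:ℕ):ℝ) * (-(x - 0)^2 / (2 * v)) = -(x^2 / v) := by push_cast; field_simp; ring
        rw [this, Real.exp_neg, inv_le_comm₀ (Real.exp_pos _) (by positivity), inv_div]
        have := Real.add_one_le_exp (x^2 / (v:ℝ))
        linarith
      calc _ ≤ (2 * Real.pi * (v:ℝ))⁻¹ * (v / x ^ 2) := mul_le_mul_of_nonneg_left e1 (by positivity)
        _ = 1 / (2 * Real.pi * x ^ 2) := by field_simp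
        _ ≤ 5 ^ 2 := by
          rw [div_le_iff₀ (by positivity)]
          nlinarith
  rw [gaussianReal_apply 0 hv]
  calc ∫⁻ x in {x : ℝ | |b + x| ≤ w}, gaussianPDF 0 v x
      ≤ ∫⁻ x in {x : ℝ | |b + x| ≤ w}, ENNReal.ofReal 5 :=
        setLIntegral_mono measurable_const hbound
    _ = ENNReal.ofReal 5 * volume {x : ℝ | |b + x| ≤ w} := by rw [setLIntegral_const]
    _ = ENNReal.ofReal (10 * w) := by
      rw [hset, Real.volume_Icc, ← ENNReal.ofReal_mul (by norm_num)]
      congr 1; ring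

theorem gaussian_tail (t : ℝ) (ht : 0 ≤ t) :
    gaussianReal 0 1 {x | t < |x|} ≤ ENNReal.ofReal (2 * Real.exp (-(t^2) / 2)) := by
  have h1 : gaussianReal 0 1 {x | t ≤ x} ≤ ENNReal.ofReal (Real.exp (-(t^2) / 2)) := by
    have := measure_ge_le_exp_mul_mgf (μ := gaussianReal 0 1) (X := id) t ht
      (integrable_exp_mul_gaussianReal t)
    rw [mgf_id_gaussianReal] at this
    simp only [id] at this
    rw [← ENNReal.ofReal_toReal (measure_ne_top (gaussianReal 0 1) {x | t ≤ x})]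
    apply ENNReal.ofReal_le_ofReal
    refine le_trans this (le_of_eq ?_)
    rw [← Real.exp_add]; congr 1; push_cast; ring
  have h2 : gaussianReal 0 1 {x | x ≤ -t} ≤ ENNReal.ofReal (Real.exp (-(t^2) / 2)) := by
    have hh : (gaussianReal 0 1).map (fun x => -x) = gaussianReal 0 1 := by
      rw [gaussianReal_map_neg]; simp
    have e : {x : ℝ | t ≤ x} = {x : ℝ | t ≤ x} := rfl
    have h3 : gaussianReal 0 1 {x : ℝ | x ≤ -t} = gaussianReal 0 1 {x : ℝ | t ≤ x} := by
      conv_rhs => rw [← hh]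
      rw [Measure.map_apply measurable_neg (show MeasurableSet {x : ℝ | t ≤ x} from measurableSet_Ici)]
      congr 1; ext x; simp only [Set.mem_ofPred_eq, Set.mem_preimage]; constructor <;> intro h <;> linarith
    rw [h3]; exact h1
  calc gaussianReal 0 1 {x | t < |x|} ≤ gaussianReal 0 1 ({x | t ≤ x} ∪ {x | x ≤ -t}) := by
        apply measure_mono
        intro x hx
        rcases lt_abs.mp (show t < |x| from hx) with h | h
        · exact Or.inl h.le
        · right; show x ≤ -t; linarith
    _ ≤ _ := measure_union_le _ _
    _ ≤ ENNReal.ofReal (Real.exp (-(t^2) / 2)) + ENNReal.ofReal (Real.exp (-(t^2) / 2)) := add_le_add h1 h2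
    _ = _ := by rw [← ENNReal.ofReal_add (Real.exp_pos _).le (Real.exp_pos _).le]; congr 1; ring

/-- Slab lemma: a net argument in dimension `D`. -/
theorem slab {Ω : Type*} [MeasurableSpace Ω] (P : Measure Ω) {ι : Type*} (T : Finset ι) (D N : ℕ)
    (hD : 1 ≤ D) (hN : D ≤ N) (ζ : ι → Ω → Fin D → ℝ) (C0 κ R : ℝ) (hκ : 0 ≤ κ) (hR : 0 ≤ R)
    (hC0 : 0 ≤ C0)
    (hball : ∀ u : Fin D → ℝ, 1/4 ≤ u ⬝ᵥ u → ∀ w, 0 ≤ w →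
      P {ω | ∀ i ∈ T, |u ⬝ᵥ ζ i ω| ≤ w} ≤ ENNReal.ofReal ((C0 * w) ^ T.card)) :
    P {ω | ∃ u : Fin D → ℝ, u ⬝ᵥ u = 1 ∧ ∀ i ∈ T, |u ⬝ᵥ ζ i ω| ≤ κ ∧ ∑ s, |ζ i ω s| ≤ R}
      ≤ ENNReal.ofReal ((3 * N) ^ D * (C0 * (κ + R / N)) ^ T.card) := by
  classical
  have hN0 : (0:ℝ) < N := by exact_mod_cast (lt_of_lt_of_le hD hN)
  let G : Finset (Fin D → ℤ) := Fintype.piFinset fun _ => Finset.Icc (-(N:ℤ)) N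
  let pt : (Fin D → ℤ) → Fin D → ℝ := fun z s => (z s : ℝ) / N
  have hcard : (G.card : ℝ) ≤ (3 * N) ^ D := by
    have : G.card = (2 * N + 1) ^ D := by
      simp only [G, Fintype.card_piFinset, Int.card_Icc, Finset.prod_const, Finset.card_univ, Fintype.card_fin]
      congr 1; omega
    rw [this]; push_cast
    apply pow_le_pow_left₀ (by positivity)
    have : (1:ℝ) ≤ N := by exact_mod_cast hD.trans hN
    linarith
  have hsub : {ω | ∃ u : Fin D → ℝ, u ⬝ᵥ u = 1 ∧ ∀ i ∈ T, |u ⬝ᵥ ζ i ω| ≤ κ ∧ ∑ s, |ζ i ω s| ≤ R}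
      ⊆ ⋃ z ∈ G.filter (fun z => 1/4 ≤ pt z ⬝ᵥ pt z), {ω | ∀ i ∈ T, |pt z ⬝ᵥ ζ i ω| ≤ κ + R / N} := by
    rintro ω ⟨u, hu, hT⟩
    have hu1 : ∀ s, |u s| ≤ 1 := by
      intro s
      have : u s * u s ≤ u ⬝ᵥ u := Finset.single_le_sum (f := fun s => u s * u s)
        (fun s _ => mul_self_nonneg _) (Finset.mem_univ s)
      rw [hu] at this
      have h2 : u s ^ 2 ≤ 1 ^ 2 := by rw [sq]; linarith
      exact abs_le_of_sq_le_sq h2 zero_le_one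
    let z : Fin D → ℤ := fun s => round (u s * N)
    have hz : ∀ s, |u s - pt z s| ≤ 1 / (2 * N) := by
      intro s
      have h := abs_sub_round (u s * N)
      have : u s - pt z s = (u s * N - round (u s * N)) / N := by
        simp only [pt, z]; field_simp
      rw [this, abs_div, abs_of_pos hN0, div_le_div_iff₀ hN0 (by positivity)]
      nlinarith
    simp only [Set.mem_iUnion, Finset.mem_filter, Set.mem_ofPred_eq, exists_prop]
    refine ⟨z, ⟨?_, ?_⟩, ?_⟩
    · simp only [G, Fintype.mem_piFinset, Finset.mem_Icc]
      intro s
      have h1 := abs_le.mp (hu1 s)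
      have h := abs_le.mp (abs_sub_round (u s * N))
      have a1 : ((round (u s * N) : ℤ) : ℝ) < (N:ℤ) + 1 := by push_cast; nlinarith
      have a2 : (-(N:ℤ) : ℝ) - 1 < ((round (u s * N) : ℤ) : ℝ) := by push_cast; nlinarith
      constructor
      · have : (-(N:ℤ)) - 1 < round (u s * N) := by exact_mod_cast a2
        show _ ≤ round (u s * N); omega
      · have : round (u s * N) < (N:ℤ) + 1 := by exact_mod_cast a1
        show round (u s * N) ≤ _; omega
    · -- norm bound
      have hterm : ∀ s, u s * u s ≤ 2 * (pt z s * pt z s) + 2 * (1 / (2 * N))^2 := by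
        intro s
        have h1 := hz s
        have h2 : (u s - pt z s)^2 ≤ (1 / (2 * N))^2 := by
          rw [← sq_abs]; exact pow_le_pow_left₀ (abs_nonneg _) h1 2
        nlinarith [sq_nonneg (u s - 2 * pt z s)]
      have hsum : u ⬝ᵥ u ≤ 2 * (pt z ⬝ᵥ pt z) + D * (2 * (1 / (2 * N))^2) := by
        calc u ⬝ᵥ u ≤ ∑ s : Fin D, (2 * (pt z s * pt z s) + 2 * (1 / (2 * N))^2) :=
              Finset.sum_le_sum fun s _ => hterm s
          _ = _ := by rw [Finset.sum_add_distrib, ← Finset.mul_sum]; simp [dotProduct]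
      rw [hu] at hsum
      have : (D:ℝ) * (2 * (1 / (2 * N))^2) ≤ 1/2 := by
        have hDN : (D:ℝ) ≤ N := by exact_mod_cast hN
        have h1N : (1:ℝ) ≤ N := by exact_mod_cast hD.trans hN
        have : (D:ℝ) * (2 * (1 / (2 * N))^2) = D / (2 * (N * N)) := by field_simp; 
        rw [this, div_le_div_iff₀ (by positivity) (by norm_num)]
        nlinarith
      linarith
    · intro i hi
      obtain ⟨h1, h2⟩ := hT i hi
      have e : pt z ⬝ᵥ ζ i ω = u ⬝ᵥ ζ i ω - (u - pt z) ⬝ᵥ ζ i ω := by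
        rw [sub_dotProduct]; ring
      rw [e]
      have h3 : |(u - pt z) ⬝ᵥ ζ i ω| ≤ R / N := by
        calc |(u - pt z) ⬝ᵥ ζ i ω| ≤ ∑ s, |(u - pt z) s * ζ i ω s| := Finset.abs_sum_le_sum_abs _ _
          _ ≤ ∑ s, 1 / N * |ζ i ω s| := by
            refine Finset.sum_le_sum fun s _ => ?_
            rw [abs_mul]
            refine mul_le_mul_of_nonneg_right ((hz s).trans ?_) (abs_nonneg _)
            apply one_div_le_one_div_of_le hN0; linarith
          _ = (∑ s, |ζ i ω s|) / N := by rw [← Finset.mul_sum]; ring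
          _ ≤ R / N := by gcongr
      exact (abs_sub _ _).trans (add_le_add h1 h3)
  refine (measure_mono hsub).trans ((measure_biUnion_finset_le _ _).trans ?_)
  have hw : 0 ≤ κ + R / N := by positivity
  calc _ ≤ ∑ z ∈ G.filter (fun z => 1/4 ≤ pt z ⬝ᵥ pt z), ENNReal.ofReal ((C0 * (κ + R / N)) ^ T.card) :=
        Finset.sum_le_sum fun z hz => hball _ (Finset.mem_filter.mp hz).2 _ hw
    _ ≤ ∑ z ∈ G, ENNReal.ofReal ((C0 * (κ + R / N)) ^ T.card) :=
        Finset.sum_le_sum_of_subset (Finset.filter_subset _ _)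
    _ = ENNReal.ofReal (G.card * (C0 * (κ + R / N)) ^ T.card) := by
        rw [Finset.sum_const, nsmul_eq_mul, ENNReal.ofReal_mul (by positivity), ENNReal.ofReal_natCast]
    _ ≤ _ := ENNReal.ofReal_le_ofReal (mul_le_mul_of_nonneg_right hcard (by positivity))

end

section
/-- Renyi-type closeness in dual form; `s` is the dual exponent. -/
def RR {Ω : Type*} [MeasurableSpace Ω] (P Q : Measure Ω) (s c δ : ℝ) : Prop :=
  ∀ f : Ω → ℝ≥0∞, Measurable f → (∀ x, f x ≤ 1) →
    ∫⁻ x, f x ∂P ≤ ENNReal.ofReal (Real.exp c) * (∫⁻ x, f x ^ s ∂Q) ^ (1 / s) + ENNReal.ofReal δ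

theorem RR_comp {S S' : Type*} [MeasurableSpace S] [MeasurableSpace S'] {P Q : Measure S}
    [IsProbabilityMeasure P] [IsProbabilityMeasure Q]
    {κ κ' : S → Measure S'} (hκ : Measurable κ) (hκ' : Measurable κ')
    (hp : ∀ x, IsProbabilityMeasure (κ x)) (hp' : ∀ x, IsProbabilityMeasure (κ' x))
    {s c1 c2 δ1 δ2 : ℝ} (hs : 1 ≤ s) (hδ1 : 0 ≤ δ1) (hδ2 : 0 ≤ δ2)
    (h1 : RR P Q s c1 δ1) (h2 : ∀ x, RR (κ x) (κ' x) s c2 δ2) :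
    RR (P.bind κ) (Q.bind κ') s (c1 + c2) (δ1 + δ2) := by
  intro f hf hf1
  have hs0 : 0 < s := by linarith
  rw [Measure.lintegral_bind hκ.aemeasurable hf.aemeasurable,
    Measure.lintegral_bind hκ'.aemeasurable (hf.pow_const s).aemeasurable]
  set E2 := ENNReal.ofReal (Real.exp c2) with hE2
  let g : S → ℝ≥0∞ := fun x => min 1 (E2 * (∫⁻ y, f y ^ s ∂(κ' x)) ^ (1 / s))
  have hgm : Measurable g := by
    refine measurable_const.min (Measurable.const_mul ?_ _)
    exact ((Measure.measurable_lintegral (hf.pow_const s)).comp hκ').pow_const _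
  have hle : ∀ x, ∫⁻ y, f y ∂(κ x) ≤ g x + ENNReal.ofReal δ2 := by
    intro x
    have a1 : ∫⁻ y, f y ∂(κ x) ≤ 1 := by
      calc ∫⁻ y, f y ∂(κ x) ≤ ∫⁻ y, 1 ∂(κ x) := lintegral_mono hf1
        _ = 1 := by simp
    have a2 := h2 x f hf hf1
    simp only [g]
    rcases le_total 1 (E2 * (∫⁻ y, f y ^ s ∂(κ' x)) ^ (1 / s)) with h | h
    · rw [min_eq_left h]; exact a1.trans le_self_add
    · rw [min_eq_right h]; exact a2
  have b1 := h1 g hgm (fun x => min_le_left _ _)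
  have b2 : ∫⁻ x, g x ^ s ∂Q ≤ E2 ^ s * ∫⁻ x, ∫⁻ y, f y ^ s ∂(κ' x) ∂Q := by
    have hmm : Measurable fun x => ∫⁻ y, f y ^ s ∂(κ' x) :=
      (Measure.measurable_lintegral (hf.pow_const s)).comp hκ'
    rw [← lintegral_const_mul _ hmm]
    refine lintegral_mono fun x => ?_
    calc g x ^ s ≤ (E2 * (∫⁻ y, f y ^ s ∂(κ' x)) ^ (1 / s)) ^ s :=
          ENNReal.rpow_le_rpow (min_le_right _ _) hs0.le
      _ = _ := by
          rw [ENNReal.mul_rpow_of_nonneg _ _ hs0.le, ← ENNReal.rpow_mul, one_div,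
            inv_mul_cancel₀ hs0.ne', ENNReal.rpow_one]
  have b3 : (∫⁻ x, g x ^ s ∂Q) ^ (1/s) ≤ E2 * (∫⁻ x, ∫⁻ y, f y ^ s ∂(κ' x) ∂Q) ^ (1/s) := by
    calc _ ≤ (E2 ^ s * ∫⁻ x, ∫⁻ y, f y ^ s ∂(κ' x) ∂Q) ^ (1/s) := ENNReal.rpow_le_rpow b2 (by positivity)
      _ = _ := by
          rw [ENNReal.mul_rpow_of_nonneg _ _ (by positivity), ← ENNReal.rpow_mul, one_div,
            mul_inv_cancel₀ hs0.ne', ENNReal.rpow_one]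
  calc ∫⁻ x, ∫⁻ y, f y ∂(κ x) ∂P ≤ ∫⁻ x, (g x + ENNReal.ofReal δ2) ∂P := lintegral_mono hle
    _ = ∫⁻ x, g x ∂P + ENNReal.ofReal δ2 := by rw [lintegral_add_right _ measurable_const]; simp
    _ ≤ (ENNReal.ofReal (Real.exp c1) * (∫⁻ x, g x ^ s ∂Q) ^ (1/s) + ENNReal.ofReal δ1) + ENNReal.ofReal δ2 := by
        gcongr
    _ ≤ (ENNReal.ofReal (Real.exp c1) * (E2 * (∫⁻ x, ∫⁻ y, f y ^ s ∂(κ' x) ∂Q) ^ (1/s)) + ENNReal.ofReal δ1) + ENNReal.ofReal δ2 := by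
        gcongr
    _ = _ := by
        rw [Real.exp_add, ENNReal.ofReal_mul (Real.exp_pos _).le, ENNReal.ofReal_add hδ1 hδ2, hE2]
        ring

theorem RR_refl {Ω : Type*} [MeasurableSpace Ω] (P : Measure Ω) [IsProbabilityMeasure P] {s : ℝ}
    (hs : 1 < s) : RR P P s 0 0 := by
  intro f hf hf1
  have hc : s.HolderConjugate (s / (s - 1)) := Real.HolderConjugate.conjExponent hs
  have := ENNReal.lintegral_mul_le_Lp_mul_Lq P hc hf.aemeasurable
    (aemeasurable_const (b := (1 : ℝ≥0∞)))
  simpa using this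

theorem RR_convert {Ω : Type*} [MeasurableSpace Ω] {P Q : Measure Ω} [IsProbabilityMeasure Q]
    {s t c δ ε δ' : ℝ} (hst : t.HolderConjugate s) (h : RR P Q s c δ) (hc : c ≤ ε / 2)
    (hδ' : 0 < δ') (hδ1 : δ' ≤ 1) (ht : Real.log (1 / δ') ≤ t * ε / 2) (hδ : 0 ≤ δ)
    (O : Set Ω) (hO : MeasurableSet O) :
    P O ≤ ENNReal.ofReal (Real.exp ε) * Q O + ENNReal.ofReal (Real.exp ε * δ' + δ) := by
  classical
  have hs0 : 0 < s := hst.symm.pos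
  have ht0 : 0 < t := hst.pos
  have h1 := h (O.indicator 1) (measurable_one.indicator hO) (fun x => by
    by_cases hx : x ∈ O <;> simp [hx])
  have e1 : ∫⁻ x, O.indicator 1 x ∂P = P O := lintegral_indicator_one hO
  have e2 : ∫⁻ x, (O.indicator 1 x : ℝ≥0∞) ^ s ∂Q = Q O := by
    rw [← lintegral_indicator_one hO]
    refine lintegral_congr fun x => ?_
    by_cases hx : x ∈ O <;> simp [hx, hs0]
  rw [e1, e2] at h1
  set x := (Q O).toReal with hx
  have hQ : Q O = ENNReal.ofReal x := (ENNReal.ofReal_toReal (measure_ne_top Q O)).symm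
  have hx0 : 0 ≤ x := ENNReal.toReal_nonneg
  have h1s : 1 / s = 1 - 1 / t := by
    have := hst.inv_add_inv_eq_one
    rw [one_div, one_div]; linarith
  set y := max x δ' with hy
  have hy0 : 0 < y := lt_of_lt_of_le hδ' (le_max_right _ _)
  have key : Real.exp c * x ^ (1/s) ≤ Real.exp ε * y := by
    have k1 : x ^ (1/s) ≤ y ^ (1/s) := Real.rpow_le_rpow hx0 (le_max_left _ _) (by positivity)
    have k2 : y ^ (1/s) ≤ y * Real.exp (ε/2) := by
      rw [h1s, Real.rpow_sub hy0, Real.rpow_one, div_eq_mul_inv, ← Real.rpow_neg hy0.le]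
      refine mul_le_mul_of_nonneg_left ?_ hy0.le
      calc y ^ (-(1/t)) ≤ δ' ^ (-(1/t)) :=
            Real.rpow_le_rpow_of_nonpos hδ' (le_max_right _ _) (by simp; exact ht0.le)
        _ = Real.exp (Real.log (1/δ') / t) := by
            rw [Real.rpow_def_of_pos hδ', one_div δ', Real.log_inv]; congr 1; field_simp
        _ ≤ _ := by
            apply Real.exp_le_exp.mpr
            rw [div_le_iff₀ ht0]; linarith
    calc Real.exp c * x ^ (1/s) ≤ Real.exp (ε/2) * (y * Real.exp (ε/2)) :=
          mul_le_mul (Real.exp_le_exp.mpr hc) (k1.trans k2) (by positivity) (by positivity)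
      _ = Real.exp ε * y := by
          rw [mul_left_comm, ← Real.exp_add]; ring_nf
  refine h1.trans ?_
  rw [hQ, ENNReal.ofReal_rpow_of_nonneg hx0 (by positivity), ← ENNReal.ofReal_mul (Real.exp_pos _).le,
    ← ENNReal.ofReal_mul (Real.exp_pos _).le, ← ENNReal.ofReal_add (by positivity) hδ,
    ← ENNReal.ofReal_add (by positivity) (by positivity)]
  apply ENNReal.ofReal_le_ofReal
  have : y ≤ x + δ' := max_le (by linarith) (by linarith)
  have := mul_le_mul_of_nonneg_left this (Real.exp_pos ε).le
  linarith

theorem dp_density {Ω : Type*} [MeasurableSpace Ω] {P Q : Measure Ω} [IsProbabilityMeasure P]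
    [IsProbabilityMeasure Q] {E δ : ℝ≥0∞} (hE : E ≠ ∞) 
    (h : ∀ O, MeasurableSet O → P O ≤ E * Q O + δ) :
    ∃ g : Ω → ℝ≥0∞, Measurable g ∧ (∀ x, g x ≤ E) ∧ Q.withDensity g ≤ P ∧
      ∀ f : Ω → ℝ≥0∞, Measurable f → (∀ x, f x ≤ 1) →
        ∫⁻ x, f x ∂P ≤ ∫⁻ x, g x * f x ∂Q + δ := by
  classical
  let r := P.rnDeriv Q
  have hr : Measurable r := Measure.measurable_rnDeriv P Q
  let g : Ω → ℝ≥0∞ := fun x => min (r x) E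
  have hg : Measurable g := hr.min measurable_const
  have hle : Q.withDensity g ≤ P :=
    (withDensity_mono (Filter.Eventually.of_forall fun x => min_le_left _ _)).trans
      (Measure.withDensity_rnDeriv_le P Q)
  obtain ⟨S, hS, hS1, hS2⟩ := Measure.mutuallySingular_singularPart P Q
  have hdec := Measure.haveLebesgueDecomposition_add P Q
  let A : Set Ω := Sᶜ ∪ {x | E < r x}
  have hA : MeasurableSet A := hS.compl.union (measurableSet_lt measurable_const hr)
  have hset : ∀ O, MeasurableSet O → P O ≤ Q.withDensity g O + δ := by
    intro O hO
    have c1 : P (O \ A) ≤ Q.withDensity g (O \ A) := by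
      have : P (O \ A) = P.singularPart Q (O \ A) + Q.withDensity r (O \ A) := by
        conv_lhs => rw [hdec]
        rfl
      rw [this]
      have z : P.singularPart Q (O \ A) = 0 := by
        refine measure_mono_null ?_ hS1
        intro x hx; by_contra hxS; exact hx.2 (Or.inl hxS)
      rw [z, zero_add, withDensity_apply _ (hO.diff hA), withDensity_apply _ (hO.diff hA)]
      refine setLIntegral_mono hg fun x hx => ?_
      have : ¬ E < r x := fun hh => hx.2 (Or.inr hh)
      exact le_min le_rfl (not_lt.mp this)
    have c2 : P (O ∩ A) ≤ Q.withDensity g (O ∩ A) + δ := by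
      refine (h _ (hO.inter hA)).trans ?_
      gcongr
      rw [withDensity_apply _ (hO.inter hA), ← setLIntegral_const]
      refine lintegral_mono_ae ?_
      have hq : ∀ᵐ x ∂Q, x ∉ Sᶜ := measure_eq_zero_iff_ae_notMem.mp hS2
      filter_upwards [ae_restrict_of_ae hq, ae_restrict_mem (hO.inter hA)] with x hx hxm
      rcases hxm.2 with hh | hh
      · exact absurd hh hx
      · exact le_min (le_of_lt hh) le_rfl
    calc P O = P (O ∩ A) + P (O \ A) := (measure_inter_add_diff O hA).symm
      _ ≤ (Q.withDensity g (O ∩ A) + δ) + Q.withDensity g (O \ A) := add_le_add c2 c1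
      _ = Q.withDensity g (O ∩ A) + Q.withDensity g (O \ A) + δ := by ring
      _ = _ := by rw [measure_inter_add_diff O hA]
  refine ⟨g, hg, fun x => min_le_right _ _, hle, fun f hf hf1 => ?_⟩
  haveI : IsFiniteMeasure (Q.withDensity g) := isFiniteMeasure_of_le P hle
  have hP : P = (P - Q.withDensity g) + Q.withDensity g := (Measure.sub_add_cancel_of_le hle).symm
  have htot : (P - Q.withDensity g) Set.univ ≤ δ := by
    rw [Measure.sub_apply MeasurableSet.univ hle]
    exact tsub_le_iff_left.mpr (hset _ MeasurableSet.univ)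
  calc ∫⁻ x, f x ∂P = ∫⁻ x, f x ∂(P - Q.withDensity g) + ∫⁻ x, f x ∂(Q.withDensity g) := by
        conv_lhs => rw [hP]
        rw [lintegral_add_measure]
    _ ≤ δ + ∫⁻ x, g x * f x ∂Q := by
        refine add_le_add ?_ ?_
        · calc ∫⁻ x, f x ∂(P - Q.withDensity g) ≤ ∫⁻ x, 1 ∂(P - Q.withDensity g) := lintegral_mono hf1
            _ = (P - Q.withDensity g) Set.univ := by simp
            _ ≤ δ := htot
        · rw [lintegral_withDensity_eq_lintegral_mul _ hg hf]; rfl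
    _ = _ := add_comm _ _

theorem RR_of_dp {Ω : Type*} [MeasurableSpace Ω] {P Q : Measure Ω} [IsProbabilityMeasure P]
    [IsProbabilityMeasure Q] {s t ε δ : ℝ} (hst : t.HolderConjugate s) (hε : 0 ≤ ε) (hδ : 0 ≤ δ)
    (htε : t * ε ≤ 1)
    (hPQ : ∀ O, MeasurableSet O → P O ≤ ENNReal.ofReal (Real.exp ε) * Q O + ENNReal.ofReal δ)
    (hQP : ∀ O, MeasurableSet O → Q O ≤ ENNReal.ofReal (Real.exp ε) * P O + ENNReal.ofReal δ) :
    RR P Q s (δ + t * ε ^ 2) δ := by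
  classical
  obtain ⟨g, hg, hgE, hgP, hgf⟩ := dp_density ENNReal.ofReal_ne_top hPQ
  have ht0 : 0 < t := hst.pos
  let l := ENNReal.ofReal (Real.exp (-ε))
  let k : Ω → ℝ≥0∞ := fun x => max (g x) l
  have hk : Measurable k := hg.max measurable_const
  have hkint : ∫⁻ x, k x ∂Q ≤ 1 + ENNReal.ofReal δ := by
    let A : Set Ω := {x | g x < l}
    have hA : MeasurableSet A := measurableSet_lt hg measurable_const
    rw [← lintegral_add_compl _ hA]
    have c1 : ∫⁻ x in A, k x ∂Q ≤ P A + ENNReal.ofReal δ := by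
      calc ∫⁻ x in A, k x ∂Q ≤ ∫⁻ x in A, l ∂Q :=
            setLIntegral_mono measurable_const fun x hx => max_le (le_of_lt hx) le_rfl
        _ = l * Q A := setLIntegral_const _ _
        _ ≤ l * (ENNReal.ofReal (Real.exp ε) * P A + ENNReal.ofReal δ) := by gcongr; exact hQP A hA
        _ = P A + l * ENNReal.ofReal δ := by
            rw [mul_add, ← mul_assoc, ← ENNReal.ofReal_mul (Real.exp_pos _).le, ← Real.exp_add]
            simp
        _ ≤ P A + 1 * ENNReal.ofReal δ := by
            gcongr
            simp only [l]; rw [← ENNReal.ofReal_one]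
            exact ENNReal.ofReal_le_ofReal (Real.exp_le_one_iff.mpr (by linarith))
        _ = _ := by rw [one_mul]
    have c2 : ∫⁻ x in Aᶜ, k x ∂Q ≤ P Aᶜ := by
      calc ∫⁻ x in Aᶜ, k x ∂Q ≤ ∫⁻ x in Aᶜ, g x ∂Q :=
            setLIntegral_mono hg fun x hx => max_le le_rfl (not_lt.mp hx)
        _ = Q.withDensity g Aᶜ := (withDensity_apply _ hA.compl).symm
        _ ≤ P Aᶜ := hgP _
    calc _ ≤ (P A + ENNReal.ofReal δ) + P Aᶜ := add_le_add c1 c2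
      _ = P A + P Aᶜ + ENNReal.ofReal δ := by ring
      _ = _ := by rw [prob_add_prob_compl hA]
  have hpt : ∀ x, k x ^ t + ENNReal.ofReal t ≤ ENNReal.ofReal t * k x + ENNReal.ofReal (1 + t^2 * ε^2) := by
    intro x
    have hk1 : k x ≤ ENNReal.ofReal (Real.exp ε) := max_le (hgE x)
      (ENNReal.ofReal_le_ofReal (Real.exp_le_exp.mpr (by linarith)))
    have hk2 : l ≤ k x := le_max_right _ _
    have hkt : k x ≠ ∞ := (hk1.trans_lt ENNReal.ofReal_lt_top).ne
    set z := (k x).toReal with hz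
    have ez : k x = ENNReal.ofReal z := (ENNReal.ofReal_toReal hkt).symm
    have z1 : z ≤ Real.exp ε := by
      rw [ez] at hk1; exact (ENNReal.ofReal_le_ofReal_iff (Real.exp_pos _).le).mp hk1
    have z2 : Real.exp (-ε) ≤ z := by
      rw [ez] at hk2; exact (ENNReal.ofReal_le_ofReal_iff ENNReal.toReal_nonneg).mp hk2
    have z0 : 0 < z := lt_of_lt_of_le (Real.exp_pos _) z2
    rw [ez, ENNReal.ofReal_rpow_of_nonneg z0.le ht0.le, ← ENNReal.ofReal_add (by positivity) ht0.le,
      ← ENNReal.ofReal_mul ht0.le, ← ENNReal.ofReal_add (by positivity) (by positivity)]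
    apply ENNReal.ofReal_le_ofReal
    set y := Real.log z with hy
    have y1 : y ≤ ε := by rw [hy, Real.log_le_iff_le_exp z0]; exact z1
    have y2 : -ε ≤ y := by rw [hy, Real.le_log_iff_exp_le z0]; exact z2
    have y3 : y + 1 ≤ z := by
      have := Real.add_one_le_exp y; rwa [hy, Real.exp_log z0] at this
    have yabs : |y| ≤ ε := abs_le.mpr ⟨y2, y1⟩
    have yt : |t * y| ≤ 1 := by
      rw [abs_mul, abs_of_pos ht0]
      exact (mul_le_mul_of_nonneg_left yabs ht0.le).trans htε
    have e1 := Real.abs_exp_sub_one_sub_id_le yt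
    have e2 : z ^ t = Real.exp (t * y) := by rw [Real.rpow_def_of_pos z0, mul_comm]
    rw [e2]
    have e3 := (abs_le.mp e1).2
    have e4 : (t * y)^2 ≤ t^2 * ε^2 := by
      rw [mul_pow]
      have : y^2 ≤ ε^2 := by rw [← sq_abs]; exact pow_le_pow_left₀ (abs_nonneg _) yabs 2
      exact mul_le_mul_of_nonneg_left this (by positivity)
    nlinarith [mul_le_mul_of_nonneg_left y3 ht0.le]
  have hkt : ∫⁻ x, k x ^ t ∂Q ≤ ENNReal.ofReal (Real.exp (t * (δ + t * ε^2))) := by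
    have i1 : ∫⁻ x, k x ^ t ∂Q + ENNReal.ofReal t ≤
        ENNReal.ofReal t * (1 + ENNReal.ofReal δ) + ENNReal.ofReal (1 + t^2 * ε^2) := by
      calc ∫⁻ x, k x ^ t ∂Q + ENNReal.ofReal t = ∫⁻ x, (k x ^ t + ENNReal.ofReal t) ∂Q := by
            rw [lintegral_add_right _ measurable_const]; simp
        _ ≤ ∫⁻ x, (ENNReal.ofReal t * k x + ENNReal.ofReal (1 + t^2 * ε^2)) ∂Q := lintegral_mono hpt
        _ = ENNReal.ofReal t * ∫⁻ x, k x ∂Q + ENNReal.ofReal (1 + t^2 * ε^2) := by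
            rw [lintegral_add_right _ measurable_const, lintegral_const_mul _ hk]; simp
        _ ≤ _ := by gcongr
    have i2 : ENNReal.ofReal t * (1 + ENNReal.ofReal δ) + ENNReal.ofReal (1 + t^2 * ε^2)
        = ENNReal.ofReal (1 + t * δ + t^2 * ε^2) + ENNReal.ofReal t := by
      rw [← ENNReal.ofReal_one, ← ENNReal.ofReal_add zero_le_one hδ, ← ENNReal.ofReal_mul ht0.le,
        ← ENNReal.ofReal_add (by positivity) (by positivity),
        ← ENNReal.ofReal_add (by positivity) (by positivity)]
      congr 1; ring
    rw [i2] at i1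
    have i3 := (ENNReal.add_le_add_iff_right ENNReal.ofReal_ne_top).mp i1
    refine i3.trans (ENNReal.ofReal_le_ofReal ?_)
    have := Real.add_one_le_exp (t * (δ + t * ε^2))
    nlinarith
  intro f hf hf1
  have hold := ENNReal.lintegral_mul_le_Lp_mul_Lq Q hst hk.aemeasurable hf.aemeasurable
  refine (hgf f hf hf1).trans ?_
  gcongr
  calc ∫⁻ x, g x * f x ∂Q ≤ ∫⁻ x, (k * f) x ∂Q := lintegral_mono fun x => by
          simp only [Pi.mul_apply, k]; gcongr; exact le_max_left _ _
    _ ≤ _ := hold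
    _ ≤ _ := by
      gcongr
      calc (∫⁻ x, k x ^ t ∂Q) ^ (1/t) ≤ (ENNReal.ofReal (Real.exp (t * (δ + t * ε^2)))) ^ (1/t) :=
            ENNReal.rpow_le_rpow hkt (by positivity)
        _ = _ := by
            rw [ENNReal.ofReal_rpow_of_nonneg (Real.exp_pos _).le (by positivity), ← Real.exp_mul]
            congr 2; field_simp

end

section
theorem pi_withDensity' {ι : Type*} [Fintype ι] {E : Type*} [MeasurableSpace E]
    (μ : Measure E) [IsProbabilityMeasure μ] (f : E → ℝ≥0∞) (hf : Measurable f)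
    [IsProbabilityMeasure (μ.withDensity f)] :
    Measure.pi (fun _ : ι => μ.withDensity f)
      = (Measure.pi fun _ : ι => μ).withDensity (fun x => ∏ i, f (x i)) := by
  refine Measure.pi_eq fun s hs => ?_
  rw [withDensity_apply _ (MeasurableSet.univ_pi hs), ← lintegral_indicator (MeasurableSet.univ_pi hs)]
  have e1 : ∀ x : ι → E, (Set.univ.pi s).indicator (fun x => ∏ i, f (x i)) x
      = ∏ i, (s i).indicator f (x i) := by
    intro x
    by_cases hx : x ∈ Set.univ.pi s
    · rw [Set.indicator_of_mem hx]
      refine Finset.prod_congr rfl fun i _ => ?_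
      rw [Set.indicator_of_mem (hx i trivial)]
    · rw [Set.indicator_of_notMem hx]
      simp only [Set.mem_pi, Set.mem_univ, true_imp_iff, not_forall] at hx
      obtain ⟨i, hi⟩ := hx
      symm
      apply Finset.prod_eq_zero (Finset.mem_univ i)
      rw [Set.indicator_of_notMem hi]
  simp_rw [e1]
  rw [lintegral_pi_prod (fun _ : ι => μ) (fun i => (s i).indicator f) (fun i => hf.indicator (hs i))]
  refine Finset.prod_congr rfl fun i _ => ?_
  rw [withDensity_apply _ (hs i), lintegral_indicator (hs i)]

def rhoR (a x : ℝ) : ℝ := Real.sqrt (a / (a + 1)) * Real.exp (x ^ 2 / (2 * (a * (a + 1))))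

theorem rho_mul_pdf (a : ℝ) (ha : 0 < a) (x : ℝ) :
    gaussianPDFReal 0 (Real.toNNReal a) x * rhoR a x = gaussianPDFReal 0 (Real.toNNReal (a + 1)) x := by
  have hpi := Real.pi_pos
  unfold gaussianPDFReal rhoR
  rw [Real.coe_toNNReal _ ha.le, Real.coe_toNNReal _ (by linarith)]
  have e : (√(2 * π * a))⁻¹ * √(a / (a + 1)) = (√(2 * π * (a + 1)))⁻¹ := by
    rw [← Real.sqrt_inv, ← Real.sqrt_inv, ← Real.sqrt_mul (by positivity)]
    congr 1; field_simp
  rw [← e]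
  have e2 : rexp (-(x - 0) ^ 2 / (2 * (a + 1)))
    = rexp (-(x - 0) ^ 2 / (2 * a)) * rexp (x ^ 2 / (2 * (a * (a + 1)))) := by
    rw [← Real.exp_add]; congr 1; field_simp; ring
  rw [e2]; ring

theorem rho_pow_mul_pdf (a : ℝ) (t : ℕ) (ha : 0 < a) (hta : (t : ℝ) < a) (x : ℝ) :
    gaussianPDFReal 0 (Real.toNNReal (a+1)) x * rhoR a x ^ t
      = (Real.sqrt (a / (a+1)) ^ t * Real.sqrt (a / (a - t))) *
        gaussianPDFReal 0 (Real.toNNReal (a * (a + 1) / (a - t))) x := by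
  have hpi := Real.pi_pos
  have hd : 0 < a - t := by linarith
  unfold gaussianPDFReal rhoR
  rw [Real.coe_toNNReal _ (by positivity), Real.coe_toNNReal _ (by positivity)]
  have e : (√(2 * π * (a+1)))⁻¹ = √(a / (a - t)) * (√(2 * π * (a * (a + 1) / (a - t))))⁻¹ := by
    rw [← Real.sqrt_inv, ← Real.sqrt_inv, ← Real.sqrt_mul (by positivity)]
    congr 1; field_simp
  rw [e, mul_pow, ← Real.exp_nat_mul]
  have e2 : rexp (-(x - 0) ^ 2 / (2 * (a * (a + 1) / (a - t))))
    = rexp (-(x - 0) ^ 2 / (2 * (a+1))) * rexp (t * (x ^ 2 / (2 * (a * (a + 1))))) := by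
    rw [← Real.exp_add]; congr 1; field_simp; ring
  rw [e2]; ring

theorem gauss_ratio (a : ℝ) (ha : 0 < a) : gaussianReal 0 (Real.toNNReal (a + 1))
    = (gaussianReal 0 (Real.toNNReal a)).withDensity (fun x => ENNReal.ofReal (rhoR a x)) := by
  have h1 : Real.toNNReal a ≠ 0 := by simp [ha]
  have h2 : Real.toNNReal (a + 1) ≠ 0 := by
    simp; linarith
  rw [gaussianReal_of_var_ne_zero _ h1, gaussianReal_of_var_ne_zero _ h2]
  have hm : Measurable fun x => ENNReal.ofReal (rhoR a x) := by unfold rhoR; fun_prop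
  rw [← withDensity_mul _ (measurable_gaussianPDF _ _) hm]
  congr 1; funext x
  simp only [Pi.mul_apply, gaussianPDF]
  rw [← ENNReal.ofReal_mul (gaussianPDFReal_nonneg _ _ _), rho_mul_pdf a ha]

theorem lintegral_rho_pow (a : ℝ) (t : ℕ) (ha : 0 < a) (hta : (t : ℝ) < a) :
    ∫⁻ x, ENNReal.ofReal (rhoR a x) ^ t ∂(gaussianReal 0 (Real.toNNReal (a + 1)))
      = ENNReal.ofReal (Real.sqrt (a / (a+1)) ^ t * Real.sqrt (a / (a - t))) := by
  have hd : 0 < a - t := by linarith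
  have h2 : Real.toNNReal (a + 1) ≠ 0 := by
    simp; linarith
  have h3 : Real.toNNReal (a * (a + 1) / (a - t)) ≠ 0 := by
    simp; positivity
  have hm : Measurable fun x => ENNReal.ofReal (rhoR a x) := by unfold rhoR; fun_prop
  have hr : ∀ x, 0 ≤ rhoR a x := fun x => by unfold rhoR; positivity
  rw [gaussianReal_of_var_ne_zero _ h2,
    lintegral_withDensity_eq_lintegral_mul _ (measurable_gaussianPDF _ _) (hm.pow_const t)]
  have e : ∀ x, (gaussianPDF 0 (Real.toNNReal (a+1)) * fun x => ENNReal.ofReal (rhoR a x) ^ t) x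
      = ENNReal.ofReal (Real.sqrt (a / (a+1)) ^ t * Real.sqrt (a / (a - t))) *
        gaussianPDF 0 (Real.toNNReal (a * (a + 1) / (a - t))) x := by
    intro x
    simp only [Pi.mul_apply, gaussianPDF]
    rw [← ENNReal.ofReal_pow (hr x), ← ENNReal.ofReal_mul (gaussianPDFReal_nonneg _ _ _),
      rho_pow_mul_pdf a t ha hta, ENNReal.ofReal_mul (by positivity)]
  rw [lintegral_congr e, lintegral_const_mul _ (measurable_gaussianPDF _ _),
    lintegral_gaussianPDF_eq_one _ h3, mul_one]

theorem rho_num (a : ℝ) (t p : ℕ) (ht : 1 ≤ t) (hp : 4 ≤ p) (hta : (t : ℝ) * Real.sqrt p ≤ a) :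
    (Real.sqrt (a / (a+1)) ^ t * Real.sqrt (a / (a - t))) ^ p ≤ Real.exp 2 := by
  have ht' : (1 : ℝ) ≤ t := by exact_mod_cast ht
  have hp' : (4 : ℝ) ≤ p := by exact_mod_cast hp
  have hsp : 2 ≤ Real.sqrt p := by
    rw [show (2:ℝ) = Real.sqrt 4 by rw [show (4:ℝ) = 2^2 by norm_num]; simp]
    exact Real.sqrt_le_sqrt hp'
  have h2t : 2 * (t:ℝ) ≤ a := by nlinarith
  have ha : 0 < a := by linarith
  have hpa : (t:ℝ)^2 * p ≤ a^2 := by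
    have := pow_le_pow_left₀ (by positivity) hta 2
    rwa [mul_pow, Real.sq_sqrt (by positivity)] at this
  have hd : 0 < a - t := by linarith
  have hx1 : Real.sqrt (a/(a+1)) = Real.exp (-(1/2) * Real.log (1 + 1/a)) := by
    rw [Real.sqrt_eq_rpow, Real.rpow_def_of_pos (by positivity)]
    congr 1
    rw [show a / (a+1) = (1 + 1/a)⁻¹ by field_simp, Real.log_inv]; ring
  have hx2 : Real.sqrt (a/(a-t)) = Real.exp ((1/2) * Real.log (a / (a-t))) := by
    rw [Real.sqrt_eq_rpow, Real.rpow_def_of_pos (by positivity)]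
    congr 1; ring
  rw [hx1, hx2, ← Real.exp_nat_mul, ← Real.exp_add, ← Real.exp_nat_mul]
  apply Real.exp_le_exp.mpr
  have l1 : 1/a - 1/a^2 ≤ Real.log (1 + 1/a) := by
    have := Real.one_sub_inv_le_log_of_pos (show 0 < 1 + 1/a by positivity)
    refine le_trans ?_ this
    rw [show 1 - (1 + 1/a)⁻¹ = 1/(a+1) by field_simp; ring]
    rw [div_sub_div _ _ (by positivity) (by positivity), div_le_div_iff₀ (by positivity) (by positivity)]
    nlinarith [pow_pos ha 3]
  have l2 : Real.log (a / (a - t)) ≤ t/a + 2*t^2/a^2 := by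
    have := Real.log_le_sub_one_of_pos (show 0 < a / (a-t) by positivity)
    refine this.trans ?_
    rw [show a/(a-t) - 1 = t/(a-t) by field_simp; ring]
    rw [div_add_div _ _ (by positivity) (by positivity), div_le_div_iff₀ hd (by positivity)]
    have : 0 ≤ (t:ℝ) * a * t * (a - 2*t) := by
      apply mul_nonneg (by positivity) (by linarith)
    nlinarith
  have l3 : (t:ℝ) * (1/a - 1/a^2) ≤ t * Real.log (1+1/a) := mul_le_mul_of_nonneg_left l1 (by positivity)
  have l4 : (t:ℝ) * (-(1/2) * Real.log (1 + 1/a)) + 1/2 * Real.log (a/(a-t)) ≤ 2 * t^2/a^2 := by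
    have : (t:ℝ)/a^2 ≤ t^2/a^2 := by
      apply div_le_div_of_nonneg_right _ (by positivity); nlinarith
    have e1 : (t:ℝ) * (1/a - 1/a^2) = t/a - t/a^2 := by ring
    have e2 : 2 * (t:ℝ)^2/a^2 = 2 * (t^2/a^2) := by ring
    have : 0 ≤ (t:ℝ)^2/a^2 := by positivity
    rw [e2] at l2 ⊢
    rw [e1] at l3
    linarith
  calc _ ≤ (p:ℝ) * (2 * t^2/a^2) := by gcongr
    _ = 2 * (t^2 * p / a^2) := by ring
    _ ≤ 2 * 1 := by
        gcongr
        rw [div_le_one (by positivity)]; exact hpa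
    _ = 2 := by norm_num

/-- product Gaussian comparison -/
theorem pi_gauss_dom (a : ℝ) (t p : ℕ) (ht : 1 ≤ t) (hp : 4 ≤ p) (hta : (t : ℝ) * Real.sqrt p ≤ a)
    (O : Set (Fin p → ℝ)) (hO : MeasurableSet O) :
    Measure.pi (fun _ : Fin p => gaussianReal 0 (Real.toNNReal (a+1))) O
      ≤ ENNReal.ofReal (Real.exp 3) * Measure.pi (fun _ : Fin p => gaussianReal 0 (Real.toNNReal a)) O
        + ENNReal.ofReal (Real.exp (-t)) := by
  have ht' : (1 : ℝ) ≤ t := by exact_mod_cast ht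
  have hp' : (4 : ℝ) ≤ p := by exact_mod_cast hp
  have hsp : 2 ≤ Real.sqrt p := by
    rw [show (2:ℝ) = Real.sqrt 4 by rw [show (4:ℝ) = 2^2 by norm_num]; simp]
    exact Real.sqrt_le_sqrt hp'
  have h2t : 2 * (t:ℝ) ≤ a := by nlinarith
  have ha : 0 < a := by linarith
  have hm : Measurable fun x => ENNReal.ofReal (rhoR a x) := by unfold rhoR; fun_prop
  let F : (Fin p → ℝ) → ℝ≥0∞ := fun x => ∏ i, ENNReal.ofReal (rhoR a (x i))
  have hF : Measurable F := Finset.measurable_prod _ fun i _ => hm.comp (measurable_pi_apply i)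
  set Q := Measure.pi (fun _ : Fin p => gaussianReal 0 (Real.toNNReal a)) with hQ
  set P := Measure.pi (fun _ : Fin p => gaussianReal 0 (Real.toNNReal (a+1))) with hP
  have hPQ : P = Q.withDensity F := by
    rw [hP, hQ]
    have h1 := gauss_ratio a ha
    haveI : IsProbabilityMeasure ((gaussianReal 0 (Real.toNNReal a)).withDensity
      (fun x => ENNReal.ofReal (rhoR a x))) := by rw [← h1]; infer_instance
    rw [h1]
    exact pi_withDensity' (ι := Fin p) _ _ hm
  let H := ENNReal.ofReal (Real.exp 3)
  have hH0 : H ≠ 0 := by simp [H, Real.exp_pos]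
  let A : Set (Fin p → ℝ) := {x | H < F x}
  have hA : MeasurableSet A := measurableSet_lt measurable_const hF
  have c1 : P (O \ A) ≤ H * Q O := by
    rw [hPQ, withDensity_apply _ (hO.diff hA)]
    calc ∫⁻ x in O \ A, F x ∂Q ≤ ∫⁻ x in O \ A, H ∂Q :=
          setLIntegral_mono measurable_const fun x hx => not_lt.mp hx.2
      _ = H * Q (O \ A) := setLIntegral_const _ _
      _ ≤ _ := by gcongr; exact Set.diff_subset
  have c2 : P A ≤ ENNReal.ofReal (Real.exp (-t)) := by
    have m1 : H ^ t * P A ≤ ∫⁻ x, F x ^ t ∂P := by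
      refine le_trans ?_ (mul_meas_ge_le_lintegral₀ (hF.pow_const t).aemeasurable (H ^ t))
      gcongr
      intro x hx
      exact pow_le_pow_left₀ (zero_le) (le_of_lt (show H < F x from hx)) t
    have m2 : ∫⁻ x, F x ^ t ∂P ≤ ENNReal.ofReal (Real.exp 2) := by
      have : ∀ x, F x ^ t = ∏ i, ENNReal.ofReal (rhoR a (x i)) ^ t := fun x => by
        simp only [F, Finset.prod_pow]
      simp_rw [this]
      rw [hP, lintegral_pi_prod _ (fun _ x => ENNReal.ofReal (rhoR a x) ^ t) (fun i => hm.pow_const t)]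
      simp only [lintegral_rho_pow a t ha (by linarith), Finset.prod_const, Finset.card_univ,
        Fintype.card_fin]
      rw [← ENNReal.ofReal_pow (by positivity)]
      exact ENNReal.ofReal_le_ofReal (rho_num a t p ht hp hta)
    have m3 : H ^ t = ENNReal.ofReal (Real.exp (3 * t)) := by
      simp only [H]
      rw [← ENNReal.ofReal_pow (Real.exp_pos _).le, ← Real.exp_nat_mul]; congr 2; ring
    have m4 : P A = ENNReal.ofReal (Real.exp (-(3*t))) * (H ^ t * P A) := by
      rw [m3, ← mul_assoc, ← ENNReal.ofReal_mul (Real.exp_pos _).le, ← Real.exp_add]; simp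
    rw [m4]
    calc _ ≤ ENNReal.ofReal (Real.exp (-(3*t))) * ENNReal.ofReal (Real.exp 2) := by
          gcongr; exact m1.trans m2
      _ = ENNReal.ofReal (Real.exp (-(3*t) + 2)) := by
          rw [← ENNReal.ofReal_mul (Real.exp_pos _).le, ← Real.exp_add]
      _ ≤ _ := by
          apply ENNReal.ofReal_le_ofReal; apply Real.exp_le_exp.mpr; linarith
  calc P O ≤ P ((O \ A) ∪ A) := measure_mono (by intro x hx; by_cases h : x ∈ A <;> simp [hx, h])
    _ ≤ P (O \ A) + P A := measure_union_le _ _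
    _ ≤ _ := add_le_add c1 c2

/-- one-sided approximate domination -/
def Dom {Ω : Type*} [MeasurableSpace Ω] (P Q : Measure Ω) (H δ : ℝ≥0∞) : Prop :=
  ∀ O, MeasurableSet O → P O ≤ H * Q O + δ

theorem Dom.map {Ω Ω' : Type*} [MeasurableSpace Ω] [MeasurableSpace Ω'] {P Q : Measure Ω} {H δ : ℝ≥0∞}
    (h : Dom P Q H δ) (f : Ω → Ω') (hf : Measurable f) : Dom (P.map f) (Q.map f) H δ := by
  intro O hO
  rw [Measure.map_apply hf hO, Measure.map_apply hf hO]
  exact h _ (hf hO)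

theorem Dom.prod {Ω Ω' : Type*} [MeasurableSpace Ω] [MeasurableSpace Ω'] {P Q : Measure Ω} {H δ : ℝ≥0∞}
    [SFinite P] [SFinite Q]
    (h : Dom P Q H δ) (ν : Measure Ω') [IsProbabilityMeasure ν] : Dom (P.prod ν) (Q.prod ν) H δ := by
  intro O hO
  rw [Measure.prod_apply_symm hO, Measure.prod_apply_symm hO]
  calc ∫⁻ y, P ((fun x => (x, y)) ⁻¹' O) ∂ν ≤ ∫⁻ y, (H * Q ((fun x => (x, y)) ⁻¹' O) + δ) ∂ν :=
        lintegral_mono fun y => h _ (measurable_prodMk_right hO)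
    _ = _ := by
        rw [lintegral_add_right _ measurable_const,
          lintegral_const_mul _ (measurable_measure_prodMk_right hO)]
        simp

/-- single sketch vector and its sketch frame -/
def sk {n D : ℕ} (y : Fin n → Fin D → ℝ) (B : Finset (Fin n)) : Measure (Fin D → ℝ) :=
  (stdG (Fin n)).map (fun g => ∑ i ∈ B, g i • y i)

def skF {n D : ℕ} (p : ℕ) (y : Fin n → Fin D → ℝ) (B : Finset (Fin n)) :
    Measure (Fin p → Fin D → ℝ) :=
  (Measure.pi fun _ : Fin p => stdG (Fin n)).map (fun g l => ∑ i ∈ B, g l i • y i)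

theorem sk_meas {n D : ℕ} (y : Fin n → Fin D → ℝ) (B : Finset (Fin n)) :
    Measurable (fun g : Fin n → ℝ => ∑ i ∈ B, g i • y i) := by
  refine Finset.measurable_sum _ fun i _ => ?_
  fun_prop

theorem skF_meas {n D : ℕ} (p : ℕ) (y : Fin n → Fin D → ℝ) (B : Finset (Fin n)) :
    Measurable (fun (g : Fin p → Fin n → ℝ) l => ∑ i ∈ B, g l i • y i) :=
  measurable_pi_lambda _ fun l => (sk_meas y B).comp (measurable_pi_apply l)

instance sk_prob {n D : ℕ} (y : Fin n → Fin D → ℝ) (B : Finset (Fin n)) :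
    IsProbabilityMeasure (sk y B) := Measure.isProbabilityMeasure_map (sk_meas y B).aemeasurable

instance skF_prob {n D : ℕ} (p : ℕ) (y : Fin n → Fin D → ℝ) (B : Finset (Fin n)) :
    IsProbabilityMeasure (skF p y B) := Measure.isProbabilityMeasure_map (skF_meas p y B).aemeasurable

theorem skF_eq {n D : ℕ} (p : ℕ) (y : Fin n → Fin D → ℝ) (B : Finset (Fin n)) :
    skF p y B = Measure.pi (fun _ : Fin p => sk y B) := by
  unfold skF sk
  rw [Measure.pi_map_pi (fun _ => (sk_meas y B).aemeasurable)]

theorem sk_proj {n D : ℕ} (y : Fin n → Fin D → ℝ) (B : Finset (Fin n)) (v : Fin D → ℝ) :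
    (sk y B).map (fun x => v ⬝ᵥ x) = gaussianReal 0 (Real.toNNReal (∑ i ∈ B, (v ⬝ᵥ y i)^2)) := by
  classical
  unfold sk
  rw [Measure.map_map (by unfold dotProduct; fun_prop) (sk_meas y B)]
  have := stdG_map_lin (fun i => if i ∈ B then v ⬝ᵥ y i else 0)
  convert this using 2
  · funext g
    simp only [Function.comp, dotProduct_sum, dotProduct_smul, smul_eq_mul]
    simp only [ite_mul, zero_mul, Finset.sum_ite_mem, Finset.univ_inter]
    exact Finset.sum_congr rfl fun i _ => mul_comm _ _
  · congr 1
    simp [Finset.sum_ite_mem]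

/-- model of the sketch law after splitting off one direction -/
theorem sk_split {n D : ℕ} (y : Fin n → Fin D → ℝ) (B : Finset (Fin n)) (y1 : Fin D → ℝ) (a c : ℝ)
    (ha : 0 ≤ a) (hc : 0 ≤ c) (E : Matrix (Fin D) (Fin D) ℝ)
    (h : ∀ v, ∑ i ∈ B, (v ⬝ᵥ y i)^2 = c * (v ⬝ᵥ y1)^2 + (v ᵥ* E) ⬝ᵥ (v ᵥ* E)) :
    sk y B = ((gaussianReal 0 (Real.toNNReal c)).prod (stdG (Fin D))).map
      (fun q => q.1 • y1 + E *ᵥ q.2) := by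
  have hm : Measurable (fun q : ℝ × (Fin D → ℝ) => q.1 • y1 + E *ᵥ q.2) := by
    apply Continuous.measurable
    exact (continuous_fst.smul continuous_const).add
      (Continuous.matrix_mulVec continuous_const continuous_snd)
  haveI := Measure.isProbabilityMeasure_map (μ := (gaussianReal 0 (Real.toNNReal c)).prod (stdG (Fin D)))
    hm.aemeasurable
  apply measure_ext_of_proj
  intro v
  have hv : Measurable (fun x : Fin D → ℝ => v ⬝ᵥ x) := by unfold dotProduct; fun_prop
  rw [sk_proj, Measure.map_map hv hm, h]
  have e : (fun x => v ⬝ᵥ x) ∘ (fun q : ℝ × (Fin D → ℝ) => q.1 • y1 + E *ᵥ q.2)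
      = (fun q : ℝ × ℝ => q.1 + q.2) ∘ (Prod.map (fun x : ℝ => (v ⬝ᵥ y1) * x)
          (fun g : Fin D → ℝ => ∑ i, (v ᵥ* E) i * g i)) := by
    funext q
    simp only [Function.comp, Prod.map, dotProduct_add, dotProduct_smul, smul_eq_mul,
      dotProduct_mulVec]
    rw [mul_comm]; rfl
  rw [e, ← Measure.map_map (by fun_prop) (by fun_prop),
    ← Measure.map_prod_map _ _ (by fun_prop) (by fun_prop), gaussianReal_map_const_mul, stdG_map_lin]
  have := gaussianReal_conv_gaussianReal (m₁ := (v ⬝ᵥ y1) * 0) (m₂ := 0)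
    (v₁ := NNReal.mk ((v ⬝ᵥ y1) ^ 2) (sq_nonneg _) * Real.toNNReal c)
    (v₂ := Real.toNNReal (∑ i, (v ᵥ* E) i ^ 2))
  rw [Measure.conv] at this
  rw [this]
  congr 1
  · simp
  · ext
    have : 0 ≤ ∑ i, (v ᵥ* E) i ^ 2 := Finset.sum_nonneg fun i _ => sq_nonneg _
    have e4 : (v ᵥ* E) ⬝ᵥ (v ᵥ* E) = ∑ i, (v ᵥ* E) i ^ 2 := by
      simp [dotProduct, sq]
    rw [e4, NNReal.coe_add, NNReal.coe_mul, Real.coe_toNNReal _ hc, Real.coe_toNNReal _ this,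
      Real.coe_toNNReal _ (by positivity)]
    simp; ring

theorem skF_split {n D : ℕ} (p : ℕ) (y : Fin n → Fin D → ℝ) (B : Finset (Fin n)) (y1 : Fin D → ℝ) (c : ℝ)
    (hc : 0 ≤ c) (E : Matrix (Fin D) (Fin D) ℝ)
    (h : ∀ v, ∑ i ∈ B, (v ⬝ᵥ y i)^2 = c * (v ⬝ᵥ y1)^2 + (v ᵥ* E) ⬝ᵥ (v ᵥ* E)) :
    skF p y B = ((Measure.pi fun _ : Fin p => gaussianReal 0 (Real.toNNReal c)).prod
      (Measure.pi fun _ : Fin p => stdG (Fin D))).map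
        (fun q l => q.1 l • y1 + E *ᵥ q.2 l) := by
  have hm : Measurable (fun q : ℝ × (Fin D → ℝ) => q.1 • y1 + E *ᵥ q.2) := by
    apply Continuous.measurable
    exact (continuous_fst.smul continuous_const).add
      (Continuous.matrix_mulVec continuous_const continuous_snd)
  have hmp := (measurePreserving_arrowProdEquivProdArrow ℝ (Fin D → ℝ) (Fin p)
    (fun _ => gaussianReal 0 (Real.toNNReal c)) (fun _ => stdG (Fin D))).symm
  rw [skF_eq, sk_split y B y1 c c hc hc E h]
  haveI := Measure.isProbabilityMeasure_map (μ := (gaussianReal 0 (Real.toNNReal c)).prod (stdG (Fin D)))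
    hm.aemeasurable
  rw [← Measure.pi_map_pi (fun _ => hm.aemeasurable), ← hmp.map_eq,
    Measure.map_map (show Measurable (fun (x : Fin p → ℝ × (Fin D → ℝ)) l => (x l).1 • y1 + E *ᵥ (x l).2)
      from measurable_pi_lambda _ fun l => hm.comp (measurable_pi_apply l)) hmp.measurable]
  rfl

theorem skF_dom {n D : ℕ} (p t : ℕ) (y : Fin n → Fin D → ℝ) (B : Finset (Fin n)) (i0 : Fin n)
    (hi0 : i0 ∈ B) (a : ℝ) (ht : 1 ≤ t) (hp : 4 ≤ p) (hta : (t : ℝ) * Real.sqrt p ≤ a)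
    (h : ∀ v, a * (v ⬝ᵥ y i0)^2 ≤ ∑ i ∈ B.erase i0, (v ⬝ᵥ y i)^2) :
    Dom (skF p y B) (skF p y (B.erase i0)) (ENNReal.ofReal (Real.exp 3))
      (ENNReal.ofReal (Real.exp (-t))) := by
  have ha : 0 ≤ a := le_trans (by positivity) hta
  let G : Matrix (Fin D) (Fin D) ℝ := ∑ i ∈ B.erase i0, vecMulVec (y i) (y i) - a • vecMulVec (y i0) (y i0)
  have hq : ∀ v, v ⬝ᵥ (G *ᵥ v) = ∑ i ∈ B.erase i0, (v ⬝ᵥ y i)^2 - a * (v ⬝ᵥ y i0)^2 := by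
    intro v
    have e : ∀ z : Fin D → ℝ, v ⬝ᵥ (vecMulVec z z *ᵥ v) = (v ⬝ᵥ z)^2 := by
      intro z
      rw [vecMulVec_mulVec, dotProduct_smul, dotProduct_comm z v]
      simp [sq]
    simp only [G, Matrix.sub_mulVec, dotProduct_sub, Matrix.sum_mulVec, dotProduct_sum, e,
      Matrix.smul_mulVec, dotProduct_smul, smul_eq_mul]
  have hG : G.PosSemidef := by
    refine Matrix.PosSemidef.of_dotProduct_mulVec_nonneg ?_ ?_
    · rw [Matrix.IsHermitian, conjTranspose_eq_transpose_of_trivial]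
      simp only [G, Matrix.transpose_sub, Matrix.transpose_sum, Matrix.transpose_smul,
        Matrix.transpose_vecMulVec]
    · intro v
      simp only [star_trivial]
      rw [hq]; linarith [h v]
  obtain ⟨E, hE⟩ := psd_factor hG
  have hEv : ∀ v, (v ᵥ* E) ⬝ᵥ (v ᵥ* E) = ∑ i ∈ B.erase i0, (v ⬝ᵥ y i)^2 - a * (v ⬝ᵥ y i0)^2 := by
    intro v
    rw [← hq, ← hE, ← Matrix.mulVec_mulVec, dotProduct_mulVec, Matrix.mulVec_transpose]
  rw [skF_split p y B (y i0) (a+1) (by linarith) E (fun v => by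
      rw [hEv, ← Finset.add_sum_erase _ _ hi0]; ring),
    skF_split p y (B.erase i0) (y i0) a ha E (fun v => by rw [hEv]; ring)]
  refine Dom.map (Dom.prod ?_ _) _ ?_
  · intro O hO
    exact pi_gauss_dom a t p ht hp hta O hO
  · refine measurable_pi_lambda _ fun l => ?_
    apply Continuous.measurable
    refine Continuous.add ?_ ?_
    · exact ((continuous_apply l).comp continuous_fst).smul continuous_const
    · exact Continuous.matrix_mulVec continuous_const ((continuous_apply l).comp continuous_snd)

end

section
/-- normalise a finite measure -/
def normM {Ω : Type*} [MeasurableSpace Ω] (ν : Measure Ω) : Measure Ω := (ν Set.univ)⁻¹ • ν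

theorem normM_prob {Ω : Type*} [MeasurableSpace Ω] (ν : Measure Ω) (h0 : ν Set.univ ≠ 0)
    (h1 : ν Set.univ ≠ ∞) : IsProbabilityMeasure (normM ν) := by
  constructor
  simp [normM, ENNReal.inv_mul_cancel h0 h1]

theorem normM_dom {Ω : Type*} [MeasurableSpace Ω] (ν ν' : Measure Ω) (h0 : ν Set.univ ≠ 0)
    (h1 : ν Set.univ ≠ ∞) (h0' : ν' Set.univ ≠ 0) (h1' : ν' Set.univ ≠ ∞) (ε δ : ℝ)
    (hε : ε ≤ 1) (hδ : δ ≤ 1/2) (hδ0 : 0 ≤ δ)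
    (hd : ∀ O, MeasurableSet O → ν O ≤ ENNReal.ofReal (Real.exp ε) * ν' O + ENNReal.ofReal δ * ν Set.univ)
    (hd' : ∀ O, MeasurableSet O → ν' O ≤ ENNReal.ofReal (Real.exp ε) * ν O + ENNReal.ofReal δ * ν' Set.univ)
    (O : Set Ω) (hO : MeasurableSet O) :
    normM ν O ≤ ENNReal.ofReal (Real.exp (2*ε)) * normM ν' O + ENNReal.ofReal (20 * δ) := by
  simp only [normM, Measure.smul_apply, smul_eq_mul]
  have hO1 : ν O ≠ ∞ := ((measure_mono (Set.subset_univ O)).trans_lt h1.lt_top).ne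
  have hO1' : ν' O ≠ ∞ := ((measure_mono (Set.subset_univ O)).trans_lt h1'.lt_top).ne
  have g1 := hd O hO
  have g2 := hd' _ MeasurableSet.univ
  have g3 : ν' O ≤ ν' Set.univ := measure_mono (Set.subset_univ O)
  set A := (ν Set.univ).toReal with hA
  set A' := (ν' Set.univ).toReal with hA'
  set x := (ν O).toReal with hx
  set x' := (ν' O).toReal with hx'
  have eA : ν Set.univ = ENNReal.ofReal A := (ENNReal.ofReal_toReal h1).symm
  have eA' : ν' Set.univ = ENNReal.ofReal A' := (ENNReal.ofReal_toReal h1').symm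
  have ex : ν O = ENNReal.ofReal x := (ENNReal.ofReal_toReal hO1).symm
  have ex' : ν' O = ENNReal.ofReal x' := (ENNReal.ofReal_toReal hO1').symm
  have pA : 0 < A := ENNReal.toReal_pos h0 h1
  have pA' : 0 < A' := ENNReal.toReal_pos h0' h1'
  have px : 0 ≤ x := ENNReal.toReal_nonneg
  have px' : 0 ≤ x' := ENNReal.toReal_nonneg
  have E0 := Real.exp_pos ε
  rw [eA, ex, ex', ← ENNReal.ofReal_mul E0.le, ← ENNReal.ofReal_mul hδ0,
    ← ENNReal.ofReal_add (by positivity) (by positivity), ENNReal.ofReal_le_ofReal_iff (by positivity)] at g1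
  rw [eA, eA', ← ENNReal.ofReal_mul E0.le, ← ENNReal.ofReal_mul hδ0,
    ← ENNReal.ofReal_add (by positivity) (by positivity), ENNReal.ofReal_le_ofReal_iff (by positivity)] at g2
  rw [eA', ex', ENNReal.ofReal_le_ofReal_iff pA'.le] at g3
  rw [eA, eA', ex, ex', ← ENNReal.ofReal_inv_of_pos pA, ← ENNReal.ofReal_inv_of_pos pA',
    ← ENNReal.ofReal_mul (by positivity), ← ENNReal.ofReal_mul (by positivity),
    ← ENNReal.ofReal_mul (by positivity), ← ENNReal.ofReal_add (by positivity) (by positivity)]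
  apply ENNReal.ofReal_le_ofReal
  have e2 : Real.exp (2*ε) = Real.exp ε * Real.exp ε := by rw [← Real.exp_add]; ring_nf
  have hE : Real.exp ε * Real.exp ε ≤ 8 := by
    rw [← e2]
    calc Real.exp (2*ε) ≤ Real.exp 2 := Real.exp_le_exp.mpr (by linarith)
      _ = Real.exp 1 * Real.exp 1 := by rw [← Real.exp_add]; norm_num
      _ ≤ 8 := by nlinarith [Real.exp_one_lt_d9, Real.exp_pos 1]
  -- A'⁻¹ bounds
  have k1 : A' * (1 - δ) ≤ Real.exp ε * A := by linarith
  have k2 : A⁻¹ ≤ Real.exp ε * (1 + 2*δ) * A'⁻¹ := by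
    rw [inv_eq_one_div, inv_eq_one_div, mul_one_div, div_le_div_iff₀ pA pA']
    have : A' ≤ A' * (1 - δ) * (1 + 2*δ) := by nlinarith [mul_nonneg pA'.le hδ0]
    nlinarith
  have k3 : x' * A'⁻¹ ≤ 1 := by
    rw [← div_eq_mul_inv, div_le_one pA']; exact g3
  have k4 : 0 ≤ x' * A'⁻¹ := by positivity
  calc A⁻¹ * x ≤ A⁻¹ * (Real.exp ε * x' + δ * A) := by gcongr
    _ = Real.exp ε * x' * A⁻¹ + δ := by field_simp
    _ ≤ Real.exp ε * x' * (Real.exp ε * (1 + 2*δ) * A'⁻¹) + δ := by gcongr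
    _ = (Real.exp ε * Real.exp ε) * (x' * A'⁻¹) + (Real.exp ε * Real.exp ε) * (2 * δ * (x' * A'⁻¹)) + δ := by ring
    _ ≤ (Real.exp ε * Real.exp ε) * (x' * A'⁻¹) + 8 * (2 * δ * 1) + δ := by gcongr
    _ ≤ _ := by rw [e2]; nlinarith

/-- abstract single-step domination -/
theorem step_dom {Ω : Type*} [MeasurableSpace Ω] {n : ℕ} (i0 : Fin n) (h : ℕ)
    (w w' e : Finset (Fin n) → ℝ≥0∞) (φ φ' : Finset (Fin n) → Measure Ω) (ν0 : Measure Ω) (Λ E β H δ1 δ2 : ℝ≥0∞)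
    (hφp : ∀ B, φ B Set.univ = 1) (hφ : ∀ B, i0 ∉ B → φ B = φ' B)
    (hw : ∀ B, i0 ∉ B → w B ≤ E * w' B + e B) (he : ∑ B, e B ≤ δ1 * Λ)
    (hs : ∀ B, B.card < h → w B = 0) (hsh : ∑ B ∈ Finset.univ.filter (fun B => B.card = h), w B ≤ δ1 * Λ)
    (hb : ∀ B, i0 ∈ B → h < B.card → w B ≠ 0 → w B ≤ β * w (B.erase i0) ∧
      Dom (φ B) (φ (B.erase i0)) H δ2)
    (hν0 : ν0 Set.univ = 1) (hE : 1 ≤ E) (hβ : β * H ≤ 1)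
    (O : Set Ω) (hO : MeasurableSet O) :
    (Λ • ν0 + ∑ B, w B • φ B) O ≤ E * (1 + β * H) * (Λ • ν0 + ∑ B, w' B • φ' B) O
      + (3 * δ1 + δ2) * (Λ • ν0 + ∑ B, w B • φ B) Set.univ := by
  classical
  simp only [Measure.add_apply, Measure.smul_apply, smul_eq_mul, Measure.coe_finset_sum,
    Finset.sum_apply, hφp, mul_one, hν0]
  have hφ1 : ∀ B, φ B O ≤ 1 := fun B => (measure_mono (Set.subset_univ O)).trans (hφp B).le
  -- split by i0
  let I := Finset.univ.filter (fun B : Finset (Fin n) => i0 ∈ B)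
  let J := Finset.univ.filter (fun B : Finset (Fin n) => ¬ i0 ∈ B)
  have hIJ : ∀ f : Finset (Fin n) → ℝ≥0∞, ∑ B, f B = ∑ B ∈ I, f B + ∑ B ∈ J, f B := fun f =>
    (Finset.sum_filter_add_sum_filter_not _ _ _).symm
  have b1 : ∑ B ∈ J, w B * φ B O ≤ E * (∑ B, w' B * φ' B O) + δ1 * Λ := by
    calc ∑ B ∈ J, w B * φ B O ≤ ∑ B ∈ J, (E * (w' B * φ' B O) + e B) := by
          refine Finset.sum_le_sum fun B hB => ?_
          have hB' : i0 ∉ B := (Finset.mem_filter.mp hB).2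
          calc w B * φ B O ≤ (E * w' B + e B) * φ B O := by gcongr; exact hw B hB'
            _ = E * (w' B * φ' B O) + e B * φ B O := by rw [← hφ B hB']; ring
            _ ≤ _ := by
                gcongr
                exact mul_le_of_le_one_right (zero_le) (hφ1 B)
      _ = E * (∑ B ∈ J, w' B * φ' B O) + ∑ B ∈ J, e B := by
          rw [Finset.sum_add_distrib, Finset.mul_sum]
      _ ≤ _ := by
          gcongr
          · exact Finset.subset_univ _
          · exact (Finset.sum_le_sum_of_subset (Finset.subset_univ _)).trans he
  have b2 : ∑ B ∈ I, w B * φ B O ≤ δ1 * Λ + β * H * ∑ B ∈ J, w B * φ B O + δ2 * ∑ B, w B := by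
    have c0 : ∀ B ∈ I, w B * φ B O ≤ (if B.card = h then w B else 0) +
        β * H * (w (B.erase i0) * φ (B.erase i0) O) + δ2 * w B := by
      intro B hB
      have hB' : i0 ∈ B := (Finset.mem_filter.mp hB).2
      by_cases hw0 : w B = 0
      · simp [hw0]
      have hc : h ≤ B.card := by
        by_contra hlt; exact hw0 (hs B (not_le.mp hlt))
      rcases hc.eq_or_lt with hh | hh
      · rw [if_pos hh.symm]
        calc w B * φ B O ≤ w B := mul_le_of_le_one_right (zero_le) (hφ1 B)
          _ ≤ _ := by rw [add_assoc]; exact le_self_add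
      · obtain ⟨d1, d2⟩ := hb B hB' hh hw0
        calc w B * φ B O ≤ w B * (H * φ (B.erase i0) O + δ2) := by gcongr; exact d2 O hO
          _ = H * (w B * φ (B.erase i0) O) + δ2 * w B := by ring
          _ ≤ H * ((β * w (B.erase i0)) * φ (B.erase i0) O) + δ2 * w B := by gcongr
          _ = β * H * (w (B.erase i0) * φ (B.erase i0) O) + δ2 * w B := by ring
          _ ≤ _ := by rw [add_assoc]; exact le_add_self
    refine (Finset.sum_le_sum c0).trans ?_
    rw [Finset.sum_add_distrib, Finset.sum_add_distrib, ← Finset.mul_sum, ← Finset.mul_sum]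
    gcongr
    · refine le_trans ?_ hsh
      rw [Finset.sum_filter (fun B : Finset (Fin n) => B.card = h)]
      exact Finset.sum_le_sum_of_subset (Finset.subset_univ I)
    · have : ∑ B ∈ I, w (B.erase i0) * φ (B.erase i0) O
          = ∑ C ∈ I.image (fun B => B.erase i0), w C * φ C O := by
        rw [Finset.sum_image]
        intro B hB C hC hBC
        have hB' : i0 ∈ B := (Finset.mem_filter.mp hB).2
        have hC' : i0 ∈ C := (Finset.mem_filter.mp hC).2
        rw [← Finset.insert_erase hB', ← Finset.insert_erase hC', show B.erase i0 = C.erase i0 from hBC]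
      rw [this]
      refine Finset.sum_le_sum_of_subset ?_
      intro C hC
      obtain ⟨B, _, rfl⟩ := Finset.mem_image.mp hC
      simp [J]
    · exact Finset.subset_univ _
  set sJ := ∑ B ∈ J, w B * φ B O
  set s' := ∑ B, w' B * φ' B O
  set W := ∑ B, w B
  rw [hIJ]
  calc Λ * ν0 O + (∑ B ∈ I, w B * φ B O + sJ)
      ≤ Λ * ν0 O + ((δ1 * Λ + β * H * sJ + δ2 * W) + sJ) := by gcongr
    _ = Λ * ν0 O + ((1 + β * H) * sJ + δ1 * Λ + δ2 * W) := by ring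
    _ ≤ Λ * ν0 O + ((1 + β * H) * (E * s' + δ1 * Λ) + δ1 * Λ + δ2 * W) := by gcongr
    _ = 1 * (Λ * ν0 O) + E * (1 + β * H) * s' + ((2 + β * H) * δ1 * Λ + δ2 * W) := by ring
    _ ≤ (E * (1 + β * H)) * (Λ * ν0 O) + E * (1 + β * H) * s' + ((2 + 1) * δ1 * Λ + δ2 * W) := by
        gcongr
        calc (1:ℝ≥0∞) = 1 * 1 := by simp
          _ ≤ E * (1 + β * H) := mul_le_mul' hE le_self_add
    _ = E * (1 + β * H) * (Λ * ν0 O + s') + (3 * δ1 * Λ + δ2 * W) := by ring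
    _ ≤ E * (1 + β * H) * (Λ * ν0 O + s') + ((3 * δ1 + δ2) * Λ + (3 * δ1 + δ2) * W) := by
        gcongr
        · exact le_self_add
        · exact le_add_self
    _ = _ := by ring

end

section
/-- parameters of the first stage -/
structure Par where
  m : ℕ
  h : ℕ
  b : ℕ
  N1 : ℕ
  N2 : ℕ
  p : ℕ
  t : ℕ
  K : ℝ
  K2 : ℝ
  a : ℝ
  β : ℝ
  η : ℝ
  Λ : ℝ

def qs {ι : Type*} {D : ℕ} (z : ι → Fin D → ℝ) (T : Finset ι) (v : Fin D → ℝ) : ℝ :=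
  ∑ i ∈ T, (v ⬝ᵥ z i) ^ 2

theorem qs_nonneg {ι : Type*} {D : ℕ} (z : ι → Fin D → ℝ) (T : Finset ι) (v : Fin D → ℝ) :
    0 ≤ qs z T v := Finset.sum_nonneg fun _ _ => sq_nonneg _

theorem qs_mono {ι : Type*} {D : ℕ} (z : ι → Fin D → ℝ) {T T' : Finset ι} (h : T ⊆ T') (v : Fin D → ℝ) :
    qs z T v ≤ qs z T' v := Finset.sum_le_sum_of_subset_of_nonneg h fun _ _ _ => sq_nonneg _

theorem qs_congr {ι : Type*} {D : ℕ} {z z' : ι → Fin D → ℝ} {T : Finset ι} (h : ∀ i ∈ T, z i = z' i)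
    (v : Fin D → ℝ) : qs z T v = qs z' T v :=
  Finset.sum_congr rfl fun i hi => by rw [h i hi]

def gY (P : Par) {n D : ℕ} (y : Fin n → Fin D → ℝ) (Y : Finset (Fin n)) : Prop :=
  ∀ T ⊆ Y, T.card = P.m → ∀ i ∈ Y, ∀ v, (v ⬝ᵥ y i) ^ 2 ≤ P.K * qs y T v

def gB (P : Par) {n D : ℕ} (y : Fin n → Fin D → ℝ) (B : Finset (Fin n)) : Prop :=
  ∀ T ⊆ B, T.card = P.h → ∀ i ∈ B, ∀ v, P.a * (v ⬝ᵥ y i) ^ 2 ≤ qs y T v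

def close2 {ι ι' : Type*} {D : ℕ} (K : ℝ) (z : ι → Fin D → ℝ) (T : Finset ι) (z' : ι' → Fin D → ℝ)
    (T' : Finset ι') : Prop :=
  (∀ v, qs z T v ≤ K * qs z' T' v) ∧ (∀ v, qs z' T' v ≤ K * qs z T v)

abbrev St (k p D : ℕ) := Fin k → Fin p → Fin D → ℝ

def okS (P : Par) {n D k : ℕ} (r : ℕ) (y : Fin n → Fin D → ℝ) (st : St k P.p D) (B : Finset (Fin n)) : Prop :=
  ∀ T ⊆ B, T.card = P.m → ∀ j : Fin k, j.val < r → ¬ close2 P.K2 y T (st j) Finset.univ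

open Classical in
def score (P : Par) {n D : ℕ} (y : Fin n → Fin D → ℝ) (B : Finset (Fin n)) : ℕ :=
  Finset.univ.sup fun Y => if B ⊆ Y ∧ gY P y Y then Y.card else 0

def condB (P : Par) {n D k : ℕ} (r : ℕ) (y : Fin n → Fin D → ℝ) (st : St k P.p D) (B : Finset (Fin n)) : Prop :=
  (P.h ≤ B.card ∧ B.card ≤ P.b) ∧ gB P y B ∧ okS P r y st B ∧ P.N1 < score P y B

open Classical in
def wt (P : Par) {n D k : ℕ} (r : ℕ) (y : Fin n → Fin D → ℝ) (st : St k P.p D) (B : Finset (Fin n)) : ℝ≥0∞ :=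
  if condB P r y st B then ENNReal.ofReal (P.β ^ B.card * Real.exp (P.η * (min (score P y B) P.N2 : ℕ))) else 0

def stepM (P : Par) {n D k : ℕ} (r : ℕ) (y : Fin n → Fin D → ℝ) (st : St k P.p D) :
    Measure (Fin P.p → Fin D → ℝ) :=
  ENNReal.ofReal P.Λ • Measure.dirac 0 + ∑ B, wt P r y st B • skF P.p y B

theorem le_score (P : Par) {n D : ℕ} (y : Fin n → Fin D → ℝ) {B Y : Finset (Fin n)} (h : B ⊆ Y)
    (hY : gY P y Y) : Y.card ≤ score P y B := by
  classical
  have := Finset.le_sup (f := fun Y => if B ⊆ Y ∧ gY P y Y then Y.card else 0) (Finset.mem_univ Y)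
  simp only [h, hY, and_self, if_true] at this
  refine this.trans (le_of_eq ?_)
  unfold score; congr!

theorem score_spec (P : Par) {n D : ℕ} (y : Fin n → Fin D → ℝ) {B : Finset (Fin n)} (h : 0 < score P y B) :
    ∃ Y, B ⊆ Y ∧ gY P y Y ∧ Y.card = score P y B := by
  classical
  obtain ⟨Y, _, hY⟩ := Finset.exists_mem_eq_sup Finset.univ (Finset.univ_nonempty)
    (fun Y => if B ⊆ Y ∧ gY P y Y then Y.card else 0)
  have e : score P y B = if B ⊆ Y ∧ gY P y Y then Y.card else 0 := by rw [← hY]; unfold score; congr!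
  by_cases hc : B ⊆ Y ∧ gY P y Y
  · rw [if_pos hc] at e; exact ⟨Y, hc.1, hc.2, e.symm⟩
  · rw [if_neg hc] at e; omega

theorem gY_mono (P : Par) {n D : ℕ} {y : Fin n → Fin D → ℝ} {Y Y' : Finset (Fin n)} (h : Y' ⊆ Y)
    (hY : gY P y Y) : gY P y Y' := fun T hT hc i hi v => hY T (hT.trans h) hc i (h hi) v

theorem gB_mono (P : Par) {n D : ℕ} {y : Fin n → Fin D → ℝ} {Y Y' : Finset (Fin n)} (h : Y' ⊆ Y)
    (hY : gB P y Y) : gB P y Y' := fun T hT hc i hi v => hY T (hT.trans h) hc i (h hi) v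

theorem okS_mono (P : Par) {n D k r : ℕ} {y : Fin n → Fin D → ℝ} {st : St k P.p D} {Y Y' : Finset (Fin n)} (h : Y' ⊆ Y)
    (hY : okS P r y st Y) : okS P r y st Y' := fun T hT hc j hj => hY T (hT.trans h) hc j hj

theorem gY_congr (P : Par) {n D : ℕ} {y y' : Fin n → Fin D → ℝ} {Y : Finset (Fin n)}
    (h : ∀ i ∈ Y, y i = y' i) (hY : gY P y Y) : gY P y' Y := by
  intro T hT hc i hi v
  rw [← h i hi, ← qs_congr (fun i hi => h i (hT hi))]
  exact hY T hT hc i hi v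

theorem gB_congr (P : Par) {n D : ℕ} {y y' : Fin n → Fin D → ℝ} {Y : Finset (Fin n)}
    (h : ∀ i ∈ Y, y i = y' i) (hY : gB P y Y) : gB P y' Y := by
  intro T hT hc i hi v
  rw [← h i hi, ← qs_congr (fun i hi => h i (hT hi))]
  exact hY T hT hc i hi v

theorem okS_congr (P : Par) {n D k r : ℕ} {y y' : Fin n → Fin D → ℝ} {st : St k P.p D} {Y : Finset (Fin n)}
    (h : ∀ i ∈ Y, y i = y' i) (hY : okS P r y st Y) : okS P r y' st Y := by
  intro T hT hc j hj hcl
  refine hY T hT hc j hj ⟨fun v => ?_, fun v => ?_⟩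
  · rw [qs_congr (fun i hi => h i (hT hi))]; exact hcl.1 v
  · rw [qs_congr (fun i hi => h i (hT hi))]; exact hcl.2 v

theorem score_anti (P : Par) {n D : ℕ} (y : Fin n → Fin D → ℝ) {B B' : Finset (Fin n)} (h : B' ⊆ B) :
    score P y B ≤ score P y B' := by
  rcases Nat.eq_zero_or_pos (score P y B) with h0 | h0
  · omega
  obtain ⟨Y, h1, h2, h3⟩ := score_spec P y h0
  rw [← h3]; exact le_score P y (h.trans h1) h2

theorem score_adj (P : Par) {n D : ℕ} (y y' : Fin n → Fin D → ℝ) (i0 : Fin n) (hy : ∀ i, i ≠ i0 → y i = y' i)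
    {B : Finset (Fin n)} (hB : i0 ∉ B) : score P y B ≤ score P y' B + 1 := by
  rcases Nat.eq_zero_or_pos (score P y B) with h0 | h0
  · omega
  obtain ⟨Y, h1, h2, h3⟩ := score_spec P y h0
  have h4 : gY P y' (Y.erase i0) := gY_congr P (fun i hi => hy i (Finset.ne_of_mem_erase hi))
    (gY_mono P (Finset.erase_subset _ _) h2)
  have h5 : B ⊆ Y.erase i0 := fun i hi => Finset.mem_erase.mpr ⟨fun e => hB (e ▸ hi), h1 hi⟩
  have := le_score P y' h5 h4
  have := Finset.pred_card_le_card_erase (s := Y) (a := i0)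
  omega

/-- hypotheses on parameters for privacy -/
structure ParOK (P : Par) (n : ℕ) (δ1 : ℝ) : Prop where
  ht : 1 ≤ P.t
  hp : 4 ≤ P.p
  hta : (P.t : ℝ) * Real.sqrt P.p ≤ P.a
  hβ0 : 0 < P.β
  hβ1 : P.β ≤ 1
  hη : 0 ≤ P.η
  hδ1 : 0 < δ1
  hΛ1 : ((n : ℝ) * P.β) ^ P.h * Real.exp (P.η * P.N2) ≤ δ1 * P.Λ
  hΛ2 : ((n : ℝ) + 1) ^ P.b * Real.exp (P.η * (P.N1 + 1)) ≤ δ1 * P.Λ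
  hβH : P.β * Real.exp 3 ≤ 1

theorem ParOK.Λpos {P : Par} {n : ℕ} {δ1 : ℝ} (h : ParOK P n δ1) : 0 < P.Λ := by
  have h1 : 0 < ((n : ℝ) + 1) ^ P.b * Real.exp (P.η * (P.N1 + 1)) := by positivity
  exact (pos_iff_pos_of_mul_pos (lt_of_lt_of_le h1 h.hΛ2)).mp h.hδ1

theorem card_small_subsets (n b : ℕ) :
    (Finset.univ.filter (fun B : Finset (Fin n) => B.card ≤ b)).card ≤ (n+1)^b := by
  classical
  -- each small subset is the image of a map from `Fin b` to `Option (Fin n)`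
  have : (Finset.univ.filter (fun B : Finset (Fin n) => B.card ≤ b)) ⊆
      (Finset.univ : Finset (Fin b → Option (Fin n))).image
        (fun f => (Finset.univ.image f).eraseNone) := by
    intro B hB
    have hB' : B.card ≤ b := (Finset.mem_filter.mp hB).2
    rw [Finset.mem_image]
    refine ⟨fun i => if h : i.val < B.card then some (B.orderEmbOfFin rfl ⟨i.val, h⟩) else none,
      Finset.mem_univ _, ?_⟩
    ext x
    simp only [Finset.mem_eraseNone, Finset.mem_image, Finset.mem_univ, true_and]
    constructor
    · rintro ⟨i, hi⟩
      split_ifs at hi with h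
      · simp only [Option.some.injEq] at hi
        rw [← hi]; exact Finset.orderEmbOfFin_mem _ _ _
    · intro hx
      have hr := Finset.range_orderEmbOfFin B rfl
      have : x ∈ Set.range (B.orderEmbOfFin rfl) := by rw [hr]; exact hx
      obtain ⟨j, hj⟩ := this
      refine ⟨⟨j.val, lt_of_lt_of_le j.2 hB'⟩, ?_⟩
      rw [dif_pos j.2]
      simp [← hj]
  refine (Finset.card_le_card this).trans (Finset.card_image_le.trans ?_)
  simp

theorem stepM_dom (P : Par) {n D k : ℕ} {δ1 : ℝ} (hP : ParOK P n δ1) (r : ℕ) (y y' : Fin n → Fin D → ℝ)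
    (i0 : Fin n) (hy : ∀ i, i ≠ i0 → y i = y' i) (st : St k P.p D) 
    (O : Set (Fin P.p → Fin D → ℝ)) (hO : MeasurableSet O) :
    stepM P r y st O ≤ ENNReal.ofReal (Real.exp (P.η + P.β * Real.exp 3)) * stepM P r y' st O +
      ENNReal.ofReal (3 * δ1 + Real.exp (-P.t)) * stepM P r y st Set.univ := by
  classical
  have hδ := hP.hδ1
  have hβ := hP.hβ0
  have hΛ := hP.Λpos
  let e : Finset (Fin n) → ℝ≥0∞ := fun B => if B.card ≤ P.b then
    ENNReal.ofReal (Real.exp (P.η * (P.N1 + 1))) else 0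
  have main := step_dom i0 P.h (wt P r y st) (wt P r y' st) e (skF P.p y) (skF P.p y')
    (Measure.dirac 0) (ENNReal.ofReal P.Λ) (ENNReal.ofReal (Real.exp P.η)) (ENNReal.ofReal P.β)
    (ENNReal.ofReal (Real.exp 3)) (ENNReal.ofReal δ1) (ENNReal.ofReal (Real.exp (-P.t)))
    (fun B => measure_univ) ?_ ?_ ?_ ?_ ?_ ?_ measure_univ ?_ ?_ O hO
  · refine main.trans ?_
    unfold stepM
    gcongr
    · rw [← ENNReal.ofReal_mul hβ.le, ← ENNReal.ofReal_one, ← ENNReal.ofReal_add zero_le_one (by positivity),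
        ← ENNReal.ofReal_mul (Real.exp_pos _).le, Real.exp_add]
      apply ENNReal.ofReal_le_ofReal
      gcongr
      linarith [Real.add_one_le_exp (P.β * Real.exp 3)]
    · rw [ENNReal.ofReal_add (by positivity) (by positivity), ENNReal.ofReal_mul (by norm_num)]
      simp
  · intro B hB
    unfold skF
    congr 1
    funext g l
    exact Finset.sum_congr rfl fun i hi => by rw [hy i (fun e => hB (e ▸ hi))]
  · intro B hB
    have hyB : ∀ i ∈ B, y i = y' i := fun i hi => hy i (fun e => hB (e ▸ hi))
    by_cases hc : condB P r y st B
    · obtain ⟨⟨c1, c2⟩, c3, c4, c5⟩ := hc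
      have hs := score_adj P y y' i0 hy hB
      have hw : wt P r y st B = ENNReal.ofReal (P.β ^ B.card * Real.exp (P.η * (min (score P y B) P.N2 : ℕ))) :=
        if_pos ⟨⟨c1, c2⟩, c3, c4, c5⟩
      by_cases hs' : P.N1 < score P y' B
      · have hw' : wt P r y' st B = ENNReal.ofReal (P.β ^ B.card * Real.exp (P.η * (min (score P y' B) P.N2 : ℕ))) :=
          if_pos ⟨⟨c1, c2⟩, gB_congr P hyB c3, okS_congr P hyB c4, hs'⟩
        refine le_trans ?_ le_self_add
        rw [hw, hw', ← ENNReal.ofReal_mul (Real.exp_pos _).le]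
        apply ENNReal.ofReal_le_ofReal
        rw [mul_left_comm, ← Real.exp_add]
        gcongr
        have : min (score P y B) P.N2 ≤ min (score P y' B) P.N2 + 1 := by omega
        have : ((min (score P y B) P.N2 : ℕ) : ℝ) ≤ ((min (score P y' B) P.N2 : ℕ) : ℝ) + 1 := by exact_mod_cast this
        nlinarith [hP.hη]
      · refine le_trans ?_ le_add_self
        simp only [e, if_pos c2]
        rw [hw]
        apply ENNReal.ofReal_le_ofReal
        have h1 : min (score P y B) P.N2 ≤ P.N1 + 1 := by omega
        have h2 : ((min (score P y B) P.N2 : ℕ) : ℝ) ≤ P.N1 + 1 := by exact_mod_cast h1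
        calc _ ≤ 1 * Real.exp (P.η * (P.N1 + 1)) := by
              gcongr
              · exact pow_le_one₀ hβ.le hP.hβ1
              · exact hP.hη
          _ = _ := one_mul _
    · have : wt P r y st B = 0 := if_neg hc
      rw [this]; exact zero_le
  · simp only [e]
    rw [← Finset.sum_filter, Finset.sum_const, nsmul_eq_mul, ← ENNReal.ofReal_mul hδ.le,
      ← ENNReal.ofReal_natCast, ← ENNReal.ofReal_mul (by positivity)]
    apply ENNReal.ofReal_le_ofReal
    refine le_trans ?_ hP.hΛ2
    gcongr
    exact_mod_cast card_small_subsets n P.b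
  · intro B hB
    exact if_neg fun hc => by have := hc.1.1; omega
  · calc _ ≤ ∑ B ∈ Finset.univ.filter (fun B : Finset (Fin n) => B.card = P.h),
          ENNReal.ofReal (P.β ^ P.h * Real.exp (P.η * P.N2)) := by
          refine Finset.sum_le_sum fun B hB => ?_
          have hB' := (Finset.mem_filter.mp hB).2
          unfold wt
          split_ifs with hc
          · apply ENNReal.ofReal_le_ofReal
            rw [hB']
            gcongr
            · exact hP.hη
            · exact min_le_right _ _
          · exact zero_le
      _ ≤ _ := by
          rw [Finset.sum_const, nsmul_eq_mul, ← ENNReal.ofReal_mul hδ.le,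
            ← ENNReal.ofReal_natCast, ← ENNReal.ofReal_mul (by positivity)]
          apply ENNReal.ofReal_le_ofReal
          refine le_trans ?_ hP.hΛ1
          rw [mul_pow, mul_assoc]
          gcongr
          have hpc : Finset.univ.filter (fun B : Finset (Fin n) => B.card = P.h)
              = Finset.powersetCard P.h Finset.univ := by
            ext B; simp [Finset.mem_powersetCard]
          rw [hpc, Finset.card_powersetCard, Finset.card_univ, Fintype.card_fin]
          exact_mod_cast Nat.choose_le_pow n P.h
  · intro B hi hh hw0
    have hc : condB P r y st B := by
      by_contra hc; exact hw0 (if_neg hc)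
    obtain ⟨⟨c1, c2⟩, c3, c4, c5⟩ := hc
    have hce : (B.erase i0).card + 1 = B.card := Finset.card_erase_add_one hi
    have hsub := Finset.erase_subset i0 B
    have hsc := score_anti P y hsub
    have hc' : condB P r y st (B.erase i0) :=
      ⟨⟨by omega, by omega⟩, gB_mono P hsub c3, okS_mono P hsub c4, by omega⟩
    constructor
    · unfold wt
      rw [if_pos ⟨⟨c1, c2⟩, c3, c4, c5⟩, if_pos hc', ← ENNReal.ofReal_mul hβ.le, ← hce, pow_succ]
      apply ENNReal.ofReal_le_ofReal
      calc _ ≤ P.β ^ (B.erase i0).card * P.β * Real.exp (P.η * (min (score P y (B.erase i0)) P.N2 : ℕ)) := by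
            gcongr
            exact hP.hη
        _ = _ := by ring
    · obtain ⟨T, hT1, hT2⟩ := Finset.exists_subset_card_eq (s := B.erase i0) (n := P.h) (by omega)
      refine skF_dom P.p P.t y B i0 hi P.a hP.ht hP.hp hP.hta fun v => ?_
      exact (c3 T (hT1.trans hsub) hT2 i0 hi v).trans (qs_mono y hT1 v)
  · rw [← ENNReal.ofReal_one]; apply ENNReal.ofReal_le_ofReal
    exact Real.one_le_exp hP.hη
  · rw [← ENNReal.ofReal_mul hβ.le, ← ENNReal.ofReal_one]
    exact ENNReal.ofReal_le_ofReal hP.hβH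

end

section
theorem cont_dot {X : Type*} [TopologicalSpace X] {D : ℕ} (v : Fin D → ℝ) {f : X → Fin D → ℝ} (hf : Continuous f) :
    Continuous fun x => v ⬝ᵥ f x := by
  unfold dotProduct
  exact continuous_finset_sum _ fun i _ => continuous_const.mul ((continuous_apply i).comp hf)

theorem cont_qs {X ι : Type*} [TopologicalSpace X] {D : ℕ} (v : Fin D → ℝ) (T : Finset ι) {f : X → ι → Fin D → ℝ}
    (hf : Continuous f) : Continuous fun x => qs (f x) T v := by
  unfold qs
  exact continuous_finset_sum _ fun i _ => (cont_dot v ((continuous_apply i).comp hf)).pow 2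

theorem closed_gY (P : Par) {n D : ℕ} (Y : Finset (Fin n)) :
    IsClosed {y : Fin n → Fin D → ℝ | gY P y Y} := by
  have : {y : Fin n → Fin D → ℝ | gY P y Y} = ⋂ T, ⋂ (_ : T ⊆ Y), ⋂ (_ : T.card = P.m), ⋂ i, ⋂ (_ : i ∈ Y),
      ⋂ v, {y | (v ⬝ᵥ y i) ^ 2 ≤ P.K * qs y T v} := by
    ext y; simp [gY]
  rw [this]
  refine isClosed_iInter fun T => isClosed_iInter fun _ => isClosed_iInter fun _ => isClosed_iInter fun i =>
    isClosed_iInter fun _ => isClosed_iInter fun v => ?_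
  exact isClosed_le ((cont_dot v (continuous_apply i)).pow 2) (continuous_const.mul (cont_qs v T continuous_id))

theorem closed_gB (P : Par) {n D : ℕ} (Y : Finset (Fin n)) :
    IsClosed {y : Fin n → Fin D → ℝ | gB P y Y} := by
  have : {y : Fin n → Fin D → ℝ | gB P y Y} = ⋂ T, ⋂ (_ : T ⊆ Y), ⋂ (_ : T.card = P.h), ⋂ i, ⋂ (_ : i ∈ Y),
      ⋂ v, {y | P.a * (v ⬝ᵥ y i) ^ 2 ≤ qs y T v} := by
    ext y; simp [gB]
  rw [this]
  refine isClosed_iInter fun T => isClosed_iInter fun _ => isClosed_iInter fun _ => isClosed_iInter fun i =>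
    isClosed_iInter fun _ => isClosed_iInter fun v => ?_
  exact isClosed_le (continuous_const.mul ((cont_dot v (continuous_apply i)).pow 2)) (cont_qs v T continuous_id)

theorem closed_close2 {X ι ι' : Type*} [TopologicalSpace X] {D : ℕ} (K : ℝ) (T : Finset ι) (T' : Finset ι')
    {f : X → ι → Fin D → ℝ} {f' : X → ι' → Fin D → ℝ} (hf : Continuous f) (hf' : Continuous f') :
    IsClosed {x | close2 K (f x) T (f' x) T'} := by
  have : {x | close2 K (f x) T (f' x) T'} = (⋂ v, {x | qs (f x) T v ≤ K * qs (f' x) T' v}) ∩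
      (⋂ v, {x | qs (f' x) T' v ≤ K * qs (f x) T v}) := by
    ext y; simp [close2]
  rw [this]
  exact (isClosed_iInter fun v => isClosed_le (cont_qs v T hf) (continuous_const.mul (cont_qs v T' hf'))).inter
    (isClosed_iInter fun v => isClosed_le (cont_qs v T' hf') (continuous_const.mul (cont_qs v T hf)))

theorem meas_okS (P : Par) {n D k : ℕ} (r : ℕ) (B : Finset (Fin n)) :
    MeasurableSet {q : (Fin n → Fin D → ℝ) × St k P.p D | okS P r q.1 q.2 B} := by
  have : {q : (Fin n → Fin D → ℝ) × St k P.p D | okS P r q.1 q.2 B} = ⋂ T, ⋂ (_ : T ⊆ B), ⋂ (_ : T.card = P.m),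
      ⋂ j : Fin k, ⋂ (_ : j.val < r), {q | close2 P.K2 q.1 T (q.2 j) Finset.univ}ᶜ := by
    ext y; simp [okS]
  rw [this]
  refine MeasurableSet.iInter fun T => MeasurableSet.iInter fun _ => MeasurableSet.iInter fun _ =>
    MeasurableSet.iInter fun j => MeasurableSet.iInter fun _ => ?_
  exact (closed_close2 _ _ _ continuous_fst ((continuous_apply j).comp continuous_snd)).measurableSet.compl

theorem meas_score (P : Par) {n D : ℕ} (B : Finset (Fin n)) :
    Measurable fun y : Fin n → Fin D → ℝ => score P y B := by
  classical
  have key : ∀ s : Finset (Finset (Fin n)), Measurable fun y : Fin n → Fin D → ℝ =>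
      s.sup fun Y => if B ⊆ Y ∧ gY P y Y then Y.card else 0 := by
    intro s
    induction s using Finset.induction_on with
    | empty => simp
    | insert Y s hY ih =>
      simp only [Finset.sup_insert]
      refine Measurable.sup ?_ ih
      refine Measurable.ite ?_ measurable_const measurable_const
      exact (MeasurableSet.const (B ⊆ Y)).inter (closed_gY P Y).measurableSet
  convert key Finset.univ
  unfold score; congr!

theorem meas_wt (P : Par) {n D k : ℕ} (r : ℕ) (B : Finset (Fin n)) :
    Measurable fun q : (Fin n → Fin D → ℝ) × St k P.p D => wt P r q.1 q.2 B := by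
  classical
  unfold wt
  refine Measurable.ite ?_ ?_ measurable_const
  · have h1 : MeasurableSet {q : (Fin n → Fin D → ℝ) × St k P.p D | P.h ≤ B.card ∧ B.card ≤ P.b} :=
      MeasurableSet.const _
    have h2 : MeasurableSet {q : (Fin n → Fin D → ℝ) × St k P.p D | gB P q.1 B} :=
      measurable_fst (closed_gB P (D := D) B).measurableSet
    have h3 := meas_okS P (D := D) (k := k) r B
    have h4 : MeasurableSet {q : (Fin n → Fin D → ℝ) × St k P.p D | P.N1 < score P q.1 B} :=
      measurableSet_lt measurable_const ((meas_score P B).comp measurable_fst)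
    exact h1.inter (h2.inter (h3.inter h4))
  · have : Measurable fun q : (Fin n → Fin D → ℝ) × St k P.p D => min (score P q.1 B) P.N2 :=
      ((meas_score P B).comp measurable_fst).min measurable_const
    have h2 : Measurable fun q : (Fin n → Fin D → ℝ) × St k P.p D => ((min (score P q.1 B) P.N2 : ℕ) : ℝ) :=
      measurable_from_top.comp this
    fun_prop

theorem meas_skF {n D : ℕ} (p : ℕ) (B : Finset (Fin n)) :
    Measurable fun y : Fin n → Fin D → ℝ => skF p y B := by
  refine Measure.measurable_of_measurable_coe _ fun O hO => ?_
  have hm : Measurable fun q : (Fin n → Fin D → ℝ) × (Fin p → Fin n → ℝ) =>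
      (fun l => ∑ i ∈ B, q.2 l i • q.1 i : Fin p → Fin D → ℝ) := by
    refine measurable_pi_lambda _ fun l => Finset.measurable_sum _ fun i _ => ?_
    fun_prop
  have : ∀ y : Fin n → Fin D → ℝ, skF p y B O = (Measure.pi fun _ : Fin p => stdG (Fin n))
      (Prod.mk y ⁻¹' ((fun q : (Fin n → Fin D → ℝ) × (Fin p → Fin n → ℝ) =>
      (fun l => ∑ i ∈ B, q.2 l i • q.1 i : Fin p → Fin D → ℝ)) ⁻¹' O)) := by
    intro y
    unfold skF
    rw [Measure.map_apply (skF_meas p y B) hO]; rfl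
  simp_rw [this]
  exact measurable_measure_prodMk_left (hm hO)

theorem meas_stepM (P : Par) {n D k : ℕ} (r : ℕ) :
    Measurable fun q : (Fin n → Fin D → ℝ) × St k P.p D => stepM P r q.1 q.2 := by
  refine Measure.measurable_of_measurable_coe _ fun O hO => ?_
  unfold stepM
  simp only [Measure.add_apply, Measure.smul_apply, smul_eq_mul, Measure.coe_finset_sum,
    Finset.sum_apply]
  refine measurable_const.add (Finset.measurable_sum _ fun B _ => ?_)
  exact (meas_wt P r B).mul ((Measure.measurable_coe hO).comp ((meas_skF P.p B).comp measurable_fst))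

theorem stepM_univ (P : Par) {n D k : ℕ} (r : ℕ) (y : Fin n → Fin D → ℝ) (st : St k P.p D) :
    stepM P r y st Set.univ = ENNReal.ofReal P.Λ + ∑ B, wt P r y st B := by
  simp [stepM]

theorem wt_ne_top (P : Par) {n D k : ℕ} (r : ℕ) (y : Fin n → Fin D → ℝ) (st : St k P.p D) (B) :
    wt P r y st B ≠ ∞ := by
  unfold wt; split_ifs <;> simp

theorem stepM_ne_top (P : Par) {n D k : ℕ} (r : ℕ) (y : Fin n → Fin D → ℝ) (st : St k P.p D) :
    stepM P r y st Set.univ ≠ ∞ := by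
  rw [stepM_univ]
  exact ENNReal.add_ne_top.mpr ⟨ENNReal.ofReal_ne_top, ENNReal.sum_ne_top.mpr fun B _ => wt_ne_top P r y st B⟩

theorem stepM_ne_zero (P : Par) (hΛ : 0 < P.Λ) {n D k : ℕ} (r : ℕ) (y : Fin n → Fin D → ℝ) (st : St k P.p D) :
    stepM P r y st Set.univ ≠ 0 := by
  rw [stepM_univ]; simp [hΛ]

def stepP (P : Par) {n D k : ℕ} (r : ℕ) (q : (Fin n → Fin D → ℝ) × St k P.p D) :
    Measure (Fin P.p → Fin D → ℝ) := normM (stepM P r q.1 q.2)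

theorem meas_stepP (P : Par) {n D k : ℕ} (r : ℕ) :
    Measurable (stepP P (n := n) (D := D) (k := k) r) := by
  refine Measure.measurable_of_measurable_coe _ fun O hO => ?_
  unfold stepP normM
  simp only [Measure.smul_apply, smul_eq_mul]
  exact (((Measure.measurable_coe MeasurableSet.univ).comp (meas_stepM P r)).inv).mul
    ((Measure.measurable_coe hO).comp (meas_stepM P r))

def stepK0 (P : Par) (n D k r : ℕ) : Kernel ((Fin n → Fin D → ℝ) × St k P.p D) (Fin P.p → Fin D → ℝ) :=
  ⟨stepP P r, meas_stepP P r⟩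

theorem stepK0_markov (P : Par) (hΛ : 0 < P.Λ) (n D k r : ℕ) : IsMarkovKernel (stepK0 P n D k r) :=
  ⟨fun q => normM_prob _ (stepM_ne_zero P hΛ _ _ _) (stepM_ne_top P _ _ _)⟩

def upd {k p D : ℕ} (r : ℕ) (st : St k p D) (z : Fin p → Fin D → ℝ) : St k p D :=
  fun j => if j.val = r then z else st j

theorem meas_upd {k p D : ℕ} (r : ℕ) : Measurable fun q : St k p D × (Fin p → Fin D → ℝ) => upd r q.1 q.2 := by
  refine measurable_pi_lambda _ fun j => ?_
  unfold upd
  split_ifs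
  · exact measurable_snd
  · exact (measurable_pi_apply j).comp measurable_fst

def stepK (P : Par) (n D k r : ℕ) : Kernel ((Fin n → Fin D → ℝ) × St k P.p D) (St k P.p D) :=
  (Kernel.id ×ₖ stepK0 P n D k r).map (fun q => upd r q.1.2 q.2)

theorem stepK_apply (P : Par) (hΛ : 0 < P.Λ) (n D k r : ℕ) (y : Fin n → Fin D → ℝ) (st : St k P.p D) :
    stepK P n D k r (y, st) = (stepP P r (y, st)).map (upd r st) := by
  haveI := stepK0_markov P hΛ n D k r
  have hm : Measurable fun q : ((Fin n → Fin D → ℝ) × St k P.p D) × (Fin P.p → Fin D → ℝ) => upd r q.1.2 q.2 :=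
    (meas_upd r).comp ((measurable_snd.comp measurable_fst).prodMk measurable_snd)
  unfold stepK
  haveI : SFinite (stepP P r (y, st)) := (inferInstance : SFinite (stepK0 P n D k r (y, st)))
  rw [Kernel.map_apply _ hm, Kernel.prod_apply, Kernel.id_apply, Measure.dirac_prod,
    Measure.map_map hm (by fun_prop)]
  rfl

theorem stepK_markov (P : Par) (hΛ : 0 < P.Λ) (n D k r : ℕ) : IsMarkovKernel (stepK P n D k r) := by
  haveI := stepK0_markov P hΛ n D k r
  have hm : Measurable fun q : ((Fin n → Fin D → ℝ) × St k P.p D) × (Fin P.p → Fin D → ℝ) => upd r q.1.2 q.2 :=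
    (meas_upd r).comp ((measurable_snd.comp measurable_fst).prodMk measurable_snd)
  unfold stepK
  exact Kernel.IsMarkovKernel.map _ hm

def rounds (P : Par) (n D k : ℕ) : ℕ → Kernel (Fin n → Fin D → ℝ) (St k P.p D)
  | 0 => Kernel.const _ (Measure.dirac 0)
  | r + 1 => stepK P n D k r ∘ₖ (Kernel.id ×ₖ rounds P n D k r)

theorem rounds_markov (P : Par) (hΛ : 0 < P.Λ) (n D k r : ℕ) : IsMarkovKernel (rounds P n D k r) := by
  induction r with
  | zero => unfold rounds; infer_instance
  | succ r ih =>
    haveI := stepK_markov P hΛ n D k r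
    unfold rounds; infer_instance

theorem rounds_succ (P : Par) (hΛ : 0 < P.Λ) (n D k r : ℕ) (y : Fin n → Fin D → ℝ) :
    rounds P n D k (r+1) y = (rounds P n D k r y).bind (fun st => stepK P n D k r (y, st)) := by
  haveI := stepK_markov P hΛ n D k r
  haveI := rounds_markov P hΛ n D k r
  show (stepK P n D k r ∘ₖ (Kernel.id ×ₖ rounds P n D k r)) y = _
  ext O hO
  rw [Kernel.comp_apply' _ _ _ hO, Kernel.prod_apply, Kernel.id_apply, Measure.dirac_prod,
    lintegral_map (Kernel.measurable_coe _ hO) (by fun_prop), Measure.bind_apply hO]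
  exact ((stepK P n D k r).measurable.comp (by fun_prop)).aemeasurable

theorem step_dp (P : Par) {n D k : ℕ} {δ1 ε1 : ℝ} (hP : ParOK P n δ1) (r : ℕ) (y y' : Fin n → Fin D → ℝ)
    (i0 : Fin n) (hy : ∀ i, i ≠ i0 → y i = y' i) (st : St k P.p D) (hε : P.η + P.β * Real.exp 3 ≤ ε1) (hε1 : ε1 ≤ 1)
    (hδ : 3 * δ1 + Real.exp (-P.t) ≤ 1/2)
    (O : Set (St k P.p D)) (hO : MeasurableSet O) :
    stepK P n D k r (y, st) O ≤ ENNReal.ofReal (Real.exp (2 * ε1)) * stepK P n D k r (y', st) O +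
      ENNReal.ofReal (20 * (3 * δ1 + Real.exp (-P.t))) := by
  have hm : Measurable (upd (k := k) (p := P.p) (D := D) r st) := (meas_upd r).comp measurable_prodMk_left
  have hδ1 := hP.hδ1
  rw [stepK_apply P hP.Λpos, stepK_apply P hP.Λpos, Measure.map_apply hm hO, Measure.map_apply hm hO]
  refine normM_dom _ _ (stepM_ne_zero P hP.Λpos _ _ _) (stepM_ne_top P _ _ _)
    (stepM_ne_zero P hP.Λpos _ _ _) (stepM_ne_top P _ _ _) ε1 _ hε1 hδ (by positivity) ?_ ?_ _ (hm hO)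
  · intro O hO
    refine (stepM_dom P hP r y y' i0 hy st O hO).trans ?_
    gcongr
  · intro O hO
    refine (stepM_dom P hP r y' y i0 (fun i hi => (hy i hi).symm) st O hO).trans ?_
    gcongr

theorem rounds_RR (P : Par) {n D k : ℕ} {δ1 ε1 s t : ℝ} (hP : ParOK P n δ1) (hst : t.HolderConjugate s) (r : ℕ) (y y' : Fin n → Fin D → ℝ)
    (i0 : Fin n) (hy : ∀ i, i ≠ i0 → y i = y' i) (hε : P.η + P.β * Real.exp 3 ≤ ε1) (hε1 : ε1 ≤ 1)
    (hδ : 3 * δ1 + Real.exp (-P.t) ≤ 1/2) (htε : t * (2 * ε1) ≤ 1) :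
    RR (rounds P n D k r y) (rounds P n D k r y') s
      (r * (20 * (3 * δ1 + Real.exp (-P.t)) + t * (2 * ε1)^2)) (r * (20 * (3 * δ1 + Real.exp (-P.t)))) := by
  have hδ1 := hP.hδ1
  have hs1 : 1 < s := hst.symm.lt
  have hε0 : 0 ≤ ε1 := le_trans (by have := hP.hη; have := hP.hβ0; positivity) hε
  induction r with
  | zero =>
    have := RR_refl (Measure.dirac (0 : St k P.p D)) hs1
    simpa [rounds] using this
  | succ r ih =>
    haveI := rounds_markov P hP.Λpos n D k r
    haveI := stepK_markov P hP.Λpos n D k r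
    rw [rounds_succ P hP.Λpos, rounds_succ P hP.Λpos]
    have := RR_comp (κ := fun st => stepK P n D k r (y, st)) (κ' := fun st => stepK P n D k r (y', st))
      ((stepK P n D k r).measurable.comp (by fun_prop)) ((stepK P n D k r).measurable.comp (by fun_prop))
      (fun _ => inferInstance) (fun _ => inferInstance) hs1.le (by positivity) (by positivity)
      ih (fun st => RR_of_dp hst (by positivity) (by positivity) htε
        (step_dp P hP r y y' i0 hy st hε hε1 hδ)
        (step_dp P hP r y' y i0 (fun i hi => (hy i hi).symm) st hε hε1 hδ))
    convert this using 1 <;> push_cast <;> ring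

/-- privacy of the first stage -/
theorem rounds_dp (P : Par) {n D k : ℕ} {δ1 ε1 ε δ : ℝ} (hP : ParOK P n δ1) 
    (hε : P.η + P.β * Real.exp 3 ≤ ε1) (hε0 : 0 < ε) (hεlt : ε < 1) (hδ0 : 0 < δ) (hδlt : δ < 1)
    (hk : 1 ≤ k)
    (hδ1 : 400 * k * (3 * δ1 + Real.exp (-P.t)) ≤ ε * δ)
    (hε1 : ε1 ^ 2 * (64 * k * Real.log (8 / δ) ^ 2) ≤ ε ^ 2) :
    IsDP (rounds P n D k k) ε δ := by
  intro y y' hadj O hO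
  obtain ⟨i0, hi0⟩ := hadj
  have hk' : (1:ℝ) ≤ k := by exact_mod_cast hk
  have hδ1p := hP.hδ1
  have hεp : 0 ≤ ε1 := le_trans (by have := hP.hη; have := hP.hβ0; positivity) hε
  set Lg := Real.log (8/δ) with hLg
  have hL1 : 1 < Lg := by
    rw [hLg, Real.lt_log_iff_exp_lt (by positivity)]
    calc Real.exp 1 < 8 := by linarith [Real.exp_one_lt_d9]
      _ < 8 / δ := by rw [lt_div_iff₀ hδ0]; nlinarith
  set t := 2 * Lg / ε with ht
  have ht1 : 1 < t := by
    rw [ht, lt_div_iff₀ hε0]; nlinarith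
  have hst : t.HolderConjugate (t / (t-1)) := Real.HolderConjugate.conjExponent ht1
  have hq : ε1 * (8 * Lg) ≤ ε := by
    refine abs_le_of_sq_le_sq' ?_ hε0.le |>.2
    calc (ε1 * (8 * Lg))^2 = ε1^2 * (64 * 1 * Lg^2) := by ring
      _ ≤ ε1^2 * (64 * k * Lg^2) := by gcongr
      _ ≤ ε^2 := hε1
  have het := Real.exp_pos (-(P.t:ℝ))
  set δ3 := 3 * δ1 + Real.exp (-P.t) with hδ3
  have hδ3p : 0 < δ3 := by positivity
  have hkδ : 400 * (k * δ3) ≤ ε * δ := by linarith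
  have hδ3k : δ3 ≤ k * δ3 := by nlinarith
  have hεδ : ε * δ ≤ 1 := by nlinarith
  have hεδ' : ε * δ ≤ δ := by nlinarith
  have hεδ'' : ε * δ ≤ ε := by nlinarith
  have hε1' : ε1 ≤ 1 := by nlinarith
  have htε : t * (2 * ε1) ≤ 1 := by
    rw [ht, div_mul_eq_mul_div, div_le_one hε0]; nlinarith
  have hRR := rounds_RR P (D := D) (k := k) hP hst k y' y i0 (fun i hi => (hi0 i hi).symm) hε hε1'
    (by linarith) htε
  haveI := rounds_markov P hP.Λpos n D k k
  have hc : (k:ℝ) * (20 * δ3 + t * (2 * ε1)^2) ≤ ε / 2 := by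
    have e1 : (k:ℝ) * (t * (2 * ε1)^2) ≤ ε/8 := by
      have : (k:ℝ) * (t * (2 * ε1)^2) = 8 * (ε1^2 * (k * Lg)) / ε := by rw [ht]; field_simp; ring
      rw [this, div_le_iff₀ hε0]
      have : ε1^2 * (k * Lg) ≤ ε1^2 * (k * Lg^2) := by
        gcongr; nlinarith
      nlinarith
    nlinarith
  have hfin := RR_convert hst hRR hc (δ' := δ/8) (by positivity) (by linarith) (by
    rw [one_div_div, ← hLg, ht]; apply le_of_eq; field_simp) (by positivity) O hO
  refine hfin.trans ?_
  gcongr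
  have : Real.exp ε ≤ 3 := (Real.exp_le_exp.mpr hεlt.le).trans (by linarith [Real.exp_one_lt_d9])
  nlinarith

end

section
theorem coord_tail (ι κ : Type*) [Fintype ι] [Fintype κ] (t : ℝ) (ht : 0 ≤ t) :
    (Measure.pi fun _ : ι => stdG κ) {g | ∃ l i, t < |g l i|} ≤
      ENNReal.ofReal (Fintype.card ι * (Fintype.card κ * (2 * Real.exp (-(t^2) / 2)))) := by
  have hm : MeasurableSet {x : ℝ | t < |x|} := measurableSet_lt measurable_const (by fun_prop)
  have h1 : ∀ l i, (Measure.pi fun _ : ι => stdG κ) {g | t < |g l i|} ≤ ENNReal.ofReal (2 * Real.exp (-(t^2) / 2)) := by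
    intro l i
    have hm2 : MeasurableSet {x : κ → ℝ | t < |x i|} := measurableSet_lt measurable_const (by fun_prop)
    have e1 := (measurePreserving_eval (fun _ : ι => stdG κ) l).measure_preimage
      (s := {x : κ → ℝ | t < |x i|}) hm2.nullMeasurableSet
    have e2 := (measurePreserving_eval (fun _ : κ => gaussianReal 0 1) i).measure_preimage
      (s := {x : ℝ | t < |x|}) hm.nullMeasurableSet
    calc (Measure.pi fun _ : ι => stdG κ) {g | t < |g l i|} = stdG κ {x : κ → ℝ | t < |x i|} := e1
      _ = gaussianReal 0 1 {x : ℝ | t < |x|} := e2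
      _ ≤ _ := gaussian_tail t ht
  have h2 : {g : ι → κ → ℝ | ∃ l i, t < |g l i|} = ⋃ l, ⋃ i, {g : ι → κ → ℝ | t < |g l i|} := by
    ext g; simp
  rw [h2]
  refine (measure_iUnion_fintype_le _ _).trans ?_
  calc ∑ l, (Measure.pi fun _ : ι => stdG κ) (⋃ i, {g : ι → κ → ℝ | t < |g l i|})
      ≤ ∑ l : ι, ∑ i : κ, ENNReal.ofReal (2 * Real.exp (-(t^2) / 2)) := by
        refine Finset.sum_le_sum fun l _ => (measure_iUnion_fintype_le _ _).trans ?_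
        exact Finset.sum_le_sum fun i _ => h1 l i
    _ = _ := by
        simp only [Finset.sum_const, Finset.card_univ, nsmul_eq_mul]
        rw [ENNReal.ofReal_mul (Nat.cast_nonneg _), ENNReal.ofReal_mul (p := (Fintype.card κ : ℝ)) (Nat.cast_nonneg _),
          ENNReal.ofReal_natCast, ENNReal.ofReal_natCast]

theorem qs_mat {D : ℕ} (F : Fin D → Fin D → ℝ) (v : Fin D → ℝ) :
    qs F Finset.univ v = (Matrix.of F *ᵥ v) ⬝ᵥ (Matrix.of F *ᵥ v) := by
  unfold qs dotProduct mulVec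
  refine Finset.sum_congr rfl fun s _ => ?_
  rw [sq]
  simp [dotProduct, mul_comm]

theorem gauss_ball0 (s : ℝ) (c w : ℝ) (hc : 0 < c) (hw : 0 ≤ w) (hs : 1/4 ≤ c^2 * s) :
    gaussianReal 0 (Real.toNNReal s) {x | |x| ≤ w} ≤ ENNReal.ofReal (10 * c * w) := by
  have hs0 : 0 ≤ s := by
    by_contra h; push Not at h; nlinarith [mul_pos hc hc]
  have h := gaussianReal_map_const_mul (μ := 0) (v := Real.toNNReal s) c
  have hm : MeasurableSet {x : ℝ | |x| ≤ c * w} := measurableSet_le (by fun_prop) measurable_const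
  have e : {x : ℝ | |x| ≤ w} = (fun x => c * x) ⁻¹' {x | |x| ≤ c * w} := by
    ext x
    simp only [Set.mem_preimage, Set.mem_ofPred_eq, abs_mul, abs_of_pos hc]
    exact (mul_le_mul_iff_right₀ hc).symm
  rw [e, ← Measure.map_apply (by fun_prop) hm, h, mul_zero]
  have := gaussian_small_ball (NNReal.mk (c^2) (sq_nonneg c) * Real.toNNReal s) 0 (c * w) (by positivity) (by
    push_cast; rw [Real.coe_toNNReal _ hs0]; simpa using hs)
  simp only [zero_add] at this
  rw [mul_assoc]
  exact this

theorem sketch_close {n D p : ℕ} (hp : p = 2 * D) (hD : 1 ≤ D) (X : ℕ) (hX : 1000 ≤ X) (hn : n ≤ X) (hpX : p ≤ X)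
    (F : Fin D → Fin D → ℝ) (hF : (Matrix.of F).det ≠ 0) (y : Fin n → Fin D → ℝ) (B : Finset (Fin n))
    (hU : ∀ v, qs y B v ≤ (X:ℝ)^22 * qs F Finset.univ v)
    (hL : ∀ v, qs F Finset.univ v ≤ (X:ℝ)^32 * qs y B v) :
    skF p y B {z | ¬ close2 ((X:ℝ)^100) F Finset.univ z Finset.univ} ≤ ENNReal.ofReal (1 / (100 * X)) := by
  set A := Matrix.of F with hA
  have hAu : IsUnit A.det := isUnit_iff_ne_zero.mpr hF
  have hX1 : (1000:ℝ) ≤ X := by exact_mod_cast hX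
  have hX0 : (0:ℝ) < X := by linarith
  have hnX : (n:ℝ) ≤ X := by exact_mod_cast hn
  have hpX' : (p:ℝ) ≤ X := by exact_mod_cast hpX
  have hp' : (p:ℝ) = 2 * D := by rw [hp]; push_cast; ring
  set ζ : Fin p → (Fin p → Fin D → ℝ) → Fin D → ℝ := fun l z => z l ᵥ* A⁻¹ with hζ
  have hζd : ∀ u l z, u ⬝ᵥ ζ l z = (A⁻¹ *ᵥ u) ⬝ᵥ z l := by
    intro u l z
    rw [hζ, dotProduct_comm, ← dotProduct_mulVec, dotProduct_comm]
  have hAi : ∀ u, A *ᵥ (A⁻¹ *ᵥ u) = u := by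
    intro u; rw [mulVec_mulVec, mul_nonsing_inv _ hAu, one_mulVec]
  have hiA : ∀ u, A⁻¹ *ᵥ (A *ᵥ u) = u := by
    intro u; rw [mulVec_mulVec, nonsing_inv_mul _ hAu, one_mulVec]
  have hMi : ∀ u, qs F Finset.univ (A⁻¹ *ᵥ u) = u ⬝ᵥ u := by
    intro u; rw [qs_mat, ← hA, hAi]
  set κ : ℝ := ((X:ℝ)^50)⁻¹ with hκ
  set S1 : Set (Fin p → Fin D → ℝ) := {z | ∃ u : Fin D → ℝ, u ⬝ᵥ u = 1 ∧
    ∀ l ∈ (Finset.univ : Finset (Fin p)), |u ⬝ᵥ ζ l z| ≤ κ ∧ ∑ s, |ζ l z s| ≤ (X:ℝ)^14} with hS1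
  set E : Set (Fin p → Fin D → ℝ) := {z | ∀ l v, (v ⬝ᵥ z l)^2 ≤ (X:ℝ)^25 * qs F Finset.univ v} with hE
  have hsub : {z | ¬ close2 ((X:ℝ)^100) F Finset.univ z Finset.univ} ⊆ S1 ∪ Eᶜ := by
    intro z hz
    by_contra hc
    simp only [Set.mem_union, Set.mem_compl_iff, not_or, not_not] at hc
    obtain ⟨hc1, hc2⟩ := hc
    apply hz
    have hc2' : ∀ l v, (v ⬝ᵥ z l)^2 ≤ (X:ℝ)^25 * qs F Finset.univ v := hc2
    have hζs : ∀ l s, |ζ l z s| ≤ (X:ℝ)^13 := by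
      intro l s
      have e1 : ζ l z s = (A⁻¹ *ᵥ (Pi.single s 1)) ⬝ᵥ z l := by
        rw [← hζd]; simp
      have e2 := hc2' l (A⁻¹ *ᵥ (Pi.single s 1))
      rw [hMi, ← e1] at e2
      simp only [dotProduct_single, Pi.single_eq_same, mul_one] at e2
      refine abs_le_of_sq_le_sq (e2.trans ?_) (by positivity)
      rw [← pow_mul]
      exact pow_le_pow_right₀ (by linarith) (by norm_num)
    have hR : ∀ l, ∑ s, |ζ l z s| ≤ (X:ℝ)^14 := by
      intro l
      calc ∑ s, |ζ l z s| ≤ ∑ s : Fin D, (X:ℝ)^13 := Finset.sum_le_sum fun s _ => hζs l s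
        _ = D * (X:ℝ)^13 := by simp
        _ ≤ X * (X:ℝ)^13 := by gcongr; linarith [Nat.cast_nonneg (α := ℝ) D]
        _ = _ := by ring
    constructor
    · intro v
      by_cases h0 : qs F Finset.univ v = 0
      · rw [h0]; have := qs_nonneg z Finset.univ v; positivity
      have hpos : 0 < qs F Finset.univ v := lt_of_le_of_ne (qs_nonneg _ _ _) (Ne.symm h0)
      set q := qs F Finset.univ v with hq
      have hsq : 0 < Real.sqrt q := Real.sqrt_pos.mpr hpos
      by_contra hcon
      push Not at hcon
      apply hc1
      refine ⟨(Real.sqrt q)⁻¹ • (A *ᵥ v), ?_, fun l _ => ⟨?_, hR l⟩⟩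
      · rw [smul_dotProduct, dotProduct_smul, ← qs_mat, ← hq, smul_eq_mul, smul_eq_mul, ← mul_assoc,
          ← mul_inv, Real.mul_self_sqrt hpos.le, inv_mul_cancel₀ h0]
      · rw [hζd, mulVec_smul, hiA, smul_dotProduct, smul_eq_mul]
        have hl : (v ⬝ᵥ z l)^2 ≤ qs z Finset.univ v :=
          Finset.single_le_sum (f := fun l => (v ⬝ᵥ z l)^2) (fun _ _ => sq_nonneg _) (Finset.mem_univ l)
        refine abs_le_of_sq_le_sq ?_ (by positivity)
        rw [mul_pow, inv_pow, Real.sq_sqrt hpos.le, hκ, inv_pow, ← pow_mul, inv_mul_le_iff₀ hpos,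
          ← div_eq_mul_inv, le_div_iff₀ (by positivity)]
        norm_num
        nlinarith [pow_pos hX0 100]
    · intro v
      calc qs z Finset.univ v ≤ ∑ l : Fin p, (X:ℝ)^25 * qs F Finset.univ v :=
            Finset.sum_le_sum fun l _ => hc2' l v
        _ = p * ((X:ℝ)^25 * qs F Finset.univ v) := by simp
        _ ≤ X * ((X:ℝ)^25 * qs F Finset.univ v) := by
            gcongr; have := qs_nonneg F Finset.univ v; positivity
        _ = X^26 * qs F Finset.univ v := by ring
        _ ≤ _ := by
            gcongr
            · exact qs_nonneg _ _ _
            · linarith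
            · norm_num
  have hDp : D ≤ X ^ 64 := by
    have : X ≤ X^64 := Nat.le_self_pow (by norm_num) X
    omega
  have hS1m : skF p y B S1 ≤ ENNReal.ofReal (1 / (200 * X)) := by
    have hs := slab (skF p y B) (Finset.univ : Finset (Fin p)) D (X^64) hD hDp ζ (10 * (X:ℝ)^16) κ ((X:ℝ)^14)
      (by positivity) (by positivity) (by positivity) (by
        intro u hu w hw
        set v := A⁻¹ *ᵥ u with hv
        have e : {z : Fin p → Fin D → ℝ | ∀ l ∈ (Finset.univ : Finset (Fin p)), |u ⬝ᵥ ζ l z| ≤ w}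
            = Set.univ.pi fun _ => {x | |v ⬝ᵥ x| ≤ w} := by
          ext z
          simp only [Set.mem_ofPred_eq, Set.mem_univ_pi, Finset.mem_univ, true_implies, hζd, ← hv]
        rw [e, skF_eq, Measure.pi_pi, Finset.prod_const, ENNReal.ofReal_pow (by positivity)]
        gcongr
        have e2 : {x : Fin D → ℝ | |v ⬝ᵥ x| ≤ w} = (fun x => v ⬝ᵥ x) ⁻¹' {x | |x| ≤ w} := rfl
        rw [e2, ← Measure.map_apply (by unfold dotProduct; fun_prop)
          (measurableSet_le (by fun_prop) measurable_const), sk_proj]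
        refine gauss_ball0 _ _ _ (by positivity) hw ?_
        have := hL v
        rw [hv, hMi, ← hv] at this
        calc (1/4:ℝ) ≤ _ := hu
          _ ≤ _ := this
          _ = _ := by unfold qs; ring)
    refine hs.trans (ENNReal.ofReal_le_ofReal ?_)
    rw [Finset.card_univ, Fintype.card_fin, hp, pow_mul, ← mul_pow]
    have e : 3 * ((X ^ 64 : ℕ) : ℝ) * (10 * (X:ℝ) ^ 16 * (κ + (X:ℝ) ^ 14 / ((X ^ 64 : ℕ) : ℝ))) ^ 2 = 1200 / X^4 := by
      rw [hκ]; push_cast; field_simp; norm_num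
    rw [e]
    have e2 : (1200 : ℝ) / X^4 ≤ 1 / (200 * X) := by
      rw [div_le_div_iff₀ (by positivity) (by positivity)]
      have : (1000:ℝ)^3 ≤ X^3 := by gcongr
      nlinarith
    refine le_trans (pow_le_of_le_one (by positivity) (e2.trans ?_) (by omega)) e2
    rw [div_le_one (by positivity)]; linarith
  have hEm : MeasurableSet E := by
    have : E = ⋂ l, ⋂ v, {z : Fin p → Fin D → ℝ | (v ⬝ᵥ z l)^2 ≤ (X:ℝ)^25 * qs F Finset.univ v} := by
      ext z; simp [hE]
    rw [this]
    refine (isClosed_iInter fun l => isClosed_iInter fun v => ?_).measurableSet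
    exact isClosed_le (by unfold dotProduct; fun_prop) continuous_const
  have hE1 : skF p y B Eᶜ ≤ ENNReal.ofReal (1 / (200 * X)) := by
    have hmeas : Measurable (fun (g : Fin p → Fin n → ℝ) l => ∑ i ∈ B, g l i • y i) := by
      refine measurable_pi_lambda _ fun l => ?_
      exact (sk_meas y B).comp (measurable_pi_apply l)
    rw [skF, Measure.map_apply hmeas hEm.compl]
    have hs2 : (fun (g : Fin p → Fin n → ℝ) l => ∑ i ∈ B, g l i • y i) ⁻¹' Eᶜ ⊆
        {g | ∃ l i, (X:ℝ) < |g l i|} := by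
      intro g hg
      by_contra hc
      have hc' : ∀ l i, |g l i| ≤ X := by
        intro l i; by_contra hh; push Not at hh; exact hc ⟨l, i, hh⟩
      apply hg
      intro l v
      have e1 : v ⬝ᵥ (∑ i ∈ B, g l i • y i) = ∑ i ∈ B, g l i * (v ⬝ᵥ y i) := by
        rw [dotProduct_sum]; simp
      show (v ⬝ᵥ (∑ i ∈ B, g l i • y i))^2 ≤ _
      rw [e1]
      calc (∑ i ∈ B, g l i * (v ⬝ᵥ y i))^2 ≤ (∑ i ∈ B, g l i ^ 2) * (∑ i ∈ B, (v ⬝ᵥ y i)^2) :=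
            Finset.sum_mul_sq_le_sq_mul_sq _ _ _
        _ ≤ (∑ i ∈ B, (X:ℝ)^2) * ((X:ℝ)^22 * qs F Finset.univ v) := by
            refine mul_le_mul (Finset.sum_le_sum fun i _ => ?_) (hU v) (qs_nonneg _ _ _)
              (Finset.sum_nonneg fun _ _ => sq_nonneg _)
            rw [← sq_abs]
            exact pow_le_pow_left₀ (abs_nonneg _) (hc' l i) 2
        _ ≤ (X * (X:ℝ)^2) * ((X:ℝ)^22 * qs F Finset.univ v) := by
            have := qs_nonneg F Finset.univ v
            gcongr
            rw [Finset.sum_const, nsmul_eq_mul]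
            gcongr
            exact ((Finset.card_le_univ B).trans (by simp)).trans hn
        _ = _ := by ring
    refine (measure_mono hs2).trans ((coord_tail (Fin p) (Fin n) X hX0.le).trans (ENNReal.ofReal_le_ofReal ?_))
    simp only [Fintype.card_fin]
    have e1 : Real.exp (-(X:ℝ)^2/2) ≤ 48 / X^6 := by
      rw [neg_div, Real.exp_neg]
      have := Real.pow_div_factorial_le_exp ((X:ℝ)^2/2) (by positivity) 3
      have e3 : ((3:ℕ).factorial : ℝ) = 6 := by norm_num [Nat.factorial]
      rw [e3] at this
      rw [inv_le_comm₀ (Real.exp_pos _) (by positivity)]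
      refine le_trans (le_of_eq ?_) this
      field_simp; norm_num
    calc (p:ℝ) * (n * (2 * Real.exp (-(X:ℝ)^2/2))) ≤ X * (X * (2 * (48 / X^6))) := by gcongr
      _ = 96 / X^4 := by field_simp; norm_num
      _ ≤ _ := by
        rw [div_le_div_iff₀ (by positivity) (by positivity)]
        have : (1000:ℝ)^3 ≤ X^3 := by gcongr
        nlinarith
  calc _ ≤ skF p y B (S1 ∪ Eᶜ) := measure_mono hsub
    _ ≤ _ := measure_union_le _ _
    _ ≤ ENNReal.ofReal (1 / (200 * X)) + ENNReal.ofReal (1 / (200 * X)) := add_le_add hS1m hE1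
    _ = _ := by rw [← ENNReal.ofReal_add (by positivity) (by positivity)]; congr 1; field_simp; norm_num

end

section
/-- parameter hypotheses for utility of stage one -/
structure ParU (P : Par) (n D k X : ℕ) : Prop where
  hX : 1000 ≤ X
  hn : n ≤ X
  hk : 1 ≤ k
  hkX : k ≤ X
  hp : P.p = 2 * D
  hpX : P.p ≤ X
  hD : 1 ≤ D
  hmX : P.m ≤ X
  hbX : P.b ≤ X
  hK : P.K = (X:ℝ)^17
  hK2 : P.K2 = (X:ℝ)^132
  hN1 : k * P.m ≤ P.N1
  hN12 : P.N1 < P.N2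
  hmh : P.m ≤ P.h
  hhb : P.h ≤ P.b
  hΛ : 0 < P.Λ
  hβ : 0 ≤ P.β
  hW : 100 * k * P.Λ ≤ (1/2) * P.N2.choose P.b * (P.β^P.b * Real.exp (P.η * P.N2))

open Classical in
/-- deterministic good event for the data -/
structure GoodD (P : Par) {n D k : ℕ} (X : ℕ) (y : Fin n → Fin D → ℝ) (J : Fin n → Fin k)
    (F : Fin k → Fin D → Fin D → ℝ) (hv : Finset (Fin k)) : Prop where
  h1 : ∀ j T, (∀ i ∈ T, J i = j) → T.card = P.m → ∀ v, qs (F j) Finset.univ v ≤ (X:ℝ)^14 * qs y T v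
  h2 : ∀ i v, (v ⬝ᵥ y i)^2 ≤ (X:ℝ)^3 * qs (F (J i)) Finset.univ v
  h3 : ∀ j ∈ hv, P.N2 ≤ (Finset.univ.filter fun i => J i = j).card
  h4 : ∀ j ∈ hv, (Finset.univ.filter fun i => J i = j).card.choose P.b ≤
    2 * (((Finset.univ.filter fun i => J i = j).powersetCard P.b).filter fun B => gB P y B).card

theorem close2_symm {ι ι' : Type*} {D : ℕ} {K : ℝ} {z : ι → Fin D → ℝ} {T : Finset ι} {z' : ι' → Fin D → ℝ}
    {T' : Finset ι'} (h : close2 K z T z' T') : close2 K z' T' z T := ⟨h.2, h.1⟩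

theorem close2_trans {ι ι' ι'' : Type*} {D : ℕ} {K K' : ℝ} (hK : 0 ≤ K) (hK' : 0 ≤ K') {z : ι → Fin D → ℝ} {T : Finset ι}
    {z' : ι' → Fin D → ℝ} {T' : Finset ι'} {z'' : ι'' → Fin D → ℝ} {T'' : Finset ι''}
    (h : close2 K z T z' T') (h' : close2 K' z' T' z'' T'') : close2 (K * K') z T z'' T'' := by
  refine ⟨fun v => ?_, fun v => ?_⟩
  · calc _ ≤ K * qs z' T' v := h.1 v
      _ ≤ K * (K' * qs z'' T'' v) := by gcongr; exact h'.1 v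
      _ = _ := by ring
  · calc _ ≤ K' * qs z' T' v := h'.2 v
      _ ≤ K' * (K * qs z T v) := by gcongr; exact h.2 v
      _ = _ := by ring

theorem close2_mono {ι ι' : Type*} {D : ℕ} {K K' : ℝ} (hK : K ≤ K') {z : ι → Fin D → ℝ} {T : Finset ι}
    {z' : ι' → Fin D → ℝ} {T' : Finset ι'}
    (h : close2 K z T z' T') : close2 K' z T z' T' := by
  refine ⟨fun v => ?_, fun v => ?_⟩
  · exact (h.1 v).trans (mul_le_mul_of_nonneg_right hK (qs_nonneg _ _ _))
  · exact (h.2 v).trans (mul_le_mul_of_nonneg_right hK (qs_nonneg _ _ _))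

variable {P : Par} {n D k X : ℕ} {y : Fin n → Fin D → ℝ} {J : Fin n → Fin k}
    {F : Fin k → Fin D → Fin D → ℝ} {hv : Finset (Fin k)}

theorem qs_le_card {z : Fin n → Fin D → ℝ} {T : Finset (Fin n)} {v : Fin D → ℝ} {c : ℝ}
    (h : ∀ i ∈ T, (v ⬝ᵥ z i)^2 ≤ c) : qs z T v ≤ T.card * c := by
  unfold qs
  refine (Finset.sum_le_sum h).trans ?_
  simp

theorem condB_comp (hU : ParU P n D k X) (hG : GoodD P X y J F hv) {r : ℕ} {st : St k P.p D} {B : Finset (Fin n)}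
    (hB : condB P r y st B) : ∃ j, (∀ v, qs y B v ≤ (X:ℝ)^22 * qs (F j) Finset.univ v) ∧
      (∀ v, qs (F j) Finset.univ v ≤ (X:ℝ)^32 * qs y B v) ∧
      ∃ T ⊆ B, T.card = P.m ∧ close2 ((X:ℝ)^32) (F j) Finset.univ y T := by
  classical
  obtain ⟨⟨hb1, hb2⟩, _, _, hsc⟩ := hB
  have hX1 : (1:ℝ) ≤ X := by exact_mod_cast (le_trans (by norm_num) hU.hX)
  have hX0 : (0:ℝ) < X := by linarith
  obtain ⟨Y, hBY, hY, hYc⟩ := score_spec P y (lt_of_le_of_lt (Nat.zero_le _) hsc)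
  obtain ⟨j, _, hj⟩ : ∃ j ∈ (Finset.univ : Finset (Fin k)), P.m ≤ (Y.filter fun i => J i = j).card := by
    by_contra hc
    push Not at hc
    have h1 := Finset.card_eq_sum_card_fiberwise (s := Y) (t := Finset.univ) (f := J) (fun _ _ => by simp)
    have h2 : ∑ j : Fin k, (Y.filter fun i => J i = j).card ≤ ∑ j : Fin k, P.m :=
      Finset.sum_le_sum fun j hj => (hc j hj).le
    simp at h2
    have := hU.hN1
    omega
  obtain ⟨T0, hT0, hT0c⟩ := Finset.exists_subset_card_eq hj
  have hT0Y : T0 ⊆ Y := hT0.trans (Finset.filter_subset _ _)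
  have hT0J : ∀ i ∈ T0, J i = j := fun i hi => (Finset.mem_filter.mp (hT0 hi)).2
  have hmX : (P.m:ℝ) ≤ X := by exact_mod_cast hU.hmX
  have hbX : (P.b:ℝ) ≤ X := by exact_mod_cast hU.hbX
  have a1 : ∀ v, qs (F j) Finset.univ v ≤ (X:ℝ)^14 * qs y T0 v := hG.h1 j T0 hT0J hT0c
  have a2 : ∀ v, qs y T0 v ≤ X^4 * qs (F j) Finset.univ v := by
    intro v
    have := qs_nonneg (F j) Finset.univ v
    calc qs y T0 v ≤ T0.card * ((X:ℝ)^3 * qs (F j) Finset.univ v) :=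
          qs_le_card fun i hi => by have := hG.h2 i v; rwa [hT0J i hi] at this
      _ ≤ X * ((X:ℝ)^3 * qs (F j) Finset.univ v) := by rw [hT0c]; gcongr
      _ = _ := by ring
  -- sub-sets of Y
  have a3 : ∀ T ⊆ Y, (T.card:ℝ) ≤ X → ∀ v, qs y T v ≤ (X:ℝ)^22 * qs (F j) Finset.univ v := by
    intro T hT hc v
    have := qs_nonneg (F j) Finset.univ v
    have := qs_nonneg y T0 v
    calc qs y T v ≤ T.card * (P.K * qs y T0 v) := qs_le_card fun i hi => hY T0 hT0Y hT0c i (hT hi) v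
      _ ≤ X * ((X:ℝ)^17 * (X^4 * qs (F j) Finset.univ v)) := by rw [hU.hK]; gcongr; exact a2 v
      _ = _ := by ring
  have a4 : ∀ T ⊆ Y, T.card = P.m → ∀ v, qs (F j) Finset.univ v ≤ (X:ℝ)^32 * qs y T v := by
    intro T hT hc v
    have := qs_nonneg y T v
    calc qs (F j) Finset.univ v ≤ (X:ℝ)^14 * qs y T0 v := a1 v
      _ ≤ (X:ℝ)^14 * (T0.card * (P.K * qs y T v)) := by
          gcongr; exact qs_le_card fun i hi => hY T hT hc i (hT0Y hi) v
      _ ≤ (X:ℝ)^14 * (X * (X^17 * qs y T v)) := by rw [hU.hK, hT0c]; gcongr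
      _ = _ := by ring
  obtain ⟨T, hTB, hTc⟩ := Finset.exists_subset_card_eq (hU.hmh.trans hb1)
  refine ⟨j, a3 B hBY ?_, ?_, T, hTB, hTc, ?_, ?_⟩
  · refine le_trans ?_ hbX; exact_mod_cast hb2
  · intro v
    exact (a4 T (hTB.trans hBY) hTc v).trans (mul_le_mul_of_nonneg_left (qs_mono _ hTB v) (by positivity))
  · exact a4 T (hTB.trans hBY) hTc
  · intro v
    refine (a3 T (hTB.trans hBY) (by rw [hTc]; exact hmX) v).trans ?_
    gcongr
    · exact qs_nonneg _ _ _
    · norm_num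

theorem wt_lower (hU : ParU P n D k X) (hG : GoodD P X y J F hv) {r : ℕ} {st : St k P.p D} 
    (hex : ∃ j ∈ hv, ∀ i : Fin k, i.val < r → ¬ close2 ((X:ℝ)^146) (F j) Finset.univ (st i) Finset.univ) :
    ENNReal.ofReal (100 * k * P.Λ) ≤ ∑ B, wt P r y st B := by
  classical
  obtain ⟨j, hj, hne⟩ := hex
  have hX1 : (1:ℝ) ≤ X := by exact_mod_cast (le_trans (by norm_num) hU.hX)
  have hX0 : (0:ℝ) < X := by linarith
  have hmX : (P.m:ℝ) ≤ X := by exact_mod_cast hU.hmX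
  set I := Finset.univ.filter fun i => J i = j with hI
  have hIJ : ∀ i ∈ I, J i = j := fun i hi => (Finset.mem_filter.mp hi).2
  have hgY : gY P y I := by
    intro T hT hc i hi v
    have h2 := hG.h2 i v
    rw [hIJ i hi] at h2
    have h1 := hG.h1 j T (fun i hi => hIJ i (hT hi)) hc v
    calc _ ≤ _ := h2
      _ ≤ (X:ℝ)^3 * ((X:ℝ)^14 * qs y T v) := by gcongr
      _ = _ := by rw [hU.hK]; ring
  have hcond : ∀ B ∈ (I.powersetCard P.b).filter (fun B => gB P y B),
      wt P r y st B = ENNReal.ofReal (P.β ^ P.b * Real.exp (P.η * P.N2)) := by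
    intro B hB
    rw [Finset.mem_filter, Finset.mem_powersetCard] at hB
    obtain ⟨⟨hBI, hBc⟩, hgB⟩ := hB
    have hsc : P.N2 ≤ score P y B := (hG.h3 j hj).trans (by rw [← hI] at *; exact le_score P y hBI hgY)
    have hco : condB P r y st B := by
      refine ⟨⟨by rw [hBc]; exact hU.hhb, hBc.le⟩, hgB, ?_, lt_of_lt_of_le hU.hN12 hsc⟩
      intro T hT hTc i hi hcl
      refine hne i hi ?_
      have c1 : close2 ((X:ℝ)^14) (F j) Finset.univ y T := by
        refine ⟨hG.h1 j T (fun i hi => hIJ i (hBI (hT hi))) hTc, fun v => ?_⟩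
        have := qs_nonneg (F j) Finset.univ v
        calc qs y T v ≤ T.card * ((X:ℝ)^3 * qs (F j) Finset.univ v) :=
              qs_le_card fun i hi => by have := hG.h2 i v; rwa [hIJ i (hBI (hT hi))] at this
          _ ≤ X * ((X:ℝ)^3 * qs (F j) Finset.univ v) := by rw [hTc]; gcongr
          _ = X^4 * qs (F j) Finset.univ v := by ring
          _ ≤ _ := by
            gcongr
            norm_num
      have := close2_trans (by positivity) (by rw [hU.hK2]; positivity) c1 hcl
      rw [hU.hK2, ← pow_add] at this
      exact this
    rw [wt, if_pos hco, hBc, min_eq_right hsc]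
  calc ENNReal.ofReal (100 * k * P.Λ) ≤ ENNReal.ofReal ((1/2) * P.N2.choose P.b * (P.β^P.b * Real.exp (P.η * P.N2))) :=
        ENNReal.ofReal_le_ofReal hU.hW
    _ ≤ ENNReal.ofReal (((I.powersetCard P.b).filter (fun B => gB P y B)).card * (P.β ^ P.b * Real.exp (P.η * P.N2))) := by
        apply ENNReal.ofReal_le_ofReal
        have hβ := hU.hβ
        gcongr
        have e1 := hG.h4 j hj
        have e2 : P.N2.choose P.b ≤ I.card.choose P.b := Nat.choose_le_choose _ (hG.h3 j hj)
        have e3 : P.N2.choose P.b ≤ 2 * (((Finset.univ.filter fun i => J i = j).powersetCard P.b).filter fun B => gB P y B).card := by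
          refine e2.trans (le_trans (le_of_eq ?_) (e1.trans (le_of_eq ?_))) <;> congr!
        have e4 : (P.N2.choose P.b : ℝ) ≤ 2 * (((Finset.univ.filter fun i => J i = j).powersetCard P.b).filter fun B => gB P y B).card := by
          exact_mod_cast e3
        rw [hI]; linarith
    _ = ∑ B ∈ (I.powersetCard P.b).filter (fun B => gB P y B), wt P r y st B := by
        rw [Finset.sum_congr rfl hcond, Finset.sum_const, nsmul_eq_mul, ENNReal.ofReal_mul (by positivity),
          ENNReal.ofReal_natCast]
    _ ≤ _ := Finset.sum_le_sum_of_subset_of_nonneg (Finset.subset_univ _) fun _ _ _ => zero_le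

theorem meas_cl (K : ℝ) (G : Fin D → Fin D → ℝ) {p : ℕ} :
    MeasurableSet {z : Fin p → Fin D → ℝ | close2 K G Finset.univ z Finset.univ} :=
  (closed_close2 K _ _ continuous_const continuous_id).measurableSet

/-- new component found by `z` -/
def newc (X : ℕ) (F : Fin k → Fin D → Fin D → ℝ) {p : ℕ} (r : ℕ) (st : St k p D) (z : Fin p → Fin D → ℝ) : Prop :=
  ∃ j, (∀ i : Fin k, i.val < r → ¬ close2 ((X:ℝ)^100) (F j) Finset.univ (st i) Finset.univ) ∧
    close2 ((X:ℝ)^100) (F j) Finset.univ z Finset.univ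

theorem step_util (hU : ParU P n D k X) (hG : GoodD P X y J F hv) (hF : ∀ j, (Matrix.of (F j)).det ≠ 0)
    {r : ℕ} {st : St k P.p D} 
    (hex : ∃ j ∈ hv, ∀ i : Fin k, i.val < r → ¬ close2 ((X:ℝ)^146) (F j) Finset.univ (st i) Finset.univ) :
    stepP P r (y, st) {z | ¬ newc X F r st z} ≤ ENNReal.ofReal (1 / (50 * k)) := by
  classical
  have hX1 : (1:ℝ) ≤ X := by exact_mod_cast (le_trans (by norm_num) hU.hX)
  have hX0 : (0:ℝ) < X := by linarith
  have hk1 : (1:ℝ) ≤ k := by exact_mod_cast hU.hk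
  have hkX : (k:ℝ) ≤ X := by exact_mod_cast hU.hkX
  set W := ∑ B, wt P r y st B with hW
  have hWl := wt_lower hU hG hex
  rw [← hW] at hWl
  have hWt : W ≠ ∞ := ENNReal.sum_ne_top.mpr fun B _ => wt_ne_top P r y st B
  set c : ℝ≥0∞ := ENNReal.ofReal (1 / (100 * k)) with hc
  have hΛ := hU.hΛ
  have hΛW : ENNReal.ofReal P.Λ ≤ c * W := by
    calc ENNReal.ofReal P.Λ = c * ENNReal.ofReal (100 * k * P.Λ) := by
          rw [hc, ← ENNReal.ofReal_mul (by positivity)]; congr 1; field_simp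
      _ ≤ _ := by gcongr
  have hsk : ∀ B, wt P r y st B * skF P.p y B {z | ¬ newc X F r st z} ≤ c * wt P r y st B := by
    intro B
    by_cases hB : condB P r y st B
    · rw [mul_comm]
      gcongr
      obtain ⟨j, a1, a2, T, hTB, hTc, hcl⟩ := condB_comp hU hG hB
      have hs := sketch_close hU.hp hU.hD X hU.hX hU.hn hU.hpX (F j) (hF j) y B a1 a2
      refine le_trans (measure_mono ?_) (hs.trans ?_)
      · intro z hz hcz
        refine hz ⟨j, fun i hi hcl' => ?_, hcz⟩
        refine hB.2.2.1 T hTB hTc i hi ?_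
        have := close2_trans (by positivity) (by positivity) (close2_symm hcl) hcl'
        rw [← pow_add] at this
        rw [hU.hK2]; exact this
      · rw [hc]; apply ENNReal.ofReal_le_ofReal; gcongr
    · simp [wt, if_neg hB]
  have hlow : W ≤ stepM P r y st Set.univ := by rw [stepM_univ]; exact le_add_self
  have hup : stepM P r y st {z | ¬ newc X F r st z} ≤ (c + c) * W := by
    rw [stepM]
    simp only [Measure.coe_add, Pi.add_apply, Measure.smul_apply, Measure.coe_finset_sum, Finset.sum_apply, smul_eq_mul]
    rw [add_mul]
    refine add_le_add ?_ ?_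
    · refine le_trans (mul_le_of_le_one_right' ?_) hΛW
      exact prob_le_one
    · rw [hW, Finset.mul_sum]
      exact Finset.sum_le_sum fun B _ => hsk B
  have hcc : c + c = ENNReal.ofReal (1 / (50 * k)) := by
    rw [hc, ← ENNReal.ofReal_add (by positivity) (by positivity)]; congr 1; field_simp; norm_num
  have hW0 : stepM P r y st Set.univ ≠ 0 := stepM_ne_zero P hΛ r y st
  have hWT := stepM_ne_top P r y st
  show normM (stepM P r y st) _ ≤ _
  rw [normM, Measure.smul_apply, smul_eq_mul, ← hcc]
  calc _ ≤ (stepM P r y st Set.univ)⁻¹ * ((c + c) * stepM P r y st Set.univ) := by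
        gcongr; exact hup.trans (by gcongr)
    _ = (c + c) := by
        rw [mul_comm (c+c), ← mul_assoc, ENNReal.inv_mul_cancel hW0 hWT, one_mul]

def InvR (X : ℕ) (F : Fin k → Fin D → Fin D → ℝ) (hv : Finset (Fin k)) {p : ℕ} (r : ℕ) (st : St k p D) : Prop :=
  (∀ j ∈ hv, ∃ i : Fin k, i.val < r ∧ close2 ((X:ℝ)^146) (F j) Finset.univ (st i) Finset.univ) ∨
  ∃ S : Finset (Fin k), r ≤ S.card ∧ ∀ j ∈ S, ∃ i : Fin k, i.val < r ∧ close2 ((X:ℝ)^100) (F j) Finset.univ (st i) Finset.univ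

theorem meas_InvR (X : ℕ) (F : Fin k → Fin D → Fin D → ℝ) (hv : Finset (Fin k)) {p : ℕ} (r : ℕ) :
    MeasurableSet {st : St k p D | InvR X F hv r st} := by
  have h : ∀ (K : ℝ) j (i : Fin k), Measurable fun st : St k p D => close2 K (F j) Finset.univ (st i) Finset.univ := by
    intro K j i
    rw [← measurableSet_setOfPred]
    exact (closed_close2 K _ _ continuous_const (continuous_apply i)).measurableSet
  rw [measurableSet_setOfPred]
  unfold InvR
  refine Measurable.or ?_ ?_
  · refine Measurable.forall fun j => Measurable.imp measurable_const (Measurable.exists fun i => ?_)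
    exact Measurable.and measurable_const (h _ _ _)
  · refine Measurable.exists fun S => Measurable.and measurable_const ?_
    refine Measurable.forall fun j => Measurable.imp measurable_const (Measurable.exists fun i => ?_)
    exact Measurable.and measurable_const (h _ _ _)

theorem upd_lt {p : ℕ} {r : ℕ} (st : St k p D) (z : Fin p → Fin D → ℝ) {i : Fin k} (h : i.val < r) :
    upd r st z i = st i := by simp [upd, h.ne]

theorem InvR_step {p : ℕ} {r : ℕ} (hr : r < k) {st : St k p D} {z : Fin p → Fin D → ℝ} (hI : InvR X F hv r st)
    (hz : newc X F r st z ∨ ∀ j ∈ hv, ∃ i : Fin k, i.val < r ∧ close2 ((X:ℝ)^146) (F j) Finset.univ (st i) Finset.univ) :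
    InvR X F hv (r+1) (upd r st z) := by
  classical
  have key : ∀ K j, (∃ i : Fin k, i.val < r ∧ close2 K (F j) Finset.univ (st i) Finset.univ) →
    ∃ i : Fin k, i.val < r + 1 ∧ close2 K (F j) Finset.univ (upd r st z i) Finset.univ := by
    rintro K j ⟨i, hi, hc⟩
    exact ⟨i, by omega, by rwa [upd_lt st z hi]⟩
  rcases hI with h | ⟨S, hS, hS'⟩
  · left; intro j hj; exact key _ j (h j hj)
  rcases hz with ⟨j0, hj0, hz⟩ | h
  · right
    have hj0S : j0 ∉ S := by
      intro h; obtain ⟨i, hi, hc⟩ := hS' j0 h; exact hj0 i hi hc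
    refine ⟨insert j0 S, by rw [Finset.card_insert_of_notMem hj0S]; omega, fun j hj => ?_⟩
    rcases Finset.mem_insert.mp hj with rfl | hj
    · exact ⟨⟨r, hr⟩, by simp, by simpa [upd] using hz⟩
    · exact key _ j (hS' j hj)
  · left; intro j hj; exact key _ j (h j hj)

theorem rounds_util_aux (hU : ParU P n D k X) (hG : GoodD P X y J F hv) (hF : ∀ j, (Matrix.of (F j)).det ≠ 0)
    (r : ℕ) (hr : r ≤ k) : rounds P n D k r y {st | ¬ InvR X F hv r st} ≤ r * ENNReal.ofReal (1 / (50 * k)) := by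
  haveI : ∀ s, IsMarkovKernel (rounds P n D k s) := fun s => rounds_markov P hU.hΛ n D k s
  induction r with
  | zero =>
    have : {st : St k P.p D | ¬ InvR X F hv 0 st} = ∅ := by
      ext st; simp only [Set.mem_ofPred_eq, Set.mem_empty_iff_false, iff_false, not_not]
      right; exact ⟨∅, by simp, by simp⟩
    rw [this]; simp
  | succ r ih =>
    haveI := stepK_markov P hU.hΛ n D k r
    have hm : MeasurableSet {st : St k P.p D | ¬ InvR X F hv r st} := (meas_InvR X F hv r).compl
    have hm1 : MeasurableSet {st : St k P.p D | ¬ InvR X F hv (r+1) st} := (meas_InvR X F hv (r+1)).compl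
    have hmk : Measurable fun st => stepK P n D k r (y, st) := (stepK P n D k r).measurable.comp (by fun_prop)
    rw [rounds_succ P hU.hΛ, Measure.bind_apply hm1 hmk.aemeasurable]
    set c : ℝ≥0∞ := ENNReal.ofReal (1 / (50 * k)) with hc
    have hpt : ∀ st, stepK P n D k r (y, st) {st | ¬ InvR X F hv (r+1) st} ≤
        c + Set.indicator {st : St k P.p D | ¬ InvR X F hv r st} (fun _ => 1) st := by
      intro st
      by_cases hI : InvR X F hv r st
      · refine le_add_right ?_
        have hmu : Measurable (upd (k := k) (p := P.p) (D := D) r st) := (meas_upd r).comp measurable_prodMk_left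
        rw [stepK_apply P hU.hΛ, Measure.map_apply hmu hm1]
        by_cases hall : ∀ j ∈ hv, ∃ i : Fin k, i.val < r ∧ close2 ((X:ℝ)^146) (F j) Finset.univ (st i) Finset.univ
        · have : upd r st ⁻¹' {st : St k P.p D | ¬ InvR X F hv (r+1) st} = ∅ := by
            ext z
            simp only [Set.mem_preimage, Set.mem_ofPred_eq, Set.mem_empty_iff_false, iff_false, not_not]
            exact InvR_step (by omega) hI (Or.inr hall)
          rw [this]; simp
        · push Not at hall
          refine le_trans (measure_mono ?_) (step_util hU hG hF hall)
          intro z hz hn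
          exact hz (InvR_step (by omega) hI (Or.inl hn))
      · have : Set.indicator {st : St k P.p D | ¬ InvR X F hv r st} (fun _ => (1:ℝ≥0∞)) st = 1 :=
          Set.indicator_of_mem hI _
        rw [this]
        exact le_add_left prob_le_one
    calc _ ≤ ∫⁻ st, (c + Set.indicator {st : St k P.p D | ¬ InvR X F hv r st} (fun _ => 1) st) ∂(rounds P n D k r y) :=
          lintegral_mono hpt
      _ = c + rounds P n D k r y {st | ¬ InvR X F hv r st} := by
          rw [lintegral_add_left measurable_const, lintegral_indicator hm]; simp
      _ ≤ c + r * c := by gcongr; exact ih (by omega)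
      _ = _ := by push_cast; ring

/-- utility of stage one, for good data -/
theorem rounds_util (hU : ParU P n D k X) (hG : GoodD P X y J F hv) (hF : ∀ j, (Matrix.of (F j)).det ≠ 0) :
    rounds P n D k k y {st | ¬ ∀ j ∈ hv, ∃ i, close2 ((X:ℝ)^146) (F j) Finset.univ (st i) Finset.univ} ≤
      ENNReal.ofReal (1/50) := by
  have hX1 : (1:ℝ) ≤ X := by exact_mod_cast (le_trans (by norm_num) hU.hX)
  have hk1 : (1:ℝ) ≤ k := by exact_mod_cast hU.hk
  refine le_trans (measure_mono ?_) ((rounds_util_aux hU hG hF k le_rfl).trans (le_of_eq ?_))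
  · intro st hst hI
    apply hst
    rcases hI with h | ⟨S, hS, hS'⟩
    · intro j hj; obtain ⟨i, _, hc⟩ := h j hj; exact ⟨i, hc⟩
    · have : S = Finset.univ := by
        apply Finset.eq_univ_of_card
        have := Finset.card_le_univ S
        simp at this ⊢; omega
      intro j hj
      obtain ⟨i, _, hc⟩ := hS' j (by rw [this]; simp)
      exact ⟨i, close2_mono (pow_le_pow_right₀ hX1 (by norm_num)) hc⟩
  · rw [← ENNReal.ofReal_natCast, ← ENNReal.ofReal_mul (by positivity)]
    congr 1; field_simp

end

section
theorem lintegral_le_of_good {Ω : Type*} [MeasurableSpace Ω] (μ : Measure Ω) [IsProbabilityMeasure μ] (f : Ω → ℝ≥0∞)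
    (s : Set Ω) (c : ℝ≥0∞) (h1 : ∀ x, f x ≤ 1) (h : ∀ x, x ∉ s → f x ≤ c) : ∫⁻ x, f x ∂μ ≤ c + μ s := by
  have hm := measurableSet_toMeasurable μ s
  calc ∫⁻ x, f x ∂μ ≤ ∫⁻ x, (c + Set.indicator (toMeasurable μ s) (fun _ => 1) x) ∂μ := by
        refine lintegral_mono fun x => ?_
        by_cases hx : x ∈ toMeasurable μ s
        · rw [Set.indicator_of_mem hx]; exact le_add_left (h1 x)
        · rw [Set.indicator_of_notMem hx, add_zero]
          exact h x fun hx' => hx (subset_toMeasurable μ s hx')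
    _ = c + μ s := by
        rw [lintegral_add_left measurable_const, lintegral_indicator hm]; simp

/-- homogeneous coordinates -/
def lft {d : ℕ} (x : Fin d → ℝ) : Fin (d+1) → ℝ := Fin.cons 1 x

theorem meas_lft {d : ℕ} : Measurable (lft (d := d)) := by
  refine measurable_pi_lambda _ fun s => ?_
  refine Fin.cases ?_ (fun s => ?_) s
  · simp [lft]
  · simpa [lft] using measurable_pi_apply s

theorem dot_lft {d : ℕ} (u : Fin (d+1) → ℝ) (x : Fin d → ℝ) : u ⬝ᵥ lft x = u 0 + ∑ s, u (Fin.succ s) * x s := by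
  simp [lft, dotProduct, Fin.sum_univ_succ]

theorem ball_lft {n d : ℕ} (T : Finset (Fin n)) (u : Fin (d+1) → ℝ) (hu : 1/4 ≤ u ⬝ᵥ u) (w : ℝ) (hw : 0 ≤ w) :
    (Measure.pi fun _ : Fin n => stdG (Fin d)) {g | ∀ i ∈ T, |u ⬝ᵥ lft (g i)| ≤ w} ≤
      ENNReal.ofReal ((10 * w) ^ T.card) := by
  classical
  have e : {g : Fin n → Fin d → ℝ | ∀ i ∈ T, |u ⬝ᵥ lft (g i)| ≤ w} =
      Set.univ.pi fun i => if i ∈ T then {x | |u ⬝ᵥ lft x| ≤ w} else Set.univ := by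
    ext g
    simp only [Set.mem_ofPred_eq, Set.mem_univ_pi]
    refine forall_congr' fun i => ?_
    by_cases hi : i ∈ T <;> simp [hi]
  rw [e, Measure.pi_pi]
  have h1 : stdG (Fin d) {x | |u ⬝ᵥ lft x| ≤ w} ≤ ENNReal.ofReal (10 * w) := by
    have hb := gaussian_small_ball (Real.toNNReal (∑ s, u (Fin.succ s)^2)) (u 0) w hw (by
      rw [Real.coe_toNNReal _ (Finset.sum_nonneg fun _ _ => sq_nonneg _)]
      refine hu.trans (le_of_eq ?_)
      simp only [dotProduct, Fin.sum_univ_succ, sq]; ring)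
    rw [← stdG_map_lin, Measure.map_apply (by fun_prop) (measurableSet_le (by fun_prop) measurable_const)] at hb
    refine le_trans (le_of_eq ?_) hb
    congr 1
    ext x
    simp [dot_lft]
  calc ∏ i, stdG (Fin d) (if i ∈ T then {x | |u ⬝ᵥ lft x| ≤ w} else Set.univ)
      ≤ ∏ i : Fin n, (if i ∈ T then ENNReal.ofReal (10 * w) else 1) := by
        refine Finset.prod_le_prod' fun i _ => ?_
        by_cases hi : i ∈ T
        · simpa only [hi, if_true] using h1
        · simp [hi]
    _ = _ := by
        rw [Finset.prod_ite_mem, Finset.univ_inter, Finset.prod_const, ENNReal.ofReal_pow (by positivity)]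

theorem sum_lft_le {d : ℕ} {x : Fin d → ℝ} {ρ : ℝ} (hρ : 1 ≤ ρ) (h : ∀ s, |x s| ≤ ρ) : ∑ s, |lft x s| ≤ ((d+1 : ℕ) : ℝ) * ρ := by
  have : ∀ s, |lft x s| ≤ ρ := by
    intro s; refine Fin.cases ?_ (fun s => ?_) s
    · simpa [lft] using hρ
    · simpa [lft] using h s
  refine (Finset.sum_le_sum fun s _ => this s).trans ?_
  simp

theorem sq_lft_le {d : ℕ} {x : Fin d → ℝ} {ρ : ℝ} (hρ : 1 ≤ ρ) (h : ∀ s, |x s| ≤ ρ) : lft x ⬝ᵥ lft x ≤ ((d+1 : ℕ) : ℝ) * ρ^2 := by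
  have : ∀ s, lft x s * lft x s ≤ ρ^2 := by
    intro s; rw [← sq, ← sq_abs]
    refine pow_le_pow_left₀ (abs_nonneg _) ?_ 2
    refine Fin.cases ?_ (fun s => ?_) s
    · simpa [lft] using hρ
    · simpa [lft] using h s
  refine (Finset.sum_le_sum fun s _ => this s).trans ?_
  simp

/-- bad direction event for subsets of size `q` of `B` -/
def badQ {n d : ℕ} (q : ℕ) (w : ℝ) (B : Finset (Fin n)) (g : Fin n → Fin d → ℝ) : Prop :=
  ∃ Q ⊆ B, Q.card = q ∧ ∃ u : Fin (d+1) → ℝ, u ⬝ᵥ u = 1 ∧ ∀ i ∈ Q, |u ⬝ᵥ lft (g i)| ≤ w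

def bdd {n d : ℕ} (ρ : ℝ) (g : Fin n → Fin d → ℝ) : Prop := ∀ i s, |g i s| ≤ ρ

theorem badQ_le {n d : ℕ} (q N : ℕ) (w ρ : ℝ) (hw : 0 ≤ w) (hρ : 1 ≤ ρ) (hN : d + 1 ≤ N) (hNw : ((d+1:ℕ):ℝ) * ρ ≤ N * w)
    (B : Finset (Fin n)) :
    (Measure.pi fun _ : Fin n => stdG (Fin d)) {g | bdd ρ g ∧ badQ q w B g} ≤
      ENNReal.ofReal (B.card.choose q * ((3 * N) ^ (d+1) * (20 * w) ^ q)) := by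
  have hN0 : (0:ℝ) < N := by exact_mod_cast (lt_of_lt_of_le (Nat.succ_pos d) hN)
  have hsub : {g : Fin n → Fin d → ℝ | bdd ρ g ∧ badQ q w B g} ⊆ ⋃ Q ∈ B.powersetCard q,
      {g | ∃ u : Fin (d+1) → ℝ, u ⬝ᵥ u = 1 ∧ ∀ i ∈ Q, |u ⬝ᵥ lft (g i)| ≤ w ∧ ∑ s, |lft (g i) s| ≤ ((d+1:ℕ):ℝ) * ρ} := by
    rintro g ⟨hb, Q, hQB, hQc, u, hu, hQ⟩
    simp only [Set.mem_iUnion]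
    exact ⟨Q, Finset.mem_powersetCard.mpr ⟨hQB, hQc⟩, u, hu, fun i hi => ⟨hQ i hi, sum_lft_le hρ (hb i)⟩⟩
  refine (measure_mono hsub).trans ((measure_biUnion_finset_le _ _).trans ?_)
  calc _ ≤ ∑ Q ∈ B.powersetCard q, ENNReal.ofReal ((3 * N) ^ (d+1) * (20 * w) ^ q) := by
        refine Finset.sum_le_sum fun Q hQ => ?_
        have hs := slab (Measure.pi fun _ : Fin n => stdG (Fin d)) Q (d+1) N (by omega) hN (fun i g => lft (g i)) 10 w
          (((d+1:ℕ):ℝ) * ρ) hw (by positivity) (by norm_num) (fun u hu w hw => ball_lft Q u hu w hw)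
        refine hs.trans (ENNReal.ofReal_le_ofReal ?_)
        rw [(Finset.mem_powersetCard.mp hQ).2]
        have : ((d+1:ℕ):ℝ) * ρ / N ≤ w := by rw [div_le_iff₀ hN0]; linarith
        have h2 : 10 * (w + ((d+1:ℕ):ℝ) * ρ / N) ≤ 20 * w := by linarith
        gcongr
    _ = _ := by
        rw [Finset.sum_const, Finset.card_powersetCard, nsmul_eq_mul,
          ENNReal.ofReal_mul (p := (B.card.choose q : ℝ)) (Nat.cast_nonneg _), ENNReal.ofReal_natCast]

/-- consequences of absence of bad directions -/
theorem not_badQ {n d : ℕ} {q : ℕ} {w : ℝ} (hw : 0 ≤ w) {B : Finset (Fin n)} {g : Fin n → Fin d → ℝ} (h : ¬ badQ q w B g)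
    (T : Finset (Fin n)) (hT : T ⊆ B) (hTc : 2 * q ≤ T.card) (u : Fin (d+1) → ℝ) :
    q * w^2 * (u ⬝ᵥ u) ≤ ∑ i ∈ T, (u ⬝ᵥ lft (g i))^2 := by
  classical
  rcases eq_or_ne (u ⬝ᵥ u) 0 with h0 | h0
  · rw [h0, mul_zero]; exact Finset.sum_nonneg fun _ _ => sq_nonneg _
  have hpos : 0 < u ⬝ᵥ u := lt_of_le_of_ne (Finset.sum_nonneg fun s _ => mul_self_nonneg _) (Ne.symm h0)
  have hsq : 0 < Real.sqrt (u ⬝ᵥ u) := Real.sqrt_pos.mpr hpos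
  set G := T.filter fun i => w * Real.sqrt (u ⬝ᵥ u) < |u ⬝ᵥ lft (g i)| with hG
  have hGc : q ≤ G.card := by
    by_contra hc
    push Not at hc
    have h1 := Finset.card_filter_add_card_filter_not (s := T) (fun i => w * Real.sqrt (u ⬝ᵥ u) < |u ⬝ᵥ lft (g i)|)
    obtain ⟨Q, hQ, hQc⟩ := Finset.exists_subset_card_eq (s := T.filter fun i => ¬ w * Real.sqrt (u ⬝ᵥ u) < |u ⬝ᵥ lft (g i)|)
      (n := q) (by rw [← hG] at h1; omega)
    refine h ⟨Q, (hQ.trans (Finset.filter_subset _ _)).trans hT, hQc, (Real.sqrt (u ⬝ᵥ u))⁻¹ • u, ?_, fun i hi => ?_⟩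
    · rw [smul_dotProduct, dotProduct_smul, smul_eq_mul, smul_eq_mul, ← mul_assoc,
          ← mul_inv, Real.mul_self_sqrt hpos.le, inv_mul_cancel₀ h0]
    · have := (Finset.mem_filter.mp (hQ hi)).2
      push Not at this
      rw [smul_dotProduct, smul_eq_mul, abs_mul, abs_of_pos (inv_pos.mpr hsq), inv_mul_le_iff₀ hsq]
      linarith
  calc q * w^2 * (u ⬝ᵥ u) ≤ G.card * (w^2 * (u ⬝ᵥ u)) := by
        rw [mul_assoc]; gcongr
    _ = ∑ i ∈ G, w^2 * (u ⬝ᵥ u) := by simp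
    _ ≤ ∑ i ∈ G, (u ⬝ᵥ lft (g i))^2 := by
        refine Finset.sum_le_sum fun i hi => ?_
        have := (Finset.mem_filter.mp hi).2
        rw [← sq_abs (u ⬝ᵥ _)]
        calc w^2 * (u ⬝ᵥ u) = (w * Real.sqrt (u ⬝ᵥ u))^2 := by rw [mul_pow, Real.sq_sqrt hpos.le]
          _ ≤ _ := by gcongr
    _ ≤ _ := Finset.sum_le_sum_of_subset_of_nonneg (Finset.filter_subset _ _) fun _ _ _ => sq_nonneg _

open Classical in
theorem markov_count {Ω β : Type*} [MeasurableSpace Ω] (μ : Measure Ω) (S : Finset β) (s : β → Set Ω) (c : ℝ≥0∞)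
    (h : ∀ B ∈ S, μ (s B) ≤ c) : μ {ω | 0 < S.card ∧ S.card ≤ 2 * (S.filter fun B => ω ∈ s B).card} ≤ 2 * c := by
  rcases Nat.eq_zero_or_pos S.card with h0 | h0
  · simp [h0]
  set f : Ω → ℝ≥0∞ := fun ω => ∑ B ∈ S, Set.indicator (toMeasurable μ (s B)) (fun _ => 1) ω with hf
  have hfm : Measurable f := by
    refine Finset.measurable_sum _ fun B _ => ?_
    exact measurable_const.indicator (measurableSet_toMeasurable _ _)
  have hIntg : ∫⁻ ω, f ω ∂μ ≤ S.card * c := by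
    rw [hf, lintegral_finset_sum _ fun B _ => measurable_const.indicator (measurableSet_toMeasurable _ _)]
    calc _ ≤ ∑ B ∈ S, c := by
          refine Finset.sum_le_sum fun B hB => ?_
          rw [lintegral_indicator (measurableSet_toMeasurable _ _)]
          simpa using h B hB
      _ = _ := by simp
  have hsub : {ω | 0 < S.card ∧ S.card ≤ 2 * (S.filter fun B => ω ∈ s B).card} ⊆ {ω | (S.card : ℝ≥0∞) / 2 ≤ f ω} := by
    rintro ω ⟨_, hω⟩
    have : ((S.filter fun B => ω ∈ s B).card : ℝ≥0∞) ≤ f ω := by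
      rw [hf, Finset.card_filter]; push_cast
      refine Finset.sum_le_sum fun B _ => ?_
      by_cases hB : ω ∈ s B
      · rw [Set.indicator_of_mem (subset_toMeasurable _ _ hB)]; simp [hB]
      · simp [hB]
    refine le_trans ?_ this
    rw [ENNReal.div_le_iff (by norm_num) (by norm_num), mul_comm]
    exact_mod_cast hω
  have hS0 : (S.card : ℝ≥0∞) ≠ 0 := by simpa using h0.ne'
  have hS1 : (S.card : ℝ≥0∞) / 2 ≠ 0 := by simpa using hS0
  refine (measure_mono hsub).trans ((meas_ge_le_lintegral_div hfm.aemeasurable hS1 (by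
    refine (ENNReal.div_lt_top (by simp) (by norm_num)).ne)).trans ?_)
  rw [ENNReal.div_le_iff hS1 (by refine (ENNReal.div_lt_top (by simp) (by norm_num)).ne)]
  refine hIntg.trans (le_of_eq ?_)
  rw [mul_comm 2 c, mul_assoc, ENNReal.mul_div_cancel (by norm_num) (by norm_num), mul_comm]

/-- parameters for the good event -/
structure ParG (P : Par) (n d k X q N : ℕ) (w ρ : ℝ) : Prop where
  hm : P.m = 4 * (d + 1)
  hh : P.h = 2 * q
  hX : 1000 ≤ X
  hn : n ≤ X
  hD : d + 1 ≤ X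
  hk : 1 ≤ k
  hρ : 1 ≤ ρ
  hρX : ρ ≤ X
  hw : 0 ≤ w
  hN : d + 1 ≤ N
  hNw : ((d+1:ℕ):ℝ) * ρ ≤ N * w
  ha0 : 0 ≤ P.a
  ha : P.a * (((d+1:ℕ):ℝ) * ρ^2) ≤ q * w^2
  hpr : P.b.choose q * ((3 * N) ^ (d+1) * (20 * w) ^ q) ≤ 1 / (200 * (k:ℝ))
  htail : (n : ℝ) * (d * (2 * Real.exp (-(ρ^2) / 2))) ≤ 1/100

open Classical in
/-- the bad event for the noise, given labels -/
def badG (P : Par) {n d k : ℕ} (X q : ℕ) (w ρ : ℝ) (J : Fin n → Fin k) (g : Fin n → Fin d → ℝ) : Prop :=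
  ¬ bdd ρ g ∨ (bdd (X:ℝ) g ∧ badQ (2 * (d+1)) (((X:ℝ)^7)⁻¹) Finset.univ g) ∨
  ∃ j, 0 < ((Finset.univ.filter fun i => J i = j).powersetCard P.b).card ∧
    ((Finset.univ.filter fun i => J i = j).powersetCard P.b).card ≤
      2 * (((Finset.univ.filter fun i => J i = j).powersetCard P.b).filter fun B => g ∈ {g | bdd ρ g ∧ badQ q w B g}).card

theorem badG_prob {P : Par} {n d k X q N : ℕ} {w ρ : ℝ} (hG : ParG P n d k X q N w ρ) (J : Fin n → Fin k) :
    (Measure.pi fun _ : Fin n => stdG (Fin d)) {g | badG P X q w ρ J g} ≤ ENNReal.ofReal (3/100) := by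
  classical
  have hX1 : (1000:ℝ) ≤ X := by exact_mod_cast hG.hX
  have hX0 : (0:ℝ) < X := by linarith
  have hk1 : (1:ℝ) ≤ k := by exact_mod_cast hG.hk
  have hρ := hG.hρ
  have hw := hG.hw
  have h1 : (Measure.pi fun _ : Fin n => stdG (Fin d)) {g | ¬ bdd ρ g} ≤ ENNReal.ofReal (1/100) := by
    have := coord_tail (Fin n) (Fin d) ρ (by linarith)
    simp only [Fintype.card_fin] at this
    refine le_trans (measure_mono ?_) (this.trans (ENNReal.ofReal_le_ofReal hG.htail))
    intro g hg
    by_contra hc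
    apply hg
    intro i s
    by_contra hh; push Not at hh; exact hc ⟨i, s, hh⟩
  have h2 : (Measure.pi fun _ : Fin n => stdG (Fin d)) {g | bdd (X:ℝ) g ∧ badQ (2 * (d+1)) (((X:ℝ)^7)⁻¹) Finset.univ g}
      ≤ ENNReal.ofReal (1/100) := by
    have hdX : ((d+1:ℕ):ℝ) ≤ X := by exact_mod_cast hG.hD
    refine (badQ_le (2 * (d+1)) (X^9) (((X:ℝ)^7)⁻¹) X (by positivity) (by linarith)
      (hG.hD.trans (Nat.le_self_pow (by norm_num) X)) ?_ Finset.univ).trans (ENNReal.ofReal_le_ofReal ?_)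
    · have : (((X^9:ℕ):ℝ)) * ((X:ℝ)^7)⁻¹ = X * X := by push_cast; field_simp
      rw [this]; gcongr
    · have hc : ((Finset.univ : Finset (Fin n)).card.choose (2*(d+1)) : ℝ) ≤ (X^2)^(d+1) := by
        rw [← pow_mul]
        calc ((Finset.univ : Finset (Fin n)).card.choose (2*(d+1)) : ℝ) ≤ (n:ℝ)^(2*(d+1)) := by
              rw [Finset.card_univ, Fintype.card_fin]; exact_mod_cast Nat.choose_le_pow n _
          _ ≤ (X:ℝ)^(2*(d+1)) := by gcongr; exact_mod_cast hG.hn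
      have e2 : (1200 : ℝ) / X^3 ≤ 1 / 100 := by
        rw [div_le_div_iff₀ (by positivity) (by positivity)]
        have : (1000:ℝ)^3 ≤ X^3 := by gcongr
        nlinarith
      calc _ ≤ ((X:ℝ)^2)^(d+1) * ((3 * ((X^9:ℕ):ℝ)) ^ (d+1) * (20 * ((X:ℝ)^7)⁻¹) ^ (2*(d+1))) := by gcongr
        _ = (1200 / X^3)^(d+1) := by
            rw [pow_mul (20 * ((X:ℝ)^7)⁻¹), ← mul_pow, ← mul_pow]
            congr 1
            push_cast; field_simp; norm_num
        _ ≤ 1200 / X^3 := pow_le_of_le_one (by positivity) (e2.trans (by norm_num)) (by omega)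
        _ ≤ 1/100 := e2
  have h3 : (Measure.pi fun _ : Fin n => stdG (Fin d)) {g | ∃ j, 0 < ((Finset.univ.filter fun i => J i = j).powersetCard P.b).card ∧
      ((Finset.univ.filter fun i => J i = j).powersetCard P.b).card ≤
      2 * (((Finset.univ.filter fun i => J i = j).powersetCard P.b).filter fun B => g ∈ {g | bdd ρ g ∧ badQ q w B g}).card} ≤
      ENNReal.ofReal (1/100) := by
    have hu : {g : Fin n → Fin d → ℝ | ∃ j, 0 < ((Finset.univ.filter fun i => J i = j).powersetCard P.b).card ∧
      ((Finset.univ.filter fun i => J i = j).powersetCard P.b).card ≤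
      2 * (((Finset.univ.filter fun i => J i = j).powersetCard P.b).filter fun B => g ∈ {g | bdd ρ g ∧ badQ q w B g}).card} =
      ⋃ j, {g : Fin n → Fin d → ℝ | 0 < ((Finset.univ.filter fun i => J i = j).powersetCard P.b).card ∧
      ((Finset.univ.filter fun i => J i = j).powersetCard P.b).card ≤
      2 * (((Finset.univ.filter fun i => J i = j).powersetCard P.b).filter fun B => g ∈ {g | bdd ρ g ∧ badQ q w B g}).card} := by
      ext g; simp only [Set.mem_ofPred_eq, Set.mem_iUnion]
    rw [hu]
    refine (measure_iUnion_fintype_le _ _).trans ?_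
    calc _ ≤ ∑ j : Fin k, 2 * ENNReal.ofReal (1 / (200 * (k:ℝ))) := by
          refine Finset.sum_le_sum fun j _ => ?_
          have := markov_count (Measure.pi fun _ : Fin n => stdG (Fin d)) ((Finset.univ.filter fun i => J i = j).powersetCard P.b)
            (fun B => {g : Fin n → Fin d → ℝ | bdd ρ g ∧ badQ q w B g}) (ENNReal.ofReal (1 / (200 * (k:ℝ)))) (by
              intro B hB
              refine (badQ_le q N w ρ hw hρ hG.hN hG.hNw B).trans (ENNReal.ofReal_le_ofReal ?_)
              rw [(Finset.mem_powersetCard.mp hB).2]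
              exact hG.hpr)
          refine le_trans (le_of_eq ?_) this
          congr!
      _ = _ := by
          rw [Finset.sum_const, Finset.card_univ, Fintype.card_fin, nsmul_eq_mul, ← ENNReal.ofReal_natCast,
            ← ENNReal.ofReal_ofNat, ← ENNReal.ofReal_mul (by norm_num), ← ENNReal.ofReal_mul (by positivity)]
          congr 1; field_simp; norm_num
  have hsub : {g : Fin n → Fin d → ℝ | badG P X q w ρ J g} ⊆ {g : Fin n → Fin d → ℝ | ¬ bdd ρ g} ∪ ({g : Fin n → Fin d → ℝ | bdd (X:ℝ) g ∧ badQ (2 * (d+1)) (((X:ℝ)^7)⁻¹) Finset.univ g} ∪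
      {g : Fin n → Fin d → ℝ | ∃ j, 0 < ((Finset.univ.filter fun i => J i = j).powersetCard P.b).card ∧
      ((Finset.univ.filter fun i => J i = j).powersetCard P.b).card ≤
      2 * (((Finset.univ.filter fun i => J i = j).powersetCard P.b).filter fun B => g ∈ {g : Fin n → Fin d → ℝ | bdd ρ g ∧ badQ q w B g}).card}) := by
    intro g hg
    rcases hg with h | h | ⟨j, h1, h2⟩
    · exact Or.inl h
    · exact Or.inr (Or.inl h)
    · exact Or.inr (Or.inr ⟨j, by convert h1, by convert h2⟩)
  refine (measure_mono hsub).trans ((measure_union_le _ _).trans ?_)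
  calc _ ≤ ENNReal.ofReal (1/100) + (ENNReal.ofReal (1/100) + ENNReal.ofReal (1/100)) :=
        add_le_add h1 ((measure_union_le _ _).trans (add_le_add h2 h3))
    _ = _ := by
        rw [← ENNReal.ofReal_add (by norm_num) (by norm_num), ← ENNReal.ofReal_add (by norm_num) (by norm_num)]
        norm_num

theorem dot_vecMul {D : ℕ} (F : Fin D → Fin D → ℝ) (v x : Fin D → ℝ) :
    v ⬝ᵥ (x ᵥ* Matrix.of F) = (Matrix.of F *ᵥ v) ⬝ᵥ x := by
  rw [dotProduct_comm, ← dotProduct_mulVec, dotProduct_comm]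

open Classical in
theorem goodD_of {P : Par} {n d k X q N : ℕ} {w ρ : ℝ} (hG : ParG P n d k X q N w ρ) (J : Fin n → Fin k)
    (F : Fin k → Fin (d+1) → Fin (d+1) → ℝ) (g : Fin n → Fin d → ℝ) (hg : ¬ badG P X q w ρ J g) (hv : Finset (Fin k))
    (hJ : ∀ j ∈ hv, P.N2 ≤ (Finset.univ.filter fun i => J i = j).card) :
    GoodD P X (fun i => lft (g i) ᵥ* Matrix.of (F (J i))) J F hv := by
  have hX1 : (1000:ℝ) ≤ X := by exact_mod_cast hG.hX
  have hX0 : (0:ℝ) < X := by linarith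
  have hρ := hG.hρ
  have hw := hG.hw
  have hdX : ((d+1:ℕ):ℝ) ≤ X := by exact_mod_cast hG.hD
  unfold badG at hg
  push Not at hg
  obtain ⟨g1, g2, g3⟩ := hg
  have g1' : bdd (X:ℝ) g := fun i s => (g1 i s).trans hG.hρX
  have g2' := g2 g1'
  have hqs : ∀ j T, (∀ i ∈ T, J i = j) → ∀ v, qs (fun i => lft (g i) ᵥ* Matrix.of (F (J i))) T v =
      ∑ i ∈ T, ((Matrix.of (F j) *ᵥ v) ⬝ᵥ lft (g i))^2 := by
    intro j T hT v
    unfold qs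
    refine Finset.sum_congr rfl fun i hi => ?_
    rw [dot_vecMul, hT i hi]
  refine ⟨?_, ?_, hJ, ?_⟩
  · intro j T hT hTc v
    have := not_badQ (by positivity) g2' T (Finset.subset_univ _) (by rw [hTc, hG.hm]; omega) (Matrix.of (F j) *ᵥ v)
    rw [hqs j T hT, qs_mat]
    set M := (Matrix.of (F j) *ᵥ v) ⬝ᵥ (Matrix.of (F j) *ᵥ v) with hM
    have hM0 : 0 ≤ M := Finset.sum_nonneg fun s _ => mul_self_nonneg _
    refine le_trans ?_ (mul_le_mul_of_nonneg_left this (by positivity))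
    push_cast
    calc M = 1 * M := by ring
      _ ≤ (2 * (d+1)) * M := by gcongr; linarith [Nat.cast_nonneg (α := ℝ) d]
      _ = _ := by field_simp
  · intro i v
    rw [dot_vecMul, qs_mat]
    set u := Matrix.of (F (J i)) *ᵥ v
    have hu0 : 0 ≤ u ⬝ᵥ u := Finset.sum_nonneg fun s _ => mul_self_nonneg _
    have hcs : (u ⬝ᵥ lft (g i))^2 ≤ (u ⬝ᵥ u) * (lft (g i) ⬝ᵥ lft (g i)) := by
      have := Finset.sum_mul_sq_le_sq_mul_sq Finset.univ u (lft (g i))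
      simpa only [dotProduct, ← sq] using this
    refine hcs.trans ?_
    calc _ ≤ (u ⬝ᵥ u) * (((d+1 : ℕ) : ℝ) * X^2) := by
          gcongr; exact sq_lft_le (by linarith) (g1' i)
      _ ≤ (u ⬝ᵥ u) * (X * X^2) := by gcongr
      _ = _ := by ring
  · intro j hj
    set I := Finset.univ.filter fun i => J i = j with hI
    have hIJ : ∀ i ∈ I, J i = j := fun i hi => (Finset.mem_filter.mp hi).2
    have hgB : ∀ B ⊆ I, ¬ badQ q w B g → gB P (fun i => lft (g i) ᵥ* Matrix.of (F (J i))) B := by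
      intro B hB hbad T hT hTc i hi v
      rw [dot_vecMul, hIJ i (hB hi), hqs j T fun i hi => hIJ i (hB (hT hi))]
      refine le_trans ?_ (not_badQ hw hbad T hT (by rw [hTc, hG.hh]) (Matrix.of (F j) *ᵥ v))
      set u := Matrix.of (F j) *ᵥ v
      have hu0 : 0 ≤ u ⬝ᵥ u := Finset.sum_nonneg fun s _ => mul_self_nonneg _
      have hcs : (u ⬝ᵥ lft (g i))^2 ≤ (u ⬝ᵥ u) * (lft (g i) ⬝ᵥ lft (g i)) := by
        have := Finset.sum_mul_sq_le_sq_mul_sq Finset.univ u (lft (g i))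
        simpa only [dotProduct, ← sq] using this
      have ha0 := hG.ha0
      calc P.a * (u ⬝ᵥ lft (g i))^2 ≤ P.a * ((u ⬝ᵥ u) * (((d+1 : ℕ) : ℝ) * ρ^2)) := by
            gcongr; refine hcs.trans ?_; gcongr; exact sq_lft_le hρ (g1 i)
        _ = (P.a * (((d+1 : ℕ) : ℝ) * ρ^2)) * (u ⬝ᵥ u) := by ring
        _ ≤ (q * w^2) * (u ⬝ᵥ u) := mul_le_mul_of_nonneg_right hG.ha hu0
        _ = _ := by
            first | ring | (rw [hG.hh]; ring) | (rw [hTc, hG.hh]; push_cast; rw [Nat.add_sub_cancel]; ring) | skip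
    by_contra hcon
    push Not at hcon
    have e0 := Finset.card_powersetCard P.b I
    have e1 := Finset.card_filter_add_card_filter_not (s := I.powersetCard P.b)
      (fun B => gB P (fun i => lft (g i) ᵥ* Matrix.of (F (J i))) B)
    have e2 : ((I.powersetCard P.b).filter fun B => ¬ gB P (fun i => lft (g i) ᵥ* Matrix.of (F (J i))) B).card ≤
        ((I.powersetCard P.b).filter fun B => g ∈ {g | bdd ρ g ∧ badQ q w B g}).card := by
      refine Finset.card_le_card fun B hB => ?_
      rw [Finset.mem_filter] at hB ⊢
      refine ⟨hB.1, g1, ?_⟩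
      by_contra hn
      exact hB.2 (hgB B (Finset.mem_powersetCard.mp hB.1).1 hn)
    have := g3 j (by rw [← hI, e0]; omega)
    rw [← hI, e0] at this
    omega

end

section
def labM {k : ℕ} (w : Fin k → ℝ) : Measure (Fin k) := ∑ j, ENNReal.ofReal (w j) • Measure.dirac j

theorem labM_prob {k : ℕ} (w : Fin k → ℝ) (h0 : ∀ i, 0 ≤ w i) (h1 : ∑ i, w i = 1) : IsProbabilityMeasure (labM w) := by
  constructor
  unfold labM
  rw [Measure.finsetSum_apply]
  simp only [Measure.smul_apply, measure_univ, smul_eq_mul, mul_one]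
  rw [← ENNReal.ofReal_sum_of_nonneg fun i _ => h0 i, h1, ENNReal.ofReal_one]

theorem lintegral_labM {k : ℕ} (w : Fin k → ℝ) (f : Fin k → ℝ≥0∞) :
    ∫⁻ j, f j ∂(labM w) = ∑ j, ENNReal.ofReal (w j) * f j := by
  unfold labM
  rw [lintegral_finset_sum_measure]
  refine Finset.sum_congr rfl fun j _ => ?_
  rw [lintegral_smul_measure, lintegral_dirac, smul_eq_mul]

theorem labels_few {n k : ℕ} (w : Fin k → ℝ) (h0 : ∀ i, 0 ≤ w i) (h1 : ∑ i, w i = 1) (j : Fin k) (N : ℕ) :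
    (Measure.pi fun _ : Fin n => labM w) {J | (Finset.univ.filter fun i => J i = j).card < N} ≤
      ENNReal.ofReal (2^N * Real.exp (-(n * w j / 2))) := by
  haveI := labM_prob w h0 h1
  set φ : Fin k → ℝ≥0∞ := fun i => ENNReal.ofReal (if i = j then 1/2 else 1) with hφ
  have hprod : ∀ J : Fin n → Fin k, ∏ i, φ (J i) = ENNReal.ofReal ((1/2)^(Finset.univ.filter fun i => J i = j).card) := by
    intro J
    rw [hφ]
    simp only
    rw [← ENNReal.ofReal_prod_of_nonneg (fun i _ => by split_ifs <;> norm_num)]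
    congr 1
    rw [Finset.prod_ite]; simp
  have hIntg : ∫⁻ J, ∏ i, φ (J i) ∂(Measure.pi fun _ : Fin n => labM w) ≤ ENNReal.ofReal (Real.exp (-(n * w j / 2))) := by
    rw [lintegral_pi_prod (fun _ : Fin n => labM w) (fun _ => φ) (fun _ => measurable_of_countable _)]
    rw [Finset.prod_const, Finset.card_univ, Fintype.card_fin, lintegral_labM]
    have : ∑ i, ENNReal.ofReal (w i) * φ i = ENNReal.ofReal (1 - w j / 2) := by
      have e : ∀ i, ENNReal.ofReal (w i) * φ i = ENNReal.ofReal (w i - if i = j then w j / 2 else 0) := by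
        intro i
        rw [hφ, ← ENNReal.ofReal_mul (h0 i)]
        congr 1
        split_ifs with h
        · subst h; ring
        · ring
      simp_rw [e]
      rw [← ENNReal.ofReal_sum_of_nonneg]
      · rw [Finset.sum_sub_distrib, h1]; simp
      · intro i _
        split_ifs with h
        · subst h; linarith [h0 i]
        · linarith [h0 i]
    rw [this]
    calc _ ≤ ENNReal.ofReal (Real.exp (-(w j/2))) ^ n := by
          gcongr
          have := Real.add_one_le_exp (-(w j/2)); linarith
      _ = _ := by
          rw [← ENNReal.ofReal_pow (Real.exp_nonneg _), ← Real.exp_nat_mul]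
          congr 2; ring
  have hmk := mul_meas_ge_le_lintegral (μ := Measure.pi fun _ : Fin n => labM w)
    (f := fun J => ∏ i, φ (J i)) (measurable_of_countable _) (ENNReal.ofReal ((1/2)^N))
  have hsub : {J : Fin n → Fin k | (Finset.univ.filter fun i => J i = j).card < N} ⊆
      {J | ENNReal.ofReal ((1/2)^N) ≤ ∏ i, φ (J i)} := by
    intro J hJ
    have hJ' : (Finset.univ.filter fun i => J i = j).card < N := hJ
    show ENNReal.ofReal ((1/2)^N) ≤ ∏ i, φ (J i)
    rw [hprod]
    exact ENNReal.ofReal_le_ofReal (pow_le_pow_of_le_one (by norm_num) (by norm_num) hJ'.le)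
  calc _ ≤ (Measure.pi fun _ : Fin n => labM w) {J | ENNReal.ofReal ((1/2)^N) ≤ ∏ i, φ (J i)} := measure_mono hsub
    _ = ENNReal.ofReal (2^N) * (ENNReal.ofReal ((1/2)^N) * (Measure.pi fun _ : Fin n => labM w) {J | ENNReal.ofReal ((1/2)^N) ≤ ∏ i, φ (J i)}) := by
        rw [← mul_assoc, ← ENNReal.ofReal_mul (by positivity), ← mul_pow]; norm_num
    _ ≤ ENNReal.ofReal (2^N) * ENNReal.ofReal (Real.exp (-(n * w j / 2))) := by gcongr; exact hmk.trans hIntg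
    _ = _ := by rw [ENNReal.ofReal_mul (by positivity)]

theorem labels_good {n k : ℕ} (hk : 1 ≤ k) (w : Fin k → ℝ) (h0 : ∀ i, 0 ≤ w i) (h1 : ∑ i, w i = 1) (N : ℕ) (τ : ℝ)
    (h : 2^N * Real.exp (-(n * τ / 2)) ≤ 1 / (100 * (k:ℝ))) (hv : Finset (Fin k)) (hhv : ∀ j ∈ hv, τ ≤ w j) :
    (Measure.pi fun _ : Fin n => labM w) {J | ¬ ∀ j ∈ hv, N ≤ (Finset.univ.filter fun i => J i = j).card} ≤
      ENNReal.ofReal (1/100) := by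
  haveI := labM_prob w h0 h1
  have hk1 : (1:ℝ) ≤ k := by exact_mod_cast hk
  have hsub : {J : Fin n → Fin k | ¬ ∀ j ∈ hv, N ≤ (Finset.univ.filter fun i => J i = j).card} ⊆
      ⋃ j ∈ hv, {J : Fin n → Fin k | (Finset.univ.filter fun i => J i = j).card < N} := by
    intro J hJ
    have hJ' : ¬ ∀ j ∈ hv, N ≤ (Finset.univ.filter fun i => J i = j).card := hJ
    push Not at hJ'
    obtain ⟨j, hj, h⟩ := hJ'
    simp only [Set.mem_iUnion]
    exact ⟨j, hj, h⟩
  refine (measure_mono hsub).trans ((measure_biUnion_finset_le _ _).trans ?_)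
  calc _ ≤ ∑ j ∈ hv, ENNReal.ofReal (1 / (100 * (k:ℝ))) := by
        refine Finset.sum_le_sum fun j hj => (labels_few w h0 h1 j N).trans (ENNReal.ofReal_le_ofReal (le_trans ?_ h))
        have := hhv j hj
        gcongr
    _ ≤ ∑ j : Fin k, ENNReal.ofReal (1 / (100 * (k:ℝ))) := Finset.sum_le_sum_of_subset (Finset.subset_univ _)
    _ = _ := by
        rw [Finset.sum_const, Finset.card_univ, Fintype.card_fin, nsmul_eq_mul, ← ENNReal.ofReal_natCast,
          ← ENNReal.ofReal_mul (by positivity)]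
        congr 1; field_simp

/-- affine image of labelled standard gaussian -/
def aff {d k : ℕ} (μs : Fin k → Fin d → ℝ) (As : Fin k → Matrix (Fin d) (Fin d) ℝ) (z : Fin k × (Fin d → ℝ)) : Fin d → ℝ :=
  μs z.1 + As z.1 *ᵥ z.2

theorem meas_aff1 {d : ℕ} (μ : Fin d → ℝ) (A : Matrix (Fin d) (Fin d) ℝ) : Measurable (fun g : Fin d → ℝ => μ + A *ᵥ g) :=
    (continuous_const.add (Continuous.matrix_mulVec continuous_const continuous_id)).measurable

theorem meas_aff {d k : ℕ} (μs : Fin k → Fin d → ℝ) (As : Fin k → Matrix (Fin d) (Fin d) ℝ) : Measurable (aff μs As) :=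
  measurable_from_prod_countable_right fun j => meas_aff1 (μs j) (As j)

theorem mixture_eq_map {d k : ℕ} (w : Fin k → ℝ) (h0 : ∀ i, 0 ≤ w i) (h1 : ∑ i, w i = 1) (μs : Fin k → Fin d → ℝ)
    (As : Fin k → Matrix (Fin d) (Fin d) ℝ) (hA : ∀ j, (As j).det ≠ 0) :
    mixture d k w μs (fun j => As j * (As j)ᵀ) = ((labM w).prod (stdG (Fin d))).map (aff μs As) := by
  haveI := labM_prob w h0 h1
  ext s hs
  rw [Measure.map_apply (meas_aff _ _) hs, Measure.prod_apply ((meas_aff _ _) hs), lintegral_labM]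
  unfold mixture
  rw [Measure.sum_apply _ hs, tsum_fintype]
  refine Finset.sum_congr rfl fun j _ => ?_
  rw [Measure.smul_apply, smul_eq_mul, gauss_eq_map d _ _ (hA j), Measure.map_apply (meas_aff1 _ _) hs]
  rfl

theorem mixture_prob {d k : ℕ} (w : Fin k → ℝ) (μs : Fin k → Fin d → ℝ) (Ss : Fin k → Matrix (Fin d) (Fin d) ℝ)
    (h : IsMixtureParams w Ss) : IsProbabilityMeasure (mixture d k w μs Ss) := by
  choose As hA hAS using fun j => exists_sqrt (h.2.2 j)
  have hSs : Ss = fun j => As j * (As j)ᵀ := funext fun j => (hAS j).symm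
  haveI := labM_prob w h.1 h.2.1
  rw [hSs, mixture_eq_map w h.1 h.2.1 μs As hA]
  exact Measure.isProbabilityMeasure_map (meas_aff _ _).aemeasurable

theorem pi_mixture {n d k : ℕ} (w : Fin k → ℝ) (h0 : ∀ i, 0 ≤ w i) (h1 : ∑ i, w i = 1) (μs : Fin k → Fin d → ℝ)
    (As : Fin k → Matrix (Fin d) (Fin d) ℝ) (hA : ∀ j, (As j).det ≠ 0) :
    (Measure.pi fun _ : Fin n => mixture d k w μs (fun j => As j * (As j)ᵀ)) =
      ((Measure.pi fun _ : Fin n => labM w).prod (Measure.pi fun _ : Fin n => stdG (Fin d))).map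
        (fun z i => aff μs As (z.1 i, z.2 i)) := by
  haveI := labM_prob w h0 h1
  have e := (measurePreserving_arrowProdEquivProdArrow (Fin k) (Fin d → ℝ) (Fin n) (fun _ => labM w) (fun _ => stdG (Fin d))).symm
  rw [mixture_eq_map w h0 h1 μs As hA]
  haveI : IsProbabilityMeasure (((labM w).prod (stdG (Fin d))).map (aff μs As)) :=
    Measure.isProbabilityMeasure_map (meas_aff _ _).aemeasurable
  rw [← Measure.pi_map_pi (μ := fun _ : Fin n => (labM w).prod (stdG (Fin d))) (f := fun _ => aff μs As) (fun _ => (meas_aff _ _).aemeasurable)]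
  rw [← e.map_eq, Measure.map_map (by
    exact measurable_pi_lambda _ fun i => (meas_aff _ _).comp (measurable_pi_apply i)) e.measurable]
  rfl

def Fmat {d : ℕ} (μ : Fin d → ℝ) (A : Matrix (Fin d) (Fin d) ℝ) : Fin (d+1) → Fin (d+1) → ℝ :=
  Fin.cons (lft μ) fun s => Fin.cons 0 fun r => A r s

theorem Fmat_mul {d : ℕ} (μ : Fin d → ℝ) (A : Matrix (Fin d) (Fin d) ℝ) (g : Fin d → ℝ) :
    lft g ᵥ* Matrix.of (Fmat μ A) = lft (μ + A *ᵥ g) := by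
  ext r
  rw [vecMul, dotProduct_comm, dot_lft]
  refine Fin.cases ?_ (fun r => ?_) r
  · simp [Fmat, lft]
  · simp [Fmat, lft, mulVec, dotProduct]

theorem Fmat_det {d : ℕ} (μ : Fin d → ℝ) (A : Matrix (Fin d) (Fin d) ℝ) : (Matrix.of (Fmat μ A)).det = A.det := by
  rw [Matrix.det_succ_column_zero, Fin.sum_univ_succ]
  have : (Matrix.of (Fmat μ A)).submatrix (Fin.succAbove 0) Fin.succ = Aᵀ := by
    ext i j; simp [Fmat]
  rw [this, Matrix.det_transpose]
  simp [Fmat, lft]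

theorem stage1_util {P : Par} {n d k X q N : ℕ} {ww ρ τ : ℝ} (hU : ParU P n (d+1) k X) (hG : ParG P n d k X q N ww ρ)
    (hτ : 2^P.N2 * Real.exp (-(n * τ / 2)) ≤ 1 / (100 * (k:ℝ)))
    (w : Fin k → ℝ) (h0 : ∀ i, 0 ≤ w i) (h1 : ∑ i, w i = 1) (μs : Fin k → Fin d → ℝ)
    (As : Fin k → Matrix (Fin d) (Fin d) ℝ) (hA : ∀ j, (As j).det ≠ 0) (hv : Finset (Fin k)) (hhv : ∀ j ∈ hv, τ ≤ w j) :
    ∫⁻ x, rounds P n (d+1) k k (fun i => lft (x i)) {st | ¬ ∀ j ∈ hv, ∃ i,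
        close2 ((X:ℝ)^146) (Fmat (μs j) (As j)) Finset.univ (st i) Finset.univ}
      ∂(Measure.pi fun _ : Fin n => mixture d k w μs (fun j => As j * (As j)ᵀ)) ≤ ENNReal.ofReal (3/50) := by
  classical
  haveI := labM_prob w h0 h1
  haveI := rounds_markov P hU.hΛ n (d+1) k k
  set S : Set (St k P.p (d+1)) := {st | ¬ ∀ j ∈ hv, ∃ i,
        close2 ((X:ℝ)^146) (Fmat (μs j) (As j)) Finset.univ (st i) Finset.univ} with hS
  have hSm : MeasurableSet S := by
    rw [hS]
    refine MeasurableSet.compl (s := {st : St k P.p (d+1) | ∀ j ∈ hv, ∃ i,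
        close2 ((X:ℝ)^146) (Fmat (μs j) (As j)) Finset.univ (st i) Finset.univ}) ?_
    refine measurableSet_setOfPred.mpr ?_
    refine Measurable.forall fun j => Measurable.imp measurable_const (Measurable.exists fun i => ?_)
    refine measurableSet_setOfPred.mp ?_
    exact (meas_cl (D := d+1) ((X:ℝ)^146) (Fmat (μs j) (As j)) (p := P.p)).preimage (measurable_pi_apply i)
  have hlm : Measurable (fun x : Fin n → Fin d → ℝ => fun i => lft (x i)) :=
    measurable_pi_lambda _ fun i => meas_lft.comp (measurable_pi_apply i)
  have hfm : Measurable (fun x : Fin n → Fin d → ℝ => rounds P n (d+1) k k (fun i => lft (x i)) S) :=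
    ((rounds P n (d+1) k k).measurable_coe hSm).comp hlm
  have ham : Measurable (fun z : (Fin n → Fin k) × (Fin n → Fin d → ℝ) => fun i => aff μs As (z.1 i, z.2 i)) :=
    measurable_pi_lambda _ fun i => (meas_aff _ _).comp (by fun_prop)
  rw [pi_mixture w h0 h1 μs As hA, lintegral_map hfm ham]
  refine (le_of_eq (lintegral_prod _ (hfm.comp ham).aemeasurable)).trans ?_
  refine (lintegral_le_of_good _ _ _ (ENNReal.ofReal (5/100)) (fun J => ?_) (fun J hJ => ?_)).trans
    ((add_le_add le_rfl (labels_good hU.hk w h0 h1 P.N2 τ hτ hv hhv)).trans (le_of_eq ?_))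
  · calc _ ≤ ∫⁻ _ : Fin n → Fin d → ℝ, 1 ∂(Measure.pi fun _ : Fin n => stdG (Fin d)) := lintegral_mono fun _ => prob_le_one
      _ = 1 := by simp
  · have hJ' : ∀ j ∈ hv, P.N2 ≤ (Finset.univ.filter fun i => J i = j).card := by
      by_contra hc; exact hJ hc
    refine (lintegral_le_of_good _ _ {g | badG P X q ww ρ J g} (ENNReal.ofReal (1/50)) (fun g => prob_le_one) (fun g hg => ?_)).trans
      ((add_le_add le_rfl (badG_prob hG J)).trans (le_of_eq ?_))
    · have := goodD_of hG J (fun j => Fmat (μs j) (As j)) g hg hv (by convert hJ')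
      have h2 := rounds_util hU this (fun j => by rw [Fmat_det]; exact hA j)
      simp only [Fmat_mul] at h2
      exact h2
    · rw [← ENNReal.ofReal_add (by norm_num) (by norm_num)]; norm_num
  · rw [← ENNReal.ofReal_add (by norm_num) (by norm_num)]; norm_num

end

section
theorem vol_affine {d : ℕ} (μ : Fin d → ℝ) (A : Matrix (Fin d) (Fin d) ℝ) (hA : A.det ≠ 0) :
    (volume : Measure (Fin d → ℝ))
      = ENNReal.ofReal |A.det| • Measure.map (fun g : Fin d → ℝ => μ + A *ᵥ g) volume := by
  have hmap : Measure.map (fun g : Fin d → ℝ => A *ᵥ g) volume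
      = ENNReal.ofReal |A.det⁻¹| • (volume : Measure (Fin d → ℝ)) := by
    have := Real.map_matrix_volume_pi_eq_smul_volume_pi hA
    have e0 : (fun g : Fin d → ℝ => A *ᵥ g) = ⇑(toLin' A) := by ext g; simp [toLin'_apply]
    rw [e0]; exact this
  have h2 : Measure.map (fun g : Fin d → ℝ => μ + A *ᵥ g) volume
        = ENNReal.ofReal |A.det⁻¹| • (volume : Measure (Fin d → ℝ)) := by
    have : (fun g : Fin d → ℝ => μ + A *ᵥ g) = (fun y => μ + y) ∘ (fun g => A *ᵥ g) := rfl
    have hc : Measurable (fun g : Fin d → ℝ => A *ᵥ g) :=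
      (Continuous.matrix_mulVec continuous_const continuous_id).measurable
    rw [this, ← Measure.map_map (measurable_const_add μ) hc, hmap, Measure.map_smul]
    rw [(measurePreserving_add_left volume μ).map_eq]
  rw [h2, smul_smul, ← ENNReal.ofReal_mul (abs_nonneg _), ← abs_mul, mul_inv_cancel₀ hA]
  simp

theorem bilin_bound {d : ℕ} (Δ : Matrix (Fin d) (Fin d) ℝ) (κ : ℝ) (hκ : 0 ≤ κ) (h : ∀ i j, |Δ i j| ≤ κ) (v : Fin d → ℝ) :
    |v ⬝ᵥ (Δ *ᵥ v)| ≤ d * κ * (v ⬝ᵥ v) := by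
  have h1 : |v ⬝ᵥ (Δ *ᵥ v)| ≤ κ * (∑ i, |v i|)^2 := by
    calc |v ⬝ᵥ (Δ *ᵥ v)| ≤ ∑ i, |v i| * ∑ j, κ * |v j| := by
          simp only [dotProduct, mulVec]
          refine (Finset.abs_sum_le_sum_abs _ _).trans (Finset.sum_le_sum fun i _ => ?_)
          rw [abs_mul]
          gcongr
          refine (Finset.abs_sum_le_sum_abs _ _).trans (Finset.sum_le_sum fun j _ => ?_)
          rw [abs_mul]; gcongr; exact h i j
      _ = _ := by rw [← Finset.mul_sum, ← Finset.sum_mul]; ring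
  have h2 := sq_sum_le_card_mul_sum_sq (s := (Finset.univ : Finset (Fin d))) (f := fun i => |v i|)
  simp only [sq_abs, Finset.card_univ, Fintype.card_fin] at h2
  have h3 : ∑ i, v i ^ 2 = v ⬝ᵥ v := by simp [dotProduct, sq]
  rw [h3] at h2
  nlinarith

theorem det_lower {d : ℕ} (Δ : Matrix (Fin d) (Fin d) ℝ) (κ : ℝ) (hκ : 0 ≤ κ) (h : ∀ i j, |Δ i j| ≤ κ)
    (hd : 2 * d * κ ≤ 1) : 1 - 2 * d^2 * κ ≤ |(1 + Δ).det| := by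
  set M := (1 + Δ)ᵀ * (1 + Δ) with hM
  have hH : M.IsHermitian := by
    have := Matrix.isHermitian_conjTranspose_mul_self (1 + Δ)
    rwa [Matrix.conjTranspose_eq_transpose_of_trivial] at this
  have hdet : M.det = (1+Δ).det ^ 2 := by rw [hM, det_mul, det_transpose]; ring
  have hq : ∀ v : Fin d → ℝ, (1 - 2 * d * κ) * (v ⬝ᵥ v) ≤ v ⬝ᵥ (M *ᵥ v) := by
    intro v
    have e : v ⬝ᵥ (M *ᵥ v) = v ⬝ᵥ v + 2 * (v ⬝ᵥ (Δ *ᵥ v)) + (Δ *ᵥ v) ⬝ᵥ (Δ *ᵥ v) := by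
      rw [hM, ← Matrix.mulVec_mulVec, Matrix.dotProduct_mulVec, Matrix.vecMul_transpose, Matrix.add_mulVec, Matrix.one_mulVec,
        add_dotProduct, dotProduct_add, dotProduct_add, dotProduct_comm (Δ *ᵥ v) v]
      ring
    have h0 : 0 ≤ (Δ *ᵥ v) ⬝ᵥ (Δ *ᵥ v) := Finset.sum_nonneg fun s _ => mul_self_nonneg _
    have := abs_le.mp (bilin_bound Δ κ hκ h v)
    rw [e]; nlinarith [this.1]
  have hev : ∀ i, 1 - 2 * d * κ ≤ hH.eigenvalues i := by
    intro i
    set v : Fin d → ℝ := (hH.eigenvectorBasis i).ofLp with hv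
    have e1 := hH.mulVec_eigenvectorBasis i
    rw [← hv] at e1
    have e2 := hq v
    rw [e1, dotProduct_smul, smul_eq_mul] at e2
    have hpos : 0 < v ⬝ᵥ v := by
      have h0 : 0 ≤ v ⬝ᵥ v := Finset.sum_nonneg fun s _ => mul_self_nonneg _
      refine lt_of_le_of_ne h0 fun hc => ?_
      have hv0 : v = 0 := dotProduct_self_eq_zero.mp hc.symm
      have : hH.eigenvectorBasis i = 0 := by
        ext s; exact congrFun hv0 s
      have hn := hH.eigenvectorBasis.orthonormal.norm_eq_one i
      rw [this] at hn; simp at hn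
    exact le_of_mul_le_mul_right e2 hpos
  have hdl : (1 - 2 * d * κ)^d ≤ M.det := by
    rw [hH.det_eq_prod_eigenvalues]
    have := Finset.prod_le_prod (s := (Finset.univ : Finset (Fin d))) (f := fun _ => 1 - 2 * d * κ) (g := fun i => hH.eigenvalues i)
      (fun _ _ => by linarith) (fun i _ => hev i)
    simpa using this
  have hb : 1 - 2 * d^2 * κ ≤ (1 - 2 * d * κ)^d := by
    have := one_add_mul_le_pow (a := - (2 * d * κ)) (by linarith) d
    calc _ = 1 + d * (-(2 * d * κ)) := by ring
      _ ≤ _ := this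
      _ = _ := by ring
  have h2 : 1 - 2 * d^2 * κ ≤ |(1 + Δ).det|^2 := by rw [sq_abs, ← hdet]; linarith
  by_contra hc
  push Not at hc
  have h3 := abs_nonneg (1+Δ).det
  have : (0:ℝ) ≤ 2 * d^2 * κ := by positivity
  nlinarith

/-- error term -/
def pertErr (d : ℕ) (κ R : ℝ) : ℝ :=
  2 * d^2 * κ + (d * R * (κ * (1 + d * R)) + d * (κ * (1 + d * R))^2) + d * (2 * Real.exp (-(R^2)/2))

theorem pert_sq {d : ℕ} (Δ : Matrix (Fin d) (Fin d) ℝ) (δ g : Fin d → ℝ) (κ R : ℝ) (hκ : 0 ≤ κ) (hR : 0 ≤ R)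
    (h : ∀ i j, |Δ i j| ≤ κ) (hδ : ∀ i, |δ i| ≤ κ) (hg : ∀ i, |g i| ≤ R) :
    (δ + (1 + Δ) *ᵥ g) ⬝ᵥ (δ + (1 + Δ) *ᵥ g) ≤ g ⬝ᵥ g + 2 * (d * R * (κ * (1 + d * R)) + d * (κ * (1 + d * R))^2) := by
  set e := κ * (1 + d * R) with he
  have he0 : 0 ≤ e := by positivity
  set u := δ + Δ *ᵥ g with hu
  have hu1 : ∀ i, |u i| ≤ e := by
    intro i
    calc |u i| ≤ |δ i| + |(Δ *ᵥ g) i| := abs_add_le _ _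
      _ ≤ κ + ∑ j : Fin d, κ * R := by
          gcongr
          · exact hδ i
          · simp only [dotProduct, mulVec]
            refine (Finset.abs_sum_le_sum_abs _ _).trans (Finset.sum_le_sum fun j _ => ?_)
            rw [abs_mul]; gcongr
            · exact h i j
            · exact hg j
      _ = e := by simp [he]; ring
  have e1 : δ + (1 + Δ) *ᵥ g = g + u := by rw [Matrix.add_mulVec, Matrix.one_mulVec, hu]; abel
  rw [e1, add_dotProduct, dotProduct_add g g u, dotProduct_add u g u, dotProduct_comm u g]
  have h1 : g ⬝ᵥ u ≤ d * (R * e) := by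
    calc g ⬝ᵥ u ≤ ∑ i : Fin d, R * e := by
          refine Finset.sum_le_sum fun i _ => (le_abs_self _).trans ?_
          rw [abs_mul]; gcongr
          · exact hg i
          · exact hu1 i
      _ = _ := by simp
  have h2 : u ⬝ᵥ u ≤ d * (e * e) := by
    calc u ⬝ᵥ u ≤ ∑ i : Fin d, e * e := by
          refine Finset.sum_le_sum fun i _ => (le_abs_self _).trans ?_
          rw [abs_mul]; gcongr
          · exact hu1 i
          · exact hu1 i
      _ = _ := by simp
  have : 0 ≤ (d:ℝ) * (e * e) := by positivity
  nlinarith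

theorem gauss_pert1 {d : ℕ} (Δ : Matrix (Fin d) (Fin d) ℝ) (δ : Fin d → ℝ) (κ R : ℝ) (hκ : 0 ≤ κ) (hR : 0 ≤ R)
    (h : ∀ i j, |Δ i j| ≤ κ) (hδ : ∀ i, |δ i| ≤ κ) (hd : 2 * d * κ ≤ 1) (hdet : (1 + Δ).det ≠ 0)
    (B : Set (Fin d → ℝ)) (hB : MeasurableSet B) :
    ((stdG (Fin d)) ((fun g => δ + (1 + Δ) *ᵥ g) ⁻¹' B)).toReal ≤ ((stdG (Fin d)) B).toReal + pertErr d κ R := by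
  set T := fun g : Fin d → ℝ => δ + (1 + Δ) *ᵥ g with hT
  have hTm : Measurable T := meas_aff1 δ (1 + Δ)
  set η := d * R * (κ * (1 + d * R)) + d * (κ * (1 + d * R))^2 with hη
  have hη0 : 0 ≤ η := by positivity
  set φ : (Fin d → ℝ) → ℝ≥0∞ := fun x => ∏ i, gaussianPDF 0 1 (x i) with hφ
  have hφm : Measurable φ := Finset.measurable_fun_prod _ fun i _ => (measurable_gaussianPDF 0 1).comp (measurable_pi_apply i)
  set box : Set (Fin d → ℝ) := {g | ∀ i, |g i| ≤ R} with hbox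
  have hboxm : MeasurableSet box := by
    have : box = ⋂ i, {g : Fin d → ℝ | |g i| ≤ R} := by ext g; simp [hbox]
    rw [this]
    refine MeasurableSet.iInter fun i => ?_
    exact measurableSet_le (by fun_prop) measurable_const
  have key : ENNReal.ofReal (|(1+Δ).det| * Real.exp (-η)) * (stdG (Fin d)) (T ⁻¹' B ∩ box) ≤ stdG (Fin d) B := by
    rw [stdG_withDensity, withDensity_apply _ hB, withDensity_apply _ ((hTm hB).inter hboxm)]
    conv_rhs => rw [vol_affine δ (1+Δ) hdet]
    rw [Measure.restrict_smul, lintegral_smul_measure, smul_eq_mul, ENNReal.ofReal_mul (abs_nonneg _), mul_assoc]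
    gcongr
    rw [setLIntegral_map hB hφm hTm, ← lintegral_const_mul _ hφm]
    refine le_trans ?_ (lintegral_mono_set Set.inter_subset_left (s := T ⁻¹' B ∩ box))
    refine setLIntegral_mono (hφm.comp hTm) fun g hg => ?_
    rw [hφ]
    beta_reduce
    rw [stdG_density_eq, stdG_density_eq, ← ENNReal.ofReal_mul (Real.exp_nonneg _)]
    refine ENNReal.ofReal_le_ofReal ?_
    rw [mul_left_comm, ← Real.exp_add]
    gcongr
    have := pert_sq Δ δ g κ R hκ hR h hδ hg.2
    linarith
  have hdl := det_lower Δ κ hκ h hd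
  have htail : ((stdG (Fin d)) boxᶜ).toReal ≤ d * (2 * Real.exp (-(R^2)/2)) := by
    refine ENNReal.toReal_le_of_le_ofReal (by positivity) ?_
    have hsub : boxᶜ ⊆ ⋃ i : Fin d, (fun g : Fin d → ℝ => g i) ⁻¹' {x | R < |x|} := by
      intro g hg
      have hg' : ¬ ∀ i, |g i| ≤ R := hg
      push Not at hg'
      simpa using hg'
    refine (measure_mono hsub).trans ((measure_iUnion_fintype_le _ _).trans ?_)
    calc _ ≤ ∑ i : Fin d, ENNReal.ofReal (2 * Real.exp (-(R^2)/2)) := by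
          refine Finset.sum_le_sum fun i _ => ?_
          have hm : MeasurableSet {x : ℝ | R < |x|} := measurableSet_lt measurable_const (by fun_prop)
          have hp := (measurePreserving_eval (fun _ : Fin d => gaussianReal 0 1) i).measure_preimage hm.nullMeasurableSet
          exact (le_of_eq hp).trans (gaussian_tail R hR)
      _ = _ := by
          rw [Finset.sum_const, Finset.card_univ, Fintype.card_fin, nsmul_eq_mul, ← ENNReal.ofReal_natCast,
            ← ENNReal.ofReal_mul (by positivity)]
  have key' : (|(1+Δ).det| * Real.exp (-η)) * ((stdG (Fin d)) (T ⁻¹' B ∩ box)).toReal ≤ (stdG (Fin d) B).toReal := by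
    have := ENNReal.toReal_mono (measure_ne_top _ _) key
    rwa [ENNReal.toReal_mul, ENNReal.toReal_ofReal (by positivity)] at this
  have hle : ((stdG (Fin d)) (T ⁻¹' B)).toReal ≤ ((stdG (Fin d)) (T ⁻¹' B ∩ box)).toReal + ((stdG (Fin d)) boxᶜ).toReal := by
    rw [← ENNReal.toReal_add (measure_ne_top _ _) (measure_ne_top _ _)]
    refine ENNReal.toReal_mono (ENNReal.add_ne_top.mpr ⟨measure_ne_top _ _, measure_ne_top _ _⟩) ?_
    refine (measure_mono ?_).trans (measure_union_le _ _)
    intro g hg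
    by_cases hb : g ∈ box
    · exact Or.inl ⟨hg, hb⟩
    · exact Or.inr hb
  set x := ((stdG (Fin d)) (T ⁻¹' B ∩ box)).toReal
  have hx0 : 0 ≤ x := ENNReal.toReal_nonneg
  have hx1 : x ≤ 1 := ENNReal.toReal_le_of_le_ofReal (by norm_num) (by simpa using prob_le_one)
  have hexp : 1 - η ≤ Real.exp (-η) := by have := Real.add_one_le_exp (-η); linarith
  have hexp1 : Real.exp (-η) ≤ 1 := Real.exp_le_one_iff.mpr (by linarith)
  set y := |(1+Δ).det| * Real.exp (-η) with hy
  have hy1 : 1 - (2 * d^2 * κ + η) ≤ y := by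
    have hb0 : 0 ≤ 2 * (d:ℝ)^2 * κ := by positivity
    have := Real.exp_nonneg (-η)
    calc _ ≤ Real.exp (-η) - 2 * d^2*κ := by linarith
      _ ≤ (1 - 2 * d^2 * κ) * Real.exp (-η) := by nlinarith
      _ ≤ y := by rw [hy]; gcongr
  have h3 : (1 - (2 * d^2 * κ + η)) * x ≤ y * x := by gcongr
  have hb0 : 0 ≤ 2 * (d:ℝ)^2 * κ + η := by positivity
  have h4 : (2 * d^2 * κ + η) * x ≤ 2 * d^2 * κ + η := mul_le_of_le_one_right hb0 hx1
  unfold pertErr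
  rw [← hη]
  nlinarith

theorem pert_det_ne {d : ℕ} (Δ : Matrix (Fin d) (Fin d) ℝ) (κ : ℝ) (hκ : 0 ≤ κ)
    (h : ∀ i j, |Δ i j| ≤ κ) (hd : 2 * (d:ℝ)^2 * κ < 1) : (1 + Δ).det ≠ 0 := by
  have h1 : 2 * (d:ℝ) * κ ≤ 1 := by
    rcases Nat.eq_zero_or_pos d with h0 | h0
    · subst h0; simp
    · have : (1:ℝ) ≤ d := by exact_mod_cast h0
      nlinarith [mul_nonneg (by linarith : (0:ℝ) ≤ d) hκ]
  have := det_lower Δ κ hκ h h1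
  intro hc
  rw [hc] at this; simp at this; linarith

/-- closeness of two gaussians given by perturbed parameters. -/
theorem gauss_pert {d : ℕ} (μ : Fin d → ℝ) (A Δ : Matrix (Fin d) (Fin d) ℝ) (hA : A.det ≠ 0) (δ : Fin d → ℝ) (κ R : ℝ) (hκ : 0 ≤ κ) (hR : 0 ≤ R)
    (h : ∀ i j, |Δ i j| ≤ κ) (hδ : ∀ i, |δ i| ≤ κ) (hd : 2 * (d:ℝ)^2 * κ < 1)
    (B : Set (Fin d → ℝ)) (hB : MeasurableSet B) :
    |(gauss d (μ + A *ᵥ δ) ((A * (1 + Δ)) * (A * (1+Δ))ᵀ) B).toReal - (gauss d μ (A * Aᵀ) B).toReal| ≤ pertErr d κ R := by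
  have hdet := pert_det_ne Δ κ hκ h hd
  have h1 : 2 * (d:ℝ) * κ ≤ 1 := by
    rcases Nat.eq_zero_or_pos d with h0 | h0
    · subst h0; simp
    · have : (1:ℝ) ≤ d := by exact_mod_cast h0
      nlinarith [mul_nonneg (by linarith : (0:ℝ) ≤ d) hκ]
  rw [gauss_eq_map _ _ _ hA, gauss_eq_map _ _ _ (by rw [det_mul]; exact mul_ne_zero hA hdet)]
  have key : ∀ B : Set (Fin d → ℝ), MeasurableSet B →
      ((stdG (Fin d)).map (fun g => μ + A *ᵥ δ + (A * (1 + Δ)) *ᵥ g) B).toReal ≤ ((stdG (Fin d)).map (fun g => μ + A *ᵥ g) B).toReal + pertErr d κ R := by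
    intro B hB
    rw [Measure.map_apply (meas_aff1 _ _) hB, Measure.map_apply (meas_aff1 _ _) hB]
    have := gauss_pert1 Δ δ κ R hκ hR h hδ h1 hdet ((fun g => μ + A *ᵥ g) ⁻¹' B) (meas_aff1 μ A hB)
    have e : (fun g : Fin d → ℝ => μ + A *ᵥ δ + (A * (1 + Δ)) *ᵥ g) = fun g => μ + A *ᵥ (δ + (1 + Δ) *ᵥ g) := by
      funext g
      rw [Matrix.mulVec_add, Matrix.mulVec_mulVec, add_assoc]
    rw [e]
    exact this
  haveI : IsProbabilityMeasure ((stdG (Fin d)).map (fun g => μ + A *ᵥ δ + (A * (1 + Δ)) *ᵥ g)) :=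
    Measure.isProbabilityMeasure_map (meas_aff1 _ _).aemeasurable
  haveI : IsProbabilityMeasure ((stdG (Fin d)).map (fun g => μ + A *ᵥ g)) :=
    Measure.isProbabilityMeasure_map (meas_aff1 _ _).aemeasurable
  have k1 := key B hB
  have k2 := key Bᶜ hB.compl
  have c1 := probReal_compl_eq_one_sub (μ := (stdG (Fin d)).map (fun g => μ + A *ᵥ δ + (A * (1 + Δ)) *ᵥ g)) hB
  have c2 := probReal_compl_eq_one_sub (μ := (stdG (Fin d)).map (fun g => μ + A *ᵥ g)) hB
  simp only [Measure.real] at c1 c2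
  rw [c1, c2] at k2
  rw [abs_le]; constructor <;> linarith

end

section
theorem qs_mat' {ι : Type*} [Fintype ι] {D : ℕ} (z : ι → Fin D → ℝ) (v : Fin D → ℝ) :
    qs z Finset.univ v = (Matrix.of z *ᵥ v) ⬝ᵥ (Matrix.of z *ᵥ v) := by
  unfold qs
  simp only [dotProduct, mulVec, Matrix.of_apply]
  refine Finset.sum_congr rfl fun i _ => ?_
  rw [sq]
  congr 1 <;> exact Finset.sum_congr rfl fun j _ => mul_comm _ _

theorem frame_coeff {ι : Type*} [Fintype ι] {D : ℕ} (z : ι → Fin D → ℝ) (f : Fin D → ℝ) (K : ℝ) (hK : 0 ≤ K)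
    (hinj : ∀ v, qs z Finset.univ v = 0 → v = 0) (hf : ∀ v, (v ⬝ᵥ f)^2 ≤ K * qs z Finset.univ v) :
    ∃ c : ι → ℝ, f = c ᵥ* Matrix.of z ∧ ∀ i, (c i)^2 ≤ K := by
  classical
  set Z := Matrix.of z with hZ
  set G := Zᵀ * Z with hG
  have hGv : ∀ v, v ⬝ᵥ (G *ᵥ v) = qs z Finset.univ v := by
    intro v
    rw [hG, ← Matrix.mulVec_mulVec, Matrix.dotProduct_mulVec, Matrix.vecMul_transpose, qs_mat']
  have hdet : G.det ≠ 0 := by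
    intro h0
    obtain ⟨v, hv, hv2⟩ := Matrix.exists_mulVec_eq_zero_iff.mpr h0
    apply hv; apply hinj
    rw [← hGv, hv2, dotProduct_zero]
  have hU : IsUnit G.det := isUnit_iff_ne_zero.mpr hdet
  set v := G⁻¹ *ᵥ f with hv
  have hGf : G *ᵥ v = f := by
    rw [hv, Matrix.mulVec_mulVec, Matrix.mul_nonsing_inv _ hU, Matrix.one_mulVec]
  refine ⟨Z *ᵥ v, ?_, ?_⟩
  · rw [← Matrix.mulVec_transpose, Matrix.mulVec_mulVec, ← hG, hGf]
  · intro i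
    have e1 : (Z *ᵥ v) ⬝ᵥ (Z *ᵥ v) = v ⬝ᵥ f := by
      rw [← qs_mat', ← hGv, hGf]
    have e2 := hf v
    rw [qs_mat', ← hZ, e1] at e2
    have e3 : ((Z *ᵥ v) i)^2 ≤ (Z *ᵥ v) ⬝ᵥ (Z *ᵥ v) := by
      rw [sq]
      exact Finset.single_le_sum (f := fun i => (Z *ᵥ v) i * (Z *ᵥ v) i) (fun j _ => mul_self_nonneg _) (Finset.mem_univ i)
    rw [e1] at e3
    refine e3.trans ?_
    by_contra hc
    push Not at hc
    nlinarith

/-- grid point -/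
def gridv {M : ℕ} (θ : ℝ) (i : Fin (2*M+1)) : ℝ := ((i:ℕ) - (M:ℝ)) * θ

theorem grid_exists (M : ℕ) (θ c : ℝ) (hθ : 0 < θ) (hc : |c| ≤ M * θ) : ∃ i : Fin (2*M+1), |gridv θ i - c| ≤ θ := by
  have h1 := abs_le.mp hc
  have l1 : -(M:ℝ) ≤ c / θ := by rw [le_div_iff₀ hθ]; linarith
  have l2 : c / θ ≤ M := by rw [div_le_iff₀ hθ]; linarith
  have f1 : -(M:ℤ) ≤ ⌊c/θ⌋ := by rw [Int.le_floor]; push_cast; exact l1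
  have f2 : ⌊c/θ⌋ ≤ (M:ℤ) := by
    have := Int.floor_mono l2; simpa using this
  refine ⟨⟨(⌊c/θ⌋ + M).toNat, by omega⟩, ?_⟩
  have e : (((⌊c/θ⌋ + M).toNat : ℕ) : ℝ) = (⌊c/θ⌋ : ℝ) + M := by
    have : (((⌊c/θ⌋ + M).toNat : ℤ)) = ⌊c/θ⌋ + M := Int.toNat_of_nonneg (by omega)
    exact_mod_cast this
  unfold gridv
  simp only [e]
  have g1 := Int.floor_le (c/θ)
  have g2 := Int.lt_floor_add_one (c/θ)
  rw [le_div_iff₀ hθ] at g1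
  rw [div_lt_iff₀ hθ] at g2
  rw [abs_le]; constructor <;> nlinarith

abbrev Ix (ι : Type*) (p D G M : ℕ) := Fin (G+1) × ι × (Fin D → Fin p → Fin (2*M+1))

def frm {ι : Type*} {p D G M : ℕ} (θ : ℝ) (fr : ι → Fin p → Fin D → ℝ) (x : Ix ι p D G M) : Fin D → Fin D → ℝ :=
  fun s r => ∑ i, gridv θ (x.2.2 s i) * fr x.2.1 i r

def muC {d : ℕ} (F : Fin (d+1) → Fin (d+1) → ℝ) : Fin d → ℝ := fun r => F 0 r.succ / F 0 0

def AC {d : ℕ} (F : Fin (d+1) → Fin (d+1) → ℝ) : Matrix (Fin d) (Fin d) ℝ :=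
  Matrix.of fun r s => F s.succ r.succ - F s.succ 0 * muC F r

open Classical in
def covC {d : ℕ} (F : Fin (d+1) → Fin (d+1) → ℝ) : Matrix (Fin d) (Fin d) ℝ :=
  if (AC F).det = 0 then 1 else AC F * (AC F)ᵀ

def wC {k : ℕ} (q : Fin k → ℕ) : Fin k → ℝ := if ∑ i, q i = 0 then fun _ => 1 / (k:ℝ) else fun j => q j / ((∑ i, q i : ℕ) : ℝ)

abbrev PS (d k : ℕ) := (Fin k → ℝ) × (Fin k → (Fin d → ℝ)) × (Fin k → Matrix (Fin d) (Fin d) ℝ)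

def cand {ι : Type*} {d p k G M : ℕ} (θ : ℝ) (x : Fin k → Ix ι p (d+1) G M) (fr : ι → Fin p → Fin (d+1) → ℝ) : PS d k :=
  (wC fun j => ((x j).1 : ℕ), fun j => muC (frm θ fr (x j)), fun j => covC (frm θ fr (x j)))

theorem meas_det {Ω : Type*} [MeasurableSpace Ω] {d : ℕ} (f : Ω → Matrix (Fin d) (Fin d) ℝ) (hf : ∀ i j, Measurable fun x => f x i j) :
    Measurable fun x => (f x).det := by
  simp only [Matrix.det_apply]
  refine Finset.measurable_fun_sum _ fun σ _ => ?_
  exact (Finset.measurable_fun_prod _ fun i _ => hf _ _).const_smul _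

theorem meas_cand {ι : Type*} {d p k G M : ℕ} (θ : ℝ) (x : Fin k → Ix ι p (d+1) G M) : Measurable (cand (d := d) θ x) := by
  have hF : ∀ y : Ix ι p (d+1) G M, ∀ s r, Measurable fun fr : ι → Fin p → Fin (d+1) → ℝ => frm θ fr y s r := by
    intro y s r
    unfold frm
    refine Finset.measurable_fun_sum _ fun i _ => ?_
    exact Measurable.const_mul (by fun_prop) _
  have hmu : ∀ y : Ix ι p (d+1) G M, ∀ r, Measurable fun fr : ι → Fin p → Fin (d+1) → ℝ => muC (frm θ fr y) r := by
    intro y r; unfold muC; exact (hF _ _ _).div (hF _ _ _)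
  have hAC : ∀ y : Ix ι p (d+1) G M, ∀ r s, Measurable fun fr : ι → Fin p → Fin (d+1) → ℝ => AC (frm θ fr y) r s := by
    intro y r s; unfold AC; exact (hF _ _ _).sub ((hF _ _ _).mul (hmu _ _))
  refine measurable_const.prodMk (Measurable.prodMk ?_ ?_)
  · exact measurable_pi_lambda _ fun j => measurable_pi_lambda _ fun r => hmu _ _
  · refine measurable_pi_lambda _ fun j => ?_
    unfold covC
    refine Measurable.ite ?_ measurable_const ?_
    · exact measurableSet_eq_fun (meas_det _ (hAC _)) measurable_const
    · refine measurable_pi_lambda _ fun r => measurable_pi_lambda _ fun s => ?_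
      simp only [Matrix.mul_apply, Matrix.transpose_apply]
      exact Finset.measurable_fun_sum _ fun i _ => (hAC _ _ _).mul (hAC _ _ _)

theorem posDef_mul_transpose {d : ℕ} (A : Matrix (Fin d) (Fin d) ℝ) (hA : A.det ≠ 0) : (A * Aᵀ).PosDef := by
  have := Matrix.PosDef.mul_conjTranspose_self A (by
    intro v w hvw
    have hU : IsUnit A.det := isUnit_iff_ne_zero.mpr hA
    have : v ᵥ* A ᵥ* A⁻¹ = w ᵥ* A ᵥ* A⁻¹ := by simp only at hvw; rw [hvw]
    rwa [Matrix.vecMul_vecMul, Matrix.vecMul_vecMul, Matrix.mul_nonsing_inv _ hU, Matrix.vecMul_one, Matrix.vecMul_one] at this)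
  rwa [Matrix.conjTranspose_eq_transpose_of_trivial] at this

theorem wC_valid {k : ℕ} (hk : 1 ≤ k) (q : Fin k → ℕ) : (∀ i, 0 ≤ wC q i) ∧ ∑ i, wC q i = 1 := by
  have hk0 : (k:ℝ) ≠ 0 := by positivity
  unfold wC
  split_ifs with h
  · refine ⟨fun i => by positivity, ?_⟩
    simp [hk0]
  · refine ⟨fun i => by positivity, ?_⟩
    rw [← Finset.sum_div, ← Nat.cast_sum]
    exact div_self (by exact_mod_cast h)

theorem cand_valid {ι : Type*} {d p k G M : ℕ} (hk : 1 ≤ k) (θ : ℝ) (x : Fin k → Ix ι p (d+1) G M) (fr : ι → Fin p → Fin (d+1) → ℝ) :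
    IsMixtureParams (cand θ x fr).1 (cand θ x fr).2.2 := by
  refine ⟨(wC_valid hk _).1, (wC_valid hk _).2, fun i => ?_⟩
  simp only [cand, covC]
  split_ifs with h
  · exact Matrix.PosDef.one
  · exact posDef_mul_transpose _ h

theorem net_exists {d p M : ℕ} (μ : Fin d → ℝ) (A : Matrix (Fin d) (Fin d) ℝ) (hA : A.det ≠ 0)
    (z : Fin p → Fin (d+1) → ℝ) (K θ κ : ℝ) (hK : 1 ≤ K) (hz : close2 K (Fmat μ A) Finset.univ z Finset.univ)
    (hθ : 0 < θ) (hM : K ≤ M * θ) (hκ : 2 * (p * (θ * K)) ≤ κ) (hκ1 : κ ≤ 1/2) :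
    ∃ C : Fin (d+1) → Fin p → Fin (2*M+1), ∃ Δ : Matrix (Fin d) (Fin d) ℝ, ∃ δ : Fin d → ℝ, (∀ i j, |Δ i j| ≤ κ) ∧ (∀ i, |δ i| ≤ κ) ∧
      muC (fun s r => ∑ i, gridv θ (C s i) * z i r) = μ + A *ᵥ δ ∧
      AC (fun s r => ∑ i, gridv θ (C s i) * z i r) = A * (1 + Δ) := by
  set F := Fmat μ A with hF
  have hFdet : (Matrix.of F).det ≠ 0 := by rw [hF, Fmat_det]; exact hA
  have hFinj : ∀ v, qs F Finset.univ v = 0 → v = 0 := by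
    intro v hv
    rw [qs_mat'] at hv
    have := dotProduct_self_eq_zero.mp hv
    exact Matrix.eq_zero_of_mulVec_eq_zero hFdet this
  have hzinj : ∀ v, qs z Finset.univ v = 0 → v = 0 := by
    intro v hv
    apply hFinj
    have := hz.1 v
    rw [hv, mul_zero] at this
    exact le_antisymm this (qs_nonneg _ _ _)
  have hsq : ∀ c : ℝ, c^2 ≤ K → |c| ≤ K := by
    intro c hc
    refine abs_le_of_sq_le_sq ?_ (by linarith)
    nlinarith
  have h1 : ∀ s, ∃ c : Fin p → ℝ, F s = c ᵥ* Matrix.of z ∧ ∀ i, (c i)^2 ≤ K := by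
    intro s
    refine frame_coeff z (F s) K (by linarith) hzinj fun v => le_trans ?_ (hz.1 v)
    exact Finset.single_le_sum (f := fun i => (v ⬝ᵥ F i)^2) (fun j _ => sq_nonneg _) (Finset.mem_univ s)
  have h2 : ∀ i, ∃ c : Fin (d+1) → ℝ, z i = c ᵥ* Matrix.of F ∧ ∀ r, (c r)^2 ≤ K := by
    intro i
    refine frame_coeff F (z i) K (by linarith) hFinj fun v => le_trans ?_ (hz.2 v)
    exact Finset.single_le_sum (f := fun i => (v ⬝ᵥ z i)^2) (fun j _ => sq_nonneg _) (Finset.mem_univ i)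
  choose c hc1 hc2 using h1
  choose b hb1 hb2 using h2
  have h3 : ∀ s i, ∃ g : Fin (2*M+1), |gridv θ g - c s i| ≤ θ := fun s i =>
    grid_exists M θ (c s i) hθ ((hsq _ (hc2 s i)).trans hM)
  choose C hC using h3
  set Ω : Fin (d+1) → Fin (d+1) → ℝ := fun s r => ∑ i, (gridv θ (C s i) - c s i) * b i r with hΩ
  have hΩb : ∀ s r, |Ω s r| ≤ κ / 2 := by
    intro s r
    calc |Ω s r| ≤ ∑ i : Fin p, θ * K := by
          refine (Finset.abs_sum_le_sum_abs _ _).trans (Finset.sum_le_sum fun i _ => ?_)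
          rw [abs_mul]
          exact mul_le_mul (hC s i) (hsq _ (hb2 i r)) (abs_nonneg _) hθ.le
      _ = p * (θ * K) := by simp
      _ ≤ κ/2 := by linarith
  set F' : Fin (d+1) → Fin (d+1) → ℝ := fun s r => ∑ i, gridv θ (C s i) * z i r with hF'
  have hFF : ∀ s r, F' s r = F s r + ∑ t, Ω s t * F t r := by
    intro s r
    have e1 : F s r = ∑ i, c s i * z i r := by
      have := congrFun (hc1 s) r
      rw [this]; simp [vecMul, dotProduct]
    have e2 : ∀ i, z i r = ∑ t, b i t * F t r := by
      intro i
      have := congrFun (hb1 i) r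
      rw [this]; simp [vecMul, dotProduct]
    have e3 : ∑ t, Ω s t * F t r = ∑ i, (gridv θ (C s i) - c s i) * z i r := by
      simp only [hΩ, Finset.sum_mul]
      rw [Finset.sum_comm]
      refine Finset.sum_congr rfl fun i _ => ?_
      rw [e2 i, Finset.mul_sum]
      exact Finset.sum_congr rfl fun t _ => by ring
    rw [e3, e1, ← Finset.sum_add_distrib]
    exact Finset.sum_congr rfl fun i _ => by ring
  have F00 : F 0 0 = 1 := by simp [hF, Fmat, lft]
  have Fs0 : ∀ s : Fin d, F s.succ 0 = 0 := fun s => by simp [hF, Fmat]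
  have F0r : ∀ r : Fin d, F 0 r.succ = μ r := fun r => by simp [hF, Fmat, lft]
  have Fsr : ∀ s r : Fin d, F s.succ r.succ = A r s := fun s r => by simp [hF, Fmat]
  have G0 : ∀ s, F' s 0 = F s 0 + Ω s 0 := by
    intro s; rw [hFF, Fin.sum_univ_succ]; simp [F00, Fs0]
  have Gr : ∀ s (r : Fin d), F' s r.succ = F s r.succ + (Ω s 0 * μ r + ∑ t : Fin d, A r t * Ω s t.succ) := by
    intro s r
    rw [hFF, Fin.sum_univ_succ, F0r]
    congr 2
    exact Finset.sum_congr rfl fun t _ => by rw [Fsr]; ring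
  have hb00 := abs_le.mp (hΩb 0 0)
  have hκ0 : 0 ≤ κ := by have := (abs_nonneg _).trans (hΩb 0 0); linarith
  have hpos : 3/4 ≤ 1 + Ω 0 0 := by linarith [hb00.1]
  have hδb : ∀ r : Fin d, |Ω 0 r.succ / (1 + Ω 0 0)| ≤ κ := by
    intro r
    rw [abs_div, abs_of_pos (by linarith : 0 < 1 + Ω 0 0), div_le_iff₀ (by linarith)]
    nlinarith [hΩb 0 r.succ]
  have hmu : ∀ r, muC F' r = μ r + ∑ t : Fin d, A r t * (Ω 0 t.succ / (1 + Ω 0 0)) := by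
    intro r
    unfold muC
    rw [Gr, G0, F00, F0r]
    have : ∑ t : Fin d, A r t * (Ω 0 t.succ / (1 + Ω 0 0)) = (∑ t : Fin d, A r t * Ω 0 t.succ) / (1 + Ω 0 0) := by
      rw [Finset.sum_div]; exact Finset.sum_congr rfl fun t _ => by ring
    rw [this]
    have h0 : 1 + Ω 0 0 ≠ 0 := by linarith
    field_simp; ring
  refine ⟨C, Matrix.of fun t s => Ω s.succ t.succ - Ω s.succ 0 * (Ω 0 t.succ / (1 + Ω 0 0)),
    fun r => Ω 0 r.succ / (1 + Ω 0 0), ?_, hδb, ?_, ?_⟩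
  · intro t s
    have a1 := hΩb s.succ t.succ
    have a2 := hΩb s.succ 0
    have a3 := hδb t
    simp only [Matrix.of_apply]
    calc _ ≤ |Ω s.succ t.succ| + |Ω s.succ 0 * (Ω 0 t.succ / (1 + Ω 0 0))| := abs_sub _ _
      _ ≤ κ/2 + (κ/2) * κ := by
          rw [abs_mul]; gcongr
      _ ≤ κ := by nlinarith
  · ext r; rw [hmu]; simp [mulVec, dotProduct]
  · ext r s
    show F' s.succ r.succ - F' s.succ 0 * muC F' r = _
    rw [Gr, G0, hmu, Fs0, Fsr, Matrix.mul_add, Matrix.mul_one, Matrix.add_apply, Matrix.mul_apply]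
    simp only [Matrix.of_apply, mul_sub, Finset.sum_sub_distrib]
    have : ∑ x : Fin d, A r x * (Ω s.succ 0 * (Ω 0 x.succ / (1 + Ω 0 0))) = Ω s.succ 0 * ∑ t : Fin d, A r t * (Ω 0 t.succ / (1 + Ω 0 0)) := by
      rw [Finset.mul_sum]; exact Finset.sum_congr rfl fun t _ => by ring
    rw [this]; ring


theorem gauss_prob {d : ℕ} (μ : Fin d → ℝ) (S : Matrix (Fin d) (Fin d) ℝ) (hS : S.PosDef) : IsProbabilityMeasure (gauss d μ S) := by
  obtain ⟨A, hA, rfl⟩ := exists_sqrt hS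
  rw [gauss_eq_map _ _ _ hA]
  exact Measure.isProbabilityMeasure_map (meas_aff1 _ _).aemeasurable

theorem mixture_toReal {d k : ℕ} (w : Fin k → ℝ) (μs : Fin k → Fin d → ℝ) (Ss : Fin k → Matrix (Fin d) (Fin d) ℝ)
    (h : IsMixtureParams w Ss) (B : Set (Fin d → ℝ)) (hB : MeasurableSet B) :
    (mixture d k w μs Ss B).toReal = ∑ j, w j * (gauss d (μs j) (Ss j) B).toReal := by
  haveI := fun j => gauss_prob (μs j) (Ss j) (h.2.2 j)
  unfold mixture
  rw [Measure.sum_apply _ hB, tsum_fintype, ENNReal.toReal_sum]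
  · refine Finset.sum_congr rfl fun j _ => ?_
    rw [Measure.smul_apply, smul_eq_mul, ENNReal.toReal_mul, ENNReal.toReal_ofReal (h.1 j)]
  · intro j _
    rw [Measure.smul_apply, smul_eq_mul]
    exact ENNReal.mul_ne_top ENNReal.ofReal_ne_top (measure_ne_top _ _)

theorem mixture_close {d k : ℕ} (w w' : Fin k → ℝ) (μs μs' : Fin k → Fin d → ℝ) (Ss Ss' : Fin k → Matrix (Fin d) (Fin d) ℝ)
    (h : IsMixtureParams w Ss) (h' : IsMixtureParams w' Ss') (ξ η : ℝ) (hw : ∑ j, |w' j - w j| ≤ ξ) (B : Set (Fin d → ℝ)) (hB : MeasurableSet B)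
    (hc : ∀ j, w' j ≠ 0 → |(gauss d (μs' j) (Ss' j) B).toReal - (gauss d (μs j) (Ss j) B).toReal| ≤ η) :
    |(mixture d k w' μs' Ss' B).toReal - (mixture d k w μs Ss B).toReal| ≤ ξ + η := by
  haveI := fun j => gauss_prob (μs j) (Ss j) (h.2.2 j)
  rw [mixture_toReal _ _ _ h B hB, mixture_toReal _ _ _ h' B hB, ← Finset.sum_sub_distrib]
  calc _ ≤ ∑ j, (|w' j - w j| + w' j * η) := by
        refine (Finset.abs_sum_le_sum_abs _ _).trans (Finset.sum_le_sum fun j _ => ?_)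
        have e : w' j * (gauss d (μs' j) (Ss' j) B).toReal - w j * (gauss d (μs j) (Ss j) B).toReal =
          (w' j - w j) * (gauss d (μs j) (Ss j) B).toReal + w' j * ((gauss d (μs' j) (Ss' j) B).toReal - (gauss d (μs j) (Ss j) B).toReal) := by ring
        rw [e]
        refine (abs_add_le _ _).trans (add_le_add ?_ ?_)
        · rw [abs_mul]
          refine mul_le_of_le_one_right (abs_nonneg _) ?_
          rw [abs_of_nonneg ENNReal.toReal_nonneg]
          exact ENNReal.toReal_le_of_le_ofReal (by norm_num) (by simpa using prob_le_one)
        · rw [abs_mul, abs_of_nonneg (h'.1 j)]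
          by_cases h0 : w' j = 0
          · rw [h0]; simp
          · exact mul_le_mul_of_nonneg_left (hc j h0) (h'.1 j)
    _ ≤ ξ + η := by
        rw [Finset.sum_add_distrib, ← Finset.sum_mul, h'.2.1, one_mul]; linarith

open Classical in
theorem weights_close {k G : ℕ} (hk : 1 ≤ k) (hG : 1 ≤ G) (w : Fin k → ℝ) (h0 : ∀ i, 0 ≤ w i) (h1 : ∑ i, w i = 1)
    (hv : Finset (Fin k)) (τ ξ : ℝ) (hl : ∀ j ∉ hv, w j ≤ τ) (hτ : 0 ≤ τ) (hξ : k * τ + k / (G:ℝ) ≤ ξ) (hξ1 : ξ < 1) :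
    ∃ q : Fin k → Fin (G+1), (∀ j, wC (fun j => (q j : ℕ)) j ≠ 0 → j ∈ hv) ∧ ∑ j, |wC (fun j => (q j : ℕ)) j - w j| ≤ 2 * ξ := by
  have hG0 : (0:ℝ) < G := by exact_mod_cast hG
  have hw1 : ∀ j, w j ≤ 1 := fun j => by
    rw [← h1]; exact Finset.single_le_sum (fun i _ => h0 i) (Finset.mem_univ j)
  set q0 : Fin k → ℕ := fun j => if j ∈ hv then ⌊w j * G⌋₊ else 0 with hq0
  have hq1 : ∀ j, (q0 j : ℝ) ≤ w j * G := by
    intro j; simp only [hq0]; split_ifs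
    · exact Nat.floor_le (mul_nonneg (h0 j) hG0.le)
    · simp; exact mul_nonneg (h0 j) hG0.le
  have hqG : ∀ j, q0 j ≤ G := by
    intro j
    have : (q0 j : ℝ) ≤ G := (hq1 j).trans (mul_le_of_le_one_left hG0.le (hw1 j))
    exact_mod_cast this
  have hq2 : ∀ j, w j - (τ + 1 / G) ≤ q0 j / (G:ℝ) := by
    intro j; simp only [hq0]; split_ifs with hj
    · have := Nat.lt_floor_add_one (w j * G)
      rw [le_div_iff₀ hG0]
      have e : (w j - (τ + 1 / G)) * G = w j * G - τ * G - 1 := by field_simp; ring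
      rw [e]; nlinarith [mul_nonneg hτ hG0.le]
    · have := hl j hj
      have hp : (0:ℝ) < 1 / G := by positivity
      rw [Nat.cast_zero, zero_div]; linarith
  refine ⟨fun j => ⟨q0 j, Nat.lt_succ_of_le (hqG j)⟩, ?_, ?_⟩
  all_goals
    set Q : ℕ := ∑ j, q0 j with hQ
    have hQ1 : 1 - ξ ≤ (Q:ℝ) / G := by
      rw [hQ, Nat.cast_sum, Finset.sum_div]
      calc 1 - ξ ≤ ∑ j : Fin k, (w j - (τ + 1/G)) := by
            rw [Finset.sum_sub_distrib, h1]; simp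
            have hξ' := hξ
            rw [div_eq_mul_inv] at hξ'
            linarith
        _ ≤ _ := Finset.sum_le_sum fun j _ => hq2 j
    have hQ0 : (0:ℝ) < Q := by
      have : 0 < (Q:ℝ)/G := by linarith
      by_contra hc
      have : (Q:ℝ)/G ≤ 0 := div_nonpos_of_nonpos_of_nonneg (not_lt.mp hc) hG0.le
      linarith
    have hQn : Q ≠ 0 := by intro h; rw [h] at hQ0; simp at hQ0
    have hwC : ∀ j, wC q0 j = q0 j / (Q:ℝ) := by
      intro j; unfold wC; rw [if_neg hQn]
  · intro j hj
    by_contra hc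
    apply hj
    show wC q0 j = 0
    rw [hwC]; simp [hq0, hc]
  · show ∑ j, |wC q0 j - w j| ≤ 2 * ξ
    have hQG : (Q:ℝ) / G ≤ 1 := by
      rw [div_le_one hG0, hQ, Nat.cast_sum]
      calc _ ≤ ∑ j, w j * G := Finset.sum_le_sum fun j _ => hq1 j
        _ = G := by rw [← Finset.sum_mul, h1, one_mul]
    calc _ ≤ ∑ j, ((w j - q0 j / (G:ℝ)) + (q0 j / (Q:ℝ) - q0 j / (G:ℝ))) := by
          refine Finset.sum_le_sum fun j _ => ?_
          have a1 : (q0 j : ℝ) / G ≤ w j := by rw [div_le_iff₀ hG0]; exact hq1 j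
          have a2 : (q0 j : ℝ) / G ≤ q0 j / Q := by
            have hQG' : (Q:ℝ) ≤ G := (div_le_one hG0).mp hQG
            exact div_le_div_of_nonneg_left (Nat.cast_nonneg _) hQ0 hQG'
          rw [hwC, abs_le]; constructor <;> linarith
      _ = (1 - Q / (G:ℝ)) + (1 - Q / (G:ℝ)) := by
          rw [Finset.sum_add_distrib, Finset.sum_sub_distrib, Finset.sum_sub_distrib, h1, ← Finset.sum_div, ← Finset.sum_div,
            ← Nat.cast_sum, ← hQ, div_self hQ0.ne']
      _ ≤ 2 * ξ := by linarith

/-- existence of a good candidate given good frames. -/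
theorem cand_close {ι : Type*} [Nonempty ι] {d p k G M : ℕ} (hk : 1 ≤ k) (hG : 1 ≤ G) (w : Fin k → ℝ) (h0 : ∀ i, 0 ≤ w i) (h1 : ∑ i, w i = 1)
    (μs : Fin k → Fin d → ℝ) (As : Fin k → Matrix (Fin d) (Fin d) ℝ) (hA : ∀ j, (As j).det ≠ 0)
    (τ ξ : ℝ) (hτ : 0 ≤ τ) (hξ : k * τ + k / (G:ℝ) ≤ ξ) (hξ1 : ξ < 1)
    (K θ κ R : ℝ) (hK : 1 ≤ K) (hθ : 0 < θ) (hM : K ≤ M * θ) (hκ0 : 0 ≤ κ) (hκ : 2 * (p * (θ * K)) ≤ κ) (hκ1 : κ ≤ 1/2) (hκd : 2 * (d:ℝ)^2 * κ < 1) (hR : 0 ≤ R)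
    (fr : ι → Fin p → Fin (d+1) → ℝ)
    (hfr : ∀ j, τ ≤ w j → ∃ i, close2 K (Fmat (μs j) (As j)) Finset.univ (fr i) Finset.univ) :
    ∃ x : Fin k → Ix ι p (d+1) G M, ∀ B : Set (Fin d → ℝ), MeasurableSet B →
      |(mixture d k (cand θ x fr).1 (cand θ x fr).2.1 (cand θ x fr).2.2 B).toReal -
        (mixture d k w μs (fun j => As j * (As j)ᵀ) B).toReal| ≤ 2 * ξ + pertErr d κ R := by
  classical
  set hv : Finset (Fin k) := Finset.univ.filter fun j => τ ≤ w j with hhv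
  obtain ⟨q, hq1, hq2⟩ := weights_close hk hG w h0 h1 hv τ ξ (fun j hj => by
    simp [hhv] at hj; exact hj.le) hτ hξ hξ1
  have hx : ∀ j, ∃ y : ι × (Fin (d+1) → Fin p → Fin (2*M+1)), j ∈ hv → ∃ Δ : Matrix (Fin d) (Fin d) ℝ, ∃ δ : Fin d → ℝ, (∀ i j, |Δ i j| ≤ κ) ∧ (∀ i, |δ i| ≤ κ) ∧
      muC (frm θ fr ((q j, y) : Ix ι p (d+1) G M)) = μs j + As j *ᵥ δ ∧
      AC (frm θ fr ((q j, y) : Ix ι p (d+1) G M)) = As j * (1 + Δ) := by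
    intro j
    by_cases hj : j ∈ hv
    · obtain ⟨i, hi⟩ := hfr j (by simpa [hhv] using hj)
      obtain ⟨C, Δ, δ, h⟩ := net_exists (M := M) (μs j) (As j) (hA j) (fr i) K θ κ hK hi hθ hM hκ hκ1
      exact ⟨(i, C), fun _ => ⟨Δ, δ, h⟩⟩
    · exact ⟨(Classical.arbitrary ι, fun _ _ => 0), fun h => absurd h hj⟩
  choose y hy using hx
  refine ⟨fun j => (q j, y j), fun B hB => ?_⟩
  set xx : Fin k → Ix ι p (d+1) G M := fun j => (q j, y j) with hxx
  have c1 : (cand θ xx fr).1 = wC (fun j => (q j : ℕ)) := rfl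
  have c2 : ∀ j, (cand θ xx fr).2.1 j = muC (frm θ fr ((q j, y j) : Ix ι p (d+1) G M)) := fun j => rfl
  have c3 : ∀ j, (cand θ xx fr).2.2 j = covC (frm θ fr ((q j, y j) : Ix ι p (d+1) G M)) := fun j => rfl
  have hval := cand_valid hk θ xx fr
  generalize (cand θ xx fr) = cc at c1 c2 c3 hval ⊢
  rw [← c1] at hq1 hq2
  refine mixture_close w cc.1 μs cc.2.1 (fun j => As j * (As j)ᵀ) cc.2.2 ⟨h0, h1, fun j => posDef_mul_transpose _ (hA j)⟩
    hval (2 * ξ) (pertErr d κ R) hq2 B hB ?_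
  intro j hj
  obtain ⟨Δ, δ, hΔ, hδ, e1, e2⟩ := hy j (hq1 j hj)
  have := gauss_pert (μs j) (As j) Δ (hA j) δ κ R hκ0 hR hΔ hδ hκd B hB
  rw [c2, c3, covC, e1, e2, if_neg]
  · exact this
  · rw [det_mul]; exact mul_ne_zero (hA j) (pert_det_ne Δ κ hκ0 hΔ hκd)

end

section
theorem dp_lint {Ω : Type*} [MeasurableSpace Ω] {P Q : Measure Ω} [IsProbabilityMeasure P]
    [IsProbabilityMeasure Q] {E δ : ℝ≥0∞} (hE : E ≠ ∞)
    (h : ∀ O, MeasurableSet O → P O ≤ E * Q O + δ) (f : Ω → ℝ≥0∞) (hf : Measurable f) (hf1 : ∀ x, f x ≤ 1) :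
    ∫⁻ x, f x ∂P ≤ E * ∫⁻ x, f x ∂Q + δ := by
  obtain ⟨g, hg, hgE, -, hh⟩ := dp_density hE h
  refine (hh f hf hf1).trans ?_
  rw [← lintegral_const_mul _ hf]
  gcongr with x
  exact hgE x

theorem scheffe1 {E : Type*} [MeasurableSpace E] (P Q : Measure E) [IsProbabilityMeasure P] [IsProbabilityMeasure Q]
    (S : Set E) (hS : MeasurableSet S) (h1 : ∀ B ⊆ S, MeasurableSet B → Q B ≤ P B) (h2 : ∀ B ⊆ Sᶜ, MeasurableSet B → P B ≤ Q B) :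
    ∀ B, MeasurableSet B → |(P B).toReal - (Q B).toReal| ≤ (P S).toReal - (Q S).toReal := by
  have key : ∀ B, MeasurableSet B → (P B).toReal - (Q B).toReal ≤ (P S).toReal - (Q S).toReal := by
    intro B hB
    have a1 : (P B).toReal = (P (B ∩ S)).toReal + (P (B \ S)).toReal := (measureReal_inter_add_diff hS).symm
    have a2 : (Q B).toReal = (Q (B ∩ S)).toReal + (Q (B \ S)).toReal := (measureReal_inter_add_diff hS).symm
    have a3 : (P S).toReal = (P (S ∩ B)).toReal + (P (S \ B)).toReal := (measureReal_inter_add_diff hB).symm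
    have a4 : (Q S).toReal = (Q (S ∩ B)).toReal + (Q (S \ B)).toReal := (measureReal_inter_add_diff hB).symm
    have b1 : (P (B \ S)).toReal ≤ (Q (B \ S)).toReal :=
      ENNReal.toReal_mono (measure_ne_top _ _) (h2 _ (fun x hx => hx.2) (hB.diff hS))
    have b2 : (Q (S \ B)).toReal ≤ (P (S \ B)).toReal :=
      ENNReal.toReal_mono (measure_ne_top _ _) (h1 _ (fun x hx => hx.1) (hS.diff hB))
    rw [Set.inter_comm S B] at a3 a4
    linarith
  intro B hB
  rw [abs_le]
  refine ⟨?_, key B hB⟩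
  have := key Bᶜ hB.compl
  have c1 : (P Bᶜ).toReal = 1 - (P B).toReal := probReal_compl_eq_one_sub hB
  have c2 : (Q Bᶜ).toReal = 1 - (Q B).toReal := probReal_compl_eq_one_sub hB
  linarith

theorem scheffe {F : Type*} [MeasurableSpace F] {d : ℕ} (κ η : Kernel F (Fin d → ℝ)) [IsMarkovKernel κ] [IsMarkovKernel η] :
    ∃ S : Set (F × (Fin d → ℝ)), MeasurableSet S ∧ ∀ a, ∀ B, MeasurableSet B →
      |(κ a B).toReal - (η a B).toReal| ≤ (κ a (Prod.mk a ⁻¹' S)).toReal - (η a (Prod.mk a ⁻¹' S)).toReal := by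
  set f := κ.rnDeriv (κ + η) with hf
  have hfm : Measurable fun p : F × (Fin d → ℝ) => f p.1 p.2 := Kernel.measurable_rnDeriv _ _
  have hm : MeasurableSet {p : F × (Fin d → ℝ) | (1/2 : ℝ≥0∞) < f p.1 p.2} := measurableSet_lt measurable_const hfm
  refine ⟨_, hm, fun a => ?_⟩
  have hd : ∀ B, MeasurableSet B → κ a B = ∫⁻ x in B, f a x ∂(κ a + η a) := by
    intro B hB
    have hac : κ a ≪ (κ + η) a := by
      rw [Kernel.add_apply]; exact Measure.AbsolutelyContinuous.add_right (Measure.AbsolutelyContinuous.refl _) _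
    have := Kernel.withDensity_rnDeriv_eq hac
    rw [Kernel.withDensity_apply _ (Kernel.measurable_rnDeriv _ _), Kernel.add_apply] at this
    conv_lhs => rw [← this]
    rw [withDensity_apply _ hB]
  have hhalf : ∀ B, (∫⁻ x in B, (1/2 : ℝ≥0∞) ∂(κ a + η a)) = 1/2 * (κ a B + η a B) := by
    intro B; rw [setLIntegral_const]; simp
  refine scheffe1 (κ a) (η a) (Prod.mk a ⁻¹' _) (measurable_prodMk_left hm) ?_ ?_
  · intro B hBS hB
    have h1 : 1/2 * (κ a B + η a B) ≤ κ a B := by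
      rw [hd B hB, ← hd B hB, ← hhalf, hd B hB]
      exact setLIntegral_mono' hB fun x hx => le_of_lt (hBS hx)
    have h2 := ENNReal.toReal_mono (measure_ne_top _ _) h1
    rw [ENNReal.toReal_mul, ENNReal.toReal_add (measure_ne_top _ _) (measure_ne_top _ _)] at h2
    rw [← ENNReal.toReal_le_toReal (measure_ne_top _ _) (measure_ne_top _ _)]
    norm_num at h2
    linarith
  · intro B hBS hB
    have h1 : κ a B ≤ 1/2 * (κ a B + η a B) := by
      rw [← hhalf, hd B hB]
      exact setLIntegral_mono' hB fun x hx => not_lt.mp (hBS hx)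
    have hne : (1/2 : ℝ≥0∞) * (κ a B + η a B) ≠ ∞ :=
      ENNReal.mul_ne_top (by simp) (ENNReal.add_ne_top.mpr ⟨measure_ne_top _ _, measure_ne_top _ _⟩)
    have h2 := ENNReal.toReal_mono hne h1
    rw [ENNReal.toReal_mul, ENNReal.toReal_add (measure_ne_top _ _) (measure_ne_top _ _)] at h2
    rw [← ENNReal.toReal_le_toReal (measure_ne_top _ _) (measure_ne_top _ _)]
    norm_num at h2
    linarith

/-! exponential mechanism -/

def emw {Θ Y : Type*} [Fintype Θ] (ε : ℝ) (u : Θ → Y → ℝ) (θ : Θ) (y : Y) : ℝ :=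
  Real.exp (-(ε/2 * u θ y)) / ∑ θ', Real.exp (-(ε/2 * u θ' y))

def emK {Θ Y O : Type*} [Fintype Θ] [MeasurableSpace Y] [MeasurableSpace O] (ε : ℝ) (u : Θ → Y → ℝ) (hu : ∀ θ, Measurable (u θ))
    (c : Θ → Y → O) (hc : ∀ θ, Measurable (c θ)) : Kernel Y O where
  toFun y := ∑ θ, ENNReal.ofReal (emw ε u θ y) • Measure.dirac (c θ y)
  measurable' := by
    refine Measure.measurable_of_measurable_coe _ fun s hs => ?_
    simp only [Measure.finsetSum_apply, Measure.smul_apply, smul_eq_mul]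
    refine Finset.measurable_fun_sum _ fun θ _ => Measurable.mul ?_ ?_
    · refine Measurable.ennreal_ofReal ?_
      unfold emw
      exact ((hu θ).const_mul _).neg.exp.div (Finset.measurable_fun_sum _ fun θ' _ => ((hu θ').const_mul _).neg.exp)
    · exact (Measure.measurable_coe hs).comp (Measure.measurable_dirac.comp (hc θ))

section
variable {Θ Y O : Type*} [Fintype Θ] [Nonempty Θ] [MeasurableSpace Y] [MeasurableSpace O] (ε : ℝ) (u : Θ → Y → ℝ)

theorem em_Z_pos (y : Y) : 0 < ∑ θ', Real.exp (-(ε/2 * u θ' y)) := Finset.sum_pos (fun _ _ => Real.exp_pos _) Finset.univ_nonempty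

theorem emw_nonneg (θ : Θ) (y : Y) : 0 ≤ emw ε u θ y := by
  have := em_Z_pos ε u y
  unfold emw; positivity

theorem emw_sum (y : Y) : ∑ θ, emw ε u θ y = 1 := by
  unfold emw; rw [← Finset.sum_div]; exact div_self (em_Z_pos ε u y).ne'

variable (hu : ∀ θ, Measurable (u θ)) (c : Θ → Y → O) (hc : ∀ θ, Measurable (c θ))

theorem em_apply (y : Y) (s : Set O) : emK ε u hu c hc y s = ∑ θ, ENNReal.ofReal (emw ε u θ y) * Measure.dirac (c θ y) s := by
  show (∑ θ, ENNReal.ofReal (emw ε u θ y) • Measure.dirac (c θ y)) s = _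
  simp only [Measure.finsetSum_apply, Measure.smul_apply, smul_eq_mul]

theorem em_markov : IsMarkovKernel (emK ε u hu c hc) := by
  refine ⟨fun y => ⟨?_⟩⟩
  rw [em_apply]
  simp only [measure_univ, mul_one]
  rw [← ENNReal.ofReal_sum_of_nonneg fun θ _ => emw_nonneg ε u θ y, emw_sum, ENNReal.ofReal_one]

theorem em_dp (hε : 0 ≤ ε) (y y' : Y) (h : ∀ θ, |u θ y - u θ y'| ≤ 1) (hcc : ∀ θ, c θ y = c θ y') (s : Set O) :
    emK ε u hu c hc y s ≤ ENNReal.ofReal (Real.exp ε) * emK ε u hu c hc y' s := by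
  rw [em_apply, em_apply, Finset.mul_sum]
  refine Finset.sum_le_sum fun θ _ => ?_
  rw [hcc θ, ← mul_assoc, ← ENNReal.ofReal_mul (Real.exp_pos _).le]
  gcongr
  have hb : ∀ θ, Real.exp (-(ε/2 * u θ y)) ≤ Real.exp (ε/2) * Real.exp (-(ε/2 * u θ y')) := by
    intro θ; rw [← Real.exp_add]; apply Real.exp_le_exp.mpr
    have := (abs_le.mp (h θ)).1; nlinarith
  have hb' : ∀ θ, Real.exp (-(ε/2 * u θ y')) ≤ Real.exp (ε/2) * Real.exp (-(ε/2 * u θ y)) := by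
    intro θ; rw [← Real.exp_add]; apply Real.exp_le_exp.mpr
    have := (abs_le.mp (h θ)).2; nlinarith
  have hZ : ∑ θ', Real.exp (-(ε/2 * u θ' y')) ≤ Real.exp (ε/2) * ∑ θ', Real.exp (-(ε/2 * u θ' y)) := by
    rw [Finset.mul_sum]; exact Finset.sum_le_sum fun θ _ => hb' θ
  have z1 := em_Z_pos ε u y
  have z2 := em_Z_pos ε u y'
  unfold emw
  rw [mul_div_assoc', div_le_div_iff₀ z1 z2]
  have e : Real.exp ε = Real.exp (ε/2) * Real.exp (ε/2) := by rw [← Real.exp_add]; congr 1; ring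
  rw [e]
  calc _ ≤ (Real.exp (ε/2) * Real.exp (-(ε/2 * u θ y'))) * (Real.exp (ε/2) * ∑ θ', Real.exp (-(ε/2 * u θ' y))) :=
        mul_le_mul (hb θ) hZ z2.le (by positivity)
    _ = _ := by ring

theorem em_util (hε : 0 ≤ ε) (y : Y) (θ0 : Θ) (r s : ℝ) (h0 : u θ0 y ≤ r) (G : Set O) (hG : ∀ θ, u θ y ≤ r + s → c θ y ∈ G) :
    ENNReal.ofReal (1 - Fintype.card Θ * Real.exp (-(ε/2*s))) ≤ emK ε u hu c hc y G := by
  classical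
  rw [em_apply]
  have hbad : ∀ θ, ¬ (u θ y ≤ r + s) → emw ε u θ y ≤ Real.exp (-(ε/2*s)) := by
    intro θ hθ
    push Not at hθ
    unfold emw
    rw [div_le_iff₀ (em_Z_pos ε u y)]
    calc Real.exp (-(ε/2 * u θ y)) ≤ Real.exp (-(ε/2*s)) * Real.exp (-(ε/2 * u θ0 y)) := by
          rw [← Real.exp_add]; apply Real.exp_le_exp.mpr; nlinarith
      _ ≤ _ := by
          gcongr
          exact Finset.single_le_sum (f := fun θ' => Real.exp (-(ε/2 * u θ' y))) (fun _ _ => (Real.exp_pos _).le) (Finset.mem_univ θ0)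
  calc _ ≤ ENNReal.ofReal (∑ θ, if u θ y ≤ r + s then emw ε u θ y else 0) := by
        apply ENNReal.ofReal_le_ofReal
        have h1 : ∑ θ, (emw ε u θ y - Real.exp (-(ε/2*s))) ≤ ∑ θ, if u θ y ≤ r + s then emw ε u θ y else 0 := by
          refine Finset.sum_le_sum fun θ _ => ?_
          split_ifs with h
          · linarith [Real.exp_pos (-(ε/2*s))]
          · linarith [hbad θ h]
        rw [Finset.sum_sub_distrib, emw_sum] at h1
        simpa using h1
    _ = ∑ θ, ENNReal.ofReal (if u θ y ≤ r + s then emw ε u θ y else 0) := by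
        rw [ENNReal.ofReal_sum_of_nonneg]
        intro θ _; split_ifs
        · exact emw_nonneg ε u θ y
        · exact le_rfl
    _ ≤ _ := by
        refine Finset.sum_le_sum fun θ _ => ?_
        split_ifs with h
        · have : (1:ℝ≥0∞) ≤ Measure.dirac (c θ y) G := by
            have := Measure.le_dirac_apply (a := c θ y) (s := G)
            rwa [Set.indicator_of_mem (hG θ h)] at this
          calc _ = ENNReal.ofReal (emw ε u θ y) * 1 := (mul_one _).symm
            _ ≤ _ := by gcongr
        · simp
end

/-! Hoeffding -/

open Classical in
def cnt {E : Type*} {n : ℕ} (A : Set E) (x : Fin n → E) : ℝ := ∑ i, if x i ∈ A then (1:ℝ) else 0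

theorem meas_cnt {E F : Type*} [MeasurableSpace E] [MeasurableSpace F] {n : ℕ} (S : Set (F × E)) (hS : MeasurableSet S) :
    Measurable fun y : F × (Fin n → E) => cnt (Prod.mk y.1 ⁻¹' S) y.2 := by
  classical
  unfold cnt
  refine Finset.measurable_fun_sum _ fun i _ => ?_
  refine Measurable.ite ?_ measurable_const measurable_const
  have : Measurable fun y : F × (Fin n → E) => (y.1, y.2 i) := measurable_fst.prodMk ((measurable_pi_apply i).comp measurable_snd)
  exact this hS

theorem cnt_adj {E : Type*} {n : ℕ} (A : Set E) (x x' : Fin n → E) (h : ∃ i, ∀ j, j ≠ i → x j = x' j) : |cnt A x - cnt A x'| ≤ 1 := by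
  classical
  obtain ⟨i, hi⟩ := h
  unfold cnt
  rw [← Finset.sum_sub_distrib, Finset.sum_eq_single i]
  · split_ifs <;> simp
  · intro j _ hj; rw [hi j hj]; simp
  · simp

theorem hoeff {E : Type*} [MeasurableSpace E] (D : Measure E) [IsProbabilityMeasure D] {n : ℕ} (A : Set E) (hA : MeasurableSet A) (c : ℝ) (hc : 0 ≤ c) :
    (Measure.pi fun _ : Fin n => D) {x | n * c < |n * (D A).toReal - cnt A x|} ≤ ENNReal.ofReal (2 * Real.exp (-(2 * n * c^2))) := by
  classical
  set f : E → ℝ := fun y => if y ∈ A then (1:ℝ) else 0 with hf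
  have hfm : Measurable f := Measurable.ite hA measurable_const measurable_const
  have hIntg : ∫ y, f y ∂D = (D A).toReal := by
    have : f = A.indicator 1 := by ext y; simp [hf, Set.indicator]
    rw [this, integral_indicator_one hA]; rfl
  have gen : ∀ g : E → ℝ, Measurable g → (∀ y, g y ∈ Set.Icc (0:ℝ) 1 ∨ g y ∈ Set.Icc (-1:ℝ) 0) → (∃ a b : ℝ, b - a = 1 ∧ ∀ y, g y ∈ Set.Icc a b) →
      (Measure.pi fun _ : Fin n => D).real {x | n * c ≤ ∑ i, (g (x i) - ∫ y, g y ∂D)} ≤ Real.exp (-(2 * n * c^2)) := by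
    intro g hg _ ⟨a, b, hab, hgb⟩
    have hs := hasSubgaussianMGF_of_mem_Icc (μ := D) (X := g) hg.aemeasurable (Filter.Eventually.of_forall hgb)
    have hind : iIndepFun (fun (i : Fin n) (x : Fin n → E) => g (x i) - ∫ y, g y ∂D) (Measure.pi fun _ : Fin n => D) :=
      iIndepFun_pi (X := fun _ y => g y - ∫ y, g y ∂D) (fun i => (hg.sub_const _).aemeasurable)
    have hsub : ∀ i ∈ (Finset.univ : Finset (Fin n)), HasSubgaussianMGF (fun x : Fin n → E => g (x i) - ∫ y, g y ∂D) ((‖b - a‖₊ / 2) ^ 2) (Measure.pi fun _ : Fin n => D) := by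
      intro i _
      have hmp := measurePreserving_eval (fun _ : Fin n => D) i
      have := hmp.map_eq
      rw [← this] at hs
      have h2 := HasSubgaussianMGF.of_map (Y := fun x : Fin n → E => x i) (measurable_pi_apply i).aemeasurable hs
      rw [this] at h2
      exact h2
    have := HasSubgaussianMGF.measure_sum_ge_le_of_iIndepFun hind hsub (ε := n * c) (by positivity)
    refine this.trans (le_of_eq ?_)
    congr 1
    rw [hab]
    simp
    rcases Nat.eq_zero_or_pos n with h | h
    · subst h; simp
    · have : (n:ℝ) ≠ 0 := by positivity
      field_simp
  have g1 := gen f hfm (fun y => by left; simp only [hf]; split_ifs <;> simp) ⟨0, 1, by norm_num, fun y => by simp only [hf]; split_ifs <;> simp⟩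
  have g2 := gen (fun y => - f y) hfm.neg (fun y => by right; simp only [hf]; split_ifs <;> simp) ⟨-1, 0, by norm_num, fun y => by simp only [hf]; split_ifs <;> simp⟩
  have e1 : ∀ x : Fin n → E, ∑ i, (f (x i) - ∫ y, f y ∂D) = cnt A x - n * (D A).toReal := by
    intro x; rw [Finset.sum_sub_distrib, hIntg]; simp [cnt, hf]
  have e2 : ∀ x : Fin n → E, ∑ i, (-f (x i) - ∫ y, -f y ∂D) = n * (D A).toReal - cnt A x := by
    intro x; rw [Finset.sum_sub_distrib, integral_neg, hIntg]; simp [cnt, hf]; ring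
  simp only [e1] at g1
  simp only [e2] at g2
  have hcover : {x : Fin n → E | n * c < |n * (D A).toReal - cnt A x|} ⊆ {x | n * c ≤ cnt A x - n * (D A).toReal} ∪ {x | n * c ≤ n * (D A).toReal - cnt A x} := by
    intro x hx
    have hx' : n * c < |n * (D A).toReal - cnt A x| := hx
    rcases lt_abs.mp hx' with h | h
    · right; exact h.le
    · left; show n * c ≤ cnt A x - n * (D A).toReal; linarith
  refine (measure_mono hcover).trans ((measure_union_le _ _).trans ?_)
  rw [two_mul, ENNReal.ofReal_add (Real.exp_pos _).le (Real.exp_pos _).le]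
  exact add_le_add ((ENNReal.le_ofReal_iff_toReal_le (measure_ne_top _ _) (Real.exp_pos _).le).mpr g1)
    ((ENNReal.le_ofReal_iff_toReal_le (measure_ne_top _ _) (Real.exp_pos _).le).mpr g2)

end

section
open Classical in
def AC' {d : ℕ} (F : Fin (d+1) → Fin (d+1) → ℝ) : Matrix (Fin d) (Fin d) ℝ :=
  if (AC F).det = 0 then 1 else AC F

theorem AC'_det {d : ℕ} (F : Fin (d+1) → Fin (d+1) → ℝ) : (AC' F).det ≠ 0 := by
  unfold AC'; split_ifs with h
  · simp
  · exact h

theorem covC_eq {d : ℕ} (F : Fin (d+1) → Fin (d+1) → ℝ) : covC F = AC' F * (AC' F)ᵀ := by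
  unfold covC AC'; split_ifs <;> simp

theorem meas_gaussC {ι : Type*} {d p G M : ℕ} (θ : ℝ) (y : Ix ι p (d+1) G M) (B : Set (Fin d → ℝ)) (hB : MeasurableSet B) :
    Measurable fun fr : ι → Fin p → Fin (d+1) → ℝ => gauss d (muC (frm θ fr y)) (covC (frm θ fr y)) B := by
  have hF : ∀ s r, Measurable fun fr : ι → Fin p → Fin (d+1) → ℝ => frm θ fr y s r := by
    intro s r
    unfold frm
    refine Finset.measurable_fun_sum _ fun i _ => ?_
    exact Measurable.const_mul (by fun_prop) _
  have hmu : ∀ r, Measurable fun fr : ι → Fin p → Fin (d+1) → ℝ => muC (frm θ fr y) r := by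
    intro r; unfold muC; exact (hF _ _).div (hF _ _)
  have hAC : ∀ r s, Measurable fun fr : ι → Fin p → Fin (d+1) → ℝ => AC (frm θ fr y) r s := by
    intro r s; unfold AC; exact (hF _ _).sub ((hF _ _).mul (hmu _))
  have hAC' : ∀ r s, Measurable fun fr : ι → Fin p → Fin (d+1) → ℝ => AC' (frm θ fr y) r s := by
    intro r s; unfold AC'
    have : (fun fr : ι → Fin p → Fin (d+1) → ℝ => (if (AC (frm θ fr y)).det = 0 then (1 : Matrix (Fin d) (Fin d) ℝ) else AC (frm θ fr y)) r s) =
      fun fr => if (AC (frm θ fr y)).det = 0 then (1 : Matrix (Fin d) (Fin d) ℝ) r s else AC (frm θ fr y) r s := by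
      ext fr; split_ifs <;> rfl
    rw [this]
    refine Measurable.ite ?_ measurable_const (hAC r s)
    exact measurableSet_eq_fun (meas_det _ hAC) measurable_const
  haveI := stdG_prob (Fin d)
  have hf : Measurable fun z : (ι → Fin p → Fin (d+1) → ℝ) × (Fin d → ℝ) => muC (frm θ z.1 y) + AC' (frm θ z.1 y) *ᵥ z.2 := by
    refine measurable_pi_lambda _ fun r => ?_
    simp only [Pi.add_apply, mulVec, dotProduct]
    refine ((hmu r).comp measurable_fst).add (Finset.measurable_fun_sum _ fun s _ => ?_)
    exact ((hAC' r s).comp measurable_fst).mul ((measurable_pi_apply s).comp measurable_snd)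
  have := measurable_measure_prodMk_left (ν := stdG (Fin d)) (hf hB)
  convert this using 1
  ext fr
  rw [covC_eq, gauss_eq_map _ _ _ (AC'_det _), Measure.map_apply (meas_aff1 _ _) hB]
  rfl

def candK {ι : Type*} {d p k G M : ℕ} (θ : ℝ) (x : Fin k → Ix ι p (d+1) G M) : Kernel (ι → Fin p → Fin (d+1) → ℝ) (Fin d → ℝ) where
  toFun fr := mixture d k (cand θ x fr).1 (cand θ x fr).2.1 (cand θ x fr).2.2
  measurable' := by
    refine Measure.measurable_of_measurable_coe _ fun B hB => ?_
    unfold mixture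
    simp only [Measure.sum_apply _ hB, tsum_fintype, Measure.smul_apply, smul_eq_mul]
    refine Finset.measurable_fun_sum _ fun j _ => ?_
    have hc : Measurable fun _ : ι → Fin p → Fin (d+1) → ℝ => ENNReal.ofReal (wC (fun j => ((x j).1 : ℕ)) j) := measurable_const
    exact hc.mul (meas_gaussC θ (x j) B hB)

theorem candK_markov {ι : Type*} {d p k G M : ℕ} (hk : 1 ≤ k) (θ : ℝ) (x : Fin k → Ix ι p (d+1) G M) : IsMarkovKernel (candK (d := d) θ x) :=
  ⟨fun fr => mixture_prob _ _ _ (cand_valid hk θ x fr)⟩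

/-! selection -/
section sel
variable {F Θ : Type*} [MeasurableSpace F] [Fintype Θ] [Nonempty Θ] {d : ℕ} (H : Θ → Kernel F (Fin d → ℝ)) [∀ θ, IsMarkovKernel (H θ)]

def SS (θ θ' : Θ) : Set (F × (Fin d → ℝ)) := Classical.choose (scheffe (H θ) (H θ'))

theorem SS_meas (θ θ' : Θ) : MeasurableSet (SS H θ θ') := (Classical.choose_spec (scheffe (H θ) (H θ'))).1

theorem SS_spec (θ θ' : Θ) (a : F) (B : Set (Fin d → ℝ)) (hB : MeasurableSet B) :
    |(H θ a B).toReal - (H θ' a B).toReal| ≤ (H θ a (Prod.mk a ⁻¹' SS H θ θ')).toReal - (H θ' a (Prod.mk a ⁻¹' SS H θ θ')).toReal :=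
  (Classical.choose_spec (scheffe (H θ) (H θ'))).2 a B hB

def uS (n : ℕ) (θ : Θ) (y : F × (Fin n → Fin d → ℝ)) : ℝ :=
  Finset.univ.sup' Finset.univ_nonempty fun θ' : Θ => |n * (H θ y.1 (Prod.mk y.1 ⁻¹' SS H θ θ')).toReal - cnt (Prod.mk y.1 ⁻¹' SS H θ θ') y.2|

theorem meas_uS (n : ℕ) (θ : Θ) : Measurable (uS H n θ) := by
  have h : ∀ θ' : Θ, Measurable fun y : F × (Fin n → Fin d → ℝ) => |n * (H θ y.1 (Prod.mk y.1 ⁻¹' SS H θ θ')).toReal - cnt (Prod.mk y.1 ⁻¹' SS H θ θ') y.2| := by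
    intro θ'
    refine Measurable.abs (Measurable.sub (Measurable.const_mul ?_ _) (meas_cnt _ (SS_meas H θ θ')))
    exact ((Kernel.measurable_kernel_prodMk_left (κ := H θ) (SS_meas H θ θ')).comp measurable_fst).ennreal_toReal
  have := Finset.measurable_sup' (s := (Finset.univ : Finset Θ)) Finset.univ_nonempty (fun θ' _ => h θ')
  convert this using 1
  ext y; simp [uS, Finset.sup'_apply]

theorem uS_adj (n : ℕ) (θ : Θ) (a : F) (x x' : Fin n → Fin d → ℝ) (h : Adjacent x x') : |uS H n θ (a, x) - uS H n θ (a, x')| ≤ 1 := by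
  have key : ∀ x x' : Fin n → Fin d → ℝ, Adjacent x x' → uS H n θ (a, x) ≤ uS H n θ (a, x') + 1 := by
    intro x x' h
    refine Finset.sup'_le _ _ fun θ' _ => ?_
    have h1 := cnt_adj (Prod.mk a ⁻¹' SS H θ θ') x x' h
    have h2 : |n * (H θ a (Prod.mk a ⁻¹' SS H θ θ')).toReal - cnt (Prod.mk a ⁻¹' SS H θ θ') x'| ≤ uS H n θ (a, x') :=
      Finset.le_sup' (fun θ' : Θ => |n * (H θ a (Prod.mk a ⁻¹' SS H θ θ')).toReal - cnt (Prod.mk a ⁻¹' SS H θ θ') x'|) (Finset.mem_univ θ')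
    show |n * (H θ a (Prod.mk a ⁻¹' SS H θ θ')).toReal - cnt (Prod.mk a ⁻¹' SS H θ θ') x| ≤ _
    rw [abs_le] at h1 h2 ⊢
    constructor <;> linarith [h1.1, h1.2, h2.1, h2.2]
  obtain ⟨i, hi⟩ := h
  have k1 := key x x' ⟨i, hi⟩
  have k2 := key x' x ⟨i, fun j hj => (hi j hj).symm⟩
  rw [abs_le]; constructor <;> linarith

theorem sel_util {n : ℕ} (hn : 1 ≤ n) (D : Measure (Fin d → ℝ)) (a : F) (x : Fin n → Fin d → ℝ) (θ0 : Θ) (τ c s : ℝ)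
    (h0 : ∀ B, MeasurableSet B → |(H θ0 a B).toReal - (D B).toReal| ≤ τ)
    (hx : ∀ θ θ', |n * (D (Prod.mk a ⁻¹' SS H θ θ')).toReal - cnt (Prod.mk a ⁻¹' SS H θ θ') x| ≤ n * c) :
    uS H n θ0 (a, x) ≤ n * (τ + c) ∧ ∀ θ, uS H n θ (a, x) ≤ n * (τ + c) + s →
      ∀ B, MeasurableSet B → |(H θ a B).toReal - (D B).toReal| ≤ 3 * τ + 2 * c + s / n := by
  have hn0 : (0:ℝ) < n := by exact_mod_cast hn
  constructor
  · refine Finset.sup'_le _ _ fun θ' _ => ?_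
    have h1 := h0 _ (measurable_prodMk_left (x := a) (SS_meas H θ0 θ'))
    have h2 := hx θ0 θ'
    show |n * (H θ0 a (Prod.mk a ⁻¹' SS H θ0 θ')).toReal - cnt (Prod.mk a ⁻¹' SS H θ0 θ') x| ≤ _
    rw [abs_le] at h1 h2 ⊢
    constructor <;> nlinarith [h1.1, h1.2, h2.1, h2.2]
  · intro θ hθ B hB
    have h1 := h0 _ (measurable_prodMk_left (x := a) (SS_meas H θ θ0))
    have h2 := hx θ θ0
    have h3 : |n * (H θ a (Prod.mk a ⁻¹' SS H θ θ0)).toReal - cnt (Prod.mk a ⁻¹' SS H θ θ0) x| ≤ uS H n θ (a, x) :=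
      Finset.le_sup' (fun θ' : Θ => |n * (H θ a (Prod.mk a ⁻¹' SS H θ θ')).toReal - cnt (Prod.mk a ⁻¹' SS H θ θ') x|) (Finset.mem_univ θ0)
    have h4 := SS_spec H θ θ0 a B hB
    have h5 := h0 B hB
    have h6 : (H θ a (Prod.mk a ⁻¹' SS H θ θ0)).toReal - (H θ0 a (Prod.mk a ⁻¹' SS H θ θ0)).toReal ≤ 2 * τ + 2 * c + s / n := by
      have hs : n * (s / n) = s := by field_simp
      have : n * ((H θ a (Prod.mk a ⁻¹' SS H θ θ0)).toReal - (H θ0 a (Prod.mk a ⁻¹' SS H θ θ0)).toReal) ≤ n * (2 * τ + 2 * c + s / n) := by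
        have a1 := (abs_le.mp h3).2
        have a2 := (abs_le.mp h2).1
        have a3 := (abs_le.mp h1).1
        nlinarith
      exact le_of_mul_le_mul_left this hn0
    calc _ = |((H θ a B).toReal - (H θ0 a B).toReal) + ((H θ0 a B).toReal - (D B).toReal)| := by congr 1; ring
      _ ≤ _ := abs_add_le _ _
      _ ≤ _ := by linarith

end sel

/-! splitting -/
theorem pi_reindex {E I J : Type*} [MeasurableSpace E] [Fintype I] [Fintype J] (D : Measure E) [IsProbabilityMeasure D] (e : J → I) (he : Function.Injective e) :
    (Measure.pi fun _ : I => D).map (fun x j => x (e j)) = Measure.pi fun _ : J => D := by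
  have hind : iIndepFun (fun (i : I) (x : I → E) => x i) (Measure.pi fun _ : I => D) :=
    iIndepFun_pi (X := fun _ y => y) (fun i => aemeasurable_id)
  have h2 := hind.precomp he
  rw [iIndepFun_iff_map_fun_eq_pi_map (fun j => (measurable_pi_apply _).aemeasurable)] at h2
  rw [h2]
  congr 1
  ext1 j
  exact (measurePreserving_eval (fun _ : I => D) (e j)).map_eq

theorem pi_split {E I J1 J2 : Type*} [MeasurableSpace E] [Fintype I] [Fintype J1] [Fintype J2] (D : Measure E) [IsProbabilityMeasure D] (e : J1 ⊕ J2 → I) (he : Function.Injective e) :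
    (Measure.pi fun _ : I => D).map (fun x => ((fun j => x (e (Sum.inl j))), (fun j => x (e (Sum.inr j))))) = (Measure.pi fun _ : J1 => D).prod (Measure.pi fun _ : J2 => D) := by
  have h1 := pi_reindex D e he
  have h2 := (measurePreserving_sumPiEquivProdPi (fun _ : J1 ⊕ J2 => D)).map_eq
  rw [← h2, ← h1, Measure.map_map (MeasurableEquiv.measurable _) (by fun_prop)]
  rfl

end

section
section comp
variable {F Θ O : Type*} [MeasurableSpace F] [MeasurableSpace O] [Fintype Θ] [Nonempty Θ] {d : ℕ} (H : Θ → Kernel F (Fin d → ℝ)) [∀ θ, IsMarkovKernel (H θ)]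
  (c : Θ → F → O) (hc : ∀ θ, Measurable (c θ))

def emS (ε : ℝ) (n : ℕ) : Kernel (F × (Fin n → Fin d → ℝ)) O :=
  emK ε (uS H n) (meas_uS H n) (fun θ y => c θ y.1) (fun θ => (hc θ).comp measurable_fst)

theorem emS_markov (ε : ℝ) (n : ℕ) : IsMarkovKernel (emS H c hc ε n) := em_markov _ _ _ _ _

variable {n n1 n2 : ℕ} (e : Fin n1 ⊕ Fin n2 → Fin n) (K1 : Kernel (Fin n1 → Fin d → ℝ) F)

def res1 (x : Fin n → Fin d → ℝ) : Fin n1 → Fin d → ℝ := fun j => x (e (Sum.inl j))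
def res2 (x : Fin n → Fin d → ℝ) : Fin n2 → Fin d → ℝ := fun j => x (e (Sum.inr j))

theorem meas_res1 : Measurable (res1 (d := d) e) := by unfold res1; fun_prop
theorem meas_res2 : Measurable (res2 (d := d) e) := by unfold res2; fun_prop

def compK (ε : ℝ) : Kernel (Fin n → Fin d → ℝ) O :=
  (emS H c hc ε n2) ∘ₖ ((K1.comap (res1 e) (meas_res1 e)) ×ₖ Kernel.deterministic (res2 e) (meas_res2 e))

variable [IsMarkovKernel K1]

theorem compK_markov (ε : ℝ) : IsMarkovKernel (compK H c hc e K1 ε) := by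
  haveI := emS_markov H c hc ε n2
  unfold compK; infer_instance

theorem compK_apply (ε : ℝ) (x : Fin n → Fin d → ℝ) (s : Set O) (hs : MeasurableSet s) :
    compK H c hc e K1 ε x s = ∫⁻ fr, emS H c hc ε n2 (fr, res2 e x) s ∂(K1 (res1 e x)) := by
  haveI := emS_markov H c hc ε n2
  unfold compK
  rw [Kernel.comp_apply' _ _ _ hs, Kernel.prod_apply, Kernel.comap_apply, Kernel.deterministic_apply,
    lintegral_prod _ (Kernel.measurable_coe _ hs).aemeasurable]
  refine lintegral_congr fun fr => ?_
  have hm : Measurable fun y : Fin n2 → Fin d → ℝ => emS H c hc ε n2 (fr, y) s :=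
    (Kernel.measurable_coe _ hs).comp measurable_prodMk_left
  rw [lintegral_dirac' _ hm]

theorem compK_dp (he : Function.Injective e) (ε δ : ℝ) (hε : 0 ≤ ε) (h1 : IsDP K1 ε δ) : IsDP (compK H c hc e K1 ε) ε δ := by
  intro X X' hadj s hs
  haveI := emS_markov H c hc ε n2
  rw [compK_apply _ _ _ _ _ _ _ _ hs, compK_apply _ _ _ _ _ _ _ _ hs]
  obtain ⟨i, hi⟩ := hadj
  by_cases hr : ∃ j : Fin n1, e (Sum.inl j) = i
  · obtain ⟨j, hj⟩ := hr
    have h2 : res2 e X = res2 e X' := by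
      ext1 l; unfold res2
      apply hi
      intro hl; rw [← hj] at hl; exact absurd (he hl) (by simp)
    have ha : Adjacent (res1 e X) (res1 e X') := by
      refine ⟨j, fun l hl => hi _ ?_⟩
      intro hl'; rw [← hj] at hl'; exact hl (Sum.inl_injective (he hl'))
    rw [h2]
    refine dp_lint ENNReal.ofReal_ne_top (h1 _ _ ha) _ ?_ fun x => prob_le_one
    exact (Kernel.measurable_coe _ hs).comp measurable_prodMk_right
  · push Not at hr
    have h1' : res1 e X = res1 e X' := by
      ext1 l; unfold res1
      exact hi _ (hr l)
    have hu : ∀ fr θ, |uS H n2 θ (fr, res2 e X') - uS H n2 θ (fr, res2 e X)| ≤ 1 := by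
      intro fr θ
      by_cases hr2 : ∃ j : Fin n2, e (Sum.inr j) = i
      · obtain ⟨j, hj⟩ := hr2
        refine uS_adj H n2 θ fr _ _ ⟨j, fun l hl => (hi _ ?_).symm⟩
        intro hl'; rw [← hj] at hl'; exact hl (Sum.inr_injective (he hl'))
      · push Not at hr2
        have h2' : res2 e X = res2 e X' := by
          ext1 l; unfold res2
          exact hi _ (hr2 l)
        rw [h2']; simp
    rw [h1']
    have hm : Measurable fun fr => emS H c hc ε n2 (fr, res2 e X) s := (Kernel.measurable_coe _ hs).comp measurable_prodMk_right
    refine le_trans ?_ le_self_add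
    rw [← lintegral_const_mul _ hm]
    refine lintegral_mono fun fr => ?_
    exact em_dp ε _ _ _ _ hε _ _ (hu fr) (fun θ => rfl) s

theorem compK_util (he : Function.Injective e) (ε : ℝ) (hε : 0 ≤ ε) (hn2 : 1 ≤ n2) (D : Measure (Fin d → ℝ)) [IsProbabilityMeasure D]
    (bad : Set F) (hbad : MeasurableSet bad) (b1 : ℝ≥0∞) (hb1 : ∫⁻ x, K1 x bad ∂(Measure.pi fun _ : Fin n1 => D) ≤ b1)
    (τ cc s : ℝ) (hcc : 0 ≤ cc)
    (hgood : ∀ fr, fr ∉ bad → ∃ θ, ∀ B, MeasurableSet B → |(H θ fr B).toReal - (D B).toReal| ≤ τ)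
    (T : Set O) (hT : ∀ θ fr, (∀ B, MeasurableSet B → |(H θ fr B).toReal - (D B).toReal| ≤ 3 * τ + 2 * cc + s / n2) → c θ fr ∈ T)
    (hH : (Fintype.card Θ : ℝ)^2 * (2 * Real.exp (-(2 * n2 * cc^2))) ≤ 1/100)
    (hE : (Fintype.card Θ : ℝ) * Real.exp (-(ε/2*s)) ≤ 1/100) :
    1 ≤ ((Measure.pi fun _ : Fin n => D).bind fun x => compK H c hc e K1 ε x) T + (b1 + ENNReal.ofReal (2/100)) := by
  haveI := emS_markov H c hc ε n2
  haveI := compK_markov H c hc e K1 ε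
  set ππ := (Measure.pi fun _ : Fin n => D) with hpi
  set T' := toMeasurable (ππ.bind fun x => compK H c hc e K1 ε x) T with hT'
  have hTm : MeasurableSet T' := measurableSet_toMeasurable _ _
  rw [← measure_toMeasurable T, ← hT', Measure.bind_apply hTm (Kernel.measurable _).aemeasurable]
  set V : Set (F × (Fin n2 → Fin d → ℝ)) := {y | ∃ θ θ', n2 * cc < |n2 * (D (Prod.mk y.1 ⁻¹' SS H θ θ')).toReal - cnt (Prod.mk y.1 ⁻¹' SS H θ θ') y.2|} with hV
  have hVm : MeasurableSet V := by
    have : V = ⋃ θ : Θ, ⋃ θ' : Θ, {y : F × (Fin n2 → Fin d → ℝ) | n2 * cc < |n2 * (D (Prod.mk y.1 ⁻¹' SS H θ θ')).toReal - cnt (Prod.mk y.1 ⁻¹' SS H θ θ') y.2|} := by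
      ext y; simp [hV]
    rw [this]
    refine MeasurableSet.iUnion fun θ => MeasurableSet.iUnion fun θ' => measurableSet_lt measurable_const ?_
    refine Measurable.abs (Measurable.sub (Measurable.const_mul ?_ _) (meas_cnt _ (SS_meas H θ θ')))
    exact ((measurable_measure_prodMk_left (ν := D) (SS_meas H θ θ')).comp measurable_fst).ennreal_toReal
  have hVp : ∀ fr, (Measure.pi fun _ : Fin n2 => D) (Prod.mk fr ⁻¹' V) ≤ ENNReal.ofReal (1/100) := by
    intro fr
    have hsub : Prod.mk fr ⁻¹' V ⊆ ⋃ p : Θ × Θ, {x : Fin n2 → Fin d → ℝ | n2 * cc < |n2 * (D (Prod.mk fr ⁻¹' SS H p.1 p.2)).toReal - cnt (Prod.mk fr ⁻¹' SS H p.1 p.2) x|} := by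
      intro x hx
      obtain ⟨θ, θ', h⟩ := hx
      exact Set.mem_iUnion.mpr ⟨(θ, θ'), h⟩
    refine (measure_mono hsub).trans ((measure_iUnion_fintype_le _ _).trans ?_)
    calc _ ≤ ∑ p : Θ × Θ, ENNReal.ofReal (2 * Real.exp (-(2 * n2 * cc^2))) :=
          Finset.sum_le_sum fun p _ => hoeff D _ (measurable_prodMk_left (SS_meas H p.1 p.2)) cc hcc
      _ = ENNReal.ofReal ((Fintype.card Θ : ℝ)^2 * (2 * Real.exp (-(2 * n2 * cc^2)))) := by
          rw [Finset.sum_const, Finset.card_univ, Fintype.card_prod, nsmul_eq_mul, ENNReal.ofReal_mul (p := (Fintype.card Θ : ℝ)^2) (by positivity), ← Nat.cast_pow, ENNReal.ofReal_natCast, sq (Fintype.card Θ)]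
      _ ≤ _ := ENNReal.ofReal_le_ofReal hH
  have hpt : ∀ x, 1 ≤ compK H c hc e K1 ε x T' + ((K1 (res1 e x) bad + K1 (res1 e x) ((fun fr => (fr, res2 e x)) ⁻¹' V)) + ENNReal.ofReal (1/100)) := by
    intro x
    rw [compK_apply _ _ _ _ _ _ _ _ hTm]
    set P := K1 (res1 e x) with hP
    have hb : P bad = ∫⁻ fr, bad.indicator 1 fr ∂P := by rw [lintegral_indicator_one hbad]
    have hmV : MeasurableSet ((fun fr => (fr, res2 e x)) ⁻¹' V) := measurable_prodMk_right hVm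
    have hv : P ((fun fr => (fr, res2 e x)) ⁻¹' V) = ∫⁻ fr, ((fun fr => (fr, res2 e x)) ⁻¹' V).indicator 1 fr ∂P := by
      rw [lintegral_indicator_one hmV]
    have hcst : ENNReal.ofReal (1/100) = ∫⁻ _, ENNReal.ofReal (1/100) ∂P := by simp
    have hmb : Measurable (bad.indicator (1 : F → ℝ≥0∞)) := measurable_one.indicator hbad
    have hmv : Measurable (((fun fr => (fr, res2 e x)) ⁻¹' V).indicator (1 : F → ℝ≥0∞)) := measurable_one.indicator hmV
    rw [hb, hv, hcst, ← lintegral_add_left hmb, ← lintegral_add_right _ measurable_const, ← lintegral_add_left (f := fun fr => emS H c hc ε n2 (fr, res2 e x) T') ((Kernel.measurable_coe _ hTm).comp measurable_prodMk_right)]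
    calc (1:ℝ≥0∞) = ∫⁻ _, 1 ∂P := by simp
      _ ≤ _ := lintegral_mono fun fr => ?_
    by_cases h1 : fr ∈ bad
    · rw [Set.indicator_of_mem h1]
      calc (1:ℝ≥0∞) ≤ 1 + ((fun fr => (fr, res2 e x)) ⁻¹' V).indicator 1 fr := le_self_add
        _ ≤ _ := le_self_add
        _ ≤ _ := le_add_self
    by_cases h2 : fr ∈ ((fun fr => (fr, res2 e x)) ⁻¹' V)
    · rw [Set.indicator_of_mem h2]
      calc (1:ℝ≥0∞) ≤ bad.indicator 1 fr + 1 := le_add_self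
        _ ≤ _ := le_self_add
        _ ≤ _ := le_add_self
    · obtain ⟨θ0, hθ0⟩ := hgood fr h1
      have hx : ∀ θ θ', |n2 * (D (Prod.mk fr ⁻¹' SS H θ θ')).toReal - cnt (Prod.mk fr ⁻¹' SS H θ θ') (res2 e x)| ≤ n2 * cc := by
        intro θ θ'
        by_contra hcon
        push Not at hcon
        exact h2 ⟨θ, θ', hcon⟩
      obtain ⟨s1, s2⟩ := sel_util H hn2 D fr (res2 e x) θ0 τ cc s hθ0 hx
      have := em_util ε (uS H n2) (meas_uS H n2) (fun θ (y : F × (Fin n2 → Fin d → ℝ)) => c θ y.1) (fun θ => (hc θ).comp measurable_fst) hε (fr, res2 e x) θ0 _ s s1 T' (fun θ hθ => subset_toMeasurable _ _ (hT θ fr (s2 θ hθ)))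
      calc (1:ℝ≥0∞) = ENNReal.ofReal (99/100) + ENNReal.ofReal (1/100) := by
            rw [← ENNReal.ofReal_add (by norm_num) (by norm_num)]; norm_num
        _ ≤ emS H c hc ε n2 (fr, res2 e x) T' + ENNReal.ofReal (1/100) := by
            gcongr
            refine le_trans (ENNReal.ofReal_le_ofReal ?_) this
            linarith
        _ ≤ _ := by gcongr; exact le_add_self
  have hsplit : ππ.map (fun x => (res1 e x, res2 e x)) = (Measure.pi fun _ : Fin n1 => D).prod (Measure.pi fun _ : Fin n2 => D) := pi_split (E := Fin d → ℝ) D e he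
  have hmr : Measurable fun x : Fin n → Fin d → ℝ => (res1 e x, res2 e x) := (meas_res1 e).prodMk (meas_res2 e)
  have hi1 : ∫⁻ x, K1 (res1 e x) bad ∂ππ ≤ b1 := by
    have h1 : (ππ.map (res1 e)) = Measure.pi fun _ : Fin n1 => D := by
      exact pi_reindex D (fun j => e (Sum.inl j)) (he.comp Sum.inl_injective)
    rw [← h1, lintegral_map (Kernel.measurable_coe _ hbad) (meas_res1 e)] at hb1
    exact hb1
  have hmK : Measurable fun z : (Fin n1 → Fin d → ℝ) × (Fin n2 → Fin d → ℝ) => K1 z.1 ((fun fr => (fr, z.2)) ⁻¹' V) := by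
    have hVsw : MeasurableSet {q : ((Fin n1 → Fin d → ℝ) × (Fin n2 → Fin d → ℝ)) × F | (q.2, q.1.2) ∈ V} :=
      (measurable_snd.prodMk (measurable_snd.comp measurable_fst)) hVm
    exact Kernel.measurable_kernel_prodMk_left (κ := K1.comap Prod.fst measurable_fst) hVsw
  have hi2 : ∫⁻ x, K1 (res1 e x) ((fun fr => (fr, res2 e x)) ⁻¹' V) ∂ππ ≤ ENNReal.ofReal (1/100) := by
    have : ∫⁻ x, K1 (res1 e x) ((fun fr => (fr, res2 e x)) ⁻¹' V) ∂ππ = ∫⁻ z, K1 z.1 ((fun fr => (fr, z.2)) ⁻¹' V) ∂((Measure.pi fun _ : Fin n1 => D).prod (Measure.pi fun _ : Fin n2 => D)) := by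
      rw [← hsplit, lintegral_map hmK hmr]
    rw [this, lintegral_prod _ hmK.aemeasurable]
    calc _ ≤ ∫⁻ _, ENNReal.ofReal (1/100) ∂(Measure.pi fun _ : Fin n1 => D) := ?_
      _ = _ := by simp
    refine lintegral_mono fun x1 => ?_
    show ∫⁻ y, K1 x1 ((fun fr => (fr, y)) ⁻¹' V) ∂(Measure.pi fun _ : Fin n2 => D) ≤ ENNReal.ofReal (1/100)
    rw [← Measure.prod_apply_symm hVm, Measure.prod_apply hVm]
    calc _ ≤ ∫⁻ _, ENNReal.ofReal (1/100) ∂(K1 x1) := lintegral_mono fun fr => hVp fr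
      _ = _ := by simp
  calc (1:ℝ≥0∞) = ∫⁻ _, 1 ∂ππ := by simp [hpi]
    _ ≤ ∫⁻ x, (compK H c hc e K1 ε x T' + ((K1 (res1 e x) bad + K1 (res1 e x) ((fun fr => (fr, res2 e x)) ⁻¹' V)) + ENNReal.ofReal (1/100))) ∂ππ := lintegral_mono hpt
    _ = ∫⁻ x, compK H c hc e K1 ε x T' ∂ππ + ((∫⁻ x, K1 (res1 e x) bad ∂ππ + ∫⁻ x, K1 (res1 e x) ((fun fr => (fr, res2 e x)) ⁻¹' V) ∂ππ) + ENNReal.ofReal (1/100)) := by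
        rw [lintegral_add_left (Kernel.measurable_coe _ hTm), lintegral_add_right _ measurable_const, lintegral_add_left (f := fun x => K1 (res1 e x) bad) ((Kernel.measurable_coe _ hbad).comp (meas_res1 e))]
        simp [hpi]
    _ ≤ ∫⁻ x, compK H c hc e K1 ε x T' ∂ππ + ((b1 + ENNReal.ofReal (1/100)) + ENNReal.ofReal (1/100)) := by gcongr
    _ = _ := by
        rw [add_assoc b1, ← ENNReal.ofReal_add (by norm_num) (by norm_num)]; norm_num

end comp

end

section
section core
variable {ι : Type} [Fintype ι] [Nonempty ι] {d p k : ℕ} (G M : ℕ) {n n1 n2 : ℕ}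

/-- The two stage algorithm. -/
def algK (hk : 1 ≤ k) (e : Fin n1 ⊕ Fin n2 → Fin n)
    (K1 : Kernel (Fin n1 → Fin d → ℝ) (ι → Fin p → Fin (d+1) → ℝ)) (θ ε : ℝ) : Kernel (Fin n → Fin d → ℝ) (PS d k) :=
  haveI : ∀ x : Fin k → Ix ι p (d+1) G M, IsMarkovKernel (candK (ι := ι) (d := d) (p := p) (k := k) (G := G) (M := M) θ x) := fun x => candK_markov hk θ x
  compK (fun x : Fin k → Ix ι p (d+1) G M => candK θ x) (fun x => cand θ x) (fun x => meas_cand θ x) e K1 ε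

theorem algK_markov (hk : 1 ≤ k) (e : Fin n1 ⊕ Fin n2 → Fin n)
    (K1 : Kernel (Fin n1 → Fin d → ℝ) (ι → Fin p → Fin (d+1) → ℝ)) [IsMarkovKernel K1] (θ ε : ℝ) :
    IsMarkovKernel (algK (k := k) G M hk e K1 θ ε) := by
  haveI : ∀ x : Fin k → Ix ι p (d+1) G M, IsMarkovKernel (candK (ι := ι) (d := d) (p := p) (k := k) (G := G) (M := M) θ x) := fun x => candK_markov hk θ x
  unfold algK
  apply compK_markov

theorem algK_dp (hk : 1 ≤ k) (e : Fin n1 ⊕ Fin n2 → Fin n) (he : Function.Injective e)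
    (K1 : Kernel (Fin n1 → Fin d → ℝ) (ι → Fin p → Fin (d+1) → ℝ)) [IsMarkovKernel K1] (θ ε δ : ℝ) (hε : 0 ≤ ε)
    (h1 : IsDP K1 ε δ) : IsDP (algK (k := k) G M hk e K1 θ ε) ε δ := by
  haveI : ∀ x : Fin k → Ix ι p (d+1) G M, IsMarkovKernel (candK (ι := ι) (d := d) (p := p) (k := k) (G := G) (M := M) θ x) := fun x => candK_markov hk θ x
  unfold algK
  exact compK_dp _ _ _ _ _ he ε δ hε h1

/-- the bad event of stage 1 -/
def badS (hv : Finset (Fin k)) (K : ℝ) (μs : Fin k → Fin d → ℝ) (As : Fin k → Matrix (Fin d) (Fin d) ℝ) :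
    Set (ι → Fin p → Fin (d+1) → ℝ) :=
  {st | ¬ ∀ j ∈ hv, ∃ i, close2 K (Fmat (μs j) (As j)) Finset.univ (st i) Finset.univ}

theorem meas_badS (hv : Finset (Fin k)) (K : ℝ) (μs : Fin k → Fin d → ℝ) (As : Fin k → Matrix (Fin d) (Fin d) ℝ) :
    MeasurableSet (badS (ι := ι) (p := p) hv K μs As) := by
  classical
  refine MeasurableSet.compl (s := {st : ι → Fin p → Fin (d+1) → ℝ | ∀ j ∈ hv, ∃ i,
      close2 K (Fmat (μs j) (As j)) Finset.univ (st i) Finset.univ}) ?_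
  refine measurableSet_setOfPred.mpr ?_
  refine Measurable.forall fun j => Measurable.imp measurable_const (Measurable.exists fun i => ?_)
  refine measurableSet_setOfPred.mp ?_
  exact (meas_cl (D := d+1) K (Fmat (μs j) (As j)) (p := p)).preimage (measurable_pi_apply i)

/-- parameters of stage 2 -/
structure Par2 (d p k G M n2 : ℕ) (card : ℕ) (ε α τ K θ κ R ξ cc s : ℝ) : Prop where
  hk : 1 ≤ k
  hG : 1 ≤ G
  hε : 0 ≤ ε
  hn2 : 1 ≤ n2
  hτ : 0 ≤ τ
  hξ : k * τ + k / G ≤ ξ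
  hξ1 : ξ < 1
  hK : 1 ≤ K
  hθ : 0 < θ
  hM : K ≤ M * θ
  hκ0 : 0 ≤ κ
  hκ : 2 * (p * (θ * K)) ≤ κ
  hκ1 : κ ≤ 1/2
  hκ2 : 2 * (d:ℝ)^2 * κ < 1
  hR : 0 ≤ R
  hcc : 0 ≤ cc
  hα : 3 * (2 * ξ + pertErr d κ R) + 2 * cc + s / n2 ≤ α
  hH : ((((G+1) * (card * (2*M+1)^(p*(d+1))))^k : ℕ) : ℝ)^2 * (2 * Real.exp (-(2 * n2 * cc^2))) ≤ 1/100
  hE : ((((G+1) * (card * (2*M+1)^(p*(d+1))))^k : ℕ) : ℝ) * Real.exp (-(ε/2*s)) ≤ 1/100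

theorem TV_le_of {E : Type*} [MeasurableSpace E] (P Q : Measure E) (a : ℝ)
    (h : ∀ B, MeasurableSet B → |(P B).toReal - (Q B).toReal| ≤ a) : TV P Q ≤ a := by
  unfold TV
  haveI : Nonempty {s : Set E // MeasurableSet s} := ⟨⟨∅, MeasurableSet.empty⟩⟩
  exact ciSup_le fun A => h A.1 A.2

theorem algK_util {ε α τ K θ κ R ξ cc s : ℝ} (hP : Par2 d p k G M n2 (Fintype.card ι) ε α τ K θ κ R ξ cc s)
    (e : Fin n1 ⊕ Fin n2 → Fin n) (he : Function.Injective e)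
    (K1 : Kernel (Fin n1 → Fin d → ℝ) (ι → Fin p → Fin (d+1) → ℝ)) [IsMarkovKernel K1]
    (w : Fin k → ℝ) (h0 : ∀ i, 0 ≤ w i) (h1 : ∑ i, w i = 1) (μs : Fin k → Fin d → ℝ)
    (As : Fin k → Matrix (Fin d) (Fin d) ℝ) (hA : ∀ j, (As j).det ≠ 0) (b1 : ℝ≥0∞)
    (hb : ∫⁻ x, K1 x (badS (Finset.univ.filter fun j => τ ≤ w j) K μs As)
      ∂(Measure.pi fun _ : Fin n1 => mixture d k w μs (fun j => As j * (As j)ᵀ)) ≤ b1) :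
    1 ≤ ((Measure.pi fun _ : Fin n => mixture d k w μs (fun j => As j * (As j)ᵀ)).bind fun x => algK G M hP.hk e K1 θ ε x)
      {q : PS d k | IsMixtureParams q.1 q.2.2 ∧ TV (mixture d k q.1 q.2.1 q.2.2) (mixture d k w μs (fun j => As j * (As j)ᵀ)) ≤ α}
      + (b1 + ENNReal.ofReal (2/100)) := by
  have hpos : ∀ j, (As j * (As j)ᵀ).PosDef := by
    intro j
    have := Matrix.PosDef.mul_conjTranspose_self (As j) (by
      rw [Matrix.vecMul_injective_iff_isUnit, Matrix.isUnit_iff_isUnit_det]; exact (hA j).isUnit)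
    simpa using this
  haveI := mixture_prob w μs (fun j => As j * (As j)ᵀ) ⟨h0, h1, hpos⟩
  haveI : ∀ x : Fin k → Ix ι p (d+1) G M, IsMarkovKernel (candK (ι := ι) (d := d) (p := p) (k := k) (G := G) (M := M) θ x) := fun x => candK_markov hP.hk θ x
  have hcard : Fintype.card (Fin k → Ix ι p (d+1) G M) = ((G+1) * (Fintype.card ι * (2*M+1)^(p*(d+1))))^k := by
    simp [Ix, pow_mul]
  unfold algK
  refine compK_util _ _ _ e K1 he ε hP.hε hP.hn2 _ _ (meas_badS _ K μs As) b1 hb (2*ξ + pertErr d κ R) cc s hP.hcc ?_ _ ?_ ?_ ?_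
  · intro fr hfr
    have hfr' : ∀ j ∈ (Finset.univ.filter fun j => τ ≤ w j), ∃ i, close2 K (Fmat (μs j) (As j)) Finset.univ (fr i) Finset.univ := by
      by_contra hc; exact hfr hc
    exact cand_close hP.hk hP.hG w h0 h1 μs As hA τ ξ hP.hτ hP.hξ hP.hξ1 K θ κ R hP.hK hP.hθ hP.hM hP.hκ0 hP.hκ hP.hκ1 hP.hκ2 hP.hR fr
      (fun j hj => hfr' j (by simp [hj]))
  · intro x fr hx
    refine ⟨cand_valid hP.hk θ x fr, TV_le_of _ _ _ fun B hB => (hx B hB).trans hP.hα⟩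
  · rw [hcard]; exact hP.hH
  · rw [hcard]; exact hP.hE

end core

/-- first n1, then n2 samples -/
def spl {n1 n2 n : ℕ} (h : n1 + n2 ≤ n) : Fin n1 ⊕ Fin n2 → Fin n := fun z => Fin.castLE h (finSumFinEquiv z)

theorem spl_inj {n1 n2 n : ℕ} (h : n1 + n2 ≤ n) : Function.Injective (spl h) :=
  (Fin.castLE_injective h).comp finSumFinEquiv.injective

theorem meas_lftn (n d : ℕ) : Measurable (fun x : Fin n → Fin d → ℝ => fun i => lft (x i)) :=
  measurable_pi_lambda _ fun i => meas_lft.comp (measurable_pi_apply i)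

/-- the goal of the theorem for given parameters -/
def Goal (α ε δ : ℝ) (k d n : ℕ) : Prop :=
  ∃ K : Kernel (Fin n → (Fin d → ℝ))
      ((Fin k → ℝ) × (Fin k → (Fin d → ℝ)) × (Fin k → Matrix (Fin d) (Fin d) ℝ)),
    IsMarkovKernel K ∧ IsDP K ε δ ∧
    ∀ (w : Fin k → ℝ) (μs : Fin k → (Fin d → ℝ)) (Ss : Fin k → Matrix (Fin d) (Fin d) ℝ),
      IsMixtureParams w Ss →
      (2 / 3 : ℝ≥0∞) ≤
        ((Measure.pi fun _ : Fin n => mixture d k w μs Ss).bind fun x => K x)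
          {p : (Fin k → ℝ) × (Fin k → (Fin d → ℝ)) × (Fin k → Matrix (Fin d) (Fin d) ℝ) |
            IsMixtureParams p.1 p.2.2 ∧
            TV (mixture d k p.1 p.2.1 p.2.2) (mixture d k w μs Ss) ≤ α}

theorem le_of_one_le_add {x : ℝ≥0∞} {b c : ℝ} (h : 1 ≤ x + ENNReal.ofReal b) (hc : b + c ≤ 1) (hb : 0 ≤ b) (hc0 : 0 ≤ c) : ENNReal.ofReal c ≤ x := by
  have h1 : ENNReal.ofReal c + ENNReal.ofReal b ≤ x + ENNReal.ofReal b := by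
    refine le_trans ?_ h
    rw [← ENNReal.ofReal_add hc0 hb]
    calc _ ≤ ENNReal.ofReal 1 := ENNReal.ofReal_le_ofReal (by linarith)
      _ = 1 := by simp
  exact (ENNReal.add_le_add_iff_right ENNReal.ofReal_ne_top).mp h1

theorem two_thirds_eq : (2/3 : ℝ≥0∞) = ENNReal.ofReal (2/3) := by
  rw [ENNReal.ofReal_div_of_pos (by norm_num)]; simp

theorem goal_private {P : Par} {n n1 n2 d k X q N G M : ℕ} {ww ρ δ1 ε1 ε δ α τ θ κ R ξ cc s : ℝ}
    (hn : n1 + n2 ≤ n)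
    (hU : ParU P n1 (d+1) k X) (hG : ParG P n1 d k X q N ww ρ)
    (hτ : 2^P.N2 * Real.exp (-(n1 * τ / 2)) ≤ 1 / (100 * (k:ℝ)))
    (hOK : ParOK P n1 δ1) (hε1 : P.η + P.β * Real.exp 3 ≤ ε1) (hε0 : 0 < ε) (hεlt : ε < 1) (hδ0 : 0 < δ) (hδlt : δ < 1)
    (hd1 : 400 * k * (3 * δ1 + Real.exp (-(P.t:ℝ))) ≤ ε * δ) (hd2 : ε1^2 * (64 * k * Real.log (8/δ)^2) ≤ ε^2)
    (hP : Par2 d P.p k G M n2 k ε α τ ((X:ℝ)^146) θ κ R ξ cc s) : Goal α ε δ k d n := by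
  have hk := hP.hk
  haveI : Nonempty (Fin k) := ⟨⟨0, hk⟩⟩
  haveI := rounds_markov P hU.hΛ n1 (d+1) k k
  set K1 : Kernel (Fin n1 → Fin d → ℝ) (Fin k → Fin P.p → Fin (d+1) → ℝ) := (rounds P n1 (d+1) k k).comap _ (meas_lftn n1 d) with hK1
  haveI : IsMarkovKernel K1 := by rw [hK1]; infer_instance
  have hdp : IsDP K1 ε δ := by
    intro Y Y' hadj O hO
    rw [hK1, Kernel.comap_apply, Kernel.comap_apply]
    refine rounds_dp P hOK hε1 hε0 hεlt hδ0 hδlt hk hd1 hd2 _ _ ?_ O hO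
    obtain ⟨i, hi⟩ := hadj
    exact ⟨i, fun j hj => by simp only [hi j hj]⟩
  refine ⟨algK G M hk (spl hn) K1 θ ε, algK_markov G M hk _ K1 θ ε, algK_dp G M hk _ (spl_inj hn) K1 θ ε δ hε0.le hdp, ?_⟩
  intro w μs Ss hw
  obtain ⟨h0, h1, hS⟩ := hw
  choose As hA hAS using fun j => exists_sqrt (hS j)
  obtain rfl : Ss = fun j => As j * (As j)ᵀ := funext fun j => (hAS j).symm
  have hs := stage1_util hU hG hτ w h0 h1 μs As hA (Finset.univ.filter fun j => τ ≤ w j) (fun j hj => by simpa using hj)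
  have hP' : Par2 d P.p k G M n2 (Fintype.card (Fin k)) ε α τ ((X:ℝ)^146) θ κ R ξ cc s := by rw [Fintype.card_fin]; exact hP
  have := algK_util G M hP' (spl hn) (spl_inj hn) K1 w h0 h1 μs As hA (ENNReal.ofReal (3/50)) hs
  rw [← ENNReal.ofReal_add (by norm_num) (by norm_num)] at this
  rw [two_thirds_eq]
  exact le_of_one_le_add this (by norm_num) (by norm_num) (by norm_num)

end

section
section np
variable {d k m n1 : ℕ}

def frames (m : ℕ) (x : Fin n1 → Fin d → ℝ) : (Fin m → Fin n1) → Fin m → Fin (d+1) → ℝ := fun f l => lft (x (f l))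

theorem meas_frames : Measurable (frames (d := d) (n1 := n1) m) :=
  measurable_pi_lambda _ fun f => measurable_pi_lambda _ fun l => meas_lft.comp (measurable_pi_apply _)

theorem np_close {P : Par} {X : ℕ} {n D k : ℕ} {y : Fin n → Fin D → ℝ} {J : Fin n → Fin k}
    {F : Fin k → Fin D → Fin D → ℝ} {hv : Finset (Fin k)} (hX : 1 ≤ X) (hm : P.m ≤ X) (hN : P.m ≤ P.N2) (h : GoodD P X y J F hv) :
    ∀ j ∈ hv, ∃ f : Fin P.m → Fin n, close2 ((X:ℝ)^146) (F j) Finset.univ (fun l => y (f l)) Finset.univ := by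
  classical
  intro j hj
  have h3 := h.h3 j hj
  obtain ⟨T, hTs, hTc⟩ := Finset.exists_subset_card_eq (hN.trans h3)
  have hTJ : ∀ i ∈ T, J i = j := fun i hi => by simpa using hTs hi
  have hX1 : (1:ℝ) ≤ X := by exact_mod_cast hX
  refine ⟨T.orderEmbOfFin hTc, ?_⟩
  have hq : ∀ v, qs (fun l => y (T.orderEmbOfFin hTc l)) Finset.univ v = qs y T v := by
    intro v
    unfold qs
    rw [← Finset.sum_image (s := Finset.univ) (g := fun l => T.orderEmbOfFin hTc l) (f := fun i => (v ⬝ᵥ y i)^2)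
      (fun a _ b _ hab => (T.orderEmbOfFin hTc).injective hab)]
    congr 1
    ext i
    have := Finset.range_orderEmbOfFin T hTc
    constructor
    · intro hi
      simp only [Finset.mem_image, Finset.mem_univ, true_and] at hi
      have : i ∈ Set.range (T.orderEmbOfFin hTc) := hi
      rw [Finset.range_orderEmbOfFin] at this
      exact this
    · intro hi
      have : i ∈ Set.range (T.orderEmbOfFin hTc) := by rw [Finset.range_orderEmbOfFin]; exact hi
      simpa using this
  refine ⟨fun v => ?_, fun v => ?_⟩ <;> rw [hq]
  · refine (h.h1 j T hTJ hTc v).trans ?_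
    have := qs_nonneg y T v
    gcongr
    norm_num
  · have hb : qs y T v ≤ ∑ i ∈ T, (X:ℝ)^3 * qs (F j) Finset.univ v := by
      unfold qs
      refine Finset.sum_le_sum fun i hi => ?_
      have := h.h2 i v
      rw [hTJ i hi] at this
      exact this
    rw [Finset.sum_const, hTc, nsmul_eq_mul] at hb
    refine hb.trans ?_
    have := qs_nonneg (F j) Finset.univ v
    have hmX : (P.m : ℝ) ≤ X := by exact_mod_cast hm
    rw [← mul_assoc]
    refine mul_le_mul_of_nonneg_right ?_ this
    calc (P.m:ℝ) * (X:ℝ)^3 ≤ X * (X:ℝ)^3 := by gcongr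
      _ = (X:ℝ)^4 := by ring
      _ ≤ (X:ℝ)^146 := by gcongr; norm_num

theorem stage1_np {P : Par} {n d k X q N : ℕ} {ww ρ τ : ℝ} (hG : ParG P n d k X q N ww ρ) (hmX : P.m ≤ X) (hN : P.m ≤ P.N2)
    (hτ : 2^P.N2 * Real.exp (-(n * τ / 2)) ≤ 1 / (100 * (k:ℝ)))
    (w : Fin k → ℝ) (h0 : ∀ i, 0 ≤ w i) (h1 : ∑ i, w i = 1) (μs : Fin k → Fin d → ℝ)
    (As : Fin k → Matrix (Fin d) (Fin d) ℝ) (hA : ∀ j, (As j).det ≠ 0) (hv : Finset (Fin k)) (hhv : ∀ j ∈ hv, τ ≤ w j) :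
    ∫⁻ x, (Kernel.deterministic (frames P.m) meas_frames) x (badS hv ((X:ℝ)^146) μs As)
      ∂(Measure.pi fun _ : Fin n => mixture d k w μs (fun j => As j * (As j)ᵀ)) ≤ ENNReal.ofReal (4/100) := by
  classical
  haveI := labM_prob w h0 h1
  set S : Set ((Fin P.m → Fin n) → Fin P.m → Fin (d+1) → ℝ) := badS hv ((X:ℝ)^146) μs As with hS
  have hSm : MeasurableSet S := by
    refine MeasurableSet.compl (s := {st : (Fin P.m → Fin n) → Fin P.m → Fin (d+1) → ℝ | ∀ j ∈ hv, ∃ i,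
        close2 ((X:ℝ)^146) (Fmat (μs j) (As j)) Finset.univ (st i) Finset.univ}) ?_
    refine measurableSet_setOfPred.mpr ?_
    refine Measurable.forall fun j => Measurable.imp measurable_const (Measurable.exists fun i => ?_)
    refine measurableSet_setOfPred.mp ?_
    exact (meas_cl (D := d+1) ((X:ℝ)^146) (Fmat (μs j) (As j)) (p := P.m)).preimage (measurable_pi_apply i)
  have hfm : Measurable (fun x : Fin n → Fin d → ℝ => (Kernel.deterministic (frames P.m) meas_frames) x S) :=
    Kernel.measurable_coe _ hSm
  have ham : Measurable (fun z : (Fin n → Fin k) × (Fin n → Fin d → ℝ) => fun i => aff μs As (z.1 i, z.2 i)) :=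
    measurable_pi_lambda _ fun i => (meas_aff _ _).comp (by fun_prop)
  rw [pi_mixture w h0 h1 μs As hA, lintegral_map hfm ham]
  refine (le_of_eq (lintegral_prod _ (hfm.comp ham).aemeasurable)).trans ?_
  refine (lintegral_le_of_good _ _ _ (ENNReal.ofReal (3/100)) (fun J => ?_) (fun J hJ => ?_)).trans
    ((add_le_add le_rfl (labels_good hG.hk w h0 h1 P.N2 τ hτ hv hhv)).trans (le_of_eq ?_))
  · calc _ ≤ ∫⁻ _ : Fin n → Fin d → ℝ, 1 ∂(Measure.pi fun _ : Fin n => stdG (Fin d)) := lintegral_mono fun _ => prob_le_one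
      _ = 1 := by simp
  · have hJ' : ∀ j ∈ hv, P.N2 ≤ (Finset.univ.filter fun i => J i = j).card := by
      by_contra hc; exact hJ hc
    refine (lintegral_le_of_good _ _ {g | badG P X q ww ρ J g} 0 (fun g => prob_le_one) (fun g hg => ?_)).trans
      ((add_le_add le_rfl (badG_prob hG J)).trans (le_of_eq ?_))
    · have h3 := goodD_of hG J (fun j => Fmat (μs j) (As j)) g hg hv (by convert hJ')
      have h2 := np_close (by have := hG.hX; omega) hmX hN h3
      simp only [Fmat_mul] at h2
      show (Kernel.deterministic (frames P.m) meas_frames) (fun i => aff μs As (J i, g i)) S ≤ 0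
      rw [Kernel.deterministic_apply' _ _ hSm, Set.indicator_of_notMem]
      intro hmem
      exact hmem h2
    · simp
  · rw [← ENNReal.ofReal_add (by norm_num) (by norm_num)]; norm_num

/-- mixing with a constant -/
def mixK {A O : Type*} [MeasurableSpace A] [MeasurableSpace O] (K : Kernel A O) (ν : Measure O) : Kernel A O where
  toFun x := ENNReal.ofReal (9/10) • K x + ENNReal.ofReal (1/10) • ν
  measurable' := by
    refine Measure.measurable_of_measurable_coe _ fun s hs => ?_
    simp only [Measure.coe_add, Measure.coe_smul, Pi.add_apply, Pi.smul_apply, smul_eq_mul]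
    exact ((Kernel.measurable_coe K hs).const_mul _).add_const _

theorem mixK_apply {A O : Type*} [MeasurableSpace A] [MeasurableSpace O] (K : Kernel A O) (ν : Measure O) (x : A) (s : Set O) :
    mixK K ν x s = ENNReal.ofReal (9/10) * K x s + ENNReal.ofReal (1/10) * ν s := by
  show (ENNReal.ofReal (9/10) • K x + ENNReal.ofReal (1/10) • ν) s = _
  simp

theorem mixK_markov {A O : Type*} [MeasurableSpace A] [MeasurableSpace O] (K : Kernel A O) [IsMarkovKernel K] (ν : Measure O)
    [IsProbabilityMeasure ν] : IsMarkovKernel (mixK K ν) := by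
  refine ⟨fun x => ⟨?_⟩⟩
  rw [mixK_apply, measure_univ, measure_univ, mul_one, mul_one, ← ENNReal.ofReal_add (by norm_num) (by norm_num)]
  norm_num

theorem mixK_dp {n : ℕ} {E O : Type*} [MeasurableSpace E] [MeasurableSpace O] (K : Kernel (Fin n → E) O) [IsMarkovKernel K] (ν : Measure O)
    (ε δ : ℝ) (hε : 0 ≤ ε) (hδ : 9/10 ≤ δ) : IsDP (mixK K ν) ε δ := by
  intro Y Y' _ s _
  rw [mixK_apply, mixK_apply, add_comm]
  refine add_le_add ?_ ?_
  · calc _ ≤ 1 * (ENNReal.ofReal (9/10) * K Y s + ENNReal.ofReal (1/10) * ν s) := by rw [one_mul]; exact le_add_self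
      _ ≤ _ := by
        gcongr
        rw [← ENNReal.ofReal_one]
        exact ENNReal.ofReal_le_ofReal (Real.one_le_exp hε)
  · calc _ ≤ ENNReal.ofReal (9/10) * 1 := by gcongr; exact prob_le_one
      _ ≤ _ := by rw [mul_one]; exact ENNReal.ofReal_le_ofReal hδ

theorem mixK_bind {A O : Type*} [MeasurableSpace A] [MeasurableSpace O] (μ : Measure A) (K : Kernel A O) (ν : Measure O) (T : Set O) :
    ENNReal.ofReal (9/10) * (μ.bind fun x => K x) T ≤ (μ.bind fun x => mixK K ν x) T := by
  set T' := toMeasurable (μ.bind fun x => mixK K ν x) T with hT'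
  have hTm : MeasurableSet T' := measurableSet_toMeasurable _ _
  calc _ ≤ ENNReal.ofReal (9/10) * (μ.bind fun x => K x) T' := by gcongr; exact subset_toMeasurable _ _
    _ = ∫⁻ x, ENNReal.ofReal (9/10) * K x T' ∂μ := by
        rw [Measure.bind_apply hTm (Kernel.measurable _).aemeasurable, lintegral_const_mul _ (Kernel.measurable_coe _ hTm)]
    _ ≤ ∫⁻ x, mixK K ν x T' ∂μ := lintegral_mono fun x => by rw [mixK_apply]; exact le_self_add
    _ = _ := by rw [← measure_toMeasurable T, ← hT', Measure.bind_apply hTm (Kernel.measurable _).aemeasurable]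

theorem goal_np {P : Par} {n n1 n2 d k X q N G M : ℕ} {ww ρ ε ε' δ α τ θ κ R ξ cc s : ℝ}
    (hn : n1 + n2 ≤ n) (hn1 : 1 ≤ n1) (hG : ParG P n1 d k X q N ww ρ) (hmX : P.m ≤ X) (hN : P.m ≤ P.N2)
    (hτ : 2^P.N2 * Real.exp (-(n1 * τ / 2)) ≤ 1 / (100 * (k:ℝ)))
    (hε0 : 0 < ε) (hδ : 9/10 ≤ δ)
    (hP : Par2 d P.m k G M n2 (n1^P.m) ε' α τ ((X:ℝ)^146) θ κ R ξ cc s) : Goal α ε δ k d n := by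
  have hk := hP.hk
  haveI : Nonempty (Fin n1) := ⟨⟨0, hn1⟩⟩
  set K1 : Kernel (Fin n1 → Fin d → ℝ) ((Fin P.m → Fin n1) → Fin P.m → Fin (d+1) → ℝ) := Kernel.deterministic (frames P.m) meas_frames with hK1
  haveI : IsMarkovKernel K1 := by rw [hK1]; infer_instance
  haveI := algK_markov (k := k) G M hk (spl hn) K1 θ ε'
  refine ⟨mixK (algK G M hk (spl hn) K1 θ ε') (Measure.dirac (0 : PS d k)), mixK_markov _ _, mixK_dp _ _ ε δ hε0.le hδ, ?_⟩
  intro w μs Ss hw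
  obtain ⟨h0, h1, hS⟩ := hw
  choose As hA hAS using fun j => exists_sqrt (hS j)
  obtain rfl : Ss = fun j => As j * (As j)ᵀ := funext fun j => (hAS j).symm
  have hs := stage1_np hG hmX hN hτ w h0 h1 μs As hA (Finset.univ.filter fun j => τ ≤ w j) (fun j hj => by simpa using hj)
  have hP' : Par2 d P.m k G M n2 (Fintype.card (Fin P.m → Fin n1)) ε' α τ ((X:ℝ)^146) θ κ R ξ cc s := by
    rw [Fintype.card_fun, Fintype.card_fin, Fintype.card_fin]; exact hP
  have hu := algK_util G M hP' (spl hn) (spl_inj hn) K1 w h0 h1 μs As hA (ENNReal.ofReal (4/100)) hs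
  rw [← ENNReal.ofReal_add (by norm_num) (by norm_num)] at hu
  have h9 := le_of_one_le_add (c := 94/100) hu (by norm_num) (by norm_num) (by norm_num)
  refine le_trans ?_ (mixK_bind _ _ _ _)
  refine le_trans ?_ (mul_le_mul_right h9 _)
  rw [two_thirds_eq, ← ENNReal.ofReal_mul (by norm_num)]
  exact ENNReal.ofReal_le_ofReal (by norm_num)

theorem goal_k0 (α ε δ : ℝ) (hε : 0 ≤ ε) (d n : ℕ) : Goal α ε δ 0 d n := by
  refine ⟨Kernel.const _ (Measure.dirac 0), inferInstance, ?_, ?_⟩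
  · intro Y Y' _ O _
    rw [Kernel.const_apply, Kernel.const_apply]
    refine le_trans ?_ le_self_add
    calc _ = 1 * (Measure.dirac 0 : Measure (PS d 0)) O := by rw [one_mul]
      _ ≤ _ := by
        gcongr
        rw [← ENNReal.ofReal_one]
        exact ENNReal.ofReal_le_ofReal (Real.one_le_exp hε)
  · intro w μs Ss h
    have := h.2.1
    simp at this

theorem goal_d0 (α ε δ : ℝ) (hα : 0 ≤ α) (hε : 0 ≤ ε) (k n : ℕ) (hk : 1 ≤ k) : Goal α ε δ k 0 n := by
  set p0 : PS 0 k := (fun i => if i = ⟨0, hk⟩ then 1 else 0, 0, fun _ => 1) with hp0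
  have hv : IsMixtureParams p0.1 p0.2.2 := by
    refine ⟨fun i => ?_, ?_, fun i => ?_⟩
    · simp only [hp0]; split_ifs <;> norm_num
    · simp [hp0]
    · exact Matrix.PosDef.one
  refine ⟨Kernel.const _ (Measure.dirac p0), inferInstance, ?_, ?_⟩
  · intro Y Y' _ O _
    rw [Kernel.const_apply, Kernel.const_apply]
    refine le_trans ?_ le_self_add
    calc _ = 1 * (Measure.dirac p0 : Measure (PS 0 k)) O := by rw [one_mul]
      _ ≤ _ := by
        gcongr
        rw [← ENNReal.ofReal_one]
        exact ENNReal.ofReal_le_ofReal (Real.one_le_exp hε)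
  · intro w μs Ss h
    haveI := mixture_prob w μs Ss h
    haveI := mixture_prob p0.1 p0.2.1 p0.2.2 hv
    have hc : ((Measure.pi fun _ : Fin n => mixture 0 k w μs Ss).bind fun x => (Kernel.const (Fin n → Fin 0 → ℝ) (Measure.dirac p0)) x) = Measure.dirac p0 := by
      simp
    rw [hc]
    refine le_trans ?_ (Measure.le_dirac_apply)
    rw [Set.indicator_of_mem]
    · rw [two_thirds_eq]
      calc _ ≤ ENNReal.ofReal 1 := ENNReal.ofReal_le_ofReal (by norm_num)
        _ = _ := by simp
    · refine ⟨hv, TV_le_of _ _ _ fun B hB => ?_⟩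
      rcases Set.eq_empty_or_nonempty B with rfl | ⟨b, hb⟩
      · simpa using hα
      · have : B = Set.univ := by
          ext z; simp only [Set.mem_univ, iff_true]; convert hb
        rw [this]; simpa using hα

end np

end

section
theorem pow8_le (l : ℕ) (hl : 100 ≤ l) : l^8 ≤ 2^l := by
  induction l, hl using Nat.le_induction with
  | base => norm_num
  | succ l hl ih =>
    have h1 : (l+1)^8 ≤ 2 * l^8 := by
      have hl' : (100:ℝ) ≤ l := by exact_mod_cast hl
      have h3 : ((l:ℝ)+1)^8 ≤ 2 * (l:ℝ)^8 := by
        have h2 : (l:ℝ)+1 ≤ (101/100) * l := by linarith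
        calc ((l:ℝ)+1)^8 ≤ ((101/100) * (l:ℝ))^8 := by gcongr
          _ = (101/100)^8 * (l:ℝ)^8 := by ring
          _ ≤ 2 * (l:ℝ)^8 := by gcongr; norm_num
      exact_mod_cast h3
    calc (l+1)^8 ≤ 2 * l^8 := h1
      _ ≤ 2 * 2^l := by omega
      _ = 2^(l+1) := by ring

theorem two_pow_le_exp (n : ℕ) : (2:ℝ)^n ≤ Real.exp n := by
  have h : (2:ℝ) ≤ Real.exp 1 := by have := Real.exp_one_gt_d9; linarith
  calc (2:ℝ)^n ≤ (Real.exp 1)^n := by gcongr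
    _ = Real.exp n := by rw [← Real.exp_nat_mul]; simp

theorem exp_neg_le_pow (n : ℕ) (x : ℝ) (hx : (n:ℝ) ≤ x) : Real.exp (-x) ≤ ((2:ℝ)^n)⁻¹ := by
  rw [Real.exp_neg]
  apply inv_anti₀ (by positivity)
  exact (two_pow_le_exp n).trans (Real.exp_le_exp.mpr hx)

theorem card_big {d p k l card G M : ℕ} (hl : 1 ≤ l) (hp : p ≤ 4 * (d+1)) (hcard : card ≤ 2^(32*l*(d+1))) (hG2 : G + 1 ≤ 2^(3*l))
    (hM1 : 2*M+1 ≤ 2^(2933*l)) :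
    ((G+1) * (card * (2*M+1)^(p*(d+1))))^k ≤ 2^(12000*k*l*(d+1)^2) := by
  calc ((G+1) * (card * (2*M+1)^(p*(d+1))))^k ≤ (2^(3*l) * (2^(32*l*(d+1)) * (2^(2933*l))^(4*(d+1)*(d+1))))^k := by
        refine Nat.pow_le_pow_left (Nat.mul_le_mul hG2 (Nat.mul_le_mul hcard ?_)) k
        exact (Nat.pow_le_pow_left hM1 _).trans (Nat.pow_le_pow_right (Nat.one_le_two_pow) (Nat.mul_le_mul_right _ hp))
    _ = 2^((3*l + (32*l*(d+1) + 2933*l*(4*(d+1)*(d+1))))*k) := by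
        rw [← pow_mul, ← pow_add, ← pow_add, ← pow_mul]
    _ ≤ 2^(12000*k*l*(d+1)^2) := by
        apply Nat.pow_le_pow_right (by norm_num)
        have h1 : 3*l ≤ 3 * (l * (d+1)^2) := by
          have : 1 ≤ (d+1)^2 := Nat.one_le_pow _ _ (by omega)
          nlinarith
        have h2 : 32*l*(d+1) ≤ 32 * (l * (d+1)^2) := by
          rw [mul_assoc]; gcongr; nlinarith
        have : 3*l + (32*l*(d+1) + 2933*l*(4*(d+1)*(d+1))) ≤ 12000 * l * (d+1)^2 := by
          have h3 : 2933*l*(4*(d+1)*(d+1)) = 11732 * (l * (d+1)^2) := by ring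
          have h4 : 12000 * l * (d+1)^2 = 12000 * (l * (d+1)^2) := by ring
          omega
        calc _ ≤ 12000 * l * (d+1)^2 * k := by gcongr
          _ = _ := by ring

theorem M_big (l : ℕ) (hl : 2 ≤ l) : 2*2^(2932*l)+1 ≤ 2^(2933*l) := by
  obtain ⟨M, hM⟩ : ∃ M, M = 2^(2932*l) := ⟨_, rfl⟩
  have h1 : 1 ≤ M := by rw [hM]; exact Nat.one_le_two_pow
  have h2 : 2^(2933*l) = 2^l * M := by rw [hM, ← pow_add]; congr 1; omega
  have h3 : 2^2 ≤ 2^l := Nat.pow_le_pow_right (by norm_num) hl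
  rw [← hM, h2]
  nlinarith

theorem kap10 {Y : ℝ} (hY0 : 0 < Y) (c : ℝ) (hc : c ≤ Y) : c * Y^8 * (Y^10)⁻¹ ≤ Y⁻¹ := by
  rw [← div_eq_mul_inv, ← one_div, div_le_div_iff₀ (by positivity) hY0]
  calc c * Y^8 * Y ≤ Y * Y^8 * Y := by gcongr
    _ = 1 * Y^10 := by ring

theorem pert_small {Y α l : ℝ} {d : ℕ} (hYb : 1000 ≤ Y) (hl0 : 1 ≤ l) (hl2 : l^2 ≤ Y) (hd : (d:ℝ) + 1 ≤ Y) (hYα : 1 ≤ Y * α)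
    (hRr : Real.exp (-l^2/2) ≤ (Y^3)⁻¹) : pertErr d (Y^10)⁻¹ l ≤ α/30 := by
  have hY0 : 0 < Y := by linarith
  have hY1 : 1 ≤ Y := by linarith
  have hd0 : (0:ℝ) ≤ d := Nat.cast_nonneg d
  have hD2 : (d:ℝ)^2 ≤ Y^2 := by gcongr; linarith
  unfold pertErr
  have hz : (Y^10)⁻¹ ≤ 1 := inv_le_one_of_one_le₀ (one_le_pow₀ hY1)
  have hz0 : 0 < (Y^10)⁻¹ := by positivity
  have hlY : l ≤ Y := by nlinarith
  have hdl : 1 + (d:ℝ) * l ≤ Y * Y := by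
    calc 1 + (d:ℝ) * l ≤ 1 * l + d * l := by linarith
      _ = (d+1) * l := by ring
      _ ≤ Y * Y := by gcongr
  have hdY' : (d:ℝ) ≤ Y := by linarith
  have t1 : 2 * (d:ℝ)^2 * (Y^10)⁻¹ ≤ 2 * Y^8 * (Y^10)⁻¹ := by
    gcongr
    exact hD2.trans (pow_le_pow_right₀ hY1 (by norm_num))
  have t2 : (d:ℝ) * l * ((Y^10)⁻¹ * (1 + d * l)) ≤ 1 * Y^8 * (Y^10)⁻¹ := by
    calc (d:ℝ) * l * ((Y^10)⁻¹ * (1 + d * l)) ≤ Y * Y * ((Y^10)⁻¹ * (Y*Y)) := by gcongr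
      _ = Y^4 * (Y^10)⁻¹ := by ring
      _ ≤ 1 * Y^8 * (Y^10)⁻¹ := by rw [one_mul]; gcongr; norm_num
  have t3 : (d:ℝ) * ((Y^10)⁻¹ * (1 + d * l))^2 ≤ 1 * Y^8 * (Y^10)⁻¹ := by
    calc (d:ℝ) * ((Y^10)⁻¹ * (1 + d * l))^2 ≤ Y * ((Y^10)⁻¹ * (Y * Y))^2 := by gcongr
      _ = Y^5 * (Y^10)⁻¹ * (Y^10)⁻¹ := by ring
      _ ≤ Y^5 * (Y^10)⁻¹ * 1 := by gcongr
      _ ≤ 1 * Y^8 * (Y^10)⁻¹ := by rw [one_mul, mul_one]; gcongr; norm_num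
  have t4 : (d:ℝ) * (2 * Real.exp (-l^2/2)) ≤ 2 * Y^8 * (Y^10)⁻¹ := by
    calc (d:ℝ) * (2 * Real.exp (-l^2/2)) ≤ Y * (2 * (Y^3)⁻¹) := by gcongr
      _ = 2 * Y^8 * (Y^10)⁻¹ := by field_simp
  have t5 : 6 * Y^8 * (Y^10)⁻¹ * 30 ≤ α := by
    have := kap10 hY0 (180 * 1) (by linarith)
    have h5 : Y⁻¹ ≤ α := by rw [inv_le_iff_one_le_mul₀ hY0]; linarith
    linarith
  linarith

theorem exp_card2 (E : ℕ) (S x : ℝ) (hS0 : 0 ≤ S) (hS : S ≤ 2^E) (hx : 2 * (E:ℝ) + 8 ≤ x) : S^2 * (2 * Real.exp (-x)) ≤ 1/100 := by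
  have h1 := exp_neg_le_pow (E*2+8) x (by push_cast; linarith)
  calc _ ≤ ((2:ℝ)^E)^2 * (2 * ((2:ℝ)^(E*2 + 8))⁻¹) := by gcongr
    _ = 2/2^8 := by
        rw [← pow_mul, pow_add]
        field_simp
    _ ≤ 1/100 := by norm_num

theorem exp_card1 (E : ℕ) (S x : ℝ) (hS : S ≤ 2^E) (hx : (E:ℝ) + 7 ≤ x) : S * Real.exp (-x) ≤ 1/100 := by
  have h1 := exp_neg_le_pow (E+7) x (by push_cast; linarith)
  calc _ ≤ ((2:ℝ)^E) * ((2:ℝ)^(E + 7))⁻¹ := by gcongr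
    _ = 1/2^7 := by
        rw [pow_add]
        field_simp
    _ ≤ 1/100 := by norm_num

set_option maxHeartbeats 1000000 in
theorem par2_ok {d p k l n2 card : ℕ} {α ε : ℝ} (hl : 200 ≤ l) (hk : 1 ≤ k) (hd : 1 ≤ d) (hp : p ≤ 4 * (d+1))
    (hkY : (k:ℝ) ≤ 2^l) (hdY : (d:ℝ) + 1 ≤ 2^l) (hα0 : 0 < α) (hα1 : α < 1) (hα : 1/α ≤ 2^l) (hε : 0 < ε)
    (hcard : card ≤ 2^(32*l*(d+1)))
    (hn2a : 1250000 * (k * l * ((d:ℝ)+1)^2) ≤ n2 * α^2) (hn2b : 250000 * (k * l * ((d:ℝ)+1)^2) ≤ n2 * (α * ε)) :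
    ∃ G M : ℕ, ∃ θ κ R ξ cc s : ℝ, Par2 d p k G M n2 card ε α (α/(60*k)) (((2^(10*l) : ℕ):ℝ)^146) θ κ R ξ cc s := by
  obtain ⟨Y, hY⟩ : ∃ Y : ℝ, Y = 2^l := ⟨_, rfl⟩
  rw [← hY] at hkY hdY hα
  have hk1 : (1:ℝ) ≤ k := by exact_mod_cast hk
  have hd1 : (1:ℝ) ≤ d := by exact_mod_cast hd
  have hl1 : (200:ℝ) ≤ l := by exact_mod_cast hl
  have hYb : (10:ℝ)^50 ≤ Y := by
    calc (10:ℝ)^50 ≤ 2^200 := by norm_num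
      _ ≤ 2^l := by gcongr; norm_num
      _ = Y := hY.symm
  have hY0 : 0 < Y := by linarith [show (1:ℝ) ≤ 10^50 by norm_num]
  have hY1 : 1 ≤ Y := by linarith [show (1:ℝ) ≤ 10^50 by norm_num]
  have hl8 : (l:ℝ)^8 ≤ Y := by rw [hY]; exact_mod_cast pow8_le l (by omega)
  have hl2 : (l:ℝ)^2 ≤ Y := le_trans (pow_le_pow_right₀ (by linarith) (by norm_num)) hl8
  have hKY : (((2^(10*l) : ℕ):ℝ)^146) = Y^1460 := by
    push_cast; rw [hY, ← pow_mul, ← pow_mul]; congr 1; ring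
  have hYα : 1 ≤ Y * α := by rw [div_le_iff₀ hα0] at hα; linarith
  have hkey : 200 ≤ k * l * ((d:ℝ)+1)^2 := by
    calc (200:ℝ) ≤ 1 * 200 * 1^2 := by norm_num
      _ ≤ k * l * ((d:ℝ)+1)^2 := by gcongr; linarith
  have hn2 : 1 ≤ n2 := by
    by_contra h
    have : n2 = 0 := by omega
    rw [this] at hn2a; simp at hn2a; linarith
  have hn2r : (0:ℝ) < n2 := by exact_mod_cast hn2
  set Gn := ⌈60 * (k:ℝ) / α⌉₊ with hGn
  have hG1 : 60 * (k:ℝ)/α ≤ Gn := Nat.le_ceil _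
  have hG0 : 0 < 60 * (k:ℝ)/α := by positivity
  have hGpos : (0:ℝ) < Gn := lt_of_lt_of_le hG0 hG1
  have hG2 : Gn + 1 ≤ 2^(3*l) := by
    have h1 : (Gn:ℝ) < 60 * (k:ℝ)/α + 1 := Nat.ceil_lt_add_one hG0.le
    have h2 : 60 * (k:ℝ)/α ≤ 60 * Y * Y := by
      rw [mul_div_assoc, mul_assoc]
      gcongr
      rw [div_eq_mul_one_div]; gcongr
    have h3 : (Gn:ℝ) + 1 ≤ Y^3 := by
      have : 62 * (Y*Y) ≤ Y^3 := by
        rw [show Y^3 = Y * (Y*Y) by ring]; gcongr; linarith [show (62:ℝ) ≤ 10^50 by norm_num]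
      nlinarith
    have h4 : Y^3 = ((2^(3*l) : ℕ) : ℝ) := by push_cast; rw [hY, ← pow_mul]; congr 1; ring
    rw [h4] at h3; exact_mod_cast h3
  have hGe1 : 1 ≤ Gn := by exact_mod_cast hGpos
  obtain ⟨M, hM⟩ : ∃ M : ℕ, M = 2^(2932*l) := ⟨_, rfl⟩
  have hM1 : 2*M+1 ≤ 2^(2933*l) := by rw [hM]; exact M_big l (by omega)
  have hMr : (M:ℝ) = Y^2932 := by rw [hM, hY]; push_cast; rw [← pow_mul]; congr 1; ring
  -- size of the candidate family
  have hbig : ((Gn+1) * (card * (2*M+1)^(p*(d+1))))^k ≤ 2^(12000*k*l*(d+1)^2) :=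
    card_big (by omega) hp hcard hG2 hM1
  obtain ⟨E, hE⟩ : ∃ E : ℕ, E = 12000*k*l*(d+1)^2 := ⟨_, rfl⟩
  have hEr : (E:ℝ) = 12000 * (k * l * ((d:ℝ)+1)^2) := by rw [hE]; push_cast; ring
  rw [← hE] at hbig
  have hbigr : ((((Gn+1) * (card * (2*M+1)^(p*(d+1))))^k : ℕ) : ℝ) ≤ 2^E := by
    have : ((((Gn+1) * (card * (2*M+1)^(p*(d+1))))^k : ℕ) : ℝ) ≤ ((2^E : ℕ) : ℝ) := Nat.cast_le.mpr hbig
    rwa [Nat.cast_pow 2 E, Nat.cast_ofNat] at this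
  have hD2 : (d:ℝ)^2 ≤ Y^2 := by gcongr; linarith
  have hRr : Real.exp (-(l:ℝ)^2/2) ≤ (Y^3)⁻¹ := by
    have := exp_neg_le_pow (3*l) ((l:ℝ)^2/2) (by push_cast; nlinarith)
    rw [show -(l:ℝ)^2/2 = -((l:ℝ)^2/2) by ring]
    convert this using 2
    rw [hY, ← pow_mul]; congr 1; ring
  have hpert : pertErr d (Y^10)⁻¹ l ≤ α/30 := pert_small (by linarith [show (1000:ℝ) ≤ 10^50 by norm_num]) (by linarith) hl2 hdY hYα hRr
  clear hM1 hM hY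
  refine ⟨Gn, M, (Y^1472)⁻¹, (Y^10)⁻¹, l, α/30, α/10, n2 * α/10, ?_⟩
  rw [hKY]
  refine ⟨hk, hGe1, hε.le, hn2, by positivity, ?_, by linarith, one_le_pow₀ hY1, by positivity, ?_, by positivity, ?_, ?_, ?_, by positivity, by positivity, ?_, ?_, ?_⟩
  · have h1 : (k:ℝ) * (α/(60*k)) = α/60 := by field_simp
    have h2 : (k:ℝ)/Gn ≤ α/60 := by
      rw [div_le_iff₀ hGpos]
      calc (k:ℝ) = α/60 * (60*k/α) := by field_simp
        _ ≤ _ := by gcongr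
    linarith
  · rw [hMr]
    apply le_of_eq
    rw [eq_mul_inv_iff_mul_eq₀ (by positivity), ← pow_add]
  · have hpr : (p:ℝ) ≤ 4 * Y := by
      have : (p:ℝ) ≤ 4 * ((d:ℝ)+1) := by exact_mod_cast hp
      linarith
    have h1 : (Y^1472)⁻¹ * Y^1460 = (Y^12)⁻¹ := by
      rw [inv_mul_eq_iff_eq_mul₀ (by positivity), eq_mul_inv_iff_mul_eq₀ (by positivity), ← pow_add]
    rw [h1]
    calc 2 * ((p:ℝ) * (Y^12)⁻¹) ≤ 2 * (4 * Y * (Y^12)⁻¹) := by gcongr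
      _ ≤ Y * Y * (Y^12)⁻¹ := by
          have : (8:ℝ) ≤ Y := by linarith [show (8:ℝ) ≤ 10^50 by norm_num]
          rw [← mul_assoc]
          refine mul_le_mul_of_nonneg_right ?_ (by positivity)
          nlinarith
      _ = (Y^10)⁻¹ := by field_simp
  · have := kap10 hY0 1 hY1
    have h2 : (Y^10)⁻¹ ≤ 1 * Y^8 * (Y^10)⁻¹ := by
      rw [one_mul]; exact le_mul_of_one_le_left (by positivity) (one_le_pow₀ hY1)
    have h3 : Y⁻¹ ≤ 1/2 := by
      rw [inv_le_comm₀ hY0 (by norm_num)]; linarith [show (2:ℝ) ≤ 10^50 by norm_num]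
    exact h2.trans (this.trans h3)
  · have := kap10 hY0 2 (by linarith [show (2:ℝ) ≤ 10^50 by norm_num])
    have h3 : Y⁻¹ < 1 := inv_lt_one_of_one_lt₀ (by linarith [show (2:ℝ) ≤ 10^50 by norm_num])
    have h4 : 2 * (d:ℝ)^2 * (Y^10)⁻¹ ≤ 2 * Y^8 * (Y^10)⁻¹ := by
      gcongr
      exact hD2.trans (pow_le_pow_right₀ hY1 (by norm_num))
    exact h4.trans_lt (this.trans_lt h3)
  · have : (n2:ℝ) * α/10/n2 = α/10 := by field_simp
    rw [this]; clear hbigr hbig hKY hMr hRr hE hEr; linarith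
  · exact exp_card2 _ _ _ (Nat.cast_nonneg _) hbigr (by rw [hEr]; clear hbigr hbig hKY hMr hRr hE hEr hpert; nlinarith)
  · exact exp_card1 _ _ _ hbigr (by rw [hEr]; clear hbigr hbig hKY hMr hRr hE hEr hpert; nlinarith)

end

section
theorem choose_up (q c : ℕ) (hq : 1 ≤ q) : ((c * q).choose q : ℝ) ≤ (3 * (c:ℝ))^q := by
  have h1 : ((c*q).choose q : ℝ) ≤ ((c*q : ℕ) : ℝ)^q / (q.factorial : ℝ) := Nat.choose_le_pow_div q (c*q)
  have h2 : (q:ℝ)^q / (q.factorial : ℝ) ≤ Real.exp q := Real.pow_div_factorial_le_exp _ (Nat.cast_nonneg _) q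
  have h3 : Real.exp q ≤ 3^q := by
    have h : Real.exp 1 ≤ 3 := by have := Real.exp_one_lt_d9; linarith
    calc Real.exp q = (Real.exp 1)^q := by rw [← Real.exp_nat_mul]; simp
      _ ≤ 3^q := by gcongr
  calc _ ≤ _ := h1
    _ = (c:ℝ)^q * ((q:ℝ)^q / (q.factorial:ℝ)) := by push_cast; rw [mul_pow]; ring
    _ ≤ (c:ℝ)^q * 3^q := by gcongr; exact h2.trans h3
    _ = _ := by rw [mul_pow]; ring

theorem choose_low (N b : ℕ) (hb : 2 * b ≤ N) (β : ℝ) (hβ : β * N = 16 * b) (hβ0 : 0 ≤ β) (hb1 : 1 ≤ b) :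
    (8:ℝ)^b ≤ N.choose b * β^b := by
  have h1 : ((N + 1 - b : ℕ) : ℝ)^b ≤ (b.factorial : ℝ) * (N.choose b : ℝ) := by
    have := Nat.pow_sub_le_descFactorial N b
    rw [Nat.descFactorial_eq_factorial_mul_choose] at this
    exact_mod_cast this
  have h2 : (b.factorial : ℝ) ≤ (b:ℝ)^b := by exact_mod_cast Nat.factorial_le_pow b
  have h3 : (N:ℝ)/2 ≤ ((N + 1 - b : ℕ) : ℝ) := by
    rw [div_le_iff₀ (by norm_num)]
    have : N ≤ (N+1-b)*2 := by omega
    exact_mod_cast this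
  have hbp : (0:ℝ) < (b:ℝ)^b := by positivity
  have h4 : (b:ℝ)^b * 8^b ≤ (b:ℝ)^b * (N.choose b * β^b) := by
    calc (b:ℝ)^b * 8^b = ((N:ℝ)/2 * β)^b := by rw [← mul_pow]; congr 1; linarith
      _ = ((N:ℝ)/2)^b * β^b := mul_pow _ _ _
      _ ≤ ((N + 1 - b : ℕ) : ℝ)^b * β^b := by gcongr
      _ ≤ ((b.factorial : ℝ) * (N.choose b : ℝ)) * β^b := by gcongr
      _ ≤ ((b:ℝ)^b * (N.choose b : ℝ)) * β^b := by gcongr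
      _ = _ := by ring
  exact le_of_mul_le_mul_left h4 hbp

theorem hpr_ok {d k l q : ℕ} (hl : 200 ≤ l) (hkY : (k:ℝ) ≤ 2^l) (hk : 1 ≤ k) (hdY : (d:ℝ) + 1 ≤ 2^l) (hq : 2 * l * (d+1) ≤ q) :
    (((8*l*q).choose q : ℕ) : ℝ) * ((3 * ((3840 * l^2 * (d+1) : ℕ) : ℝ))^(d+1) * (20 * (1/(3840*(l:ℝ))))^q) ≤ 1/(200*(k:ℝ)) := by
  have hl1 : (200:ℝ) ≤ l := by exact_mod_cast hl
  have hk1 : (1:ℝ) ≤ k := by exact_mod_cast hk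
  have hl8 : (l:ℝ)^8 ≤ 2^l := by exact_mod_cast pow8_le l (by omega)
  have hq1 : 1 ≤ q := by
    refine le_trans ?_ hq
    exact Nat.mul_pos (by omega) (by omega)
  have h1 := choose_up q (8*l) hq1
  have h2 : 3 * ((3840 * l^2 * (d+1) : ℕ) : ℝ) ≤ 2^(2*l) := by
    push_cast
    calc 3 * (3840 * (l:ℝ)^2 * ((d:ℝ)+1)) = (11520 * (l:ℝ)^2) * ((d:ℝ)+1) := by ring
      _ ≤ ((l:ℝ)^6 * (l:ℝ)^2) * 2^l := by
          gcongr
          calc (11520:ℝ) ≤ 200^6 := by norm_num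
            _ ≤ (l:ℝ)^6 := by gcongr
      _ = (l:ℝ)^8 * 2^l := by ring
      _ ≤ 2^l * 2^l := by gcongr
      _ = 2^(2*l) := by rw [← pow_add]; congr 1; ring
  have h5 : (8:ℝ)^(2*l*(d+1)) ≤ 8^q := pow_le_pow_right₀ (by norm_num) hq
  calc _ ≤ (3 * ((8*l:ℕ):ℝ))^q * ((2^(2*l))^(d+1) * (20 * (1/(3840*(l:ℝ))))^q) := by gcongr
    _ = (2^(2*l))^(d+1) * ((3 * ((8*l:ℕ):ℝ)) * (20 * (1/(3840*(l:ℝ)))))^q := by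
        generalize 3 * ((8*l:ℕ):ℝ) = A
        generalize 20 * (1/(3840*(l:ℝ))) = B
        generalize ((2:ℝ)^(2*l))^(d+1) = C
        rw [mul_pow]; ring
    _ = (2^(2*l))^(d+1) * ((8:ℝ)^q)⁻¹ := by
        congr 1; rw [← inv_pow]; congr 1; push_cast; field_simp; norm_num
    _ ≤ (2^(2*l))^(d+1) * ((8:ℝ)^(2*l*(d+1)))⁻¹ := by gcongr
    _ = ((2:ℝ)^(4*l*(d+1)))⁻¹ := by
        have : (8:ℝ)^(2*l*(d+1)) = (2^(2*l))^(d+1) * 2^(4*l*(d+1)) := by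
          rw [show (8:ℝ) = 2^3 by norm_num, ← pow_mul, ← pow_mul, ← pow_add]; congr 1; ring
        rw [this]; field_simp
    _ ≤ ((2:ℝ)^l * 2^l)⁻¹ := by
        gcongr
        rw [← pow_add]
        apply pow_le_pow_right₀ (by norm_num)
        nlinarith
    _ ≤ 1/(200*(k:ℝ)) := by
        rw [one_div]
        gcongr
        calc (200:ℝ) ≤ 2^200 := by norm_num
          _ ≤ 2^l := by gcongr; norm_num

theorem hW_ok {k l q N1 N2 n1 : ℕ} {β η δ1 Λ : ℝ} (hl : 200 ≤ l) (hq : 1 ≤ q) (hk : 1 ≤ k) (hkY : (k:ℝ) ≤ 2^l)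
    (hb : 2 * (8*l*q) ≤ N2) (hβ : β * N2 = 16 * ((8*l*q : ℕ):ℝ)) (hβ0 : 0 ≤ β) (hβ1 : β ≤ 1)
    (hη : η * N2 = 18 * l * ((8*l*q : ℕ):ℝ)) (hη0 : 0 ≤ η) (hδ1 : δ1 = ((2:ℝ)^(4*l))⁻¹)
    (hN : 2 * (N1 + 1) ≤ N2) (hn1 : (n1:ℝ) + 1 ≤ 2^(8*l))
    (hΛ : δ1 * Λ = (n1 * β)^(2*q) * Real.exp (η * N2) + ((n1:ℝ)+1)^(8*l*q) * Real.exp (η * (N1 + 1))) :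
    100 * k * Λ ≤ (1/2) * N2.choose (8*l*q) * (β^(8*l*q) * Real.exp (η * N2)) := by
  obtain ⟨b, hbd⟩ : ∃ b, b = 8*l*q := ⟨_, rfl⟩
  rw [← hbd] at hb hβ hη hΛ ⊢
  have hk1 : (1:ℝ) ≤ k := by exact_mod_cast hk
  have hb1 : 1 ≤ b := by rw [hbd]; exact Nat.mul_pos (by omega) hq
  have hlow := choose_low N2 b hb β hβ hβ0 hb1
  set E := Real.exp (η * N2) with hE
  have hE0 : 0 < E := Real.exp_pos _
  have hA : ((n1:ℝ) * β)^(2*q) * E ≤ 2^(16*l*q) * E := by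
    gcongr
    calc ((n1:ℝ) * β)^(2*q) ≤ ((2:ℝ)^(8*l))^(2*q) := by
          gcongr
          calc (n1:ℝ) * β ≤ n1 * 1 := by gcongr
            _ ≤ _ := by linarith
      _ = 2^(16*l*q) := by rw [← pow_mul]; congr 1; ring
  have hB : ((n1:ℝ)+1)^b * Real.exp (η * (N1 + 1)) ≤ 2^(16*l*q) * E := by
    have hN' : 2 * ((N1:ℝ) + 1) ≤ N2 := by exact_mod_cast hN
    have h1 : Real.exp (η * (N1 + 1)) ≤ Real.exp (-(9 * l * b)) * E := by
      rw [hE, ← Real.exp_add]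
      apply Real.exp_le_exp.mpr
      have : η * (2 * ((N1:ℝ) + 1)) ≤ η * N2 := by gcongr
      linarith
    have h2 : Real.exp (-(9 * (l:ℝ) * b)) ≤ ((2:ℝ)^(8*l*b))⁻¹ := exp_neg_le_pow _ _ (by
      push_cast
      have : (0:ℝ) ≤ l * b := by positivity
      nlinarith)
    calc ((n1:ℝ)+1)^b * Real.exp (η * (N1 + 1)) ≤ (2^(8*l))^b * (((2:ℝ)^(8*l*b))⁻¹ * E) := by
          gcongr
          exact h1.trans (by gcongr)
      _ = 1 * E := by rw [← pow_mul]; field_simp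
      _ ≤ 2^(16*l*q) * E := by gcongr; exact one_le_pow₀ (by norm_num)
  have hΛ' : Λ ≤ 2^(4*l) * (2 * 2^(16*l*q) * E) := by
    have : Λ = 2^(4*l) * (δ1 * Λ) := by rw [hδ1]; field_simp
    rw [this, hΛ]
    gcongr
    linarith
  have h400 : 400 * (k:ℝ) * 2^(4*l) * 2^(16*l*q) ≤ 8^b := by
    calc 400 * (k:ℝ) * 2^(4*l) * 2^(16*l*q) ≤ 2^l * 2^l * 2^(4*l) * 2^(16*l*q) := by
          gcongr
          calc (400:ℝ) ≤ 2^200 := by norm_num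
            _ ≤ 2^l := by gcongr; norm_num
      _ = 2^(6*l+16*l*q) := by rw [← pow_add, ← pow_add, ← pow_add]; congr 1; ring
      _ ≤ 2^(3*b) := by
          apply pow_le_pow_right₀ (by norm_num)
          rw [hbd]
          have : l * 1 ≤ l * q := by gcongr
          nlinarith
      _ = 8^b := by rw [pow_mul]; norm_num
  calc 100 * k * Λ ≤ 100 * k * (2^(4*l) * (2 * 2^(16*l*q) * E)) := by gcongr
    _ = 1/2 * (400 * (k:ℝ) * 2^(4*l) * 2^(16*l*q)) * E := by ring
    _ ≤ 1/2 * 8^b * E := by gcongr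
    _ ≤ 1/2 * (N2.choose b * β^b) * E := by gcongr
    _ = _ := by ring

end

section
theorem tail_small {d l n1 : ℕ} (hl : 200 ≤ l) (hdY : (d:ℝ) + 1 ≤ 2^l) (hn1b : (n1:ℝ) + 1 ≤ 2^(8*l)) :
    (n1:ℝ) * (d * (2 * Real.exp (-((l:ℝ)^2) / 2))) ≤ 1/100 := by
  have hl1 : (200:ℝ) ≤ l := by exact_mod_cast hl
  have h1 : Real.exp (-((l:ℝ)^2)/2) ≤ ((2:ℝ)^(100*l))⁻¹ := by
    rw [neg_div]
    apply exp_neg_le_pow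
    push_cast
    nlinarith
  have h200 : (200:ℝ) ≤ 2^l := by
    calc (200:ℝ) ≤ 2^200 := by norm_num
      _ ≤ 2^l := by gcongr; norm_num
  calc (n1:ℝ) * (d * (2 * Real.exp (-((l:ℝ)^2) / 2))) ≤ 2^(8*l) * (2^l * (2 * ((2:ℝ)^(100*l))⁻¹)) := by
        gcongr <;> linarith
    _ = 2 * ((2:ℝ)^(91*l))⁻¹ := by
        rw [show 100*l = 91*l + 8*l + l by ring, pow_add, pow_add]; field_simp
    _ ≤ 2 * (200:ℝ)⁻¹ := by
        gcongr
        refine h200.trans (pow_le_pow_right₀ (by norm_num) (by omega))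
    _ = 1/100 := by norm_num

theorem htau_ok {k N2 n1 : ℕ} {α : ℝ} (hk : 1 ≤ k) (hα0 : 0 < α) (hkN : 8 * k ≤ N2)
    (hn1a : 240 * (k:ℝ) * N2 ≤ n1 * α) :
    2^N2 * Real.exp (-(n1 * (α/(60*k)) / 2)) ≤ 1/(100*(k:ℝ)) := by
  have hk1 : (1:ℝ) ≤ k := by exact_mod_cast hk
  have h1 : (2 * N2 : ℝ) ≤ n1 * (α/(60*k)) / 2 := by
    rw [show (n1:ℝ) * (α/(60*k)) / 2 = (n1*α)/(120*k) by field_simp; ring]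
    rw [le_div_iff₀ (by positivity)]
    linarith
  have h2 : Real.exp (-(n1 * (α/(60*k)) / 2)) ≤ ((2:ℝ)^(2*N2))⁻¹ := exp_neg_le_pow _ _ (by push_cast; exact h1)
  have h3 : 100 * (k:ℝ) ≤ 2^N2 := by
    have : (100 * k : ℕ) ≤ 2^N2 := by
      calc 100 * k ≤ 2^7 * 2^k := by gcongr; norm_num; exact Nat.lt_two_pow_self.le
        _ = 2^(7+k) := by rw [pow_add]
        _ ≤ 2^N2 := Nat.pow_le_pow_right (by norm_num) (by omega)
    exact_mod_cast this
  calc 2^N2 * Real.exp (-(n1 * (α/(60*k)) / 2)) ≤ 2^N2 * ((2:ℝ)^(2*N2))⁻¹ := by gcongr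
    _ = ((2:ℝ)^N2)⁻¹ := by rw [two_mul, pow_add]; field_simp
    _ ≤ (100 * (k:ℝ))⁻¹ := by gcongr
    _ = _ := by rw [one_div]

set_option maxHeartbeats 4000000 in
theorem priv_core {α ε δ : ℝ} {k d l n r q N2 n1 n2 : ℕ} (hl : 200 ≤ l) (hk : 1 ≤ k) (hd : 1 ≤ d)
    (hkY : (k:ℝ) ≤ 2^l) (hdY : (d:ℝ) + 1 ≤ 2^l) (hα0 : 0 < α) (hα1 : α < 1) (hα : 1/α ≤ 2^l)
    (hε0 : 0 < ε) (hε1 : ε < 1) (hε : 1/ε ≤ 2^l) (hδ0 : 0 < δ) (hδ1 : δ < 1) (hδ : 1/δ ≤ 2^l)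
    (hr : d + 1 ≤ r^2) (hqd : q = 117964800 * l^5 * r * (d+1))
    (hN2a : 320 * (l:ℝ)^2 * ((8*l*q : ℕ):ℝ) * Real.sqrt k ≤ ε * N2)
    (hN2b : 8 * k * (d+1) + 2 ≤ N2) (hn1a : 240 * (k:ℝ) * N2 ≤ n1 * α)
    (hn1b : (n1:ℝ) + 1 ≤ 2^(8*l)) (hn : n1 + n2 ≤ n)
    (hn2a : 1250000*(k*l*((d:ℝ)+1)^2) ≤ n2*α^2) (hn2b : 250000*(k*l*((d:ℝ)+1)^2) ≤ n2*(α*ε)) :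
    Goal α ε δ k d n := by
  have hl1 : (200:ℝ) ≤ l := by exact_mod_cast hl
  have hk1 : (1:ℝ) ≤ k := by exact_mod_cast hk
  have hsk : 1 ≤ Real.sqrt k := by rw [Real.one_le_sqrt]; exact hk1
  have hr1 : 1 ≤ r := by
    rcases Nat.eq_zero_or_pos r with h | h
    · subst h; simp at hr
    · exact h
  obtain ⟨b, hb⟩ : ∃ b, b = 8*l*q := ⟨_, rfl⟩
  rw [← hb] at hN2a
  have hl0 : 1 ≤ l := by omega
  have hq0 : 2 * l * (d+1) ≤ q := by
    rw [hqd]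
    have h1 : l ≤ l^5 := by
      calc l = l^1 := (pow_one l).symm
        _ ≤ l^5 := Nat.pow_le_pow_right hl0 (by norm_num)
    calc 2 * l * (d+1) = 2 * l * 1 * (d+1) := by ring
      _ ≤ 117964800 * l^5 * r * (d+1) := by gcongr; norm_num
  have hql : 4 * (d+1) ≤ 2 * q := by nlinarith
  have hq1 : 1 ≤ q := by omega
  have hb1 : 1 ≤ b := by rw [hb]; exact Nat.mul_pos (by omega) hq1
  have hbR : (1:ℝ) ≤ b := by exact_mod_cast hb1
  have hN2pos : (0:ℝ) < N2 := by
    have : 0 < N2 := by omega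
    exact_mod_cast this
  have hεN : ε * N2 ≤ N2 := by nlinarith
  have hbN : 400 * (b:ℝ) ≤ N2 := by
    refine le_trans ?_ (hN2a.trans hεN)
    calc 400 * (b:ℝ) = 400 * b * 1 := by ring
      _ ≤ 320 * (l:ℝ)^2 * b * Real.sqrt k := by
        gcongr
        nlinarith
  have hbNn : 400 * b ≤ N2 := by exact_mod_cast hbN
  have hN1R : (N2:ℝ) ≤ n1 := by nlinarith
  have hN1n : N2 ≤ n1 := by exact_mod_cast hN1R
  have hn1X : n1 ≤ 2^(10*l) := by
    have : (n1:ℝ) ≤ 2^(8*l) := by linarith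
    have h2 : n1 ≤ 2^(8*l) := by exact_mod_cast this
    exact h2.trans (Nat.pow_le_pow_right (by norm_num) (by omega))
  have hX1 : 1000 ≤ 2^(10*l) := by
    calc 1000 ≤ 2^10 := by norm_num
      _ ≤ 2^(10*l) := Nat.pow_le_pow_right (by norm_num) (by omega)
  have hDN : 8 * (d+1) ≤ N2 := by
    have : 8 * 1 * (d+1) ≤ 8 * k * (d+1) := by gcongr
    omega
  have hkN : 8 * k ≤ N2 := by
    have : 8 * k * 1 ≤ 8 * k * (d+1) := by gcongr; omega
    omega
  have hlX : l ≤ 2^(10*l) := by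
    calc l ≤ 2^l := Nat.lt_two_pow_self.le
      _ ≤ 2^(10*l) := Nat.pow_le_pow_right (by norm_num) (by omega)
  have h48 : 8*k*(d+1) = 2*(4*k*(d+1)) := by ring
  set β : ℝ := 16 * b / N2 with hβd
  set η : ℝ := 18 * l * b / N2 with hηd
  set δ1 : ℝ := ((2:ℝ)^(4*l))⁻¹ with hδ1d
  have hδ1p : 0 < δ1 := by positivity
  have hβ0 : 0 < β := by positivity
  have hη0 : 0 ≤ η := by positivity
  have hβN : β * N2 = 16 * b := by rw [hβd]; field_simp
  have hηN : η * N2 = 18 * l * b := by rw [hηd]; field_simp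
  have hβ1 : β ≤ 1 := by rw [hβd, div_le_one hN2pos]; linarith
  have he3 : Real.exp 3 ≤ 21 := by
    have h := Real.exp_one_lt_d9
    calc Real.exp 3 = (Real.exp 1)^3 := by rw [← Real.exp_nat_mul]; norm_num
      _ ≤ 2.7182818286^3 := by gcongr
      _ ≤ 21 := by norm_num
  have hβe : β * Real.exp 3 ≤ 336 * b / N2 := by
    calc β * Real.exp 3 ≤ β * 21 := by gcongr
      _ = _ := by rw [hβd]; ring
  set A : ℝ := (n1 * β)^(2*q) * Real.exp (η * N2) with hA
  set B : ℝ := ((n1:ℝ)+1)^b * Real.exp (η * (((4*k*(d+1) : ℕ):ℝ) + 1)) with hB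
  have hA0 : 0 ≤ A := by positivity
  have hB0 : 0 < B := by positivity
  set Λ : ℝ := (A + B)/δ1 with hΛd
  have hΛe : δ1 * Λ = A + B := by rw [hΛd]; field_simp
  set P : Par := { m := 4*(d+1), h := 2*q, b := b, N1 := 4*k*(d+1), N2 := N2, p := 2*(d+1), t := 4*l,
                   K := ((2^(10*l) : ℕ):ℝ)^17, K2 := ((2^(10*l) : ℕ):ℝ)^132, a := 8*l*r, β := β, η := η, Λ := Λ } with hP
  have hU : ParU P n1 (d+1) k (2^(10*l)) := by
    refine ⟨hX1, hn1X, hk, by omega, rfl, ?_, by omega, ?_, ?_, rfl, rfl, ?_, ?_, hql, ?_, ?_, hβ0.le, ?_⟩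
    · show 2*(d+1) ≤ _; omega
    · show 4*(d+1) ≤ _; omega
    · show b ≤ _; omega
    · show k * (4*(d+1)) ≤ 4*k*(d+1); exact le_of_eq (by ring)
    · show 4*k*(d+1) < N2; rw [h48] at hN2b; omega
    · show 2*q ≤ b; rw [hb]; nlinarith
    · show 0 < Λ; positivity
    · show 100 * k * Λ ≤ (1/2) * N2.choose b * (β^b * Real.exp (η * N2))
      have := hW_ok (k := k) (l := l) (q := q) (N1 := 4*k*(d+1)) (N2 := N2) (n1 := n1) (β := β) (η := η)
        (δ1 := δ1) (Λ := Λ) hl hq1 hk hkY (by rw [← hb]; omega) (by rw [← hb]; exact hβN) hβ0.le hβ1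
        (by rw [← hb]; exact hηN) hη0 hδ1d (by rw [h48] at hN2b; omega) hn1b (by rw [← hb]; exact hΛe)
      rw [← hb] at this
      exact this
  have hG : ParG P n1 d k (2^(10*l)) q (3840*l^2*(d+1)) (1/(3840*(l:ℝ))) l := by
    refine ⟨rfl, rfl, hX1, hn1X, by omega, hk, by linarith, by exact_mod_cast hlX, by positivity, ?_, ?_, ?_, ?_, ?_, ?_⟩
    · have : 1 ≤ 3840 * l^2 := Nat.mul_pos (by norm_num) (by positivity)
      calc d+1 = 1*(d+1) := by ring
        _ ≤ _ := by gcongr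
    · push_cast; apply le_of_eq; field_simp
    · show (0:ℝ) ≤ 8*l*r; positivity
    · show (8*l*r : ℝ) * (((d+1:ℕ):ℝ) * (l:ℝ)^2) ≤ _
      rw [hqd]; push_cast; apply le_of_eq; field_simp; norm_num
    · show ((b.choose q : ℕ):ℝ) * _ ≤ _
      rw [hb]
      exact hpr_ok hl hkY hk hdY hq0
    · exact tail_small hl hdY hn1b
  have hOK : ParOK P n1 δ1 := by
    refine ⟨?_, ?_, ?_, hβ0, hβ1, hη0, hδ1p, ?_, ?_, ?_⟩
    · show 1 ≤ 4*l; omega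
    · show 4 ≤ 2*(d+1); omega
    · show ((4*l:ℕ):ℝ) * Real.sqrt ((2*(d+1):ℕ):ℝ) ≤ 8*l*r
      have : Real.sqrt ((2*(d+1):ℕ):ℝ) ≤ 2 * r := by
        apply Real.sqrt_le_iff.mpr
        refine ⟨by positivity, ?_⟩
        have : 2*(d+1) ≤ (2*r)^2 := by nlinarith
        exact_mod_cast this
      push_cast
      push_cast at this
      calc 4 * (l:ℝ) * _ ≤ 4 * l * (2 * r) := by gcongr
        _ = _ := by ring
    · show A ≤ δ1 * Λ; rw [hΛe]; linarith
    · show B ≤ δ1 * Λ; rw [hΛe]; linarith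
    · show β * Real.exp 3 ≤ 1
      refine hβe.trans ?_
      rw [div_le_one hN2pos]; linarith
  have hcard : k ≤ 2^(32*l*(d+1)) := by
    have : k ≤ 2^l := by exact_mod_cast hkY
    refine this.trans (Nat.pow_le_pow_right (by norm_num) (by nlinarith))
  obtain ⟨G, M, θ, κ, R, ξ, cc, s, hP2⟩ := par2_ok (d := d) (p := 2*(d+1)) (k := k) (l := l) (n2 := n2) (card := k)
    (α := α) (ε := ε) hl hk hd (by omega) hkY hdY hα0 hα1 hα hε0 hcard hn2a hn2b
  have h8 : (2:ℝ)^8 ≤ 2^l := pow_le_pow_right₀ (by norm_num) (by omega)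
  have hlog : Real.log (8/δ) ≤ 2 * l := by
    have h1 : 8/δ ≤ 2^(2*l) := by
      calc 8/δ = 8 * (1/δ) := by ring
        _ ≤ 2^l * 2^l := by gcongr; linarith
        _ = _ := by rw [← pow_add]; congr 1; ring
    calc Real.log (8/δ) ≤ Real.log (2^(2*l)) := Real.log_le_log (by positivity) h1
      _ = (2*l:ℕ) * Real.log 2 := by rw [Real.log_pow]
      _ ≤ (2*l:ℕ) * 1 := by gcongr; have := Real.log_two_lt_d9; linarith
      _ = 2*l := by push_cast; ring
  have hlog0 : 0 ≤ Real.log (8/δ) := Real.log_nonneg (by rw [le_div_iff₀ hδ0]; linarith)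
  refine goal_private (P := P) (n1 := n1) (n2 := n2) (δ1 := δ1) (ε1 := 20*l*b/N2) hn hU hG
    (htau_ok hk hα0 hkN hn1a) hOK ?_ hε0 hε1 hδ0 hδ1 ?_ ?_ hP2
  · show η + β * Real.exp 3 ≤ _
    calc η + β * Real.exp 3 ≤ 18*l*b/N2 + 336*b/N2 := by gcongr
      _ = (18*l*b+336*b)/N2 := by ring
      _ ≤ 20*l*b/N2 := by
        gcongr
        nlinarith
  · have h1 : Real.exp (-((P.t:ℕ):ℝ)) ≤ δ1 := exp_neg_le_pow _ _ (le_refl _)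
    have h2 : (1:ℝ) ≤ ε * 2^l := by rw [div_le_iff₀ hε0] at hε; linarith
    have h3 : (1:ℝ) ≤ δ * 2^l := by rw [div_le_iff₀ hδ0] at hδ; linarith
    have h4 : (1600:ℝ) ≤ 2^l := by
      calc (1600:ℝ) ≤ 2^200 := by norm_num
        _ ≤ 2^l := by gcongr; norm_num
    calc 400*k*(3*δ1+Real.exp (-((P.t:ℕ):ℝ))) ≤ 400*k*(3*δ1+δ1) := by gcongr
      _ = 1600 * k * δ1 := by ring
      _ ≤ 2^l * 2^l * δ1 := by gcongr
      _ = 1 * 1 * (2^l * 2^l * δ1) := by ring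
      _ ≤ (ε * 2^l) * (δ * 2^l) * (2^l * 2^l * δ1) := by gcongr
      _ = ε * δ := by
        rw [hδ1d, show 4*l = l+l+l+l by ring, pow_add, pow_add, pow_add]; field_simp
  · have hs2 : Real.sqrt k ^2 = k := Real.sq_sqrt (by positivity)
    calc (20*l*b/N2)^2*(64*k*Real.log (8/δ)^2) ≤ (20*l*b/N2)^2*(64*k*(2*l)^2) := by gcongr
      _ = (320 * (l:ℝ)^2 * b * Real.sqrt k)^2 / N2^2 := by
        rw [mul_pow _ (Real.sqrt k), hs2]; field_simp; ring
      _ ≤ (ε*N2)^2 / N2^2 := by gcongr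
      _ = ε^2 := by field_simp

end

section
theorem n2_ok {k d l : ℕ} {α ε : ℝ} (hk : 1 ≤ k) (hl : 1 ≤ l) (hα0 : 0 < α) (hα1 : α < 1) (hε0 : 0 < ε) :
    ∃ n2 : ℕ, 1250000*(k*l*((d:ℝ)+1)^2) ≤ n2*α^2 ∧ 250000*(k*l*((d:ℝ)+1)^2) ≤ n2*(α*ε) ∧
      (n2:ℝ) ≤ 1250001 * (k*l*((d:ℝ)+1)^2 * (1/α^2 + 1/(α*ε))) := by
  have hk1 : (1:ℝ) ≤ k := by exact_mod_cast hk
  have hl1 : (1:ℝ) ≤ l := by exact_mod_cast hl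
  obtain ⟨W, hW⟩ : ∃ W : ℝ, W = k*l*((d:ℝ)+1)^2 := ⟨_, rfl⟩
  have hW1 : 1 ≤ W := by
    rw [hW]
    have hd0 : (0:ℝ) ≤ d := Nat.cast_nonneg d
    have : (1:ℝ) ≤ ((d:ℝ)+1)^2 := one_le_pow₀ (by linarith)
    calc (1:ℝ) = 1*1*1 := by norm_num
      _ ≤ _ := by gcongr
  rw [← hW]
  have hαi : 1 ≤ 1/α^2 := by
    rw [le_div_iff₀ (by positivity)]; nlinarith
  have hp : 0 < 1/(α*ε) := by positivity
  have hpa : 0 < 1/(α^2) := by positivity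
  refine ⟨⌈1250000 * (W * (1/α^2 + 1/(α*ε)))⌉₊, ?_, ?_, ?_⟩
  · have := Nat.le_ceil (1250000 * (W * (1/α^2 + 1/(α*ε))))
    calc 1250000 * W = (1250000 * (W * (1/α^2))) * α^2 := by field_simp
      _ ≤ (1250000 * (W * (1/α^2 + 1/(α*ε)))) * α^2 := by gcongr; linarith
      _ ≤ _ := by gcongr
  · have := Nat.le_ceil (1250000 * (W * (1/α^2 + 1/(α*ε))))
    calc 250000 * W ≤ 1250000 * W := by linarith
      _ = (1250000 * (W * (1/(α*ε)))) * (α*ε) := by field_simp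
      _ ≤ (1250000 * (W * (1/α^2 + 1/(α*ε)))) * (α*ε) := by gcongr; linarith
      _ ≤ _ := by gcongr
  · have := Nat.ceil_lt_add_one (a := 1250000 * (W * (1/α^2 + 1/(α*ε)))) (by positivity)
    have h1 : 1 ≤ W * (1/α^2 + 1/(α*ε)) := by
      calc (1:ℝ) = 1*1 := by norm_num
        _ ≤ _ := by gcongr; linarith
    linarith

theorem priv_fin {α ε δ : ℝ} {k d l n r : ℕ} (hl : 200 ≤ l) (hk : 1 ≤ k) (hd : 1 ≤ d)
    (hkY : (k:ℝ) ≤ 2^l) (hdY : (d:ℝ) + 1 ≤ 2^l) (hα0 : 0 < α) (hα1 : α < 1) (hα : 1/α ≤ 2^l)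
    (hε0 : 0 < ε) (hε1 : ε < 1) (hε : 1/ε ≤ 2^l) (hδ0 : 0 < δ) (hδ1 : δ < 1) (hδ : 1/δ ≤ 2^l)
    (hr : d + 1 ≤ r^2) (hr2 : r ≤ 2 * (d+1))
    (hn : 10^14 * ((l:ℝ)^8 * ((k * Real.sqrt k * (r * ((d:ℝ)+1)))/(α*ε) + (k:ℝ)^2 * ((d:ℝ)+1)/α))
      + 1250001 * (k*l*((d:ℝ)+1)^2 * (1/α^2 + 1/(α*ε))) ≤ n) : Goal α ε δ k d n := by
  have hl1 : (200:ℝ) ≤ l := by exact_mod_cast hl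
  have hk1 : (1:ℝ) ≤ k := by exact_mod_cast hk
  have hd1 : (1:ℝ) ≤ (d:ℝ)+1 := by have : (0:ℝ) ≤ d := Nat.cast_nonneg d; linarith
  have hrR : (r:ℝ) ≤ 2 * ((d:ℝ)+1) := by exact_mod_cast hr2
  have hl8 : (l:ℝ)^8 ≤ 2^l := by exact_mod_cast pow8_le l (by omega)
  obtain ⟨n2, h2a, h2b, h2c⟩ := n2_ok (k := k) (d := d) (l := l) hk (by omega) hα0 hα1 hε0
  obtain ⟨q, hq⟩ : ∃ q : ℕ, q = 117964800 * l^5 * r * (d+1) := ⟨_, rfl⟩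
  obtain ⟨z, hz⟩ : ∃ z : ℝ, z = 320 * (l:ℝ)^2 * ((8*l*q : ℕ):ℝ) * Real.sqrt k / ε := ⟨_, rfl⟩
  have hz0 : 0 ≤ z := by rw [hz]; positivity
  obtain ⟨N2, hN2⟩ : ∃ N2 : ℕ, N2 = ⌈z⌉₊ + (8*k*(d+1)+2) := ⟨_, rfl⟩
  have hN2a : z ≤ N2 := by
    rw [hN2]; push_cast
    have := Nat.le_ceil z
    have : (0:ℝ) ≤ 8*k*((d:ℝ)+1) := by positivity
    linarith
  have hN2u : (N2:ℝ) ≤ z + (8*k*((d:ℝ)+1)+3) := by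
    rw [hN2]; push_cast
    have := Nat.ceil_lt_add_one hz0
    linarith
  obtain ⟨n1, hn1⟩ : ∃ n1 : ℕ, n1 = ⌈240 * (k:ℝ) * N2 / α⌉₊ := ⟨_, rfl⟩
  have hn1a : 240 * (k:ℝ) * N2 ≤ n1 * α := by
    rw [← div_le_iff₀ hα0, hn1]; exact Nat.le_ceil _
  obtain ⟨U, hU⟩ : ∃ U : ℝ, U = (k * Real.sqrt k * (r * ((d:ℝ)+1)))/(α*ε) := ⟨_, rfl⟩
  obtain ⟨V, hV⟩ : ∃ V : ℝ, V = (k:ℝ)^2 * ((d:ℝ)+1)/α := ⟨_, rfl⟩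
  rw [← hU, ← hV] at hn
  have hU0 : 0 ≤ U := by rw [hU]; positivity
  have hV1 : 1 ≤ V := by
    rw [hV, le_div_iff₀ hα0]
    have : 1 ≤ (k:ℝ)^2 * ((d:ℝ)+1) := by
      calc (1:ℝ) = 1^2*1 := by norm_num
        _ ≤ _ := by gcongr
    linarith
  have hkV : (k:ℝ)/α ≤ V := by
    rw [hV]
    gcongr
    calc (k:ℝ) = k * 1 * 1 := by ring
      _ ≤ k * k * ((d:ℝ)+1) := by gcongr
      _ = _ := by ring
  have hn1u : (n1:ℝ) ≤ 240 * k * N2 / α + 1 := by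
    rw [hn1]; exact (Nat.ceil_lt_add_one (by positivity)).le
  have hz1 : 240 * k * z / α = 72477573120000 * ((l:ℝ)^8 * U) := by
    rw [hz, hU, hq]; push_cast; field_simp; ring
  have hn1v : (n1:ℝ) + 1 ≤ 72477573120000 * ((l:ℝ)^8 * U) + 10000 * V := by
    have : 240 * k * N2 / α ≤ 240 * k * (z + (8*k*((d:ℝ)+1)+3)) / α := by gcongr
    have h2 : 240 * k * (z + (8*k*((d:ℝ)+1)+3)) / α = 240 * k * z / α + 1920 * V + 720 * (k/α) := by
      rw [hV]; field_simp; ring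
    rw [h2, hz1] at this
    linarith
  have hl8' : (1:ℝ) ≤ (l:ℝ)^8 := one_le_pow₀ (by linarith)
  have hn1w : (n1:ℝ) + 1 ≤ 10^14 * ((l:ℝ)^8 * (U + V)) := by
    refine hn1v.trans ?_
    have h1 : 1 * V ≤ (l:ℝ)^8 * V := by gcongr
    have h2 : 0 ≤ (l:ℝ)^8 * U := by positivity
    rw [mul_add]
    linarith
  have hn1b : (n1:ℝ) + 1 ≤ 2^(8*l) := by
    have hs : Real.sqrt k ≤ k := by
      rw [Real.sqrt_le_left (by positivity)]; nlinarith
    have h200 : (4*10^14:ℝ) ≤ 2^l := by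
      calc (4*10^14:ℝ) ≤ 2^200 := by norm_num
        _ ≤ 2^l := by gcongr; norm_num
    have hY8 : (2:ℝ)^(8*l) = (2^l)^8 := by rw [← pow_mul]; congr 1; ring
    rw [hY8]
    obtain ⟨Y, hY⟩ : ∃ Y : ℝ, Y = 2^l := ⟨_, rfl⟩
    rw [← hY] at hkY hdY hα hε hl8 h200 ⊢
    have hY1 : 1 ≤ Y := by linarith
    have hUY : U ≤ 2 * Y^6 := by
      calc U = k * Real.sqrt k * (r * ((d:ℝ)+1)) * (1/α) * (1/ε) := by rw [hU]; field_simp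
        _ ≤ Y * Y * ((2 * Y) * Y) * Y * Y := by
          gcongr
          · linarith
          · linarith
        _ = _ := by ring
    have hVY : V ≤ Y^6 := by
      calc V = (k:ℝ)^2 * ((d:ℝ)+1) * (1/α) := by rw [hV]; field_simp
        _ ≤ Y^2 * Y * Y := by gcongr
        _ = Y^4 := by ring
        _ ≤ Y^6 := pow_le_pow_right₀ hY1 (by norm_num)
    calc (n1:ℝ) + 1 ≤ 10^14 * ((l:ℝ)^8 * (U + V)) := hn1w
      _ ≤ 10^14 * (Y * (2*Y^6 + Y^6)) := by gcongr
      _ = (3 * 10^14) * Y^7 := by ring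
      _ ≤ Y * Y^7 := by gcongr; linarith
      _ = Y^8 := by ring
  refine priv_core (r := r) (q := q) (N2 := N2) (n1 := n1) (n2 := n2) hl hk hd hkY hdY hα0 hα1 hα hε0 hε1 hε hδ0 hδ1 hδ
    hr hq ?_ ?_ hn1a hn1b ?_ h2a h2b
  · have h := hN2a
    rw [hz, div_le_iff₀ hε0] at h
    linarith
  · rw [hN2]; omega
  · have : (n1:ℝ) + n2 ≤ n := by linarith
    exact_mod_cast this

theorem np_fin {α ε δ : ℝ} {k d l n : ℕ} (hl : 200 ≤ l) (hk : 1 ≤ k) (hd : 1 ≤ d)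
    (hkY : (k:ℝ) ≤ 2^l) (hdY : (d:ℝ) + 1 ≤ 2^l) (hα0 : 0 < α) (hα1 : α < 1) (hα : 1/α ≤ 2^l)
    (hε0 : 0 < ε) (hδ : 9/10 ≤ δ)
    (hn : 10^14 * ((l:ℝ)^8 * ((k:ℝ)^2 * ((d:ℝ)+1)/α))
      + 1250001 * (k*l*((d:ℝ)+1)^2 * (1/α^2 + 1/(α*ε))) ≤ n) : Goal α ε δ k d n := by
  have hl1 : (200:ℝ) ≤ l := by exact_mod_cast hl
  have hk1 : (1:ℝ) ≤ k := by exact_mod_cast hk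
  have hd1 : (1:ℝ) ≤ (d:ℝ)+1 := by have : (0:ℝ) ≤ d := Nat.cast_nonneg d; linarith
  obtain ⟨n2, h2a, h2b, h2c⟩ := n2_ok (k := k) (d := d) (l := l) hk (by omega) hα0 hα1 hε0
  obtain ⟨n1, hn1⟩ : ∃ n1 : ℕ, n1 = ⌈240 * (k:ℝ) * ((8*k*(d+1):ℕ):ℝ) / α⌉₊ := ⟨_, rfl⟩
  have hn1a : 240 * (k:ℝ) * ((8*k*(d+1):ℕ):ℝ) ≤ n1 * α := by
    rw [← div_le_iff₀ hα0, hn1]; exact Nat.le_ceil _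
  obtain ⟨V, hV⟩ : ∃ V : ℝ, V = (k:ℝ)^2 * ((d:ℝ)+1)/α := ⟨_, rfl⟩
  rw [← hV] at hn
  have hV1 : 1 ≤ V := by
    rw [hV, le_div_iff₀ hα0]
    have : 1 ≤ (k:ℝ)^2 * ((d:ℝ)+1) := by
      calc (1:ℝ) = 1^2*1 := by norm_num
        _ ≤ _ := by gcongr
    linarith
  have hn1u : (n1:ℝ) + 1 ≤ 2000 * V := by
    have h1 : (n1:ℝ) ≤ 240 * (k:ℝ) * ((8*k*(d+1):ℕ):ℝ) / α + 1 := by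
      rw [hn1]; exact (Nat.ceil_lt_add_one (by positivity)).le
    have h2 : 240 * (k:ℝ) * ((8*k*(d+1):ℕ):ℝ) / α = 1920 * V := by
      rw [hV]; push_cast; field_simp; ring
    rw [h2] at h1
    linarith
  have hl8' : (1:ℝ) ≤ (l:ℝ)^8 := one_le_pow₀ (by linarith)
  have hn1b : (n1:ℝ) + 1 ≤ 2^(8*l) := by
    have h200 : (2000:ℝ) ≤ 2^l := by
      calc (2000:ℝ) ≤ 2^200 := by norm_num
        _ ≤ 2^l := by gcongr; norm_num
    have hY8 : (2:ℝ)^(8*l) = (2^l)^8 := by rw [← pow_mul]; congr 1; ring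
    rw [hY8]
    obtain ⟨Y, hY⟩ : ∃ Y : ℝ, Y = 2^l := ⟨_, rfl⟩
    rw [← hY] at hkY hdY hα h200 ⊢
    have hY1 : 1 ≤ Y := by linarith
    calc (n1:ℝ) + 1 ≤ 2000 * V := hn1u
      _ = 2000 * ((k:ℝ)^2 * ((d:ℝ)+1) * (1/α)) := by rw [hV]; field_simp
      _ ≤ Y * (Y^2 * Y * Y) := by gcongr
      _ = Y^5 := by ring
      _ ≤ Y^8 := pow_le_pow_right₀ hY1 (by norm_num)
  have hn1c : n1 ≤ 2^(8*l) := by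
    have : (n1:ℝ) ≤ 2^(8*l) := by linarith
    exact_mod_cast this
  have hn1X : n1 ≤ 2^(10*l) := hn1c.trans (Nat.pow_le_pow_right (by norm_num) (by omega))
  have hX1 : 1000 ≤ 2^(10*l) := by
    calc 1000 ≤ 2^10 := by norm_num
      _ ≤ 2^(10*l) := Nat.pow_le_pow_right (by norm_num) (by omega)
  have hlX : l ≤ 2^(10*l) := by
    calc l ≤ 2^l := Nat.lt_two_pow_self.le
      _ ≤ 2^(10*l) := Nat.pow_le_pow_right (by norm_num) (by omega)
  have hDX : 4 * (d+1) ≤ 2^(10*l) := by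
    have h1 : d + 1 ≤ 2^l := by exact_mod_cast hdY
    calc 4 * (d+1) ≤ 2^2 * 2^l := by gcongr; norm_num
      _ = 2^(2+l) := by rw [pow_add]
      _ ≤ _ := Nat.pow_le_pow_right (by norm_num) (by omega)
  have hn1p : 1 ≤ n1 := by
    rcases Nat.eq_zero_or_pos n1 with h | h
    · rw [h] at hn1a
      have : (0:ℝ) < 240 * (k:ℝ) * ((8*k*(d+1):ℕ):ℝ) := by positivity
      simp only [Nat.cast_zero, zero_mul] at hn1a
      linarith
    · exact h
  have hcard : n1^(4*(d+1)) ≤ 2^(32*l*(d+1)) := by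
    calc n1^(4*(d+1)) ≤ (2^(8*l))^(4*(d+1)) := Nat.pow_le_pow_left hn1c _
      _ = _ := by rw [← pow_mul]; congr 1; ring
  have hkD : 8 * k ≤ 8*k*(d+1) := Nat.le_mul_of_pos_right _ (by omega)
  have hkD' : 4 * (d+1) ≤ 8*k*(d+1) := by gcongr; omega
  obtain ⟨G, M, θ, κ, R, ξ, cc, s, hP2⟩ := par2_ok (d := d) (p := 4*(d+1)) (k := k) (l := l) (n2 := n2) (card := n1^(4*(d+1)))
    (α := α) (ε := ε) hl hk hd (le_refl _) hkY hdY hα0 hα1 hα hε0 hcard h2a h2b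
  set P : Par := { m := 4*(d+1), h := 2*1, b := 0, N1 := 0, N2 := 8*k*(d+1), p := 0, t := 0,
                   K := 0, K2 := 0, a := 0, β := 0, η := 0, Λ := 0 } with hP
  have hG : ParG P n1 d k (2^(10*l)) 1 ((d+1)*l) 1 l := by
    refine ⟨rfl, rfl, hX1, hn1X, by omega, hk, by linarith, by exact_mod_cast hlX, by norm_num, ?_, ?_, le_refl _, ?_, ?_, ?_⟩
    · exact Nat.le_mul_of_pos_right _ (by omega)
    · push_cast; linarith
    · show (0:ℝ) * _ ≤ _
      simp
    · show (((0:ℕ).choose 1 : ℕ):ℝ) * _ ≤ _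
      simp
    · exact tail_small hl hdY hn1b
  refine goal_np (P := P) (n1 := n1) (n2 := n2) ?_ hn1p hG hDX hkD' (htau_ok hk hα0 hkD hn1a) hε0 hδ hP2
  have h1 : 1 * V ≤ (l:ℝ)^8 * V := by gcongr
  have : (n1:ℝ) + n2 ≤ n := by linarith
  exact_mod_cast this

end

section
theorem r_ok {d : ℕ} (hd : 1 ≤ d) : ∃ r : ℕ, d + 1 ≤ r^2 ∧ r ≤ 2*(d+1) ∧
    (r:ℝ) * ((d:ℝ)+1) ≤ 6 * (d:ℝ)^((7:ℝ)/4) := by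
  have hd1 : (1:ℝ) ≤ d := by exact_mod_cast hd
  refine ⟨Nat.sqrt (d+1) + 1, ?_, ?_, ?_⟩
  · have := Nat.lt_succ_sqrt (d+1)
    rw [sq]; exact this.le
  · have := Nat.sqrt_le_self (d+1); omega
  · have h1 : ((Nat.sqrt (d+1) : ℕ):ℝ) ≤ 2 * Real.sqrt d := by
      have h := Nat.sqrt_le' (d+1)
      have h' : ((Nat.sqrt (d+1) : ℕ):ℝ)^2 ≤ (d:ℝ)+1 := by exact_mod_cast h
      apply le_of_sq_le_sq _ (by positivity)
      rw [mul_pow, Real.sq_sqrt (by positivity)]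
      linarith
    have h2 : (1:ℝ) ≤ Real.sqrt d := by rw [Real.one_le_sqrt]; exact hd1
    have h3 : (d:ℝ) * Real.sqrt d ≤ (d:ℝ)^((7:ℝ)/4) := by
      rw [Real.sqrt_eq_rpow]
      nth_rewrite 1 [← Real.rpow_one (d:ℝ)]
      rw [← Real.rpow_add (by linarith)]
      apply Real.rpow_le_rpow_of_exponent_le hd1
      norm_num
    push_cast
    calc _ ≤ (2 * Real.sqrt d + Real.sqrt d) * ((d:ℝ)+d) := by gcongr
      _ = 6 * (d * Real.sqrt d) := by ring
      _ ≤ _ := by gcongr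

theorem k32 (k : ℕ) (hk : 1 ≤ k) : (k:ℝ) * Real.sqrt k = (k:ℝ)^((3:ℝ)/2) := by
  have hk1 : (0:ℝ) < k := by exact_mod_cast hk
  rw [Real.sqrt_eq_rpow]
  nth_rewrite 1 [← Real.rpow_one (k:ℝ)]
  rw [← Real.rpow_add hk1]
  norm_num

theorem log_half {δ : ℝ} (hδ0 : 0 < δ) (hδ : δ < 9/10) : 3/10 ≤ Real.log (1/δ)^((1:ℝ)/2) := by
  have h1 : 1/10 ≤ Real.log (1/δ) := by
    have := Real.one_sub_inv_le_log_of_pos (x := 1/δ) (by positivity)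
    simp only [one_div, inv_inv] at this ⊢
    norm_num at this ⊢
    linarith
  rw [← Real.sqrt_eq_rpow]
  apply Real.le_sqrt_of_sq_le
  norm_num at h1 ⊢
  linarith

theorem Y_ok {L : ℝ} {l : ℕ} (hL0 : 0 ≤ L) (hl : 200 * L ≤ l) : Real.exp L ≤ 2^l := by
  have h2 := Real.log_two_gt_d9
  rw [← Real.exp_log (show (0:ℝ) < 2 by norm_num), ← Real.exp_nat_mul]
  apply Real.exp_le_exp.mpr
  calc L ≤ (200 * L) * (1/2) := by linarith
    _ ≤ l * Real.log 2 := by gcongr; linarith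

theorem final_ok {α ε δ : ℝ} (hα0 : 0 < α) (hα1 : α < 1) (hε0 : 0 < ε) (hε1 : ε < 1) (hδ0 : 0 < δ) (hδ1 : δ < 1)
    {k d n : ℕ} (hk : 1 ≤ k) (hd : 1 ≤ d) {C : ℝ} (hC : 10^35 ≤ C)
    (hn : (n : ℝ) ≥ C * Real.log (2 + (k : ℝ) * d / (α * ε * δ)) ^ C *
          ((k : ℝ) * (d : ℝ) ^ 2 / α ^ 2 +
            ((k : ℝ) * (d : ℝ) ^ 2 +
              (d : ℝ) ^ ((7 : ℝ) / 4) * (k : ℝ) ^ ((3 : ℝ) / 2) * Real.log (1 / δ) ^ ((1 : ℝ) / 2) +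
              (k : ℝ) ^ ((3 : ℝ) / 2) * Real.log (1 / δ) ^ ((3 : ℝ) / 2)) / (α * ε) +
            (k : ℝ) ^ 2 * (d : ℝ) / α)) : Goal α ε δ k d n := by
  have hk1 : (1:ℝ) ≤ k := by exact_mod_cast hk
  have hd1 : (1:ℝ) ≤ d := by exact_mod_cast hd
  obtain ⟨x, hx⟩ : ∃ x : ℝ, x = (k : ℝ) * d / (α * ε * δ) := ⟨_, rfl⟩
  obtain ⟨L, hL⟩ : ∃ L : ℝ, L = Real.log (2 + x) := ⟨_, rfl⟩
  rw [← hx, ← hL] at hn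
  have hαi : 1 ≤ 1/α := by rw [le_div_iff₀ hα0]; linarith
  have hεi : 1 ≤ 1/ε := by rw [le_div_iff₀ hε0]; linarith
  have hδi : 1 ≤ 1/δ := by rw [le_div_iff₀ hδ0]; linarith
  have hxe : x = k * d * (1/α) * (1/ε) * (1/δ) := by rw [hx]; field_simp
  have hxk : (k:ℝ) ≤ x := by
    rw [hxe]
    calc (k:ℝ) = k * 1 * 1 * 1 * 1 := by ring
      _ ≤ _ := by gcongr
  have hxd : (d:ℝ) ≤ x := by
    rw [hxe]
    calc (d:ℝ) = 1 * d * 1 * 1 * 1 := by ring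
      _ ≤ _ := by gcongr
  have hxα : 1/α ≤ x := by
    rw [hxe]
    calc 1/α = 1 * 1 * (1/α) * 1 * 1 := by ring
      _ ≤ _ := by gcongr
  have hxε : 1/ε ≤ x := by
    rw [hxe]
    calc 1/ε = 1 * 1 * 1 * (1/ε) * 1 := by ring
      _ ≤ _ := by gcongr
  have hxδ : 1/δ ≤ x := by
    rw [hxe]
    calc 1/δ = 1 * 1 * 1 * 1 * (1/δ) := by ring
      _ ≤ _ := by gcongr
  have hx0 : 0 < 2 + x := by linarith
  have hL1 : 1 ≤ L := by
    rw [hL, Real.le_log_iff_exp_le hx0]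
    have := Real.exp_one_lt_d9
    linarith
  obtain ⟨l, hl⟩ : ∃ l : ℕ, l = ⌈200 * L⌉₊ := ⟨_, rfl⟩
  have hl1 : 200 * L ≤ l := by rw [hl]; exact Nat.le_ceil _
  have hl2 : (l:ℝ) ≤ 201 * L := by
    have := Nat.ceil_lt_add_one (a := 200 * L) (by linarith)
    rw [← hl] at this
    linarith
  have hl200R : (200:ℝ) ≤ l := by linarith
  have hl200 : 200 ≤ l := by exact_mod_cast hl200R
  have hY : 2 + x ≤ 2^l := by
    have := Y_ok (L := L) (l := l) (by linarith) hl1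
    rwa [hL, Real.exp_log hx0] at this
  clear hl hx hxe
  -- rewrite the sample size hypothesis
  obtain ⟨S, hS⟩ : ∃ S : ℝ, S = ((k : ℝ) * (d : ℝ) ^ 2 / α ^ 2 +
            ((k : ℝ) * (d : ℝ) ^ 2 +
              (d : ℝ) ^ ((7 : ℝ) / 4) * (k : ℝ) ^ ((3 : ℝ) / 2) * Real.log (1 / δ) ^ ((1 : ℝ) / 2) +
              (k : ℝ) ^ ((3 : ℝ) / 2) * Real.log (1 / δ) ^ ((3 : ℝ) / 2)) / (α * ε) +
            (k : ℝ) ^ 2 * (d : ℝ) / α) := ⟨_, rfl⟩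
  rw [← hS] at hn
  have hlog0 : 0 ≤ Real.log (1/δ) := Real.log_nonneg hδi
  obtain ⟨T1, hT1⟩ : ∃ T : ℝ, T = (k : ℝ) * (d : ℝ) ^ 2 / α ^ 2 := ⟨_, rfl⟩
  obtain ⟨T2, hT2⟩ : ∃ T : ℝ, T = (k : ℝ) * (d : ℝ) ^ 2 / (α*ε) := ⟨_, rfl⟩
  obtain ⟨T3, hT3⟩ : ∃ T : ℝ, T = (d : ℝ) ^ ((7 : ℝ) / 4) * (k : ℝ) ^ ((3 : ℝ) / 2) * Real.log (1 / δ) ^ ((1 : ℝ) / 2) / (α*ε) := ⟨_, rfl⟩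
  obtain ⟨T4, hT4⟩ : ∃ T : ℝ, T = (k : ℝ) ^ ((3 : ℝ) / 2) * Real.log (1 / δ) ^ ((3 : ℝ) / 2) / (α*ε) := ⟨_, rfl⟩
  obtain ⟨T5, hT5⟩ : ∃ T : ℝ, T = (k : ℝ)^2 * d / α := ⟨_, rfl⟩
  have hST : S = T1 + (T2 + T3 + T4) + T5 := by
    rw [hS, hT1, hT2, hT3, hT4, hT5]; ring
  have h1 : 0 ≤ T1 := by rw [hT1]; positivity
  have h2 : 0 ≤ T2 := by rw [hT2]; positivity
  have h3 : 0 ≤ T3 := by rw [hT3]; positivity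
  have h4 : 0 ≤ T4 := by rw [hT4]; positivity
  have h5 : 0 ≤ T5 := by rw [hT5]; positivity
  have hS0 : 0 ≤ S := by rw [hST]; positivity
  have hLC : L^8 ≤ L^C := by
    have : L^8 = L^(8:ℝ) := by norm_cast
    rw [this]
    apply Real.rpow_le_rpow_of_exponent_le hL1
    refine le_trans ?_ hC
    norm_num
  have hl8 : (l:ℝ)^8 ≤ 201^8 * L^8 := by
    rw [← mul_pow]; gcongr
  have hbig : 10^14 * ((l:ℝ)^8 * (20 * S)) ≤ n := by
    calc 10^14 * ((l:ℝ)^8 * (20 * S)) ≤ 10^14 * ((201^8 * L^8) * (20 * S)) := by gcongr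
      _ = (10^14 * 201^8 * 20) * L^8 * S := by ring
      _ ≤ 10^35 * L^8 * S := by gcongr; norm_num
      _ ≤ C * L^C * S := by gcongr
      _ ≤ n := hn
  clear hn hl8 hLC hC
  have hW1 : k * ((d:ℝ)+1)^2 * (1/α^2 + 1/(α*ε)) ≤ 4 * (T1 + T2) := by
    calc k * ((d:ℝ)+1)^2 * (1/α^2 + 1/(α*ε)) ≤ k * ((d:ℝ)+d)^2 * (1/α^2 + 1/(α*ε)) := by gcongr
      _ = 4 * (T1 + T2) := by rw [hT1, hT2]; field_simp; ring
  have hW2 : (k:ℝ)^2 * ((d:ℝ)+1)/α ≤ 2 * T5 := by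
    calc (k:ℝ)^2 * ((d:ℝ)+1)/α ≤ (k:ℝ)^2 * ((d:ℝ)+d)/α := by gcongr
      _ = 2 * T5 := by rw [hT5]; ring
  have hl78 : 1250001 * (l:ℝ) ≤ 10^14 * (l:ℝ)^8 := by
    have : (l:ℝ) ≤ (l:ℝ)^8 := le_self_pow₀ (by linarith) (by norm_num)
    gcongr; norm_num
  have hWl : 1250001 * (k*l*((d:ℝ)+1)^2 * (1/α^2 + 1/(α*ε))) ≤ 10^14 * (l:ℝ)^8 * (4 * (T1 + T2)) := by
    calc 1250001 * (k*l*((d:ℝ)+1)^2 * (1/α^2 + 1/(α*ε))) = (1250001 * l) * (k * ((d:ℝ)+1)^2 * (1/α^2 + 1/(α*ε))) := by ring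
      _ ≤ 10^14 * (l:ℝ)^8 * (4 * (T1 + T2)) := by gcongr
  rcases lt_or_ge δ (9/10) with hδ | hδ
  · obtain ⟨r, hr1, hr2, hr3⟩ := r_ok hd
    have hU : (k * Real.sqrt k * (r * ((d:ℝ)+1)))/(α*ε) ≤ 20 * T3 := by
      have hlh := log_half hδ0 hδ
      calc (k * Real.sqrt k * (r * ((d:ℝ)+1)))/(α*ε) ≤ ((k:ℝ)^((3:ℝ)/2) * (6 * (d:ℝ)^((7:ℝ)/4)))/(α*ε) := by
            rw [k32 k hk]; gcongr
        _ = 20 * ((d : ℝ) ^ ((7 : ℝ) / 4) * (k : ℝ) ^ ((3 : ℝ) / 2) * (3/10) / (α*ε)) := by ring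
        _ ≤ 20 * T3 := by rw [hT3]; gcongr
    refine priv_fin (l := l) (r := r) hl200 hk hd (by linarith) (by linarith) hα0 hα1 (by linarith) hε0 hε1 (by linarith)
      hδ0 hδ1 (by linarith) hr1 hr2 ?_
    calc _ ≤ 10^14 * ((l:ℝ)^8 * (20 * T3 + 2 * T5)) + 10^14 * (l:ℝ)^8 * (4 * (T1 + T2)) := by gcongr
      _ = 10^14 * ((l:ℝ)^8 * (20 * T3 + 2 * T5 + 4 * (T1 + T2))) := by ring
      _ ≤ 10^14 * ((l:ℝ)^8 * (20 * S)) := by gcongr; rw [hST]; linarith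
      _ ≤ n := hbig
  · refine np_fin (l := l) hl200 hk hd (by linarith) (by linarith) hα0 hα1 (by linarith) hε0 hδ ?_
    calc _ ≤ 10^14 * ((l:ℝ)^8 * (2 * T5)) + 10^14 * (l:ℝ)^8 * (4 * (T1 + T2)) := by gcongr
      _ = 10^14 * ((l:ℝ)^8 * (2 * T5 + 4 * (T1 + T2))) := by ring
      _ ≤ 10^14 * ((l:ℝ)^8 * (20 * S)) := by gcongr; rw [hST]; linarith
      _ ≤ n := hbig

end

/-- Theorem 1.1: sample complexity upper bound for privately learning mixtures of
`k` arbitrary Gaussians in `ℝ^d`. -/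
theorem private_GMM_learning_upper_bound :
    ∃ C > (0 : ℝ), ∃ c > (0 : ℝ),
      ∀ α ε δ : ℝ, 0 < α → α < 1 → 0 < ε → ε < 1 → 0 < δ → δ < 1 →
      ∀ k d n : ℕ,
        (n : ℝ) ≥ C * Real.log (2 + (k : ℝ) * d / (α * ε * δ)) ^ C *
          ((k : ℝ) * (d : ℝ) ^ 2 / α ^ 2 +
            ((k : ℝ) * (d : ℝ) ^ 2 +
              (d : ℝ) ^ ((7 : ℝ) / 4) * (k : ℝ) ^ ((3 : ℝ) / 2) * Real.log (1 / δ) ^ ((1 : ℝ) / 2) +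
              (k : ℝ) ^ ((3 : ℝ) / 2) * Real.log (1 / δ) ^ ((3 : ℝ) / 2)) / (α * ε) +
            (k : ℝ) ^ 2 * (d : ℝ) / α) →
        ∃ K : Kernel (Fin n → (Fin d → ℝ))
            ((Fin k → ℝ) × (Fin k → (Fin d → ℝ)) × (Fin k → Matrix (Fin d) (Fin d) ℝ)),
          IsMarkovKernel K ∧ IsDP K ε δ ∧
          ∀ (w : Fin k → ℝ) (μs : Fin k → (Fin d → ℝ)) (Ss : Fin k → Matrix (Fin d) (Fin d) ℝ),
            IsMixtureParams w Ss →
            (2 / 3 : ℝ≥0∞) ≤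
              ((Measure.pi fun _ : Fin n => mixture d k w μs Ss).bind fun x => K x)
                {p : (Fin k → ℝ) × (Fin k → (Fin d → ℝ)) × (Fin k → Matrix (Fin d) (Fin d) ℝ) |
                  IsMixtureParams p.1 p.2.2 ∧
                  TV (mixture d k p.1 p.2.1 p.2.2) (mixture d k w μs Ss) ≤ α} := by
  refine ⟨10^35, by norm_num, 1, by norm_num, ?_⟩
  intro α ε δ hα0 hα1 hε0 hε1 hδ0 hδ1 k d n hn
  rcases Nat.eq_zero_or_pos k with hk | hk
  · subst hk
    exact goal_k0 α ε δ hε0.le d n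
  rcases Nat.eq_zero_or_pos d with hd | hd
  · subst hd
    exact goal_d0 α ε δ hα0.le hε0.le k n hk
  exact final_ok hα0 hα1 hε0 hε1 hδ0 hδ1 hk hd (le_refl _) hn

end
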